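/- Interior maximum-norm stability of the Ritz projection on an extended convex polyhedron for elements of degree at least 2 (the estimate E₁ ≤ C‖u‖_{L∞} in the proof of Theorem 5.1): Let Ω and Ω̃ be convex polyhedra in ℝ³ with closure(Ω) ⊂ Ω̃, let c > 0 and let r ≥ 2 be an integer. There exist constants C > 0 and h₀ > 0 (depending only on Ω, Ω̃, c and r) such that for every h ∈ (0, h₀], every tetrahedral partition 𝔗̃ of Ω̃ with mesh size h and quasi-uniformity constant c, every Lipschitz function ũ : closure(Ω̃) → ℝ vanishing on ∂Ω̃, and every ũ_h in the space S̊_h built from 𝔗̃ and degree r satisfying ∫_{Ω̃} ∇(ũ − ũ_h)·∇χ dx = 0 for all χ ∈ S̊_h, one has sup_{x ∈ Ω} |ũ(x) − ũ_h(x)| ≤ C sup_{x ∈ Ω̃} |ũ(x)|. -/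

import Mathlib

open MeasureTheory Metric Set
open scoped RealInnerProductSpace ENNReal NNReal

noncomputable section

/-- Three-dimensional Euclidean space. -/
abbrev E3 : Type := EuclideanSpace ℝ (Fin 3)

/-- A convex polyhedron: a bounded convex open set which is the interior of the
convex hull of a finite set of points. -/
def IsConvexPolyhedron (Ω : Set E3) : Prop :=
  IsOpen Ω ∧ Bornology.IsBounded Ω ∧ Convex ℝ Ω ∧
    ∃ S : Finset E3, Ω = interior (convexHull ℝ (S : Set E3))

/-- The closed tetrahedron with vertices `v 0, v 1, v 2, v 3`. -/
def tet (v : Fin 4 → E3) : Set E3 := convexHull ℝ (Set.range v)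

/-- A quasi-uniform conforming tetrahedral partition of `Ω` with mesh size `h`
and quasi-uniformity constant `c`, recorded by the vertex tuples of its tetrahedra. -/
def IsTetPartition (Ω : Set E3) (T : Finset (Fin 4 → E3)) (h c : ℝ) : Prop :=
  (∀ v ∈ T, AffineIndependent ℝ v) ∧
  (⋃ v ∈ T, tet v) = closure Ω ∧
  (∀ v ∈ T, ∀ w ∈ T, tet v ≠ tet w → interior (tet v) ∩ interior (tet w) = ∅) ∧
  (∀ v ∈ T, ∀ w ∈ T, tet v ≠ tet w →
    tet v ∩ tet w = ∅ ∨ tet v ∩ tet w = convexHull ℝ (Set.range v ∩ Set.range w)) ∧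
  (∀ v ∈ T, Metric.diam (tet v) ≤ h) ∧
  (∀ v ∈ T, ∃ x : E3, Metric.closedBall x (c * h) ⊆ tet v)

/-- The finite element space `S_h` of continuous piecewise polynomials of degree `≤ r`. -/
def MemSh (Ω : Set E3) (T : Finset (Fin 4 → E3)) (r : ℕ) (u : E3 → ℝ) : Prop :=
  ContinuousOn u (closure Ω) ∧
  ∀ v ∈ T, ∃ p : MvPolynomial (Fin 3) ℝ,
    p.totalDegree ≤ r ∧ ∀ x ∈ tet v, u x = MvPolynomial.eval (fun i => x i) p

/-- The subspace `S̊_h` of finite element functions vanishing on the boundary. -/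
def MemSh0 (Ω : Set E3) (T : Finset (Fin 4 → E3)) (r : ℕ) (u : E3 → ℝ) : Prop :=
  MemSh Ω T r u ∧ ∀ x ∈ frontier Ω, u x = 0

/-- The Laplacian, as the trace of the Hessian. -/
def lap (v : E3 → ℝ) (x : E3) : ℝ :=
  ∑ i : Fin 3,
    fderiv ℝ (fun y => fderiv ℝ v y (EuclideanSpace.single i 1)) x (EuclideanSpace.single i 1)

/-- The `L^p(A)` norm. -/
def LpN (A : Set E3) (p : ℝ) (w : E3 → ℝ) : ℝ := (∫ x in A, |w x| ^ p) ^ (1 / p)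

/-- The `W^{1,p}(A)` norm. -/
def W1pN (A : Set E3) (p : ℝ) (w : E3 → ℝ) : ℝ :=
  (∫ x in A, (|w x| ^ p + ‖gradient w x‖ ^ p)) ^ (1 / p)

/-- The `W^{2,p}(A)` norm. -/
def W2pN (A : Set E3) (p : ℝ) (w : E3 → ℝ) : ℝ :=
  (∫ x in A, (|w x| ^ p + ‖gradient w x‖ ^ p + ‖iteratedFDeriv ℝ 2 w x‖ ^ p)) ^ (1 / p)


section
open Filter Topology
open scoped ContDiff

theorem smooth_ext {n : ℕ∞} {K U : Set E3} (hK : IsCompact K) (hU : IsOpen U) (hKU : K ⊆ U)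
    {f : E3 → ℝ} (hf : ContDiffOn ℝ n f U) :
    ∃ g : E3 → ℝ, ContDiff ℝ n g ∧ HasCompactSupport g ∧ (∀ᶠ x in 𝓝ˢ K, g x = f x) := by
  obtain ⟨t, ht, hKt, htU⟩ := exists_compact_between hK hU hKU
  obtain ⟨ζ, h1, h0, -⟩ := exists_contMDiffMap_one_nhds_of_subset_interior (n := n)
    (modelWithCornersSelf ℝ E3) hK.isClosed hKt
  have hζ : ContDiff ℝ n (fun x => ζ x) := ζ.contMDiff.contDiff
  refine ⟨fun x => ζ x * f x, ?_, ?_, ?_⟩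
  · rw [contDiff_iff_contDiffAt]
    intro x
    by_cases hx : x ∈ t
    · exact hζ.contDiffAt.mul (hf.contDiffAt (hU.mem_nhds (htU hx)))
    · refine (contDiffAt_const (c := (0:ℝ))).congr_of_eventuallyEq ?_
      filter_upwards [ht.isClosed.isOpen_compl.mem_nhds hx] with y hy
      rw [h0 y hy, zero_mul]
  · exact HasCompactSupport.intro ht fun x hx => by rw [h0 x hx, zero_mul]
  · filter_upwards [h1] with x hx
    rw [hx, one_mul]

abbrev be (i : Fin 3) : E3 := EuclideanSpace.single i 1

theorem int_fderiv_zero {C : ℝ≥0} {g : E3 → ℝ} (hg : LipschitzWith C g)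
    (h : HasCompactSupport g) (v : E3) : ∫ x, fderiv ℝ g x v = 0 := by
  have := LipschitzWith.integral_lineDeriv_mul_eq (μ := volume)
    (LipschitzWith.const (1:ℝ) : LipschitzWith 0 (fun _ : E3 => (1:ℝ))) hg h (-v)
  simp only [neg_neg, mul_one] at this
  have h2 : ∀ x : E3, lineDeriv ℝ (fun _ : E3 => (1:ℝ)) x (-v) = 0 := fun x => by simp [lineDeriv]
  simp only [h2, zero_mul, integral_zero] at this
  rw [this]
  apply integral_congr_ae
  filter_upwards [hg.ae_differentiableAt (μ := volume)] with x hx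
  exact (hx.lineDeriv_eq_fderiv).symm

theorem sum_be (z : E3) : ∑ i, z i • be i = z := by
  ext j
  fin_cases j <;> simp [Fin.sum_univ_three, be]

theorem inner_grad (f g : E3 → ℝ) (x : E3) :
    ⟪gradient f x, gradient g x⟫ = ∑ i, fderiv ℝ f x (be i) * fderiv ℝ g x (be i) := by
  rw [real_inner_comm, ← sum_be (gradient f x), inner_sum]
  refine Finset.sum_congr rfl fun i _ => ?_
  rw [inner_smul_right, inner_gradient_left, ← inner_gradient_left (f := f)]
  congr 1
  rw [EuclideanSpace.inner_single_right]; simp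

theorem norm_grad (f : E3 → ℝ) (x : E3) : ‖gradient f x‖ = ‖fderiv ℝ f x‖ := by
  simp [gradient]

theorem fderiv_le_of_lip {C : ℝ≥0} {g : E3 → ℝ} (hg : LipschitzWith C g) (x : E3) :
    ‖fderiv ℝ g x‖ ≤ C := norm_fderiv_le_of_lipschitz ℝ hg

theorem integrable_of_bdd_supp {f : E3 → ℝ} {B : ℝ} {R : ℝ} (hm : AEStronglyMeasurable f volume)
    (hb : ∀ x, |f x| ≤ B) (hs : ∀ x, R < ‖x‖ → f x = 0) : Integrable f := by
  have h1 : IntegrableOn f (closedBall 0 R) :=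
    Measure.integrableOn_of_bounded (M := B) measure_closedBall_lt_top.ne hm
      (ae_of_all _ fun x => by simpa using hb x)
  rw [← integrableOn_univ]
  refine h1.of_forall_sdiff_eq_zero MeasurableSet.univ fun x hx => hs x ?_
  simpa using hx.2

theorem ibp {C : ℝ≥0} {v f : E3 → ℝ} {U : Set E3} (hv : LipschitzWith C v)
    (hc : HasCompactSupport v) (hU : IsOpen U) (hvU : tsupport v ⊆ U) (hf : ContDiffOn ℝ 2 f U) :
    ∫ x, ⟪gradient v x, gradient f x⟫ = - ∫ x, v x * lap f x := by
  obtain ⟨g, hg, hgc, hgf⟩ := smooth_ext (n := 2) hc hU hvU hf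
  have hgf' : ∀ x ∈ tsupport v, g =ᶠ[𝓝 x] f := fun x hx =>
    (eventually_nhdsSet_iff_forall.1 hgf) x hx
  have hD : ∀ i, ContDiff ℝ 1 (fun x => fderiv ℝ g x (be i)) := fun i =>
    (hg.fderiv_right (m := 1) (by norm_num)).clm_apply contDiff_const
  have hDc : ∀ i, HasCompactSupport (fun x => fderiv ℝ g x (be i)) := fun i =>
    (hgc.fderiv ℝ).comp_left (g := fun L : E3 →L[ℝ] ℝ => L (be i)) rfl
  have hDL : ∀ i, ∃ C, LipschitzWith C (fun x => fderiv ℝ g x (be i)) := fun i =>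
    ContDiff.lipschitzWith_of_hasCompactSupport (hDc i) (hD i) (by simp)
  have hcv : Continuous v := hv.continuous
  have h1 : ∀ i, ∫ x, fderiv ℝ v x (be i) * fderiv ℝ g x (be i) =
      - ∫ x, v x * fderiv ℝ (fun y => fderiv ℝ g y (be i)) x (be i) := by
    intro i
    obtain ⟨C', hC'⟩ := hDL i
    have := LipschitzWith.integral_lineDeriv_mul_eq (μ := volume) hv hC' (hDc i) (be i)
    rw [← integral_neg]
    refine Eq.trans ?_ (this.trans ?_)
    · apply integral_congr_ae
      filter_upwards [hv.ae_differentiableAt (μ := volume)] with x hx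
      rw [hx.lineDeriv_eq_fderiv]
    · congr 1; ext x
      rw [((hD i).differentiable (by norm_num) x).lineDeriv_eq_fderiv]
      simp [mul_comm]
  have h2 : ∫ x, ⟪gradient v x, gradient f x⟫ = ∫ x, ∑ i, fderiv ℝ v x (be i) * fderiv ℝ g x (be i) := by
    congr 1; ext x
    rw [inner_grad]
    by_cases hx : x ∈ tsupport v
    · rw [(hgf' x hx).fderiv_eq]
    · have : fderiv ℝ v x = 0 := by
        by_contra hne; exact hx (support_fderiv_subset ℝ hne)
      simp [this]
  have h3 : ∫ x, v x * lap f x = ∫ x, ∑ i, v x * fderiv ℝ (fun y => fderiv ℝ g y (be i)) x (be i) := by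
    congr 1; ext x
    by_cases hx : x ∈ tsupport v
    · rw [lap, Finset.mul_sum]
      refine Finset.sum_congr rfl fun i _ => ?_
      have : (fun y => fderiv ℝ g y (be i)) =ᶠ[𝓝 x] fun y => fderiv ℝ f y (be i) := by
        filter_upwards [(hgf' x hx).fderiv (𝕜 := ℝ)] with y hy
        rw [hy]
      rw [this.fderiv_eq]
    · simp [image_eq_zero_of_notMem_tsupport hx]
  rw [h2, h3, integral_finsetSum, integral_finsetSum, ← Finset.sum_neg_distrib]
  · exact Finset.sum_congr rfl fun i _ => h1 i
  · intro i _
    refine Continuous.integrable_of_hasCompactSupport (hcv.mul ?_) hc.mul_right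
    exact ((hD i).continuous_fderiv (by norm_num)).clm_apply continuous_const
  · intro i _
    obtain ⟨C', hC'⟩ := hDL i
    have hi : Integrable (fun x => fderiv ℝ g x (be i)) :=
      (hD i).continuous.integrable_of_hasCompactSupport (hDc i)
    refine hi.bdd_mul (c := C) ?_ ?_
    · exact (measurable_fderiv_apply_const ℝ v (be i)).aestronglyMeasurable
    · refine ae_of_all _ fun x => ?_
      refine (ContinuousLinearMap.le_opNorm _ _).trans ?_
      simpa using fderiv_le_of_lip hv x

theorem eq_zero_of_grad {C : ℝ≥0} {v : E3 → ℝ} (hv : LipschitzWith C v) (hc : HasCompactSupport v)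
    (h : ∀ᵐ x, gradient v x = 0) : v = 0 := by
  obtain ⟨C', hC'⟩ : ∃ C', LipschitzWith C' (fun x => v x * v x) := by
    obtain ⟨B, hB⟩ := hc.exists_bound_of_continuous hv.continuous
    have hB0 : 0 ≤ B := (norm_nonneg _).trans (hB 0)
    refine ⟨C * B.toNNReal + C * B.toNNReal, LipschitzWith.of_dist_le_mul fun x y => ?_⟩
    have h1 := hv.dist_le_mul x y
    rw [Real.dist_eq] at *
    have : v x * v x - v y * v y = (v x - v y) * v x + (v x - v y) * v y := by ring
    rw [this]
    refine (abs_add_le _ _).trans ?_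
    rw [abs_mul, abs_mul]
    push_cast
    rw [Real.coe_toNNReal _ hB0]
    have hx := hB x; have hy := hB y
    rw [Real.norm_eq_abs] at hx hy
    have := mul_le_mul h1 hx (abs_nonneg _) (by positivity)
    have := mul_le_mul h1 hy (abs_nonneg _) (by positivity)
    linarith
  have hc2 : HasCompactSupport (fun x => v x * v x) := hc.mul_right
  have hlap : ∀ x : E3, lap (fun y => (y 0)^2) x = 2 := by
    intro x
    have hp : ∀ y : E3, HasFDerivAt (fun y : E3 => (y 0)^2) ((2 * y 0) • (EuclideanSpace.proj (𝕜 := ℝ) (0 : Fin 3) : E3 →L[ℝ] ℝ)) y := by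
      intro y
      have := ((EuclideanSpace.proj (𝕜 := ℝ) (0 : Fin 3) : E3 →L[ℝ] ℝ).hasFDerivAt (x := y)).pow 2
      simpa using this
    have : ∀ i : Fin 3, (fun y => fderiv ℝ (fun y : E3 => (y 0)^2) y (be i)) =
        (((2 * (be i) 0) • (EuclideanSpace.proj (𝕜 := ℝ) (0 : Fin 3) : E3 →L[ℝ] ℝ) : E3 →L[ℝ] ℝ) : E3 → ℝ) := by
      intro i; ext y; rw [(hp y).fderiv]
      change 2 * y 0 * (be i) 0 = 2 * (be i) 0 * y 0; ring
    simp only [lap]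
    simp only [this, ContinuousLinearMap.fderiv]
    simp [Fin.sum_univ_three]
  have key := ibp (U := univ) hC' hc2 isOpen_univ (subset_univ _) (f := fun y => (y 0)^2) (by fun_prop)
  have h0 : ∫ x, ⟪gradient (fun x => v x * v x) x, gradient (fun y : E3 => (y 0)^2) x⟫ = 0 := by
    rw [integral_eq_zero_of_ae]
    filter_upwards [h, hv.ae_differentiableAt (μ := volume)] with x hx hd
    have h1 : fderiv ℝ v x = 0 := by rw [← toDual_gradient, hx, map_zero]
    rw [inner_gradient_left, fderiv_fun_mul hd hd, h1]; simp
  rw [h0] at key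
  simp only [hlap] at key
  rw [integral_mul_const] at key
  have h4 : ∫ x, v x * v x = 0 := by linarith
  rw [integral_eq_zero_iff_of_nonneg (fun x => mul_self_nonneg _)
    ((hv.continuous.mul hv.continuous).integrable_of_hasCompactSupport hc2)] at h4
  have := (Continuous.ae_eq_iff_eq volume (hv.continuous.mul hv.continuous) continuous_const).1 h4
  ext x
  exact mul_self_eq_zero.1 (congrFun this x)

theorem hasFDerivAt_invnorm {x : E3} (hx : x ≠ 0) :
    HasFDerivAt (fun y : E3 => ‖y‖⁻¹) (-((‖x‖⁻¹)^3) • innerSL ℝ x) x := by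
  have h1 : HasFDerivAt (fun y : E3 => ‖y‖) (‖x‖⁻¹ • innerSL ℝ x) x := by
    have := (hasStrictFDerivAt_norm_sq (F := E3) x).hasFDerivAt.sqrt (by simpa using hx)
    simp only [Real.sqrt_sq (norm_nonneg _)] at this
    have e : ‖x‖⁻¹ • innerSL ℝ x = (1 / (2 * ‖x‖)) • 2 • innerSL ℝ x := by
      rw [← Nat.cast_smul_eq_nsmul ℝ, smul_smul]; congr 1; push_cast; field_simp
    rw [e]; exact this
  have h0 : ‖x‖ ≠ 0 := by simpa using hx
  have := (hasDerivAt_inv h0).comp_hasFDerivAt x h1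
  have e : -((‖x‖⁻¹)^3) • innerSL ℝ x = (-(‖x‖^2)⁻¹) • ‖x‖⁻¹ • innerSL ℝ x := by
    rw [smul_smul]; congr 1; field_simp
  rw [e]; exact this

theorem lap_congr {f g : E3 → ℝ} {x : E3} (h : f =ᶠ[𝓝 x] g) : lap f x = lap g x := by
  unfold lap
  refine Finset.sum_congr rfl fun i _ => ?_
  have : (fun y => fderiv ℝ f y (be i)) =ᶠ[𝓝 x] fun y => fderiv ℝ g y (be i) := by
    filter_upwards [h.fderiv (𝕜 := ℝ)] with y hy
    rw [hy]
  rw [this.fderiv_eq]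

theorem lap_invnorm {x : E3} (hx : x ≠ 0) : lap (fun y : E3 => ‖y‖⁻¹) x = 0 := by
  have h1 : ∀ i, fderiv ℝ (fun y => fderiv ℝ (fun y : E3 => ‖y‖⁻¹) y (be i)) x (be i) =
      -(‖x‖⁻¹)^3 + 3 * (x i)^2 * (‖x‖⁻¹)^5 := by
    intro i
    have : (fun y => fderiv ℝ (fun y : E3 => ‖y‖⁻¹) y (be i)) =ᶠ[𝓝 x]
        fun y => -((‖y‖⁻¹)^3) * (EuclideanSpace.proj (𝕜 := ℝ) i : E3 →L[ℝ] ℝ) y := by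
      filter_upwards [isOpen_ne.mem_nhds hx] with y hy
      rw [(hasFDerivAt_invnorm hy).fderiv]
      simp [EuclideanSpace.inner_single_right]
    rw [this.fderiv_eq]
    have h2 := (((hasFDerivAt_invnorm hx).pow 3).neg).mul
      (EuclideanSpace.proj (𝕜 := ℝ) i : E3 →L[ℝ] ℝ).hasFDerivAt
    have h3 := h2.fderiv
    simp only [Pi.mul_def] at h3
    refine (congrArg (fun L : E3 →L[ℝ] ℝ => L (be i)) h3).trans ?_
    simp [EuclideanSpace.inner_single_right]
    ring
  have h4 : ‖x‖^2 = ∑ i, (x i)^2 := by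
    rw [EuclideanSpace.norm_sq_eq]; simp
  have h5 : ‖x‖ ≠ 0 := by simpa using hx
  simp only [lap, h1]
  rw [Fin.sum_univ_three] at h4 ⊢
  have : -‖x‖⁻¹ ^ 3 + 3 * x 0 ^ 2 * ‖x‖⁻¹ ^ 5 + (-‖x‖⁻¹ ^ 3 + 3 * x 1 ^ 2 * ‖x‖⁻¹ ^ 5) +
    (-‖x‖⁻¹ ^ 3 + 3 * x 2 ^ 2 * ‖x‖⁻¹ ^ 5) = -3 * ‖x‖⁻¹^3 + 3 * (x 0^2+x 1^2+x 2^2) * ‖x‖⁻¹^5 := by ring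
  rw [this, ← h4]; field_simp; ring

theorem lap_add {f g : E3 → ℝ} {x : E3} (hf : ContDiffAt ℝ 2 f x) (hg : ContDiffAt ℝ 2 g x) :
    lap (fun y => f y + g y) x = lap f x + lap g x := by
  have hd : ∀ {f : E3 → ℝ}, ContDiffAt ℝ 2 f x → ∀ i, DifferentiableAt ℝ (fun y => fderiv ℝ f y (be i)) x :=
    fun hf i => ((hf.fderiv_right (m := 1) (by norm_num)).differentiableAt (by norm_num)).clm_apply
      (differentiableAt_const _)
  unfold lap
  rw [← Finset.sum_add_distrib]
  refine Finset.sum_congr rfl fun i _ => ?_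
  have : (fun y => fderiv ℝ (fun y => f y + g y) y (be i)) =ᶠ[𝓝 x]
      fun y => fderiv ℝ f y (be i) + fderiv ℝ g y (be i) := by
    filter_upwards [hf.eventually (by simp), hg.eventually (by simp)] with y h1 h2
    rw [fderiv_fun_add (h1.differentiableAt (by norm_num)) (h2.differentiableAt (by norm_num))]; rfl
  rw [this.fderiv_eq, fderiv_fun_add (hd hf i) (hd hg i)]; rfl

theorem lap_const_mul {f : E3 → ℝ} (a : ℝ) (x : E3) (hf : ContDiff ℝ 2 f) :
    lap (fun y => a * f y) x = a * lap f x := by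
  have hd : ∀ i, Differentiable ℝ (fun y => fderiv ℝ f y (be i)) :=
    fun i => ((hf.fderiv_right (m := 1) (by norm_num)).differentiable (by norm_num)).clm_apply
      (differentiable_const _)
  unfold lap
  rw [Finset.mul_sum]
  refine Finset.sum_congr rfl fun i _ => ?_
  have : (fun y => fderiv ℝ (fun y => a * f y) y (be i)) = fun y => a * fderiv ℝ f y (be i) := by
    ext y
    rw [fderiv_const_mul (hf.differentiable (by norm_num) y)]; rfl
  rw [this, fderiv_const_mul (hd i x)]; rfl

theorem lap_comp_affine {f : E3 → ℝ} (b : ℝ) (p x : E3) (hf : ContDiff ℝ 2 f) :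
    lap (fun y => f (b • (y - p))) x = b^2 * lap f (b • (x - p)) := by
  have hA : ∀ y : E3, HasFDerivAt (fun y : E3 => b • (y - p)) (b • ContinuousLinearMap.id ℝ E3) y :=
    fun y => ((hasFDerivAt_id y).sub_const p).const_smul b
  have hc : ∀ {g : E3 → ℝ}, Differentiable ℝ g → ∀ y v, fderiv ℝ (fun y => g (b • (y - p))) y v =
      b * fderiv ℝ g (b • (y - p)) v := by
    intro g hg y v
    have : HasFDerivAt (fun y => g (b • (y - p))) _ y := (hg (b • (y - p))).hasFDerivAt.comp y (hA y)
    rw [this.fderiv]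
    simp
  have hd : ∀ i, Differentiable ℝ (fun y => fderiv ℝ f y (be i)) :=
    fun i => ((hf.fderiv_right (m := 1) (by norm_num)).differentiable (by norm_num)).clm_apply
      (differentiable_const _)
  unfold lap
  rw [Finset.mul_sum]
  refine Finset.sum_congr rfl fun i _ => ?_
  simp only [hc (hf.differentiable (by norm_num))]
  have hd2 : DifferentiableAt ℝ (fun y => fderiv ℝ f (b • (y - p)) (be i)) x :=
    ((hd i _).comp x (hA x).differentiableAt)
  rw [fderiv_const_mul hd2]
  simp only [smul_apply, smul_eq_mul]
  rw [hc (hd i)]; ring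

theorem D3_scale {f : E3 → ℝ} (a b : ℝ) (x : E3) (hf : ContDiff ℝ 3 f) :
    ‖iteratedFDeriv ℝ 3 (fun y => a * f (b • y)) x‖ ≤ |a| * |b|^3 * ‖iteratedFDeriv ℝ 3 f (b • x)‖ := by
  have h2 : ContDiff ℝ 3 (f ∘ (b • ContinuousLinearMap.id ℝ E3)) :=
    hf.comp (ContinuousLinearMap.contDiff _)
  have h1 : (fun y => a * f (b • y)) = a • (f ∘ (b • ContinuousLinearMap.id ℝ E3)) := by
    ext y; simp
  rw [h1, iteratedFDeriv_const_smul_apply h2.contDiffAt, norm_smul, mul_assoc]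
  refine mul_le_mul_of_nonneg_left ?_ (norm_nonneg _)
  rw [ContinuousLinearMap.iteratedFDeriv_comp_right _ hf _ le_rfl]
  refine (ContinuousMultilinearMap.norm_compContinuousLinearMap_le _ _).trans ?_
  simp only [Finset.prod_const, Finset.card_univ, Fintype.card_fin]
  rw [mul_comm]
  have : ‖b • ContinuousLinearMap.id ℝ E3‖ ≤ |b| := by
    rw [norm_smul]; simp
  gcongr
  simp

theorem lip_clamp : LipschitzWith 1 (fun x : E3 => max 0 (min 1 (2 - ‖x‖))) := by
  have : LipschitzWith 1 (fun x : E3 => 2 - ‖x‖) := by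
    simpa using (LipschitzWith.const (2:ℝ)).sub (lipschitzWith_one_norm (E := E3))
  exact (this.const_min 1).const_max 0

theorem exists_N : ∃ (N : E3 → ℝ) (a : ℝ), 0 < a ∧ ContDiff ℝ ∞ N ∧
    (∀ x, 1/4 ≤ ‖x‖ → N x = a * ‖x‖⁻¹) ∧ (∀ x, |N x| ≤ a * ‖x‖⁻¹) ∧ ∫ x, - lap N x = 1 := by
  let χ : ContDiffBump (0 : E3) := ⟨1/8, 1/4, by norm_num, by norm_num⟩
  let M : E3 → ℝ := fun x => (1 - χ x) * ‖x‖⁻¹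
  have hMs : ContDiff ℝ ∞ M := by
    rw [contDiff_iff_contDiffAt]
    intro x
    by_cases hx : x = 0
    · refine (contDiffAt_const (c := (0:ℝ))).congr_of_eventuallyEq ?_
      filter_upwards [ball_mem_nhds x (show (0:ℝ) < 1/8 by norm_num)] with y hy
      rw [hx] at hy
      simp only [M, χ.one_of_mem_closedBall (ball_subset_closedBall hy)]; simp
    · exact (contDiffAt_const.sub χ.contDiffAt).mul ((contDiffAt_norm ℝ hx).inv (by simpa using hx))
  have hM1 : ∀ x, 1/4 ≤ ‖x‖ → M x = ‖x‖⁻¹ := by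
    intro x hx
    have : χ x = 0 := χ.zero_of_le_dist (by rw [dist_zero_right]; exact hx)
    simp [M, this]
  have hM2 : ∀ x, |M x| ≤ ‖x‖⁻¹ := by
    intro x
    have h1 := χ.le_one (x := x); have h2 := χ.nonneg (x := x)
    rw [abs_mul, abs_of_nonneg (by linarith), abs_of_nonneg (by positivity)]
    exact mul_le_of_le_one_left (by positivity) (by linarith)
  have hMe : ∀ x : E3, 1/4 < ‖x‖ → M =ᶠ[𝓝 x] fun y => ‖y‖⁻¹ := by
    intro x hx
    filter_upwards [(isOpen_lt continuous_const continuous_norm).mem_nhds hx] with y hy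
    exact hM1 y (le_of_lt hy)
  have hl : ∀ x : E3, 1/4 < ‖x‖ → lap M x = 0 := fun x hx => by
    rw [lap_congr (hMe x hx), lap_invnorm]
    intro h; simp [h] at hx; linarith
  have hpos : 0 < ∫ x, - lap M x := by
    let v : E3 → ℝ := fun x => max 0 (min 1 (2 - ‖x‖))
    have hvc : HasCompactSupport v := HasCompactSupport.intro (isCompact_closedBall 0 2) fun x hx => by
      have : 2 < ‖x‖ := by simpa using hx
      simp only [v]; rw [max_eq_left]; exact (min_le_right _ _).trans (by linarith)
    have := ibp (U := univ) lip_clamp hvc isOpen_univ (subset_univ _) (f := M) ((contDiff_infty.1 hMs 2).contDiffOn)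
    have h2 : ∫ x, - lap M x = ∫ x, ⟪gradient v x, gradient M x⟫ := by
      rw [this, ← integral_neg]
      congr 1; ext x
      by_cases hx : 1/4 < ‖x‖
      · rw [hl x hx]; simp
      · have : min 1 (2 - ‖x‖) = 1 := min_eq_left (by linarith)
        simp [this]
    have h3 : ∀ x : E3, x ≠ 0 → 1 < ‖x‖ → ‖x‖ < 2 → ⟪gradient v x, gradient M x⟫ = (‖x‖⁻¹)^2 := by
      intro x h0 h1 h2
      have e : v =ᶠ[𝓝 x] fun y => 2 - (‖y‖⁻¹)⁻¹ := by
        filter_upwards [((isOpen_lt continuous_const continuous_norm).inter (isOpen_lt continuous_norm continuous_const)).mem_nhds ⟨h1, h2⟩] with y hy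
        have a1 : (1:ℝ) < ‖y‖ := hy.1
        have a2 : ‖y‖ < 2 := hy.2
        simp only [v, inv_inv]
        rw [min_eq_right (by linarith), max_eq_right (by linarith)]
      have hn : ‖x‖ ≠ 0 := by simpa using h0
      have hd : HasFDerivAt (fun y : E3 => 2 - (‖y‖⁻¹)⁻¹) _ x :=
        ((hasDerivAt_inv (inv_ne_zero hn)).comp_hasFDerivAt x (hasFDerivAt_invnorm h0)).const_sub 2
      rw [inner_gradient_left, e.fderiv_eq, hd.fderiv]
      simp only [neg_apply, smul_apply, smul_eq_mul, innerSL_apply_apply]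
      rw [inner_gradient_right, (hMe x (by linarith)).fderiv_eq, (hasFDerivAt_invnorm h0).fderiv]
      simp
      field_simp
    have hz : ∀ x : E3, ‖x‖ < 1 ∨ 2 < ‖x‖ → fderiv ℝ v x = 0 := by
      rintro x (hx | hx)
      · have : v =ᶠ[𝓝 x] fun _ => 1 := by
          filter_upwards [(isOpen_lt continuous_norm continuous_const).mem_nhds hx] with y hy
          have : ‖y‖ < 1 := hy
          simp only [v]; rw [min_eq_left (by linarith), max_eq_right (by linarith)]
        rw [this.fderiv_eq]; simp
      · have : v =ᶠ[𝓝 x] fun _ => 0 := by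
          filter_upwards [(isOpen_lt continuous_const continuous_norm).mem_nhds hx] with y hy
          have : 2 < ‖y‖ := hy
          simp only [v]; rw [max_eq_left]; exact (min_le_right _ _).trans (by linarith)
        rw [this.fderiv_eq]; simp
    have hS : ∀ R : ℝ, R ≠ 0 → ∀ᵐ x : E3, ‖x‖ ≠ R := by
      intro R hR
      have := Measure.addHaar_sphere_of_ne_zero (volume : Measure E3) 0 hR
      filter_upwards [measure_eq_zero_iff_ae_notMem.1 this] with x hx
      simpa using hx
    have hnn : 0 ≤ᵐ[volume] fun x => ⟪gradient v x, gradient M x⟫ := by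
      filter_upwards [hS 1 (by norm_num), hS 2 (by norm_num)] with x h1 h2
      rcases lt_or_gt_of_ne h1 with h | h
      · rw [inner_gradient_left, hz x (Or.inl h)]; simp
      rcases lt_or_gt_of_ne h2 with h' | h'
      · have : x ≠ 0 := by rintro rfl; simp at h; linarith
        rw [h3 x this h h']; positivity
      · rw [inner_gradient_left, hz x (Or.inr h')]; simp
    have hint : Integrable (fun x => ⟪gradient v x, gradient M x⟫) := by
      obtain ⟨B, hB⟩ := (isCompact_closedBall (0:E3) 2).exists_bound_of_continuousOn
        ((hMs.continuous_fderiv (by simp)).continuousOn)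
      refine integrable_of_bdd_supp (B := 1 * max B 0) (R := 2) ?_ ?_ ?_
      · simp only [inner_grad]
        refine (Finset.measurable_sum _ fun i _ => ?_).aestronglyMeasurable
        exact (measurable_fderiv_apply_const ℝ v _).mul (measurable_fderiv_apply_const ℝ M _)
      · intro x
        by_cases hx : 2 < ‖x‖
        · rw [inner_gradient_left, hz x (Or.inr hx)]; simp
        · refine (abs_real_inner_le_norm _ _).trans ?_
          rw [norm_grad, norm_grad]
          exact mul_le_mul (by simpa using fderiv_le_of_lip lip_clamp x)
            ((hB x (by simpa using hx)).trans (le_max_left _ _)) (norm_nonneg _) zero_le_one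
      · intro x hx
        rw [inner_gradient_left, hz x (Or.inr hx)]; simp
    rw [h2, integral_pos_iff_support_of_nonneg_ae hnn hint]
    have hsub : ball (EuclideanSpace.single 0 (3/2 : ℝ) : E3) (1/2) ⊆ Function.support fun x => ⟪gradient v x, gradient M x⟫ := by
      intro x hx
      have hx1 : ‖x - EuclideanSpace.single 0 (3/2 : ℝ)‖ < 1/2 := by simpa [dist_eq_norm] using hx
      have n1 : ‖(EuclideanSpace.single 0 (3/2 : ℝ) : E3)‖ = 3/2 := by simp
      have h1 : 1 < ‖x‖ := by
        have := norm_sub_norm_le (EuclideanSpace.single 0 (3/2 : ℝ) : E3) x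
        rw [norm_sub_rev] at this; linarith
      have h2 : ‖x‖ < 2 := by
        have := norm_sub_norm_le x (EuclideanSpace.single 0 (3/2 : ℝ) : E3)
        linarith
      have : x ≠ 0 := by rintro rfl; simp at h1; linarith
      rw [Function.mem_support, h3 x this h1 h2]; positivity
    exact (measure_ball_pos _ _ (by norm_num)).trans_le (measure_mono hsub)
  set m := ∫ x, - lap M x
  refine ⟨fun x => m⁻¹ * M x, m⁻¹, inv_pos.2 hpos, contDiff_const.mul hMs, fun x hx => by simp only [hM1 x hx],
    fun x => ?_, ?_⟩
  · rw [abs_mul, abs_of_pos (inv_pos.2 hpos)]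
    exact mul_le_mul_of_nonneg_left (hM2 x) (inv_pos.2 hpos).le
  · have : ∀ x, -lap (fun x => m⁻¹ * M x) x = m⁻¹ * (- lap M x) := fun x => by
      rw [lap_const_mul _ _ (contDiff_infty.1 hMs 2)]; ring
    simp only [this]
    rw [integral_const_mul]; exact inv_mul_cancel₀ hpos.ne'

structure Ker where
  Φ : ℝ → ℝ → E3 → ℝ
  ρ : E3 → ℝ
  k : E3 → ℝ
  C : ℝ
  Cpos : 0 < C
  hρ : ContDiff ℝ ∞ ρ
  hk : ContDiff ℝ ∞ k
  ρ_supp : ∀ x, 1 ≤ ‖x‖ → ρ x = 0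
  k_supp : ∀ x, 1 < ‖x‖ → k x = 0
  ρ_int : ∫ x, ρ x = 1
  hΦ : ∀ d s, 0 < s → s ≤ d → ContDiff ℝ ∞ (Φ d s)
  Φ_supp : ∀ d s x, 0 < s → s ≤ d → d ≤ ‖x‖ → Φ d s x = 0
  Φ_lap : ∀ d s x, 0 < s → s ≤ d →
    lap (Φ d s) x = -((s⁻¹)^3 * ρ (s⁻¹ • x) + (d⁻¹)^3 * k (d⁻¹ • x))
  Φ_D3 : ∀ d s x, 0 < s → s ≤ d → ‖iteratedFDeriv ℝ 3 (Φ d s) x‖ ≤ C * ((‖x‖ + s)⁻¹)^4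
  Φ_bd : ∀ d s x, 0 < s → s ≤ d → |Φ d s x| ≤ C * ‖x‖⁻¹
  Φ_eq : ∀ d s s' x, 0 < s → s ≤ d → 0 < s' → s' ≤ d → s ≤ ‖x‖ → s' ≤ ‖x‖ → Φ d s x = Φ d s' x

theorem contDiff_lap {f : E3 → ℝ} (hf : ContDiff ℝ ∞ f) : ContDiff ℝ ∞ (lap f) := by
  unfold lap
  refine ContDiff.sum fun i _ => ?_
  have h1 : ContDiff ℝ ∞ (fun y => fderiv ℝ f y (be i)) :=
    (hf.fderiv_right (m := ∞) le_rfl).clm_apply contDiff_const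
  exact (h1.fderiv_right (m := ∞) le_rfl).clm_apply contDiff_const

set_option maxHeartbeats 1000000 in
theorem ker_exists : Nonempty Ker := by
  obtain ⟨N, a, ha, hN, hN1, hN2, hNi⟩ := exists_N
  have hNe : ∀ x : E3, 1/4 < ‖x‖ → ∀ᶠ y in 𝓝 x, 1/4 < ‖y‖ := fun x hx =>
    (isOpen_lt continuous_const continuous_norm).mem_nhds hx
  have hlow : ∀ (r : ℝ) (x : E3), ‖x‖ < r → ∀ᶠ y in 𝓝 x, ‖y‖ < r := fun r x hx =>
    (isOpen_lt continuous_norm continuous_const).mem_nhds hx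
  have hlN : ∀ x : E3, 1/4 < ‖x‖ → lap N x = 0 := fun x hx => by
    have : N =ᶠ[𝓝 x] fun y => a * ‖y‖⁻¹ := by
      filter_upwards [hNe x hx] with y hy using hN1 y hy.le
    have h0 : x ≠ 0 := by rintro rfl; simp at hx; linarith
    have h1 : (fun y : E3 => ‖y‖⁻¹) =ᶠ[𝓝 x] fun y => a⁻¹ * N y := by
      filter_upwards [hNe x hx] with y hy
      rw [hN1 y hy.le]; field_simp
    have := lap_invnorm h0
    rw [lap_congr h1, lap_const_mul _ _ (contDiff_infty.1 hN 2)] at this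
    exact (mul_eq_zero.1 this).resolve_left (by positivity)
  have cont3 : ∀ {f : E3 → ℝ}, ContDiff ℝ ∞ f → Continuous (fun x => iteratedFDeriv ℝ 3 f x) :=
    fun hf => (contDiff_infty.1 hf 3).continuous_iteratedFDeriv (by norm_num)
  obtain ⟨B0, hB0⟩ := (isCompact_closedBall (0:E3) 1).exists_bound_of_continuousOn (cont3 hN).continuousOn
  have hB0p : 0 ≤ B0 := (norm_nonneg _).trans (hB0 0 (by simp))
  have hD3N : ∀ x : E3, ‖iteratedFDeriv ℝ 3 N x‖ ≤ 16 * B0 * ((1 + ‖x‖)⁻¹)^4 := by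
    intro x
    by_cases hx : ‖x‖ ≤ 1
    · refine (hB0 x (by simpa using hx)).trans ?_
      have h1 : (1/2 : ℝ) ≤ (1 + ‖x‖)⁻¹ := by
        rw [one_div]; exact inv_anti₀ (by positivity) (by linarith)
      have h2 := pow_le_pow_left₀ (by norm_num) h1 4
      nlinarith
    · push Not at hx
      have hx0 : 0 < ‖x‖ := by linarith
      obtain ⟨b, hbd⟩ : ∃ b, b = ‖x‖⁻¹ := ⟨_, rfl⟩
      have hb : 0 < b := hbd ▸ inv_pos.2 hx0
      have hbx : ‖b • x‖ = 1 := by rw [norm_smul, Real.norm_of_nonneg hb.le, hbd]; exact inv_mul_cancel₀ hx0.ne'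
      have e : N =ᶠ[𝓝 x] fun y => b * N (b • y) := by
        have hcb : Continuous fun y : E3 => ‖b • y‖ := by fun_prop
        have h2 : ∀ᶠ y in 𝓝 x, 1/4 < ‖b • y‖ :=
          hcb.continuousAt.eventually (lt_mem_nhds (by beta_reduce; rw [hbx]; norm_num))
        filter_upwards [hNe x (by linarith), h2] with y hy hy2
        rw [hN1 y hy.le, hN1 _ hy2.le, norm_smul, Real.norm_of_nonneg hb.le]
        rw [mul_inv]; field_simp
      rw [(e.iteratedFDeriv (𝕜 := ℝ) 3).eq_of_nhds]
      refine (D3_scale b b x (contDiff_infty.1 hN 3)).trans ?_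
      have h3 := hB0 (b • x) (by simp [hbx])
      have h4 : b ≤ 2 * (1 + ‖x‖)⁻¹ := by
        rw [hbd, inv_eq_one_div, div_le_iff₀ hx0, ← div_eq_mul_inv, div_mul_eq_mul_div, le_div_iff₀ (by positivity)]; linarith
      rw [abs_of_pos hb]
      calc b * b^3 * ‖iteratedFDeriv ℝ 3 N (b • x)‖ ≤ b * b^3 * B0 := by gcongr
        _ = b^4 * B0 := by ring
        _ ≤ (2 * (1 + ‖x‖)⁻¹)^4 * B0 := by gcongr
        _ = _ := by ring
  let θ : ContDiffBump (0 : E3) := ⟨1/2, 1, by norm_num, by norm_num⟩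
  have θ1 : ∀ x : E3, ‖x‖ < 1/2 → θ x = 1 := fun x hx =>
    θ.one_of_mem_closedBall (by rw [mem_closedBall, dist_zero_right]; exact hx.le)
  have θ0 : ∀ x : E3, 1 ≤ ‖x‖ → θ x = 0 := fun x hx => θ.zero_of_le_dist (by rw [dist_zero_right]; exact hx)
  let P : ℝ → E3 → ℝ := fun s x => θ x * (s⁻¹ * N (s⁻¹ • x))
  have hP : ∀ s, ContDiff ℝ ∞ (P s) := fun s =>
    θ.contDiff.mul (contDiff_const.mul (hN.comp (contDiff_id.const_smul _)))
  have hNs : ∀ s x, 0 < s → s * (1/4) ≤ ‖x‖ → s⁻¹ * N (s⁻¹ • x) = a * ‖x‖⁻¹ := by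
    intro s x hs hx
    have : 1/4 ≤ ‖s⁻¹ • x‖ := by
      rw [norm_smul, Real.norm_of_nonneg (by positivity), ← div_eq_inv_mul, le_div_iff₀ hs]; linarith
    rw [hN1 _ this, norm_smul, Real.norm_of_nonneg (by positivity)]
    field_simp
  have Pin : ∀ s x, ‖x‖ < 1/2 → P s =ᶠ[𝓝 x] fun y => s⁻¹ * N (s⁻¹ • (y - 0)) := by
    intro s x hx
    filter_upwards [hlow _ x hx] with y hy
    simp only [P, θ1 y hy, one_mul, sub_zero]
  have Pout : ∀ s x, 0 < s → s ≤ 1 → 1/4 < ‖x‖ → P s =ᶠ[𝓝 x] P 1 := by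
    intro s x hs hs1 hx
    filter_upwards [hNe x hx] with y hy
    simp only [P]
    rw [hNs s y hs (by nlinarith), hNs 1 y one_pos (by linarith)]
  have hs2 : ∀ s : ℝ, ContDiff ℝ 2 (fun y => N (s • (y - 0))) := fun s =>
    (contDiff_infty.1 hN 2).comp ((contDiff_id.sub contDiff_const).const_smul _)
  have lapin : ∀ s x, ‖x‖ < 1/2 → lap (P s) x = (s⁻¹)^3 * lap N (s⁻¹ • x) := by
    intro s x hx
    rw [lap_congr (Pin s x hx), lap_const_mul _ _ (hs2 _), lap_comp_affine _ _ _ (contDiff_infty.1 hN 2), sub_zero]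
    ring
  have Psupp : ∀ s x, 1 ≤ ‖x‖ → P s x = 0 := fun s x hx => by simp [P, θ0 x hx]
  have Plap : ∀ s x, 0 < s → s ≤ 1 → lap (P s) x =
      -((s⁻¹)^3 * (- lap N (s⁻¹ • x)) + (- lap (P 1) x - (- lap N x))) := by
    intro s x hs hs1
    by_cases hx : ‖x‖ < 1/2
    · rw [lapin s x hx, lapin 1 x hx]; simp
    · have h1 : 1/4 < ‖x‖ := by linarith
      have h2 : 1/4 < ‖s⁻¹ • x‖ := by
        rw [norm_smul, Real.norm_of_nonneg (by positivity), ← div_eq_inv_mul, lt_div_iff₀ hs]; nlinarith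
      rw [lap_congr (Pout s x hs hs1 h1), hlN x h1, hlN _ h2]; ring
  obtain ⟨B1, hB1⟩ := (isCompact_closedBall (0:E3) 1).exists_bound_of_continuousOn (cont3 (hP 1)).continuousOn
  have hB1p : 0 ≤ B1 := (norm_nonneg _).trans (hB1 0 (by simp))
  have PD3 : ∀ s x, 0 < s → s ≤ 1 → ‖iteratedFDeriv ℝ 3 (P s) x‖ ≤ (16 * B0 + 16 * B1) * ((‖x‖ + s)⁻¹)^4 := by
    intro s x hs hs1
    by_cases hx : ‖x‖ < 1/2
    · have e : P s =ᶠ[𝓝 x] fun y => s⁻¹ * N (s⁻¹ • y) := by simpa using Pin s x hx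
      rw [(e.iteratedFDeriv (𝕜 := ℝ) 3).eq_of_nhds]
      refine (D3_scale s⁻¹ s⁻¹ x (contDiff_infty.1 hN 3)).trans ?_
      have h1 := hD3N (s⁻¹ • x)
      rw [norm_smul, Real.norm_of_nonneg (by positivity)] at h1
      rw [abs_of_pos (inv_pos.2 hs)]
      calc s⁻¹ * s⁻¹^3 * ‖iteratedFDeriv ℝ 3 N (s⁻¹ • x)‖
          ≤ s⁻¹ * s⁻¹^3 * (16 * B0 * ((1 + s⁻¹ * ‖x‖)⁻¹)^4) := by gcongr
        _ = 16 * B0 * ((‖x‖ + s)⁻¹)^4 := by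
          have : (‖x‖ + s) = s * (1 + s⁻¹ * ‖x‖) := by field_simp; ring
          rw [this, mul_inv]; ring
        _ ≤ _ := by gcongr; linarith
    · rw [((Pout s x hs hs1 (by linarith)).iteratedFDeriv (𝕜 := ℝ) 3).eq_of_nhds]
      by_cases hx1 : ‖x‖ ≤ 1
      · refine (hB1 x (by simpa using hx1)).trans ?_
        have h1 : (1/2 : ℝ) ≤ (‖x‖ + s)⁻¹ := by
          rw [one_div]; exact inv_anti₀ (by positivity) (by linarith)
        have h2 := pow_le_pow_left₀ (by norm_num) h1 4
        nlinarith
      · have : P 1 =ᶠ[𝓝 x] fun _ => 0 := by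
          filter_upwards [(isOpen_lt continuous_const continuous_norm).mem_nhds (not_le.1 hx1)] with y hy
          exact Psupp 1 y (le_of_lt hy)
        rw [(this.iteratedFDeriv (𝕜 := ℝ) 3).eq_of_nhds, iteratedFDeriv_fun_zero]
        simp; positivity
  have Pbd : ∀ s x, 0 < s → |P s x| ≤ a * ‖x‖⁻¹ := by
    intro s x hs
    have h1 := θ.le_one (x := x); have h2 := θ.nonneg (x := x)
    simp only [P]
    rw [abs_mul, abs_mul, abs_of_nonneg h2, abs_of_pos (inv_pos.2 hs)]
    have := hN2 (s⁻¹ • x)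
    rw [norm_smul, Real.norm_of_nonneg (by positivity)] at this
    calc θ x * (s⁻¹ * |N (s⁻¹ • x)|) ≤ 1 * (s⁻¹ * (a * (s⁻¹ * ‖x‖)⁻¹)) := by gcongr
      _ = _ := by field_simp
  have hinv : ∀ d : ℝ, 0 < d → ∀ x : E3, ‖d⁻¹ • x‖ = ‖x‖ / d := fun d hd x => by
    rw [norm_smul, Real.norm_of_nonneg (by positivity), div_eq_inv_mul]
  refine ⟨⟨fun d s x => d⁻¹ * P (s / d) (d⁻¹ • x), fun x => - lap N x, fun x => - lap (P 1) x - (- lap N x),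
    16 * B0 + 16 * B1 + a, by positivity, (contDiff_lap hN).neg,
    (contDiff_lap (hP 1)).neg.sub (contDiff_lap hN).neg, fun x hx => ?_, fun x hx => ?_, hNi, fun d s hs hsd => ?_,
    fun d s x hs hsd hx => ?_, fun d s x hs hsd => ?_, fun d s x hs hsd => ?_, fun d s x hs hsd => ?_,
    fun d s s' x hs hsd hs' hsd' hx hx' => ?_⟩⟩
  · rw [hlN x (by linarith)]; simp
  · have : P 1 =ᶠ[𝓝 x] fun y => 0 * N y := by
      filter_upwards [(isOpen_lt continuous_const continuous_norm).mem_nhds hx] with y hy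
      rw [Psupp 1 y (le_of_lt hy), zero_mul]
    rw [hlN x (by linarith), lap_congr this, lap_const_mul _ _ (contDiff_infty.1 hN 2)]; simp
  · exact contDiff_const.mul ((hP _).comp (contDiff_id.const_smul _))
  · have hd := hs.trans_le hsd
    rw [Psupp _ _ (by rw [hinv d hd, le_div_iff₀ hd]; linarith), mul_zero]
  · have hd := hs.trans_le hsd
    have e : (fun x => d⁻¹ * P (s / d) (d⁻¹ • x)) = fun x => d⁻¹ * P (s / d) (d⁻¹ • (x - 0)) := by simp
    have hc2 : ContDiff ℝ 2 (fun x => P (s / d) (d⁻¹ • (x - 0))) :=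
      (contDiff_infty.1 (hP _) 2).comp ((contDiff_id.sub contDiff_const).const_smul _)
    rw [e, lap_const_mul _ _ hc2,
      lap_comp_affine _ _ _ (contDiff_infty.1 (hP _) 2), Plap _ _ (by positivity) ((div_le_one hd).2 hsd), smul_smul, sub_zero]
    have : (s / d)⁻¹ * d⁻¹ = s⁻¹ := by field_simp
    rw [this]; field_simp
  · have hd := hs.trans_le hsd
    refine (D3_scale d⁻¹ d⁻¹ x (contDiff_infty.1 (hP _) 3)).trans ?_
    have h1 := PD3 (s/d) (d⁻¹ • x) (by positivity) ((div_le_one hd).2 hsd)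
    rw [hinv d hd] at h1
    rw [abs_of_pos (inv_pos.2 hd)]
    calc _ ≤ d⁻¹ * d⁻¹^3 * ((16 * B0 + 16 * B1) * ((‖x‖ / d + s / d)⁻¹)^4) := by gcongr
      _ = (16 * B0 + 16 * B1) * ((‖x‖ + s)⁻¹)^4 := by
        rw [← add_div, inv_div]; field_simp
      _ ≤ _ := mul_le_mul_of_nonneg_right (by linarith) (by positivity)
  · have hd := hs.trans_le hsd
    have h1 := Pbd (s/d) (d⁻¹ • x) (by positivity)
    rw [hinv d hd] at h1
    rw [abs_mul, abs_of_pos (inv_pos.2 hd)]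
    calc _ ≤ d⁻¹ * (a * (‖x‖ / d)⁻¹) := by gcongr
      _ = a * ‖x‖⁻¹ := by rw [inv_div]; field_simp
      _ ≤ _ := mul_le_mul_of_nonneg_right (by linarith) (by positivity)
  · have hd := hs.trans_le hsd
    simp only [P]
    rw [hNs _ _ (by positivity) (by rw [hinv d hd, div_mul_eq_mul_div]; gcongr; linarith),
      hNs _ _ (by positivity) (by rw [hinv d hd, div_mul_eq_mul_div]; gcongr; linarith)]

theorem lip_ext {D : Set E3} {f : E3 → ℝ} {K : ℝ≥0}
    (hf : LipschitzOnWith K f (closure D)) (h0 : ∀ x ∈ frontier D, f x = 0) :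
    LipschitzWith K (D.indicator f) := by
  have key : ∀ x ∈ D, ∀ y ∉ D, |f x| ≤ K * dist x y := by
    intro x hx y hy
    obtain ⟨z, hz, hzd⟩ := exists_mem_frontier_infDist_compl_eq_dist hx (fun h => hy (h ▸ mem_univ y))
    have h1 := hf.dist_le_mul x (subset_closure hx) z (frontier_subset_closure hz)
    rw [h0 z hz, Real.dist_eq, sub_zero] at h1
    refine h1.trans ?_
    gcongr
    rw [← hzd]; exact infDist_le_dist_of_mem hy
  refine LipschitzWith.of_dist_le_mul fun x y => ?_
  by_cases hx : x ∈ D <;> by_cases hy : y ∈ D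
  · simp only [indicator_of_mem hx, indicator_of_mem hy]
    exact hf.dist_le_mul x (subset_closure hx) y (subset_closure hy)
  · simp only [indicator_of_mem hx, indicator_of_notMem hy, Real.dist_eq, sub_zero]
    exact key x hx y hy
  · simp only [indicator_of_notMem hx, indicator_of_mem hy, Real.dist_eq, zero_sub, abs_neg]
    rw [dist_comm]; exact key y hy x hx
  · simp only [indicator_of_notMem hx, indicator_of_notMem hy, dist_self]; positivity

theorem indicator_eqOn_nhds {D : Set E3} (hD : IsOpen D) (f : E3 → ℝ) {x : E3} (hx : x ∈ D) :
    D.indicator f =ᶠ[𝓝 x] f := by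
  filter_upwards [hD.mem_nhds hx] with y hy using indicator_of_mem hy f

theorem indicator_out {D : Set E3} (f : E3 → ℝ) {x : E3} (hx : x ∉ closure D) :
    D.indicator f =ᶠ[𝓝 x] fun _ => 0 := by
  filter_upwards [isClosed_closure.isOpen_compl.mem_nhds hx] with y hy using
    indicator_of_notMem (fun h => hy (subset_closure h)) f

theorem ae_D {D : Set E3} (hDc : Convex ℝ D) : ∀ᵐ x, x ∈ D ∨ x ∉ closure D := by
  have : volume (frontier D) = 0 := hDc.addHaar_frontier volume
  filter_upwards [measure_eq_zero_iff_ae_notMem.1 this] with x hx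
  by_contra! h
  exact hx ⟨h.2, fun h' => h.1 (interior_subset h')⟩

theorem lineD {g : E3 → ℝ} {x : E3} (hg : DifferentiableAt ℝ g x) (v : E3) :
    HasDerivAt (fun t : ℝ => g (x + t • v)) (fderiv ℝ g x v) 0 := by
  have h1 : HasDerivAt (fun t : ℝ => x + t • v) v 0 := by
    simpa using ((hasDerivAt_id (0:ℝ)).smul_const v).const_add x
  have h2 : HasFDerivAt g (fderiv ℝ g x) (x + (0:ℝ) • v) := by simpa using hg.hasFDerivAt
  exact h2.comp_hasDerivAt 0 h1

theorem lineD_eq {g : E3 → ℝ} {x : E3} (hg : DifferentiableAt ℝ g x) {v : E3} {a : ℝ}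
    (h : HasDerivAt (fun t : ℝ => g (x + t • v)) a 0) : fderiv ℝ g x v = a :=
  (lineD hg v).unique h

theorem c1_lipOn {D : Set E3} (hDb : Bornology.IsBounded D) (hDc : Convex ℝ D)
    {f : E3 → ℝ} (hf : ContDiff ℝ 1 f) : ∃ K : ℝ≥0, LipschitzOnWith K f (closure D) := by
  obtain ⟨B, hB⟩ := hDb.isCompact_closure.exists_bound_of_continuousOn
    (hf.continuous_fderiv (by norm_num)).continuousOn
  refine ⟨⟨max B 0, le_max_right _ _⟩, hDc.closure.lipschitzOnWith_of_nnnorm_fderiv_le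
    (fun x _ => hf.differentiable (by norm_num) x) fun x hx => ?_⟩
  exact (hB x hx).trans (le_max_left _ _)

theorem int_D_zero {D : Set E3} (hD : IsOpen D) (hDb : Bornology.IsBounded D) (hDc : Convex ℝ D)
    {f : E3 → ℝ} (hf : ContDiff ℝ 1 f) (h0 : ∀ x ∈ frontier D, f x = 0) (v : E3) :
    ∫ x in D, fderiv ℝ f x v = 0 := by
  obtain ⟨K, hK⟩ := c1_lipOn hDb hDc hf
  have hL := lip_ext hK h0
  have hc : HasCompactSupport (D.indicator f) :=
    hDb.isCompact_closure.of_isClosed_subset (isClosed_tsupport _)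
      (closure_mono (support_indicator_subset))
  rw [← int_fderiv_zero hL hc v, ← integral_indicator hD.measurableSet]
  refine integral_congr_ae ?_
  filter_upwards [ae_D hDc] with x hx
  rcases hx with hx | hx
  · rw [indicator_of_mem hx, (indicator_eqOn_nhds hD f hx).fderiv_eq]
  · rw [indicator_of_notMem (fun h => hx (subset_closure h)), (indicator_out f hx).fderiv_eq]; simp

theorem cdfd {f : E3 → ℝ} (hf : ContDiff ℝ 2 f) (v : E3) : ContDiff ℝ 1 (fun x => fderiv ℝ f x v) :=
  (hf.fderiv_right (m := 1) (by norm_num)).clm_apply contDiff_const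

theorem cont_lap {f : E3 → ℝ} (hf : ContDiff ℝ 2 f) : Continuous (lap f) := by
  unfold lap
  refine continuous_finsetSum _ fun i _ => ?_
  exact ((cdfd hf (be i)).continuous_fderiv (by norm_num)).clm_apply continuous_const

theorem int_cont {D : Set E3} (hDb : Bornology.IsBounded D) {f : E3 → ℝ} (hf : Continuous f) :
    IntegrableOn f D :=
  (hf.continuousOn.integrableOn_compact hDb.isCompact_closure).mono_set subset_closure

/-- Kato type inequality. -/
theorem kato {D : Set E3} (hD : IsOpen D) (hDb : Bornology.IsBounded D) (hDc : Convex ℝ D)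
    {b φ : E3 → ℝ} (hb : ContDiff ℝ 2 b) (hφ : ContDiff ℝ 2 φ) {c0 : ℝ} (hc0 : 0 < c0)
    (hbp : ∀ x ∈ D, 0 ≤ b x) (hbl : ∀ x ∈ D, lap b x ≤ -c0) (h0 : ∀ x ∈ frontier D, φ x = 0) :
    c0 * ∫ x in D, |φ x| ≤ ∫ x in D, b x * |lap φ x| := by
  have hfin : volume D ≠ ⊤ := hDb.measure_lt_top.ne
  have main : ∀ ε : ℝ, 0 < ε → ∫ x in D, (c0 * (|φ x| - ε) - b x * |lap φ x|) ≤ 0 := by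
    intro ε hε
    let q : E3 → ℝ := fun x => √(φ x ^ 2 + ε ^ 2)
    have hqp : ∀ x, 0 < φ x ^ 2 + ε ^ 2 := fun x => by positivity
    have hq0 : ∀ x, 0 < q x := fun x => Real.sqrt_pos.2 (hqp x)
    have hqq : ∀ x, q x ^ 2 = φ x ^ 2 + ε ^ 2 := fun x => Real.sq_sqrt (hqp x).le
    have hq : ContDiff ℝ 2 q := ((hφ.pow 2).add contDiff_const).sqrt fun x => (hqp x).ne'
    have hq1 : ContDiff ℝ 1 q := hq.of_le (by norm_num)
    have hφ1 : ContDiff ℝ 1 φ := hφ.of_le (by norm_num)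
    have hb1 : ContDiff ℝ 1 b := hb.of_le (by norm_num)
    let X : Fin 3 → E3 → ℝ := fun i x => b x * φ x * fderiv ℝ φ x (be i) / q x - (q x - ε) * fderiv ℝ b x (be i)
    have hX : ∀ i, ContDiff ℝ 1 (X i) := fun i =>
      (((hb1.mul hφ1).mul (cdfd hφ _)).div hq1 fun x => (hq0 x).ne').sub
        ((hq1.sub contDiff_const).mul (cdfd hb _))
    have hX0 : ∀ i, ∫ x in D, fderiv ℝ (X i) x (be i) = 0 := fun i =>
      int_D_zero hD hDb hDc (hX i) (fun x hx => by
        have : q x = ε := by simp only [q, h0 x hx]; rw [zero_pow two_ne_zero, zero_add, Real.sqrt_sq hε.le]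
        simp [X, h0 x hx, this]) _
    have hXd : ∀ i x, fderiv ℝ (X i) x (be i) =
        b x * φ x * fderiv ℝ (fun y => fderiv ℝ φ y (be i)) x (be i) / q x
        + b x * (fderiv ℝ φ x (be i))^2 * (ε^2 / q x ^ 3)
        - (q x - ε) * fderiv ℝ (fun y => fderiv ℝ b y (be i)) x (be i) := by
      intro i x
      refine lineD_eq ((hX i).differentiable (by norm_num) x) ?_
      have d1 := lineD (hb1.differentiable (by norm_num) x) (be i)
      have d2 := lineD (hφ1.differentiable (by norm_num) x) (be i)
      have d3 := lineD ((cdfd hφ (be i)).differentiable (by norm_num) x) (be i)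
      have d4 := lineD ((cdfd hb (be i)).differentiable (by norm_num) x) (be i)
      have hx0 : x + (0:ℝ) • be i = x := by simp
      have d5 : HasDerivAt (fun t : ℝ => q (x + t • be i)) (φ x * fderiv ℝ φ x (be i) / q x) 0 := by
        have := ((d2.pow 2).add_const (ε^2)).sqrt (by simpa using (hqp x).ne')
        refine HasDerivAt.congr_deriv this ?_
        simp only [hx0, Pi.pow_apply]
        change _ / (2 * q x) = _
        have := (hq0 x).ne'
        norm_num
        field_simp
      have := ((((d1.mul d2).mul d3).div d5 (by simpa using (hq0 x).ne')).sub
        ((d5.sub_const ε).mul d4))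
      refine HasDerivAt.congr_deriv this ?_
      simp only [hx0, Pi.mul_apply]
      have := (hq0 x).ne'
      have e : ε^2 = q x ^2 - φ x ^2 := by rw [hqq]; ring
      rw [e]; field_simp; ring
    have hint : ∀ i, IntegrableOn (fun x => fderiv ℝ (X i) x (be i)) D := fun i =>
      int_cont hDb (((hX i).continuous_fderiv (by norm_num)).clm_apply continuous_const)
    have hsum : ∫ x in D, ∑ i, fderiv ℝ (X i) x (be i) = 0 := by
      rw [integral_finsetSum _ fun i _ => hint i]; simp [hX0]
    rw [← hsum]
    refine setIntegral_mono_on ?_ (integrable_finsetSum _ fun i _ => hint i) hD.measurableSet fun x hx => ?_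
    · refine int_cont hDb ?_
      have := cont_lap hφ
      have h1 := hφ.continuous
      have h2 := hb.continuous
      fun_prop
    · simp only [hXd, Finset.sum_sub_distrib, Finset.sum_add_distrib]
      rw [← Finset.mul_sum, ← Finset.sum_div, ← Finset.mul_sum]
      change _ ≤ b x * φ x * lap φ x / q x + _ - (q x - ε) * lap b x
      have hbx := hbp x hx
      have hqφ : |φ x| ≤ q x := Real.abs_le_sqrt (by nlinarith)
      have hqε : ε ≤ q x := Real.le_sqrt_of_sq_le (by nlinarith [sq_nonneg (φ x)])
      have t1 : -(b x * |lap φ x|) ≤ b x * φ x * lap φ x / q x := by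
        rw [le_div_iff₀ (hq0 x)]
        have : -(|φ x| * |lap φ x|) ≤ φ x * lap φ x := by rw [← abs_mul]; exact neg_abs_le _
        nlinarith [mul_le_mul_of_nonneg_right hqφ (mul_nonneg hbx (abs_nonneg (lap φ x))), mul_le_mul_of_nonneg_left this hbx]
      have t2 : 0 ≤ ∑ i, b x * (fderiv ℝ φ x (be i))^2 * (ε^2 / q x ^ 3) :=
        Finset.sum_nonneg fun i _ => by have := hq0 x; positivity
      nlinarith [hbl x hx, mul_le_mul_of_nonneg_left (hbl x hx) (sub_nonneg.2 hqε), mul_le_mul_of_nonneg_left hqφ hc0.le]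
  have i1 : IntegrableOn (fun x => |φ x|) D := int_cont hDb hφ.continuous.abs
  have i2 : IntegrableOn (fun x => b x * |lap φ x|) D := int_cont hDb (hb.continuous.mul (cont_lap hφ).abs)
  have m2 : ∀ ε : ℝ, 0 < ε → c0 * (∫ x in D, |φ x|) - c0 * ε * volume.real D ≤ ∫ x in D, b x * |lap φ x| := by
    intro ε hε
    have := main ε hε
    have hcst : IntegrableOn (fun _ : E3 => ε) D := integrableOn_const hfin
    have i3 : IntegrableOn (fun x => c0 * (|φ x| - ε)) D := (i1.sub hcst).const_mul c0
    rw [integral_sub i3 i2, integral_const_mul, integral_sub i1 hcst,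
      setIntegral_const] at this
    simp only [smul_eq_mul] at this
    linarith
  refine le_of_forall_pos_le_add fun η hη => ?_
  have := m2 (η / (c0 * (volume.real D + 1))) (by positivity)
  have h3 : c0 * (η / (c0 * (volume.real D + 1))) * volume.real D ≤ η := by
    have : c0 * (η / (c0 * (volume.real D + 1))) * volume.real D = η * (volume.real D / (volume.real D + 1)) := by field_simp
    rw [this]
    exact mul_le_of_le_one_right hη.le ((div_le_one (by positivity)).2 (by linarith))
  linarith

theorem cda_fderiv {f : E3 → ℝ} {x : E3} (hf : ContDiffAt ℝ 2 f x) (v : E3) :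
    DifferentiableAt ℝ (fun y => fderiv ℝ f y v) x :=
  ((hf.fderiv_right (m := 1) (by norm_num)).differentiableAt (by norm_num)).clm_apply (differentiableAt_const _)

theorem lap_of {f : E3 → ℝ} {x : E3} (hf : ContDiffAt ℝ 2 f x) {g : Fin 3 → E3 → ℝ} {a : Fin 3 → ℝ}
    (h1 : ∀ i, ∀ᶠ y in 𝓝 x, fderiv ℝ f y (be i) = g i y)
    (h2 : ∀ i, HasDerivAt (fun t : ℝ => g i (x + t • be i)) (a i) 0) : lap f x = ∑ i, a i := by
  unfold lap
  refine Finset.sum_congr rfl fun i _ => ?_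
  have e : (fun y => fderiv ℝ f y (be i)) =ᶠ[𝓝 x] g i := h1 i
  have := cda_fderiv hf (be i)
  rw [e.differentiableAt_iff] at this
  rw [e.fderiv_eq]
  exact lineD_eq this (h2 i)

theorem lap_harm {ι : Type*} {s : Finset ι} {p : ι → E3 → ℝ} {U : Set E3} (hU : IsOpen U)
    (hs : s.Nonempty)
    (hp : ∀ k ∈ s, ContDiffOn ℝ 2 (p k) U) (hpos : ∀ k ∈ s, ∀ x ∈ U, 0 < p k x) {c0 : ℝ} (hc : 0 ≤ c0)
    {x : E3} (hx : x ∈ U)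
    (hl : ∀ k ∈ s, lap (p k) x ≤ -c0) :
    lap (fun y => (∑ k ∈ s, (p k y)⁻¹)⁻¹) x ≤ -(c0 / s.card) := by
  have hS : ∀ y ∈ U, 0 < ∑ k ∈ s, (p k y)⁻¹ := fun y hy =>
    Finset.sum_pos (fun k hk => inv_pos.2 (hpos k hk y hy)) hs
  have hpc : ∀ k ∈ s, ∀ y ∈ U, ContDiffAt ℝ 2 (p k) y := fun k hk y hy => (hp k hk).contDiffAt (hU.mem_nhds hy)
  set b : E3 → ℝ := fun y => (∑ k ∈ s, (p k y)⁻¹)⁻¹ with hb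
  have hbc : ∀ y ∈ U, ContDiffAt ℝ 2 b y := fun y hy =>
    ContDiffAt.inv (ContDiffAt.sum fun k hk => (hpc k hk y hy).inv (hpos k hk y hy).ne') (hS y hy).ne'
  have hbd : ∀ y ∈ U, ∀ v, HasDerivAt (fun t : ℝ => b (y + t • v)) (b y ^2 * ∑ k ∈ s, fderiv ℝ (p k) y v / p k y ^2) 0 := by
    intro y hy v
    have y0 : y + (0:ℝ) • v = y := by simp
    have h1 : ∀ k ∈ s, HasDerivAt (fun t : ℝ => (p k (y + t • v))⁻¹) (-(fderiv ℝ (p k) y v) / p k y ^2) 0 := by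
      intro k hk
      have := (lineD ((hpc k hk y hy).differentiableAt (by norm_num)) v).inv (by rw [y0]; exact (hpos k hk y hy).ne')
      rw [y0] at this; exact this
    have h2 := (HasDerivAt.fun_sum h1).inv (by simp only [y0]; exact (hS y hy).ne')
    refine HasDerivAt.congr_deriv h2 ?_
    simp only [y0, hb, inv_pow, neg_div, Finset.sum_neg_distrib, neg_neg]
    rw [div_eq_inv_mul]
  have h1 : ∀ i : Fin 3, ∀ᶠ y in 𝓝 x, fderiv ℝ b y (be i) = b y ^2 * ∑ k ∈ s, fderiv ℝ (p k) y (be i) / p k y ^2 := by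
    intro i
    filter_upwards [hU.mem_nhds hx] with y hy
    exact lineD_eq ((hbc y hy).differentiableAt (by norm_num)) (hbd y hy _)
  have bp : 0 < b x := inv_pos.2 (hS x hx)
  have h2 : ∀ i : Fin 3, ∃ a, HasDerivAt (fun t : ℝ => b (x + t • be i) ^2 * ∑ k ∈ s, fderiv ℝ (p k) (x + t • be i) (be i) / p k (x + t • be i) ^2)
      a 0 ∧ a ≤ b x ^2 * ∑ k ∈ s, fderiv ℝ (fun y => fderiv ℝ (p k) y (be i)) x (be i) / p k x ^2 := by
    intro i
    have x0 : x + (0:ℝ) • be i = x := by simp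
    have e1 := (hbd x hx (be i)).pow 2
    have e2 : ∀ k ∈ s, HasDerivAt (fun t : ℝ => fderiv ℝ (p k) (x + t • be i) (be i) / p k (x + t • be i) ^2)
        (fderiv ℝ (fun y => fderiv ℝ (p k) y (be i)) x (be i) / p k x ^2 - 2 * (fderiv ℝ (p k) x (be i))^2 / p k x ^3) 0 := by
      intro k hk
      have hpk := (hpos k hk x hx).ne'
      have f1 := lineD (cda_fderiv (hpc k hk x hx) (be i)) (be i)
      have f2 := (lineD ((hpc k hk x hx).differentiableAt (by norm_num)) (be i)).pow 2
      have f3 := f1.div f2 (by simp only [Pi.pow_apply, x0]; positivity)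
      refine HasDerivAt.congr_deriv f3 ?_
      simp only [Pi.pow_apply, x0]
      norm_num
      field_simp
    have e3 := e1.mul (HasDerivAt.fun_sum e2)
    refine ⟨_, e3, ?_⟩
    simp only [Pi.pow_apply, x0]
    set A := ∑ k ∈ s, fderiv ℝ (p k) x (be i) / p k x ^2 with hA
    set Q := ∑ k ∈ s, (fderiv ℝ (p k) x (be i))^2 / p k x ^3 with hQ
    have cs : A^2 ≤ Q * ∑ k ∈ s, (p k x)⁻¹ := by
      refine Finset.sum_sq_le_sum_mul_sum_of_sq_le_mul _ (fun k hk => ?_) (fun k hk => ?_) fun k hk => ?_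
      · have := hpos k hk x hx; positivity
      · have := hpos k hk x hx; positivity
      · have := (hpos k hk x hx).ne'; refine le_of_eq ?_; field_simp
    have cs2 : b x * A^2 ≤ Q := by
      have : b x * (Q * ∑ k ∈ s, (p k x)⁻¹) = Q := by
        have h9 := (hS x hx).ne'
        simp only [hb]; rw [mul_comm, mul_assoc, mul_inv_cancel₀ h9, mul_one]
      rw [← this]; gcongr
    rw [Finset.sum_sub_distrib]
    have : ∑ k ∈ s, 2 * (fderiv ℝ (p k) x (be i))^2 / p k x ^3 = 2 * Q := by
      rw [hQ, Finset.mul_sum]; exact Finset.sum_congr rfl fun k _ => by ring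
    rw [this]
    norm_num
    nlinarith [mul_le_mul_of_nonneg_left cs2 (sq_nonneg (b x))]
  choose a ha ha' using h2
  rw [lap_of (hbc x hx) h1 ha]
  refine (Finset.sum_le_sum fun i _ => ha' i).trans ?_
  rw [← Finset.mul_sum, Finset.sum_comm]
  have : ∀ k ∈ s, ∑ i : Fin 3, fderiv ℝ (fun y => fderiv ℝ (p k) y (be i)) x (be i) / p k x ^2 ≤ -c0 * ((p k x)⁻¹)^2 := by
    intro k hk
    rw [← Finset.sum_div, div_eq_mul_inv, ← inv_pow]
    exact mul_le_mul_of_nonneg_right (hl k hk) (by positivity)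
  refine (mul_le_mul_of_nonneg_left (Finset.sum_le_sum this) (by positivity)).trans ?_
  rw [← Finset.mul_sum]
  have cs3 : (∑ k ∈ s, (p k x)⁻¹)^2 ≤ s.card * ∑ k ∈ s, ((p k x)⁻¹)^2 := sq_sum_le_card_mul_sum_sq
  have hcard : (0:ℝ) < s.card := by exact_mod_cast hs.card_pos
  have : 1 ≤ b x ^2 * (s.card * ∑ k ∈ s, ((p k x)⁻¹)^2) := by
    have h3 : b x ^2 * (∑ k ∈ s, (p k x)⁻¹)^2 = 1 := by
      have h9 := (hS x hx).ne'
      simp only [hb]; rw [← mul_pow, inv_mul_cancel₀ h9, one_pow]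
    rw [← h3]; gcongr
  have h4 : c0 / s.card ≤ c0 / s.card * (b x ^2 * (s.card * ∑ k ∈ s, ((p k x)⁻¹)^2)) :=
    le_mul_of_one_le_right (by positivity) this
  have h5 : c0 / s.card * (b x ^2 * (s.card * ∑ k ∈ s, ((p k x)⁻¹)^2)) = c0 * (b x ^2 * ∑ k ∈ s, ((p k x)⁻¹)^2) := by
    field_simp
  rw [h5] at h4
  linarith

theorem lineA (n x v : E3) (k : ℝ) : HasDerivAt (fun t : ℝ => ⟪n, x + t • v⟫ + k) ⟪n, v⟫ 0 := by
  have : (fun t : ℝ => ⟪n, x + t • v⟫ + k) = fun t : ℝ => t * ⟪n, v⟫ + (⟪n, x⟫ + k) := by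
    funext t; rw [inner_add_right, inner_smul_right]; ring
  rw [this]
  simpa using ((hasDerivAt_id (0:ℝ)).mul_const ⟪n, v⟫).add_const (⟪n, x⟫ + k)

theorem cdA (n : E3) (k : ℝ) {m : WithTop ℕ∞} : ContDiff ℝ m (fun z : E3 => ⟪n, z⟫ + k) :=
  (contDiff_const.inner ℝ contDiff_id).add contDiff_const

theorem inner_be (n m : E3) : ∑ i, ⟪n, be i⟫ * ⟪m, be i⟫ = ⟪n, m⟫ := by
  simp [be, EuclideanSpace.inner_single_right, PiLp.inner_apply, mul_comm]

theorem lap_pair {n m : E3} (hn : ‖n‖ = 1) (hm : ‖m‖ = 1) {γ a b : ℝ} (h0 : 0 < γ)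
    (hγ : γ * (1 + ⟪n, m⟫) < 1) (hγ1 : γ < 1) {x : E3} (hP : 0 < ⟪n, x⟫ + a) (hQ : 0 < ⟪m, x⟫ + b) {L : ℝ}
    (hL : (⟪n, x⟫ + a) * (⟪m, x⟫ + b) ≤ L) :
    lap (fun z => ((⟪n, z⟫ + a) * (⟪m, z⟫ + b)) ^ γ) x ≤ -(2 * γ * (1 - γ * (1 + ⟪n, m⟫)) * L ^ (γ - 1)) := by
  have hx : 0 < (⟪n, x⟫ + a) * (⟪m, x⟫ + b) := mul_pos hP hQ
  have cPQ : ContDiff ℝ 2 (fun z : E3 => (⟪n, z⟫ + a) * (⟪m, z⟫ + b)) := (cdA n a).mul (cdA m b)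
  have hev : ∀ᶠ z in 𝓝 x, 0 < (⟪n, z⟫ + a) * (⟪m, z⟫ + b) :=
    cPQ.continuous.continuousAt.eventually (lt_mem_nhds hx)
  have cd : ContDiffAt ℝ 2 (fun z : E3 => ((⟪n, z⟫ + a) * (⟪m, z⟫ + b)) ^ γ) x :=
    cPQ.contDiffAt.rpow_const_of_ne hx.ne'
  have key : ∀ y v : E3, HasDerivAt (fun t : ℝ => (⟪n, y + t • v⟫ + a) * (⟪m, y + t • v⟫ + b))
      (⟪n, v⟫ * (⟪m, y⟫ + b) + (⟪n, y⟫ + a) * ⟪m, v⟫) 0 := fun y v => by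
    refine HasDerivAt.congr_deriv ((lineA n y v a).mul (lineA m y v b)) ?_
    simp
  have h1 : ∀ i : Fin 3, ∀ᶠ y in 𝓝 x, fderiv ℝ (fun z : E3 => ((⟪n, z⟫ + a) * (⟪m, z⟫ + b)) ^ γ) y (be i) =
      γ * ((⟪n, y⟫ + a) * (⟪m, y⟫ + b)) ^ (γ - 1) * (⟪n, be i⟫ * (⟪m, y⟫ + b) + (⟪n, y⟫ + a) * ⟪m, be i⟫) := by
    intro i
    filter_upwards [hev] with y hy
    refine lineD_eq ((cPQ.contDiffAt.rpow_const_of_ne hy.ne').differentiableAt (by norm_num)) ?_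
    have := (key y (be i)).rpow_const (p := γ) (Or.inl (by simpa using hy.ne'))
    refine HasDerivAt.congr_deriv this ?_
    simp only [zero_smul, add_zero]; ring
  set P := ⟪n, x⟫ + a with hPd
  set Q := ⟪m, x⟫ + b with hQd
  have h2 : ∀ i : Fin 3, HasDerivAt (fun t : ℝ => γ * ((⟪n, x + t • be i⟫ + a) * (⟪m, x + t • be i⟫ + b)) ^ (γ - 1) * (⟪n, be i⟫ * (⟪m, x + t • be i⟫ + b) + (⟪n, x + t • be i⟫ + a) * ⟪m, be i⟫))
      (γ * (P * Q) ^ (γ - 2) * ((γ - 1) * (⟪n, be i⟫ * ⟪n, be i⟫ * Q^2 + 2 * (⟪n, be i⟫ * ⟪m, be i⟫) * (P * Q) + ⟪m, be i⟫ * ⟪m, be i⟫ * P^2) + 2 * (⟪n, be i⟫ * ⟪m, be i⟫) * (P * Q))) 0 := by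
    intro i
    have e1 := ((key x (be i)).rpow_const (p := γ - 1) (Or.inl (by simpa using hx.ne'))).const_mul γ
    have e2 := ((lineA m x (be i) b).const_mul ⟪n, be i⟫).add ((lineA n x (be i) a).mul_const ⟪m, be i⟫)
    refine HasDerivAt.congr_deriv (e1.mul e2) ?_
    simp only [zero_smul, add_zero]
    rw [← hPd, ← hQd]
    have e3 : (P * Q) ^ (γ - 1) = (P * Q) ^ (γ - 2) * (P * Q) := by
      rw [← Real.rpow_add_one hx.ne']; congr 1; ring
    have e4 : γ - 1 - 1 = γ - 2 := by ring
    rw [e4, e3]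
    ring
  rw [lap_of cd h1 h2, ← Finset.mul_sum]
  simp only [Finset.sum_add_distrib, ← Finset.mul_sum, ← Finset.sum_mul, inner_be]
  rw [real_inner_self_eq_norm_sq, real_inner_self_eq_norm_sq, hn, hm]
  have e3 : (P * Q) ^ (γ - 1) = (P * Q) ^ (γ - 2) * (P * Q) := by
    rw [← Real.rpow_add_one hx.ne']; congr 1; ring
  have e5 : L ^ (γ - 1) ≤ (P * Q) ^ (γ - 1) := Real.rpow_le_rpow_of_nonpos hx hL (by linarith)
  have e6 : 0 < (P * Q) ^ (γ - 2) := Real.rpow_pos_of_pos hx _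
  have e7 : 2 * γ * (1 - γ * (1 + ⟪n, m⟫)) * L ^ (γ - 1) ≤ 2 * γ * (1 - γ * (1 + ⟪n, m⟫)) * (P * Q) ^ (γ - 1) := by
    have : 0 ≤ 1 - γ * (1 + ⟪n, m⟫) := by linarith
    gcongr
  rw [e3] at e7
  nlinarith [mul_nonneg (mul_nonneg h0.le e6.le) (mul_nonneg (sub_nonneg.2 hγ1.le) (sq_nonneg (P - Q)))]

theorem lap_single {n : E3} (hn : ‖n‖ = 1) (a b : ℝ) (x : E3) :
    lap (fun z => (⟪n, z⟫ + a) * (⟪-n, z⟫ + b)) x = -2 := by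
  have cPQ : ContDiff ℝ 2 (fun z : E3 => (⟪n, z⟫ + a) * (⟪-n, z⟫ + b)) := (cdA n a).mul (cdA (-n) b)
  have h1 : ∀ i : Fin 3, ∀ᶠ y in 𝓝 x, fderiv ℝ (fun z : E3 => (⟪n, z⟫ + a) * (⟪-n, z⟫ + b)) y (be i) =
      ⟪n, be i⟫ * (⟪-n, y⟫ + b) + (⟪n, y⟫ + a) * ⟪-n, be i⟫ := fun i => Eventually.of_forall fun y => by
    refine lineD_eq (cPQ.differentiable (by norm_num) y) ?_
    refine HasDerivAt.congr_deriv ((lineA n y (be i) a).mul (lineA (-n) y (be i) b)) ?_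
    simp
  have h2 : ∀ i : Fin 3, HasDerivAt (fun t : ℝ => ⟪n, be i⟫ * (⟪-n, x + t • be i⟫ + b) + (⟪n, x + t • be i⟫ + a) * ⟪-n, be i⟫)
      (⟪n, be i⟫ * ⟪-n, be i⟫ + ⟪n, be i⟫ * ⟪-n, be i⟫) 0 := fun i =>
    ((lineA (-n) x (be i) b).const_mul ⟪n, be i⟫).add ((lineA n x (be i) a).mul_const ⟪-n, be i⟫)
  rw [lap_of cPQ.contDiffAt h1 h2, Finset.sum_add_distrib, inner_be, inner_neg_right, real_inner_self_eq_norm_sq, hn]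
  norm_num

section
structure HRep (D : Set E3) where
  N : Finset E3
  c : E3 → ℝ
  unit : ∀ n ∈ N, ‖n‖ = 1
  eq : D = {z | ∀ n ∈ N, c n < ⟪n, z⟫}
  bdd : Bornology.IsBounded D
  ne : D.Nonempty
  off : N.offDiag.Nonempty

namespace HRep
variable {D : Set E3} (H : HRep D)

def ell (n z : E3) : ℝ := ⟪n, z⟫ + -H.c n

theorem Nne : H.N.Nonempty := by
  obtain ⟨p, hp⟩ := H.off
  exact ⟨p.1, (Finset.mem_offDiag.1 hp).1⟩

def rho (z : E3) : ℝ := H.N.offDiag.inf' H.off (fun p => max (H.ell p.1 z) (H.ell p.2 z))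
def lam (z : E3) : ℝ := H.N.inf' H.Nne (fun n => H.ell n z)

theorem cell (n : E3) : Continuous (H.ell n) := (cdA n _ (m := 0)).continuous

theorem crho : Continuous H.rho := by
  unfold rho
  exact Continuous.finset_inf'_apply _ fun p _ => (H.cell _).max (H.cell _)

theorem clam : Continuous H.lam := by
  unfold lam
  exact Continuous.finset_inf'_apply _ fun p _ => H.cell _

theorem mem_iff {z : E3} : z ∈ D ↔ ∀ n ∈ H.N, 0 < H.ell n z := by
  have : z ∈ D ↔ ∀ n ∈ H.N, H.c n < ⟪n, z⟫ := by
    have := Set.ext_iff.1 H.eq z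
    exact this
  rw [this]
  refine forall₂_congr fun n _ => ?_
  unfold ell
  constructor <;> intro h <;> linarith

theorem isOpen (H : HRep D) : IsOpen D := by
  have : D = ⋂ n ∈ H.N, {z | 0 < H.ell n z} := by
    ext z; simp [H.mem_iff]
  rw [this]
  exact isOpen_biInter_finset fun n _ => isOpen_lt continuous_const (H.cell n)

theorem convex (H : HRep D) : Convex ℝ D := by
  have hm : ∀ z, z ∈ D ↔ ∀ n ∈ H.N, H.c n < ⟪n, z⟫ := fun z => Set.ext_iff.1 H.eq z
  intro x hx y hy a b ha hb hab
  rw [hm] at hx hy ⊢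
  intro n hn
  have h1 := hx n hn
  have h2 := hy n hn
  rw [inner_add_right, inner_smul_right, inner_smul_right]
  rcases ha.eq_or_lt with rfl | ha
  · have : b = 1 := by linarith
    subst this; linarith
  · have : H.c n = a * H.c n + b * H.c n := by rw [← add_mul, hab, one_mul]
    nlinarith [mul_lt_mul_of_pos_left h1 ha, mul_le_mul_of_nonneg_left h2.le hb]

theorem ell_clos {z : E3} (hz : z ∈ closure D) {n : E3} (hn : n ∈ H.N) : 0 ≤ H.ell n z := by
  have : D ⊆ {z | 0 ≤ H.ell n z} := fun z hz => (H.mem_iff.1 hz n hn).le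
  exact closure_minimal this (isClosed_le continuous_const (H.cell n)) hz

theorem lam_pos {z : E3} (hz : z ∈ D) : 0 < H.lam z :=
  (Finset.lt_inf'_iff _).2 fun n hn => H.mem_iff.1 hz n hn

theorem mem_iff_lam {z : E3} : z ∈ D ↔ 0 < H.lam z := by
  rw [H.mem_iff]; exact (Finset.lt_inf'_iff _).symm

theorem lam_le_rho (z : E3) : H.lam z ≤ H.rho z := by
  refine Finset.le_inf' _ _ fun p hp => ?_
  exact (Finset.inf'_le _ (Finset.mem_offDiag.1 hp).1).trans (le_max_left _ _)

theorem rho_pos {z : E3} (hz : z ∈ D) : 0 < H.rho z := (H.lam_pos hz).trans_le (H.lam_le_rho z)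

theorem exists_L : ∃ L : ℝ, 0 < L ∧ ∀ z ∈ closure D, ∀ n ∈ H.N, H.ell n z ≤ L := by
  have hc := H.bdd.isCompact_closure
  have : ∀ n, ∃ B, ∀ z ∈ closure D, H.ell n z ≤ B := fun n =>
    let ⟨B, hB⟩ := hc.exists_bound_of_continuousOn (H.cell n).continuousOn
    ⟨B, fun z hz => (le_abs_self _).trans (hB z hz)⟩
  choose B hB using this
  refine ⟨∑ n ∈ H.N, |B n| + 1, by positivity, fun z hz n hn => ?_⟩
  have := Finset.single_le_sum (f := fun n => |B n|) (fun i _ => abs_nonneg _) hn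
  linarith [hB n z hz, le_abs_self (B n)]

theorem exists_gamma : ∃ γ : ℝ, 1/2 < γ ∧ γ < 1 ∧ ∀ n ∈ H.N, ∀ m ∈ H.N, n ≠ m → γ * (1 + ⟪n, m⟫) < 1 := by
  have h1 : ∀ p ∈ H.N.offDiag, ∀ᶠ γ : ℝ in 𝓝[>] (1/2), γ * (1 + ⟪p.1, p.2⟫) < 1 := by
    intro p hp
    obtain ⟨a, b, c⟩ := Finset.mem_offDiag.1 hp
    refine nhdsWithin_le_nhds ?_
    have hcont : Continuous fun γ : ℝ => γ * (1 + ⟪p.1, p.2⟫) := by fun_prop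
    refine hcont.continuousAt.eventually (gt_mem_nhds ?_)
    have := inner_lt_one_iff_real_of_norm_eq_one (H.unit _ a) (H.unit _ b) |>.2 c
    linarith
  have h2 : ∀ᶠ γ : ℝ in 𝓝[>] (1/2), γ < 1 :=
    nhdsWithin_le_nhds (gt_mem_nhds (by norm_num))
  have h3 : ∀ᶠ γ : ℝ in 𝓝[>] (1/2), 1/2 < γ := self_mem_nhdsWithin
  obtain ⟨γ, a, b, c⟩ := (((Filter.eventually_all_finset _).2 h1).and (h2.and h3)).exists
  exact ⟨γ, c, b, fun n hn m hm hnm => a (n, m) (Finset.mem_offDiag.2 ⟨hn, hm, hnm⟩)⟩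

theorem barrier {γ : ℝ} (hγ0 : 1/2 < γ) (hγ1 : γ < 1) (hγ : ∀ n ∈ H.N, ∀ m ∈ H.N, n ≠ m → γ * (1 + ⟪n, m⟫) < 1) :
    ∃ c0 M : ℝ, 0 < c0 ∧ 0 < M ∧ ∀ δ : ℝ, 0 < δ → δ ≤ 1 → ∃ b : E3 → ℝ, ContDiff ℝ 2 b ∧
      (∀ x ∈ D, 0 ≤ b x) ∧ (∀ x ∈ D, lap b x ≤ -c0) ∧
      ∀ x ∈ D, b x ≤ M * min ((H.rho x + δ) ^ (2 * γ)) (H.lam x + δ) := by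
  obtain ⟨L, hL, hLb⟩ := H.exists_L
  have hcpos : ∀ p ∈ H.N ×ˢ H.N, ∃ c1 : ℝ, 0 < c1 ∧ (p.1 = p.2 → c1 ≤ 2) ∧
      (p.1 ≠ p.2 → c1 ≤ 2 * γ * (1 - γ * (1 + ⟪p.1, p.2⟫)) * ((L + 1) * (L + 1)) ^ (γ - 1)) := by
    intro p hp
    obtain ⟨a, b⟩ := Finset.mem_product.1 hp
    by_cases h : p.1 = p.2
    · exact ⟨2, two_pos, fun _ => le_rfl, fun h' => absurd h h'⟩
    · refine ⟨_, ?_, fun h' => absurd h' h, fun _ => le_rfl⟩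
      have := hγ _ a _ b h
      have : 0 < 1 - γ * (1 + ⟪p.1, p.2⟫) := by linarith
      have : 0 < γ := by linarith
      positivity
  choose! c1 hc1 hc2 hc3 using hcpos
  have hne : (H.N ×ˢ H.N).Nonempty := H.Nne.product H.Nne
  set s := H.N ×ˢ H.N
  let c2 := s.inf' hne c1
  have hc2p : 0 < c2 := (Finset.lt_inf'_iff _).2 hc1
  have hcard : (0:ℝ) < s.card := by exact_mod_cast hne.card_pos
  refine ⟨c2 / s.card, 1 + 2 * L, by positivity, by positivity, fun δ hδ hδ1 => ?_⟩
  classical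
  let p : E3 × E3 → E3 → ℝ := fun k z =>
    if k.1 = k.2 then (⟪k.1, z⟫ + (-H.c k.1 + δ)) * (⟪-k.1, z⟫ + (H.c k.1 + 2 * L))
    else ((⟪k.1, z⟫ + (-H.c k.1 + δ)) * (⟪k.2, z⟫ + (-H.c k.2 + δ))) ^ γ
  let U : Set E3 := ⋂ n ∈ H.N, {z | 0 < ⟪n, z⟫ + (-H.c n + δ)} ∩ {z | 0 < ⟪-n, z⟫ + (H.c n + 2 * L)}
  have hUo : IsOpen U := isOpen_biInter_finset fun n _ =>
    (isOpen_lt continuous_const (cdA n _ (m := 0)).continuous).inter (isOpen_lt continuous_const (cdA (-n) _ (m := 0)).continuous)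
  have hU : ∀ z ∈ U, ∀ n ∈ H.N, 0 < ⟪n, z⟫ + (-H.c n + δ) ∧ 0 < ⟪-n, z⟫ + (H.c n + 2 * L) := fun z hz n hn => by
    have := mem_iInter₂.1 hz n hn
    exact this
  have hDU : closure D ⊆ U := fun z hz => mem_iInter₂.2 fun n hn => by
    have h1 := H.ell_clos hz hn
    have h2 := hLb z hz n hn
    unfold ell at h1 h2
    refine ⟨?_, ?_⟩ <;> simp only [mem_ofPred_eq, inner_neg_left] <;> linarith
  have hp2 : ∀ k ∈ s, ContDiffOn ℝ 2 (p k) U := by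
    intro k hk
    obtain ⟨a, b⟩ := Finset.mem_product.1 hk
    by_cases h : k.1 = k.2
    · simp only [p, h, if_true]
      exact ((cdA _ _).mul (cdA _ _)).contDiffOn
    · simp only [p, h, if_false]
      exact ((cdA _ _).mul (cdA _ _)).contDiffOn.rpow_const_of_ne fun z hz =>
        (mul_pos (hU z hz _ a).1 (hU z hz _ b).1).ne'
  have hpp : ∀ k ∈ s, ∀ x ∈ U, 0 < p k x := by
    intro k hk z hz
    obtain ⟨a, b⟩ := Finset.mem_product.1 hk
    by_cases h : k.1 = k.2
    · simp only [p, h, if_true]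
      exact mul_pos (hU z hz _ b).1 (hU z hz _ b).2
    · simp only [p, h, if_false]
      exact Real.rpow_pos_of_pos (mul_pos (hU z hz _ a).1 (hU z hz _ b).1) _
  have hpl : ∀ x ∈ D, ∀ k ∈ s, lap (p k) x ≤ -c2 := by
    intro x hx k hk
    obtain ⟨a, b⟩ := Finset.mem_product.1 hk
    have hck : c2 ≤ c1 k := Finset.inf'_le _ hk
    have hxU := hDU (subset_closure hx)
    by_cases h : k.1 = k.2
    · have e : p k = fun z => (⟪k.1, z⟫ + (-H.c k.1 + δ)) * (⟪-k.1, z⟫ + (H.c k.1 + 2 * L)) := by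
        funext z; simp only [p, h, if_true]
      rw [e, lap_single (H.unit _ a)]
      linarith [hc2 k hk h]
    · have e : p k = fun z => ((⟪k.1, z⟫ + (-H.c k.1 + δ)) * (⟪k.2, z⟫ + (-H.c k.2 + δ))) ^ γ := by
        funext z; simp only [p, h, if_false]
      rw [e]
      have h1 := hLb x (subset_closure hx) _ a
      have h2 := hLb x (subset_closure hx) _ b
      unfold ell at h1 h2
      have h3 := hU x hxU _ a
      have h4 := hU x hxU _ b
      have := lap_pair (H.unit _ a) (H.unit _ b) (by linarith) (hγ _ a _ b h) hγ1 h3.1 h4.1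
        (L := (L + 1) * (L + 1)) (mul_le_mul (by linarith) (by linarith) h4.1.le (by linarith))
      linarith [hc3 k hk h]
  have hbc : ContDiffOn ℝ 2 (fun y => (∑ k ∈ s, (p k y)⁻¹)⁻¹) U :=
    ContDiffOn.inv (ContDiffOn.sum fun k hk => (hp2 k hk).inv fun x hx => (hpp k hk x hx).ne')
      fun x hx => (Finset.sum_pos (fun k hk => inv_pos.2 (hpp k hk x hx)) hne).ne'
  obtain ⟨b, hb, -, hbe⟩ := smooth_ext (n := 2) H.bdd.isCompact_closure hUo hDU hbc
  have hbe' : ∀ x ∈ D, b =ᶠ[𝓝 x] (fun y => (∑ k ∈ s, (p k y)⁻¹)⁻¹) := fun x hx =>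
    (eventually_nhdsSet_iff_forall.1 hbe) x (subset_closure hx)
  have hble : ∀ x ∈ D, ∀ k ∈ s, b x ≤ p k x := by
    intro x hx k hk
    have hxU := hDU (subset_closure hx)
    rw [(hbe' x hx).eq_of_nhds]
    refine inv_le_of_inv_le₀ (hpp k hk x hxU) ?_
    exact Finset.single_le_sum (f := fun k => (p k x)⁻¹) (fun i hi => (inv_pos.2 (hpp i hi x hxU)).le) hk
  have hb0 : ∀ x ∈ D, 0 ≤ b x := fun x hx => by
    have hxU := hDU (subset_closure hx)
    rw [(hbe' x hx).eq_of_nhds]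
    exact inv_nonneg.2 (Finset.sum_nonneg fun i hi => (inv_pos.2 (hpp i hi x hxU)).le)
  refine ⟨b, hb, hb0, fun x hx => ?_, fun x hx => ?_⟩
  · rw [lap_congr (hbe' x hx)]
    exact lap_harm hUo hne hp2 hpp hc2p.le (hDU (subset_closure hx)) (hpl x hx)
  · have hxU := hDU (subset_closure hx)
    have hr := H.rho_pos hx
    have hl := H.lam_pos hx
    rw [mul_min_of_nonneg _ _ (by positivity)]
    refine le_min ?_ ?_
    · obtain ⟨k, hk, hke⟩ := Finset.exists_mem_eq_inf' H.off (fun p => max (H.ell p.1 x) (H.ell p.2 x))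
      change H.rho x = _ at hke
      obtain ⟨a1, a2, a3⟩ := Finset.mem_offDiag.1 hk
      have hks : k ∈ s := Finset.mem_product.2 ⟨a1, a2⟩
      refine (hble x hx k hks).trans ?_
      simp only [p, a3, if_false]
      have e1 : H.ell k.1 x ≤ H.rho x := hke ▸ le_max_left _ _
      have e2 : H.ell k.2 x ≤ H.rho x := hke ▸ le_max_right _ _
      unfold ell at e1 e2
      have h3 := (hU x hxU _ a1).1
      have h4 := (hU x hxU _ a2).1
      have : ((H.rho x + δ) ^ (2 * γ)) = ((H.rho x + δ) * (H.rho x + δ)) ^ γ := by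
        rw [Real.rpow_mul (by positivity)]; congr 1; rw [Real.rpow_two]; ring
      rw [this]
      have hmm : (⟪k.1, x⟫ + (-H.c k.1 + δ)) * (⟪k.2, x⟫ + (-H.c k.2 + δ)) ≤ (H.rho x + δ) * (H.rho x + δ) :=
        mul_le_mul (by linarith) (by linarith) h4.le (by linarith)
      refine (Real.rpow_le_rpow (mul_pos h3 h4).le hmm (by linarith)).trans ?_
      exact le_mul_of_one_le_left (by positivity) (by linarith)
    · obtain ⟨n, hn, hne'⟩ := Finset.exists_mem_eq_inf' H.Nne (fun n => H.ell n x)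
      change H.lam x = _ at hne'
      refine (hble x hx (n, n) (Finset.mem_product.2 ⟨hn, hn⟩)).trans ?_
      simp only [p, if_true]
      rw [hne']
      have h0 := H.mem_iff.1 hx n hn
      unfold ell at h0 ⊢
      rw [inner_neg_left]
      have : 0 < ⟪n, x⟫ + (-H.c n + δ) := by linarith
      nlinarith

theorem kato_lim (hDo : IsOpen D) (hDb : Bornology.IsBounded D) (hDc : Convex ℝ D) {B : ℝ → E3 → ℝ}
    (hB : Continuous (Function.uncurry B)) {c0 M : ℝ} (hc0 : 0 < c0) (hM : 0 < M)
    (hb : ∀ δ : ℝ, 0 < δ → δ ≤ 1 → ∃ b : E3 → ℝ, ContDiff ℝ 2 b ∧ (∀ x ∈ D, 0 ≤ b x) ∧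
      (∀ x ∈ D, lap b x ≤ -c0) ∧ ∀ x ∈ D, b x ≤ M * B δ x) {φ : E3 → ℝ}
    (hφ : ContDiff ℝ 2 φ) (h0 : ∀ x ∈ frontier D, φ x = 0) :
    ∫ x in D, |φ x| ≤ M / c0 * ∫ x in D, B 0 x * |lap φ x| := by
  have cL := cont_lap hφ
  have hae : D =ᵐ[volume] closure D := by
    refine (LE.le.eventuallyLE subset_closure).antisymm ?_
    filter_upwards [ae_D hDc] with x hx hx2
    exact hx.resolve_right (fun h => h hx2)
  have cF : Continuous (Function.uncurry fun (δ : ℝ) (x : E3) => B δ x * |lap φ x|) :=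
    hB.mul (cL.comp continuous_snd).abs
  have key : ∀ δ : ℝ, 0 < δ → δ ≤ 1 → ∫ x in D, |φ x| ≤ M / c0 * ∫ x in closure D, B δ x * |lap φ x| := by
    intro δ hδ hδ1
    obtain ⟨b, hb1, hb2, hb3, hb4⟩ := hb δ hδ hδ1
    have h1 := kato hDo hDb hDc hb1 hφ hc0 hb2 hb3 h0
    have cFd : Continuous fun x => B δ x * |lap φ x| :=
      cF.comp (continuous_const.prodMk continuous_id)
    have h2 : ∫ x in D, b x * |lap φ x| ≤ ∫ x in D, M * (B δ x * |lap φ x|) := by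
      refine setIntegral_mono_on (int_cont hDb (hb1.continuous.mul cL.abs)) (int_cont hDb (continuous_const.mul cFd)) hDo.measurableSet fun x hx => ?_
      rw [← mul_assoc]
      exact mul_le_mul_of_nonneg_right (hb4 x hx) (abs_nonneg _)
    rw [integral_const_mul, setIntegral_congr_set (f := fun x => B δ x * |lap φ x|) hae] at h2
    rw [div_mul_eq_mul_div, le_div_iff₀ hc0, mul_comm]
    linarith
  have hcont := continuous_parametric_integral_of_continuous (μ := volume) cF hDb.isCompact_closure
  have hlim : Tendsto (fun δ => M / c0 * ∫ x in closure D, B δ x * |lap φ x|) (𝓝[>] 0)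
      (𝓝 (M / c0 * ∫ x in closure D, B 0 x * |lap φ x|)) :=
    ((continuous_const.mul hcont).tendsto 0).mono_left nhdsWithin_le_nhds
  have h5 := ge_of_tendsto hlim (b := ∫ x in D, |φ x|) (by
    filter_upwards [self_mem_nhdsWithin, nhdsWithin_le_nhds (gt_mem_nhds (zero_lt_one (α := ℝ)))] with δ h1 h2
    exact key δ h1 h2.le)
  rwa [← setIntegral_congr_set (f := fun x => B 0 x * |lap φ x|) hae] at h5

theorem kato2 : ∃ γ M : ℝ, 1/2 < γ ∧ γ < 1 ∧ 0 < M ∧ ∀ φ : E3 → ℝ, ContDiff ℝ 2 φ → (∀ x ∈ frontier D, φ x = 0) →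
    ∫ x in D, |φ x| ≤ M * ∫ x in D, min (H.rho x ^ (2 * γ)) (H.lam x) * |lap φ x| := by
  obtain ⟨γ, hγ0, hγ1, hγ⟩ := H.exists_gamma
  obtain ⟨c0, M, hc0, hM, hb⟩ := H.barrier hγ0 hγ1 hγ
  refine ⟨γ, M / c0, hγ0, hγ1, by positivity, fun φ hφ h0 => ?_⟩
  have cr := H.crho
  have cl := H.clam
  have cF : Continuous (Function.uncurry fun (δ : ℝ) (x : E3) => min ((H.rho x + δ) ^ (2 * γ)) (H.lam x + δ)) := by
    refine Continuous.min ?_ (by fun_prop)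
    exact Continuous.rpow_const (by fun_prop) fun _ => Or.inr (by linarith)
  have := kato_lim H.isOpen H.bdd H.convex cF hc0 hM hb hφ h0
  simpa only [add_zero] using this

end HRep
end

theorem hb_riesz {α : Type*} [MeasurableSpace α] {μ : Measure α} [IsFiniteMeasure μ] {β : α → ℝ}
    (hβ : MemLp β 2 μ) (hβ0 : ∀ᵐ x ∂μ, 0 ≤ β x) {V : Type*} [AddCommGroup V] [Module ℝ V]
    (T : V →ₗ[ℝ] Lp ℝ 2 μ) (l : V →ₗ[ℝ] ℝ) (h : ∀ v, l v ≤ ∫ x, β x * |T v x| ∂μ) :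
    ∃ w : Lp ℝ 2 μ, (∀ᵐ x ∂μ, |w x| ≤ β x) ∧ ∀ v, ∫ x, w x * T v x ∂μ = l v := by
  have hint : ∀ g : Lp ℝ 2 μ, Integrable (fun x => β x * |g x|) μ := fun g =>
    hβ.integrable_mul (Lp.memLp g).norm
  let p : Lp ℝ 2 μ → ℝ := fun g => ∫ x, β x * |g x| ∂μ
  have hp0 : p 0 = 0 := by
    simp only [p]
    rw [integral_congr_ae (g := fun _ => 0)]
    · simp
    · filter_upwards [Lp.coeFn_zero ℝ 2 μ] with x hx
      rw [hx]; simp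
  obtain ⟨g, hg⟩ := T.rangeRestrict.exists_rightInverse_of_surjective (LinearMap.range_rangeRestrict T)
  have hgl : ∀ v, l (g (T.rangeRestrict v)) = l v := by
    intro v
    have h1 : T (g (T.rangeRestrict v)) = T v := congrArg Subtype.val (LinearMap.congr_fun hg (T.rangeRestrict v))
    have a := h (g (T.rangeRestrict v) - v)
    have b := h (v - g (T.rangeRestrict v))
    rw [map_sub, map_sub, h1, sub_self] at a b
    have : ∫ x, β x * |(0 : Lp ℝ 2 μ) x| ∂μ = 0 := hp0
    linarith
  let f : Lp ℝ 2 μ →ₗ.[ℝ] ℝ := ⟨LinearMap.range T, l ∘ₗ g⟩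
  obtain ⟨L, hL1, hL2⟩ := exists_extension_of_le_sublinear f p
    (by
      intro c hc x
      simp only [p]
      rw [← integral_const_mul]
      refine integral_congr_ae ?_
      filter_upwards [Lp.coeFn_smul c x] with y hy
      rw [hy]
      simp only [Pi.smul_apply, smul_eq_mul, abs_mul, abs_of_pos hc]
      ring)
    (by
      intro x y
      simp only [p]
      rw [← integral_add (hint x) (hint y)]
      refine integral_mono_ae (hint _) ((hint x).add (hint y)) ?_
      filter_upwards [Lp.coeFn_add x y, hβ0] with z hz h0
      simp only [Pi.add_apply] at hz ⊢
      rw [hz, ← mul_add]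
      exact mul_le_mul_of_nonneg_left (abs_add_le _ _) h0)
    (by
      rintro ⟨x, v, rfl⟩
      change l (g (T.rangeRestrict v)) ≤ _
      rw [hgl]
      exact h v)
  have hbd : ∀ x, p x ≤ ‖hβ.toLp β‖ * ‖x‖ := by
    intro x
    have h1 := real_inner_le_norm (hβ.toLp β) |x|
    rw [norm_abs_eq_norm, L2.inner_def] at h1
    refine le_trans (le_of_eq ?_) h1
    refine integral_congr_ae ?_
    filter_upwards [hβ.coeFn_toLp, Lp.coeFn_abs x] with z h2 h3
    rw [h2, h3]
    simp [mul_comm]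
  let Lc : Lp ℝ 2 μ →L[ℝ] ℝ := L.mkContinuous ‖hβ.toLp β‖ (by
    intro x
    rw [Real.norm_eq_abs, abs_le]
    refine ⟨?_, (hL2 x).trans (hbd x)⟩
    have := (hL2 (-x)).trans (hbd (-x))
    rw [map_neg, norm_neg] at this
    linarith)
  let w := (InnerProductSpace.toDual ℝ (Lp ℝ 2 μ)).symm Lc
  have hw : ∀ g : Lp ℝ 2 μ, ∫ x, w x * g x ∂μ = L g := by
    intro g
    have h1 : ⟪w, g⟫ = Lc g := InnerProductSpace.toDual_symm_apply
    rw [L2.inner_def] at h1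
    rw [← show Lc g = L g from rfl, ← h1]
    refine integral_congr_ae (Eventually.of_forall fun x => ?_)
    simp [mul_comm]
  have hwi : Integrable w μ := (Lp.memLp w).integrable one_le_two
  have hβi : Integrable β μ := hβ.integrable one_le_two
  have hs : ∀ s, MeasurableSet s → ∀ c : ℝ, |c| = 1 → ∫ x in s, c * w x ∂μ ≤ ∫ x in s, β x ∂μ := by
    intro s hs c hc
    have h1 : MemLp (s.indicator (fun _ => c)) 2 μ := (memLp_const c).indicator hs
    have h2 := hw (h1.toLp _)
    have h3 := hL2 (h1.toLp _)
    rw [← h2] at h3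
    rw [← integral_indicator hs, ← integral_indicator hs]
    refine le_trans (le_of_eq ?_) (h3.trans (le_of_eq ?_))
    · refine integral_congr_ae ?_
      filter_upwards [h1.coeFn_toLp] with x hx
      rw [hx]
      by_cases hxs : x ∈ s <;> simp [hxs, mul_comm]
    · refine integral_congr_ae ?_
      filter_upwards [h1.coeFn_toLp] with x hx
      rw [hx]
      by_cases hxs : x ∈ s <;> simp [hxs, hc]
  refine ⟨w, ?_, fun v => ?_⟩
  · have h1 := ae_le_of_forall_setIntegral_le (hwi.const_mul 1) hβi fun s hs' _ => hs s hs' 1 (by simp)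
    have h2 := ae_le_of_forall_setIntegral_le (hwi.const_mul (-1)) hβi fun s hs' _ => hs s hs' (-1) (by simp)
    filter_upwards [h1, h2] with x a b
    exact abs_le.2 ⟨by linarith, by linarith⟩
  · rw [hw]
    have := hL1 ⟨T v, v, rfl⟩
    rw [this]
    exact hgl v

/-- very weak solutions -/
theorem vw_exists {D : Set E3} (hDo : IsOpen D) (hDb : Bornology.IsBounded D) {β : E3 → ℝ} (hβ : Continuous β)
    (hβ0 : ∀ x ∈ D, 0 ≤ β x)
    (hk : ∀ φ : E3 → ℝ, ContDiff ℝ 2 φ → (∀ x ∈ frontier D, φ x = 0) →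
      ∫ x in D, |φ x| ≤ ∫ x in D, β x * |lap φ x|) {F : E3 → ℝ} (hF : Continuous F) {B : ℝ} (hB0 : 0 ≤ B)
    (hFB : ∀ x, |F x| ≤ B) :
    ∃ w : E3 → ℝ, Measurable w ∧ (∀ x ∈ D, |w x| ≤ B * β x) ∧ (∀ x, x ∉ D → w x = 0) ∧
      ∀ φ : E3 → ℝ, ContDiff ℝ 2 φ → (∀ x ∈ frontier D, φ x = 0) →
        ∫ x in D, w x * lap φ x = -∫ x in D, F x * φ x := by
  classical
  have hfin : volume D ≠ ⊤ := hDb.measure_lt_top.ne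
  have : IsFiniteMeasure (volume.restrict D) := ⟨by simpa using hDb.measure_lt_top⟩
  have hL2 : ∀ g : E3 → ℝ, Continuous g → MemLp g 2 (volume.restrict D) := by
    intro g hg
    obtain ⟨C, hC⟩ := hDb.isCompact_closure.exists_bound_of_continuousOn hg.continuousOn
    refine MemLp.of_bound hg.aestronglyMeasurable C ?_
    filter_upwards [ae_restrict_mem hDo.measurableSet] with x hx
    exact hC x (subset_closure hx)
  let V : Submodule ℝ (E3 → ℝ) :=
    { carrier := {φ | ContDiff ℝ 2 φ ∧ ∀ x ∈ frontier D, φ x = 0}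
      add_mem' := fun ha hb => ⟨ha.1.add hb.1, fun x hx => by simp [ha.2 x hx, hb.2 x hx]⟩
      zero_mem' := ⟨contDiff_const, fun x hx => rfl⟩
      smul_mem' := fun c a ha => ⟨contDiff_const.mul ha.1, fun x hx => by simp [ha.2 x hx]⟩ }
  let T : V →ₗ[ℝ] Lp ℝ 2 (volume.restrict D) :=
    { toFun := fun φ => (hL2 (lap φ.1) (cont_lap φ.2.1)).toLp
      map_add' := fun a b => by
        rw [← MemLp.toLp_add]
        congr 1
        ext x
        exact lap_add a.2.1.contDiffAt b.2.1.contDiffAt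
      map_smul' := fun c a => by
        rw [RingHom.id_apply, ← MemLp.toLp_const_smul]
        congr 1
        ext x
        exact lap_const_mul c x a.2.1 }
  have hFi : ∀ φ : E3 → ℝ, Continuous φ → IntegrableOn (fun x => F x * φ x) D := fun φ h => int_cont hDb (hF.mul h)
  let l : V →ₗ[ℝ] ℝ :=
    { toFun := fun φ => -∫ x in D, F x * φ.1 x
      map_add' := fun a b => by
        rw [← neg_add, ← integral_add (hFi _ a.2.1.continuous) (hFi _ b.2.1.continuous)]
        simp [mul_add]
      map_smul' := fun c a => by
        simp only [RingHom.id_apply, smul_eq_mul]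
        rw [mul_neg, ← integral_const_mul]
        congr 2
        ext x
        simp
        ring }
  have hT : ∀ φ : V, T φ =ᵐ[volume.restrict D] lap φ.1 := fun φ => MemLp.coeFn_toLp (hL2 (lap φ.1) (cont_lap φ.2.1))
  obtain ⟨w, hw1, hw2⟩ := hb_riesz (β := fun x => B * β x) (hL2 _ (continuous_const.mul hβ))
    (by filter_upwards [ae_restrict_mem hDo.measurableSet] with x hx; exact mul_nonneg hB0 (hβ0 x hx)) T l (by
      intro φ
      have h1 : ∫ x in D, B * β x * |T φ x| = B * ∫ x in D, β x * |lap φ.1 x| := by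
        rw [← integral_const_mul]
        refine integral_congr_ae ?_
        filter_upwards [hT φ] with x hx
        rw [hx]; ring
      rw [h1]
      refine le_trans ?_ (mul_le_mul_of_nonneg_left (hk φ.1 φ.2.1 φ.2.2) hB0)
      refine (neg_le_abs _).trans ((abs_integral_le_integral_abs).trans ?_)
      rw [← integral_const_mul]
      refine integral_mono (hFi _ φ.2.1.continuous).abs (int_cont hDb (continuous_const.mul φ.2.1.continuous.abs)) fun x => ?_
      simp only [abs_mul]
      exact mul_le_mul_of_nonneg_right (hFB x) (abs_nonneg _))
  have hwm := (Lp.aestronglyMeasurable w).aemeasurable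
  let w1 := hwm.mk w
  have hw1m : Measurable w1 := hwm.measurable_mk
  let S : Set E3 := D ∩ {x | |w1 x| ≤ B * β x}
  have hS : MeasurableSet S := hDo.measurableSet.inter (measurableSet_le hw1m.abs (continuous_const.mul hβ).measurable)
  have hae : ∀ᵐ x ∂(volume.restrict D), S.indicator w1 x = w x := by
    filter_upwards [hwm.ae_eq_mk, hw1, ae_restrict_mem hDo.measurableSet] with x h1 h2 h3
    rw [indicator_of_mem]
    · exact h1.symm
    · exact ⟨h3, by rw [mem_ofPred_eq, ← show w x = w1 x from h1]; exact h2⟩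
  refine ⟨S.indicator w1, hw1m.indicator hS, fun x hx => ?_, fun x hx => indicator_of_notMem (fun h => hx h.1) _, fun φ h1 h2 => ?_⟩
  · by_cases h : x ∈ S
    · rw [indicator_of_mem h]; exact h.2
    · rw [indicator_of_notMem h, abs_zero]; exact mul_nonneg hB0 (hβ0 x hx)
  · have := hw2 ⟨φ, h1, h2⟩
    change _ = -∫ x in D, F x * φ x at this
    rw [← this]
    refine integral_congr_ae ?_
    filter_upwards [hae, hT ⟨φ, h1, h2⟩] with x a b
    rw [a, b]

section
section conv
variable {G : Type*} [NormedAddCommGroup G] [NormedSpace ℝ G]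

theorem conv_int {a : E3 → ℝ} (ha : Integrable a) {τ : E3 → E3} (hτ : Measurable τ) {f : E3 → G}
    (hf : Continuous f) {B : ℝ} (hB : ∀ x, ‖f x‖ ≤ B) (x : E3) [SecondCountableTopology G] :
    Integrable (fun z => a z • f (x + τ z)) := by
  have hm : AEStronglyMeasurable (fun z => f (x + τ z)) volume := by
    borelize G
    exact (hf.measurable.comp (measurable_const.add hτ)).aestronglyMeasurable
  exact Integrable.smul_bdd ha B hm (Eventually.of_forall fun z => hB _)

theorem conv_norm {a : E3 → ℝ} (ha : Integrable a) {τ : E3 → E3} {f : E3 → G}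
    {B : ℝ} (hB : ∀ x, ‖f x‖ ≤ B) (x : E3) :
    ‖∫ z, a z • f (x + τ z)‖ ≤ (∫ z, |a z|) * B := by
  rw [← integral_mul_const]
  refine norm_integral_le_of_norm_le (ha.abs.mul_const B) (Eventually.of_forall fun z => ?_)
  rw [norm_smul]
  exact mul_le_mul_of_nonneg_left (hB _) (abs_nonneg _)

theorem conv_hasFDeriv {a : E3 → ℝ} (ha : Integrable a) {τ : E3 → E3} (hτ : Measurable τ) {f : E3 → G}
    (hf : ContDiff ℝ 1 f) {B0 B1 : ℝ} (h0 : ∀ x, ‖f x‖ ≤ B0) (h1 : ∀ x, ‖fderiv ℝ f x‖ ≤ B1) (x : E3)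
    [SecondCountableTopology G] [SecondCountableTopology (E3 →L[ℝ] G)] :
    HasFDerivAt (fun x => ∫ z, a z • f (x + τ z)) (∫ z, a z • fderiv ℝ f (x + τ z)) x := by
  have hc := hf.continuous_fderiv (by norm_num)
  refine hasFDerivAt_integral_of_dominated_of_fderiv_le (F := fun x z => a z • f (x + τ z))
    (F' := fun x z => a z • fderiv ℝ f (x + τ z)) (bound := fun z => |a z| * B1) (s := univ) univ_mem
    (Eventually.of_forall fun y => (conv_int ha hτ hf.continuous h0 y).aestronglyMeasurable)
    (conv_int ha hτ hf.continuous h0 x) (conv_int ha hτ hc h1 x).aestronglyMeasurable ?_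
    (ha.abs.mul_const B1) ?_
  · refine Eventually.of_forall fun z y _ => ?_
    rw [norm_smul]
    exact mul_le_mul_of_nonneg_left (h1 _) (abs_nonneg _)
  · refine Eventually.of_forall fun z y _ => ?_
    have := (hf.differentiable (by norm_num)).differentiableAt (x := y + τ z) |>.hasFDerivAt
    exact ((hasFDerivAt_comp_add_right (τ z)).2 this).const_smul (a z)

theorem conv_cont {a : E3 → ℝ} (ha : Integrable a) {τ : E3 → E3} (hτ : Measurable τ) {f : E3 → G}
    (hf : Continuous f) {B0 : ℝ} (h0 : ∀ x, ‖f x‖ ≤ B0) [SecondCountableTopology G] :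
    Continuous (fun x => ∫ z, a z • f (x + τ z)) := by
  refine continuous_of_dominated (bound := fun z => |a z| * B0)
    (fun y => (conv_int ha hτ hf h0 y).aestronglyMeasurable) (fun y => Eventually.of_forall fun z => ?_)
    (ha.abs.mul_const B0) (Eventually.of_forall fun z => by fun_prop)
  rw [norm_smul]
  exact mul_le_mul_of_nonneg_left (h0 _) (abs_nonneg _)
end conv

theorem cdfd1 {f : E3 → ℝ} (hf : ContDiff ℝ 2 f) : ContDiff ℝ 1 (fderiv ℝ f) :=
  hf.fderiv_right (by norm_num)

theorem conv_C2 {a : E3 → ℝ} (ha : Integrable a) {τ : E3 → E3} (hτ : Measurable τ) {f : E3 → ℝ}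
    (hf : ContDiff ℝ 2 f) {B0 B1 B2 : ℝ} (h0 : ∀ x, |f x| ≤ B0) (h1 : ∀ x, ‖fderiv ℝ f x‖ ≤ B1)
    (h2 : ∀ x, ‖fderiv ℝ (fderiv ℝ f) x‖ ≤ B2) :
    ContDiff ℝ 2 (fun x => ∫ z, a z * f (x + τ z)) ∧
    (∀ x, ‖fderiv ℝ (fun x => ∫ z, a z * f (x + τ z)) x‖ ≤ (∫ z, |a z|) * B1) ∧
    ∀ x, ‖fderiv ℝ (fderiv ℝ (fun x => ∫ z, a z * f (x + τ z))) x‖ ≤ (∫ z, |a z|) * B2 := by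
  have d1 := fun x => conv_hasFDeriv ha hτ (hf.of_le (by norm_num)) h0 h1 x
  simp only [smul_eq_mul] at d1
  have e1 : fderiv ℝ (fun x => ∫ z, a z * f (x + τ z)) = fun x => ∫ z, a z • fderiv ℝ f (x + τ z) :=
    funext fun x => (d1 x).fderiv
  have d2 := fun x => conv_hasFDeriv ha hτ (cdfd1 hf) h1 h2 x
  have e2 := funext fun x => (d2 x).fderiv
  refine ⟨?_, fun x => ?_, fun x => ?_⟩
  · rw [show (2 : WithTop ℕ∞) = 1 + 1 by norm_num, contDiff_succ_iff_fderiv]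
    refine ⟨fun x => (d1 x).differentiableAt, by simp, ?_⟩
    rw [e1, contDiff_one_iff_fderiv]
    refine ⟨fun x => (d2 x).differentiableAt, ?_⟩
    rw [e2]
    exact conv_cont ha hτ ((cdfd1 hf).continuous_fderiv (by norm_num)) h2
  · rw [e1]; exact conv_norm ha h1 x
  · rw [e1, e2]; exact conv_norm ha h2 x

/-- bounds for derivatives of smooth compactly supported functions. -/
theorem cs_bounds {f : E3 → ℝ} (hf : ContDiff ℝ 2 f) (hc : HasCompactSupport f) : ∃ B : ℝ, 0 < B ∧
    (∀ x, |f x| ≤ B) ∧ (∀ x, ‖fderiv ℝ f x‖ ≤ B) ∧ ∀ x, ‖fderiv ℝ (fderiv ℝ f) x‖ ≤ B := by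
  obtain ⟨B0, h0⟩ := hf.continuous.bounded_above_of_compact_support hc
  obtain ⟨B1, h1⟩ := (cdfd1 hf).continuous.bounded_above_of_compact_support (hc.fderiv ℝ)
  obtain ⟨B2, h2⟩ := ((cdfd1 hf).continuous_fderiv (by norm_num)).bounded_above_of_compact_support ((hc.fderiv ℝ).fderiv ℝ)
  refine ⟨max 1 (max B0 (max B1 B2)), by positivity, fun x => ?_, fun x => ?_, fun x => ?_⟩
  · exact (h0 x).trans (by simp)
  · exact (h1 x).trans (by simp)
  · exact (h2 x).trans (by simp)

theorem scale_bounds {f : E3 → ℝ} (hf : ContDiff ℝ 2 f) (a b : ℝ) {B : ℝ}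
    (h1 : ∀ x, ‖fderiv ℝ f x‖ ≤ B) (h2 : ∀ x, ‖fderiv ℝ (fderiv ℝ f) x‖ ≤ B) :
    (∀ x, ‖fderiv ℝ (fun y => a * f (b • y)) x‖ ≤ |a| * |b| * B) ∧
    ∀ x, ‖fderiv ℝ (fderiv ℝ (fun y => a * f (b • y))) x‖ ≤ |a| * |b| ^ 2 * B := by
  have e : ∀ {G : Type} [NormedAddCommGroup G] [NormedSpace ℝ G] (c : ℝ) {g : E3 → G}, ContDiff ℝ 1 g →
      fderiv ℝ (fun y => c • g (b • y)) = fun y => (c * b) • fderiv ℝ g (b • y) := by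
    intro G _ _ c g hg
    ext1 x
    have h : HasFDerivAt (fun y : E3 => b • y) (b • ContinuousLinearMap.id ℝ E3) x := (hasFDerivAt_id x).const_smul b
    have hgd := (hg.differentiable (by norm_num)).differentiableAt (x := b • x) |>.hasFDerivAt
    have h3 : HasFDerivAt (fun y => c • g (b • y)) _ x := (hgd.comp x h).const_smul c
    rw [h3.fderiv]
    ext v
    simp [mul_smul]
  have en : ∀ {G : Type} [NormedAddCommGroup G] [NormedSpace ℝ G] (c : ℝ) {g : E3 → G}, ContDiff ℝ 1 g → ∀ x,
      ‖fderiv ℝ (fun y => c • g (b • y)) x‖ = |c| * |b| * ‖fderiv ℝ g (b • x)‖ := by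
    intro G _ _ c g hg x
    rw [e c hg, norm_smul, norm_mul, Real.norm_eq_abs, Real.norm_eq_abs]
  have e1 := e a (hf.of_le (m := 1) (by norm_num))
  simp only [smul_eq_mul] at e1
  refine ⟨fun x => ?_, fun x => ?_⟩
  · rw [e1, norm_smul, norm_mul]
    exact mul_le_mul_of_nonneg_left (h1 _) (by positivity)
  · rw [e1, en _ (cdfd1 hf), abs_mul]
    calc _ ≤ |a| * |b| * |b| * B := mul_le_mul_of_nonneg_left (h2 _) (by positivity)
      _ = _ := by ring

theorem moll_int (K : Ker) {t : ℝ} (ht : 0 < t) (x : E3) : ∫ z, (t⁻¹)^3 * K.ρ (t⁻¹ • (z - x)) = 1 := by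
  rw [integral_const_mul, integral_sub_right_eq_self (fun z => K.ρ (t⁻¹ • z)) x, Measure.integral_comp_smul, K.ρ_int]
  simp [finrank_euclideanSpace]
  rw [abs_of_pos ht]
  field_simp

theorem Ker.ρ_bd (K : Ker) : ∃ B : ℝ, 0 < B ∧ ∀ x, |K.ρ x| ≤ B := by
  obtain ⟨B, h0, h1, -⟩ := cs_bounds (contDiff_infty.1 K.hρ 2) (HasCompactSupport.intro (isCompact_closedBall 0 1) fun x hx => by
    have : 1 < ‖x‖ := by simpa using hx
    exact K.ρ_supp x this.le)
  exact ⟨B, h0, h1⟩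

theorem moll_lim (K : Ker) {w : E3 → ℝ} (hw : LocallyIntegrable w) :
    ∀ᵐ x, Tendsto (fun t => ∫ z, w z * ((t⁻¹)^3 * K.ρ (t⁻¹ • (z - x)))) (𝓝[>] (0:ℝ)) (𝓝 (w x)) := by
  obtain ⟨B, hB0, hB⟩ := K.ρ_bd
  filter_upwards [IsUnifLocDoublingMeasure.ae_tendsto_average_norm_sub volume hw 1] with x hx
  have h1 := hx (l := 𝓝[>] (0:ℝ)) (fun _ => x) id tendsto_id (by
    filter_upwards [self_mem_nhdsWithin] with t ht
    exact mem_closedBall_self (by simpa using (le_of_lt ht)))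
  rw [tendsto_iff_norm_sub_tendsto_zero]
  obtain ⟨V, hV⟩ : ∃ V, V = volume.real (closedBall (0:E3) 1) := ⟨_, rfl⟩
  have h2 := h1.const_mul (B * V)
  rw [mul_zero] at h2
  refine squeeze_zero' (Eventually.of_forall fun t => norm_nonneg _) ?_ h2
  filter_upwards [self_mem_nhdsWithin] with t ht
  have ht' : 0 < t := ht
  have hsupp : ∀ z, z ∉ closedBall x t → K.ρ (t⁻¹ • (z - x)) = 0 := by
    intro z hz
    rw [mem_closedBall, dist_eq_norm, not_le] at hz
    refine K.ρ_supp _ ?_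
    rw [norm_smul, Real.norm_of_nonneg (by positivity), ← div_eq_inv_mul, le_div_iff₀ ht']; linarith
  have hcρ : Continuous fun z => (t⁻¹)^3 * K.ρ (t⁻¹ • (z - x)) := by
    have := K.hρ.continuous; fun_prop
  have hi1 : Integrable fun z => w z * ((t⁻¹)^3 * K.ρ (t⁻¹ • (z - x))) := by
    have : HasCompactSupport fun z => (t⁻¹)^3 * K.ρ (t⁻¹ • (z - x)) :=
      HasCompactSupport.intro (isCompact_closedBall x t) fun z hz => by rw [hsupp z hz, mul_zero]
    have := hw.integrable_smul_left_of_hasCompactSupport hcρ this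
    simpa [mul_comm] using this
  have hi2 : Integrable fun z => (t⁻¹)^3 * K.ρ (t⁻¹ • (z - x)) := by
    refine hcρ.integrable_of_hasCompactSupport (HasCompactSupport.intro (isCompact_closedBall x t) fun z hz => by rw [hsupp z hz, mul_zero])
  have e : (∫ z, w z * ((t⁻¹)^3 * K.ρ (t⁻¹ • (z - x)))) - w x = ∫ z in closedBall x t, (w z - w x) * ((t⁻¹)^3 * K.ρ (t⁻¹ • (z - x))) := by
    rw [setIntegral_eq_integral_of_forall_compl_eq_zero (fun z hz => by rw [hsupp z hz]; ring)]
    have : w x = ∫ z, w x * ((t⁻¹)^3 * K.ρ (t⁻¹ • (z - x))) := by rw [integral_const_mul, moll_int K ht', mul_one]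
    conv_lhs => rw [this]
    rw [← integral_sub hi1 (hi2.const_mul _)]
    congr 1; ext z; ring
  rw [e]
  have hwi : IntegrableOn (fun z => ‖w z - w x‖) (closedBall x t) :=
    ((hw.integrableOn_isCompact (isCompact_closedBall x t)).sub (integrableOn_const measure_closedBall_lt_top.ne)).norm
  have h3 : ‖∫ z in closedBall x t, (w z - w x) * ((t⁻¹)^3 * K.ρ (t⁻¹ • (z - x)))‖ ≤ ∫ z in closedBall x t, ((t⁻¹)^3 * B) * ‖w z - w x‖ := by
    refine norm_integral_le_of_norm_le (hwi.const_mul _) (Eventually.of_forall fun z => ?_)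
    rw [norm_mul, mul_comm, norm_mul, Real.norm_of_nonneg (by positivity : (0:ℝ) ≤ (t⁻¹)^3)]
    gcongr
    exact hB _
  refine h3.trans (le_of_eq ?_)
  rw [integral_const_mul, average_eq, smul_eq_mul]
  have hv : volume.real (closedBall x t) = t^3 * V := by
    rw [hV, measureReal_def, measureReal_def, Measure.addHaar_closedBall _ _ ht'.le, ENNReal.toReal_mul, ENNReal.toReal_ofReal (by positivity),
      Measure.addHaar_closedBall_eq_addHaar_ball]
    simp [finrank_euclideanSpace]
  have hVp : 0 < V := by
    rw [hV]
    exact ENNReal.toReal_pos (measure_closedBall_pos _ _ one_pos).ne' measure_closedBall_lt_top.ne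
  rw [measureReal_restrict_apply_univ]
  simp only [id]
  rw [hv]
  field_simp
end

/-- dominating function for the kernels -/
def domK (d : ℝ) (z : E3) : ℝ := (ball (0:E3) d).indicator (fun z => ‖z‖⁻¹) z

theorem domK_nonneg (d : ℝ) (z : E3) : 0 ≤ domK d z := indicator_nonneg (fun _ _ => by positivity) _

theorem domK1_int : Integrable (domK 1) := by
  unfold domK
  rw [show (fun z => (ball (0:E3) 1).indicator (fun z => ‖z‖⁻¹) z) = (ball (0:E3) 1).indicator (fun z => ‖z‖⁻¹) from rfl,
    integrable_indicator_iff measurableSet_ball]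
  rw [integrableOn_fun_norm_addHaar volume (f := fun y => y⁻¹)]
  refine IntegrableOn.congr_fun (f := fun y : ℝ => y) ?_ ?_ measurableSet_Ioo
  · exact (continuous_id.continuousOn.integrableOn_compact (isCompact_Icc (a := (0:ℝ)) (b := 1))).mono_set Ioo_subset_Icc_self
  · intro y hy
    have : y ≠ 0 := hy.1.ne'
    simp [finrank_euclideanSpace]
    field_simp

theorem domK_scale {d : ℝ} (hd : 0 < d) : domK d = fun z => d⁻¹ * domK 1 (d⁻¹ • z) := by
  ext z
  unfold domK
  have : z ∈ ball (0:E3) d ↔ d⁻¹ • z ∈ ball (0:E3) 1 := by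
    rw [mem_ball_zero_iff, mem_ball_zero_iff, norm_smul, Real.norm_of_nonneg (by positivity), ← div_eq_inv_mul, div_lt_one hd]
  by_cases hz : z ∈ ball (0:E3) d
  · rw [indicator_of_mem hz, indicator_of_mem (this.1 hz), norm_smul, Real.norm_of_nonneg (by positivity), mul_inv, inv_inv]
    field_simp
  · rw [indicator_of_notMem hz, indicator_of_notMem (fun h => hz (this.2 h)), mul_zero]

theorem domK_int {d : ℝ} (hd : 0 < d) : Integrable (domK d) := by
  rw [domK_scale hd]
  exact (domK1_int.comp_smul (inv_pos.2 hd).ne').const_mul _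

theorem domK_integral {d : ℝ} (hd : 0 < d) : ∫ z, domK d z = d^2 * ∫ z, domK 1 z := by
  rw [domK_scale hd, integral_const_mul, Measure.integral_comp_smul]
  simp [finrank_euclideanSpace]
  rw [abs_of_pos hd]
  field_simp

/-- limit kernel -/
def Ker.Φ0 (K : Ker) (d : ℝ) (z : E3) : ℝ := (ball (0:E3) d).indicator (fun z => K.Φ d ‖z‖ z) z

theorem Ker.Φ_dom (K : Ker) {d t : ℝ} (ht : 0 < t) (htd : t ≤ d) (z : E3) : |K.Φ d t z| ≤ K.C * domK d z := by
  by_cases hz : z ∈ ball (0:E3) d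
  · unfold domK
    rw [indicator_of_mem hz]; exact K.Φ_bd d t z ht htd
  · rw [mem_ball_zero_iff, not_lt] at hz
    rw [K.Φ_supp d t z ht htd hz, abs_zero]
    exact mul_nonneg K.Cpos.le (domK_nonneg _ _)

theorem Ker.Φ_lim (K : Ker) {d : ℝ} (hd : 0 < d) : ∀ᵐ z : E3, ∀ᶠ t in 𝓝[>] (0:ℝ), K.Φ d t z = K.Φ0 d z := by
  have h0 : ∀ᵐ z : E3, z ≠ 0 := by simp [ae_iff]
  filter_upwards [h0] with z hz
  have hz' : 0 < ‖z‖ := norm_pos_iff.2 hz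
  have h1 : ∀ᶠ t in 𝓝[>] (0:ℝ), t < min ‖z‖ d := nhdsWithin_le_nhds (gt_mem_nhds (lt_min hz' hd))
  filter_upwards [h1, self_mem_nhdsWithin] with t ht ht0
  have ht0' : 0 < t := ht0
  have a := ht.trans_le (min_le_left _ _)
  have b := ht.trans_le (min_le_right _ _)
  unfold Φ0
  by_cases hzb : z ∈ ball (0:E3) d
  · rw [indicator_of_mem hzb]
    rw [mem_ball_zero_iff] at hzb
    exact K.Φ_eq d t ‖z‖ z ht0' b.le hz' hzb.le a.le le_rfl
  · rw [indicator_of_notMem hzb]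
    rw [mem_ball_zero_iff, not_lt] at hzb
    exact K.Φ_supp d t z ht0' b.le hzb

theorem Ker.Φ_ev (d : ℝ) (hd : 0 < d) : ∀ᶠ t in 𝓝[>] (0:ℝ), 0 < t ∧ t ≤ d := by
  filter_upwards [nhdsWithin_le_nhds (gt_mem_nhds hd), self_mem_nhdsWithin] with t ht ht0
  exact ⟨ht0, ht.le⟩

theorem Ker.Φ0_dom (K : Ker) {d : ℝ} (hd : 0 < d) : ∀ᵐ z, |K.Φ0 d z| ≤ K.C * domK d z := by
  filter_upwards [K.Φ_lim hd] with z hz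
  obtain ⟨t, ⟨h1, h2⟩, h3⟩ := ((Ker.Φ_ev d hd).and hz).exists
  rw [← h3]
  exact K.Φ_dom h1 h2 z

theorem Ker.Φ0_int (K : Ker) {d : ℝ} (hd : 0 < d) : Integrable (K.Φ0 d) := by
  have hm : AEStronglyMeasurable (K.Φ0 d) volume := by
    refine aestronglyMeasurable_of_tendsto_ae atTop (f := fun (n : ℕ) => K.Φ d (d / (n + 1))) ?_ ?_
    · intro n
      refine (K.hΦ d _ (by positivity) ?_).continuous.aestronglyMeasurable
      exact div_le_self hd.le (by linarith [Nat.cast_nonneg (α := ℝ) n])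
    · have ht : Tendsto (fun n : ℕ => d / ((n:ℝ) + 1)) atTop (𝓝[>] 0) := by
        rw [tendsto_nhdsWithin_iff]
        refine ⟨?_, Eventually.of_forall fun n => by simp only [mem_Ioi]; positivity⟩
        have := (tendsto_one_div_add_atTop_nhds_zero_nat (𝕜 := ℝ)).const_mul d
        simpa [div_eq_mul_inv] using this
      filter_upwards [K.Φ_lim hd] with z hz
      exact tendsto_const_nhds.congr' (by filter_upwards [ht.eventually hz] with n hn using hn.symm)
  exact ((domK_int hd).const_mul K.C).mono' hm (by simpa only [Real.norm_eq_abs] using K.Φ0_dom hd)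

theorem Ker.Φ0_L1 (K : Ker) {d : ℝ} (hd : 0 < d) : ∫ z, |K.Φ0 d z| ≤ K.C * (∫ z, domK 1 z) * d^2 := by
  have := integral_mono_ae (K.Φ0_int hd).abs ((domK_int hd).const_mul K.C) (K.Φ0_dom hd)
  rw [integral_const_mul, domK_integral hd] at this
  refine this.trans (le_of_eq (by ring))

theorem Ker.Φ_int_lim (K : Ker) {d : ℝ} (hd : 0 < d) {F : E3 → ℝ} (hF : Continuous F) {B : ℝ} (hB : ∀ x, |F x| ≤ B) (x : E3) :
    Tendsto (fun t => ∫ z, F z * K.Φ d t (z - x)) (𝓝[>] 0) (𝓝 (∫ z, K.Φ0 d z * F (x + z))) := by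
  have e : ∀ t, ∫ z, F z * K.Φ d t (z - x) = ∫ z, K.Φ d t z * F (x + z) := by
    intro t
    rw [← integral_add_left_eq_self _ x]
    simp [mul_comm]
  simp only [e]
  refine tendsto_integral_filter_of_dominated_convergence (fun z => K.C * domK d z * B) ?_ ?_ ?_ ?_
  · filter_upwards [Ker.Φ_ev d hd] with t ht
    have := (K.hΦ d t ht.1 ht.2).continuous
    exact Continuous.aestronglyMeasurable (by fun_prop)
  · filter_upwards [Ker.Φ_ev d hd] with t ht
    refine Eventually.of_forall fun z => ?_
    rw [norm_mul]
    exact mul_le_mul (K.Φ_dom ht.1 ht.2 z) (hB _) (norm_nonneg _) (mul_nonneg K.Cpos.le (domK_nonneg _ _))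
  · exact ((domK_int hd).const_mul K.C).mul_const B
  · filter_upwards [K.Φ_lim hd] with z hz
    refine tendsto_const_nhds.congr' ?_
    filter_upwards [hz] with t ht
    rw [ht]

theorem nsl {G : Type*} [NormedAddCommGroup G] {a b : G} {x y : ℝ} (ha : ‖a‖ ≤ x) (hb : ‖b‖ ≤ y) : ‖a - b‖ ≤ x + y :=
  (norm_sub_le a b).trans (add_le_add ha hb)

theorem local_rep (K : Ker) : ∃ Cl : ℝ, 0 < Cl ∧ ∀ (w F : E3 → ℝ) (x0 : E3) (d A B : ℝ) (S : Set E3), 0 < d → 0 ≤ A → 0 ≤ B →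
    Measurable w → LocallyIntegrable w → ContDiff ℝ 2 F → (∀ z ∈ ball x0 (2 * d), |w z| ≤ A) →
    (∀ x, |F x| ≤ B) → (∀ x, ‖fderiv ℝ F x‖ ≤ B) → (∀ x, ‖fderiv ℝ (fderiv ℝ F) x‖ ≤ B) → S ⊆ ball x0 d →
    (∀ x ∈ S, ∀ t, 0 < t → t ≤ d → ∫ z, w z * ((t⁻¹)^3 * K.ρ (t⁻¹ • (z - x)) + (d⁻¹)^3 * K.k (d⁻¹ • (z - x))) =
      ∫ z, F z * K.Φ d t (z - x)) →
    ∃ U : E3 → ℝ, ContDiff ℝ 2 U ∧ (∀ᵐ x, x ∈ S → w x = U x) ∧ (∀ x, ‖fderiv ℝ U x‖ ≤ Cl * (A / d + B * d^2)) ∧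
      ∀ x, ‖fderiv ℝ (fderiv ℝ U) x‖ ≤ Cl * (A / d^2 + B * d^2) := by
  have hkc : HasCompactSupport K.k := HasCompactSupport.intro (isCompact_closedBall 0 1) fun x hx => K.k_supp x (by simpa using hx)
  have hk2 := contDiff_infty.1 K.hk 2
  obtain ⟨Bk, hBk, hk0, hk1, hk2'⟩ := cs_bounds hk2 hkc
  obtain ⟨V, hV⟩ : ∃ V, V = volume.real (ball (0:E3) 1) := ⟨_, rfl⟩
  have hVp : 0 ≤ V := hV ▸ measureReal_nonneg
  obtain ⟨I, hI⟩ : ∃ I, I = ∫ z, domK 1 z := ⟨_, rfl⟩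
  have hIp : 0 ≤ I := hI ▸ integral_nonneg (domK_nonneg 1)
  have hCp := K.Cpos
  refine ⟨8 * V * Bk + K.C * I + 1, by positivity, ?_⟩
  intro w F x0 d A B S hd hA hB hwm hwi hF hwA hF0 hF1 hF2 hS h
  obtain ⟨a, ha⟩ : ∃ a, a = (ball x0 (2 * d)).indicator w := ⟨_, rfl⟩
  have hai : Integrable a := by
    rw [ha, integrable_indicator_iff measurableSet_ball]
    exact (hwi.integrableOn_isCompact (isCompact_closedBall x0 (2*d))).mono_set ball_subset_closedBall
  have haL : ∫ z, |a z| ≤ A * (8 * d^3 * V) := by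
    have h1 : ∀ z, |a z| ≤ (ball x0 (2 * d)).indicator (fun _ => A) z := by
      intro z
      rw [ha]
      by_cases hz : z ∈ ball x0 (2 * d)
      · rw [indicator_of_mem hz, indicator_of_mem hz]; exact hwA z hz
      · rw [indicator_of_notMem hz, indicator_of_notMem hz, abs_zero]
    have h2 : Integrable ((ball x0 (2 * d)).indicator (fun _ : E3 => A)) := by
      rw [integrable_indicator_iff measurableSet_ball]
      exact integrableOn_const measure_ball_lt_top.ne
    have h3 := integral_mono hai.abs h2 h1
    refine h3.trans (le_of_eq ?_)
    rw [integral_indicator measurableSet_ball, setIntegral_const, smul_eq_mul, measureReal_def,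
      Measure.addHaar_ball _ _ (by positivity), ENNReal.toReal_mul, ENNReal.toReal_ofReal (by positivity), hV, measureReal_def]
    simp only [finrank_euclideanSpace, Fintype.card_fin]
    ring
  obtain ⟨f, hf⟩ : ∃ f : E3 → ℝ, f = fun y => (d⁻¹)^3 * K.k ((-d⁻¹) • y) := ⟨_, rfl⟩
  have hf2 : ContDiff ℝ 2 f := by
    rw [hf]; exact contDiff_const.mul (hk2.comp (contDiff_id.const_smul _))
  have hsb := scale_bounds hk2 ((d⁻¹)^3) (-d⁻¹) hk1 hk2'
  rw [← hf] at hsb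
  rw [abs_neg, abs_of_pos (inv_pos.2 hd), abs_of_pos (pow_pos (inv_pos.2 hd) 3)] at hsb
  have hf0 : ∀ x, |f x| ≤ (d⁻¹)^3 * Bk := by
    intro x
    rw [hf]
    simp only [abs_mul, abs_of_pos (pow_pos (inv_pos.2 hd) 3)]
    gcongr; exact hk0 _
  obtain ⟨c1, c2, c3⟩ := conv_C2 hai measurable_neg hf2 hf0 hsb.1 hsb.2
  obtain ⟨e1, e2, e3⟩ := conv_C2 (K.Φ0_int hd) measurable_id hF hF0 hF1 hF2
  obtain ⟨U1, hU1⟩ : ∃ U : E3 → ℝ, U = fun x => ∫ z, a z * f (x + -z) := ⟨_, rfl⟩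
  obtain ⟨U2, hU2⟩ : ∃ U : E3 → ℝ, U = fun x => ∫ z, K.Φ0 d z * F (x + z) := ⟨_, rfl⟩
  simp only [id] at e1 e2 e3
  rw [← hU1] at c1 c2 c3
  rw [← hU2] at e1 e2 e3
  have hdU : fderiv ℝ (fun x => U2 x - U1 x) = fun x => fderiv ℝ U2 x - fderiv ℝ U1 x := by
    ext1 x
    exact fderiv_fun_sub (e1.differentiable (by norm_num)).differentiableAt (c1.differentiable (by norm_num)).differentiableAt
  have hL := K.Φ0_L1 hd
  rw [← hI] at hL
  refine ⟨fun x => U2 x - U1 x, e1.sub c1, ?_, fun x => ?_, fun x => ?_⟩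
  · filter_upwards [moll_lim K hwi] with x hx hxS
    have h1 := K.Φ_int_lim hd hF.continuous hF0 x
    have hsupp : ∀ z, z ∉ ball x0 (2 * d) → K.k (d⁻¹ • (z - x)) = 0 := by
      intro z hz
      refine K.k_supp _ ?_
      have hxd := hS hxS
      rw [mem_ball] at hz hxd
      have : d < ‖z - x‖ := by
        rw [← dist_eq_norm]; linarith [dist_triangle z x x0]
      rw [norm_smul, Real.norm_of_nonneg (by positivity), ← div_eq_inv_mul, lt_div_iff₀ hd]; linarith
    have hU1x : ∫ z, w z * ((d⁻¹)^3 * K.k (d⁻¹ • (z - x))) = U1 x := by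
      rw [hU1]
      congr 1; ext z
      rw [ha, hf]
      have : (-d⁻¹) • (x + -z) = d⁻¹ • (z - x) := by module
      simp only [this]
      by_cases hz : z ∈ ball x0 (2 * d)
      · rw [indicator_of_mem hz]
      · rw [indicator_of_notMem hz, hsupp z hz]; ring
    have hint : ∀ g : E3 → ℝ, Continuous g → HasCompactSupport g → Integrable fun z => w z * g z := by
      intro g hg hgc
      have := hwi.integrable_smul_left_of_hasCompactSupport hg hgc
      simpa [mul_comm] using this
    have hcs : ∀ (q : E3 → ℝ), (∀ x, 1 < ‖x‖ → q x = 0) → ∀ t : ℝ, 0 < t → HasCompactSupport fun z => (t⁻¹)^3 * q (t⁻¹ • (z - x)) := by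
      intro q hq t ht
      refine HasCompactSupport.intro (isCompact_closedBall x t) fun z hz => ?_
      rw [mem_closedBall, dist_eq_norm, not_le] at hz
      rw [hq, mul_zero]
      rw [norm_smul, Real.norm_of_nonneg (by positivity), ← div_eq_inv_mul, lt_div_iff₀ ht]; linarith
    have hev : (fun t => ∫ z, F z * K.Φ d t (z - x)) =ᶠ[𝓝[>] 0] fun t => (∫ z, w z * ((t⁻¹)^3 * K.ρ (t⁻¹ • (z - x)))) + U1 x := by
      filter_upwards [Ker.Φ_ev d hd] with t ht
      rw [← h x hxS t ht.1 ht.2, ← hU1x, ← integral_add]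
      · congr 1; ext z; ring
      · have := K.hρ.continuous
        exact hint _ (by fun_prop) (hcs _ (fun x hx => K.ρ_supp x hx.le) t ht.1)
      · have := K.hk.continuous
        exact hint _ (by fun_prop) (hcs _ K.k_supp d hd)
    have h2 := tendsto_nhds_unique (h1.congr' hev) (hx.add_const (U1 x))
    rw [hU2]
    linarith
  · rw [hdU]
    refine (norm_sub_le _ _).trans ((add_le_add (e2 x) (c2 x)).trans ?_)
    have i1 : (∫ z, |K.Φ0 d z|) * B ≤ K.C * I * d^2 * B := by gcongr
    have i2 : (∫ z, |a z|) * ((d⁻¹)^3 * d⁻¹ * Bk) ≤ A * (8 * d^3 * V) * ((d⁻¹)^3 * d⁻¹ * Bk) := by gcongr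
    have i3 : A * (8 * d^3 * V) * ((d⁻¹)^3 * d⁻¹ * Bk) = 8 * V * Bk * (A / d) := by field_simp
    have p1 : 0 ≤ A / d := by positivity
    have p2 : 0 ≤ B * d^2 := by positivity
    have p3 : 0 ≤ V * Bk * (B * d^2) := by positivity
    have p4 : 0 ≤ K.C * I * (A / d) := by positivity
    nlinarith
  · rw [hdU]
    have : fderiv ℝ (fun x => fderiv ℝ U2 x - fderiv ℝ U1 x) x = fderiv ℝ (fderiv ℝ U2) x - fderiv ℝ (fderiv ℝ U1) x :=
      fderiv_fun_sub ((cdfd1 e1).differentiable (by norm_num)).differentiableAt ((cdfd1 c1).differentiable (by norm_num)).differentiableAt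
    rw [this]
    refine (nsl (G := E3 →L[ℝ] E3 →L[ℝ] ℝ) (e3 x) (c3 x)).trans ?_
    have i1 : (∫ z, |K.Φ0 d z|) * B ≤ K.C * I * d^2 * B := by gcongr
    have i2 : (∫ z, |a z|) * ((d⁻¹)^3 * d⁻¹^2 * Bk) ≤ A * (8 * d^3 * V) * ((d⁻¹)^3 * d⁻¹^2 * Bk) := by gcongr
    have i3 : A * (8 * d^3 * V) * ((d⁻¹)^3 * d⁻¹^2 * Bk) = 8 * V * Bk * (A / d^2) := by field_simp
    have p1 : 0 ≤ A / d^2 := by positivity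
    have p2 : 0 ≤ B * d^2 := by positivity
    have p3 : 0 ≤ V * Bk * (B * d^2) := by positivity
    have p4 : 0 ≤ K.C * I * (A / d^2) := by positivity
    nlinarith

section
theorem lap_eq {f : E3 → ℝ} {x : E3} (hf : ContDiffAt ℝ 2 f x) : lap f x = ∑ i, iteratedFDeriv ℝ 2 f x ![be i, be i] := by
  unfold lap
  refine Finset.sum_congr rfl fun i _ => ?_
  have hd : DifferentiableAt ℝ (fderiv ℝ f) x := (hf.fderiv_right (m := 1) (by norm_num)).differentiableAt (by norm_num)
  rw [fderiv_clm_apply hd (by fun_prop)]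
  simp [iteratedFDeriv_two_apply]

theorem lap_isom {f : E3 → ℝ} (hf : ContDiff ℝ 2 f) (A : E3 ≃ₗᵢ[ℝ] E3) (p x : E3) :
    lap (fun z => f (A z + p)) x = lap f (A x + p) := by
  have hg : ContDiff ℝ 2 (fun z => f (z + p)) := hf.comp (contDiff_id.add contDiff_const)
  have hgA : ContDiff ℝ 2 (fun z => f (A z + p)) := hg.comp A.contDiff
  have e1 : lap f (A x + p) = lap (fun z => f (z + p)) (A x) := by
    rw [lap_eq hf.contDiffAt, lap_eq hg.contDiffAt]
    simp only [iteratedFDeriv_comp_add_right]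
  rw [e1, lap_eq hg.contDiffAt, lap_eq hgA.contDiffAt]
  have h1 := InnerProductSpace.laplacian_eq_iteratedFDeriv_orthonormalBasis (fun z => f (z + p)) (EuclideanSpace.basisFun (Fin 3) ℝ)
  have h2 := InnerProductSpace.laplacian_eq_iteratedFDeriv_orthonormalBasis (fun z => f (z + p)) ((EuclideanSpace.basisFun (Fin 3) ℝ).map A)
  have h3 := congrFun (h1.symm.trans h2) (A x)
  simp only [EuclideanSpace.basisFun_apply, OrthonormalBasis.map_apply] at h3
  rw [h3]
  refine Finset.sum_congr rfl fun i _ => ?_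
  have := A.toContinuousLinearEquiv.toContinuousLinearMap.iteratedFDeriv_comp_right hg x (i := 2) le_rfl
  change iteratedFDeriv ℝ 2 (fun z => f (A z + p)) x = _ at this
  rw [this]
  rw [ContinuousMultilinearMap.compContinuousLinearMap_apply]
  congr 1
  ext j : 1
  fin_cases j <;> rfl

theorem norm_D2 (f : E3 → ℝ) (x : E3) : ‖fderiv ℝ (fderiv ℝ f) x‖ = ‖iteratedFDeriv ℝ 2 f x‖ := by
  rw [← norm_iteratedFDeriv_fderiv, norm_iteratedFDeriv_one]

theorem norm_D1 (f : E3 → ℝ) (x : E3) : ‖fderiv ℝ f x‖ = ‖iteratedFDeriv ℝ 1 f x‖ := by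
  rw [norm_iteratedFDeriv_one]

theorem isom_bounds (f : E3 → ℝ) (A : E3 ≃ₗᵢ[ℝ] E3) (p x : E3) :
    ‖fderiv ℝ (fun z => f (A z + p)) x‖ = ‖fderiv ℝ f (A x + p)‖ ∧
    ‖fderiv ℝ (fderiv ℝ (fun z => f (A z + p))) x‖ = ‖fderiv ℝ (fderiv ℝ f) (A x + p)‖ := by
  have h : ∀ i, ‖iteratedFDeriv ℝ i (fun z => f (A z + p)) x‖ = ‖iteratedFDeriv ℝ i f (A x + p)‖ := by
    intro i
    have := A.norm_iteratedFDeriv_comp_right (𝕜 := ℝ) (fun z => f (z + p)) x i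
    rw [iteratedFDeriv_comp_add_right] at this
    exact this
  exact ⟨by rw [norm_D1, norm_D1, h], by rw [norm_D2, norm_D2, h]⟩

theorem mp_isom (A : E3 ≃ₗᵢ[ℝ] E3) (p : E3) : MeasurePreserving (fun z => A z + p) volume volume :=
  (measurePreserving_add_right volume p).comp A.measurePreserving

namespace HRep
variable {D : Set E3} (H : HRep D)

theorem ell_sub (n x y : E3) : H.ell n x - H.ell n y = ⟪n, x - y⟫ := by
  unfold ell; rw [inner_sub_right]; ring

theorem ell_lip {n : E3} (hn : n ∈ H.N) (x y : E3) : H.ell n x ≤ H.ell n y + ‖x - y‖ := by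
  have h := H.ell_sub n x y
  have h2 := real_inner_le_norm n (x - y)
  rw [H.unit n hn, one_mul] at h2
  linarith

theorem rho_lip (x y : E3) : H.rho x ≤ H.rho y + ‖x - y‖ := by
  obtain ⟨p, hp, he⟩ := Finset.exists_mem_eq_inf' H.off (fun p => max (H.ell p.1 y) (H.ell p.2 y))
  change H.rho y = _ at he
  obtain ⟨a1, a2, a3⟩ := Finset.mem_offDiag.1 hp
  have h1 : H.rho x ≤ max (H.ell p.1 x) (H.ell p.2 x) := Finset.inf'_le _ hp
  refine h1.trans ?_
  rw [he]
  refine max_le ?_ ?_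
  · exact (H.ell_lip a1 x y).trans (by gcongr; exact le_max_left _ _)
  · exact (H.ell_lip a2 x y).trans (by gcongr; exact le_max_right _ _)

theorem lam_lip (x y : E3) : H.lam x ≤ H.lam y + ‖x - y‖ := by
  obtain ⟨n, hn, he⟩ := Finset.exists_mem_eq_inf' H.Nne (fun n => H.ell n y)
  change H.lam y = _ at he
  have h1 : H.lam x ≤ H.ell n x := Finset.inf'_le _ hn
  rw [he]
  exact h1.trans (H.ell_lip hn x y)

/-- linear part of the reflection -/
def reflA (n : E3) : E3 ≃ₗᵢ[ℝ] E3 := ((ℝ ∙ n)ᗮ).reflection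

def refl (n z : E3) : E3 := reflA n z + (2 * H.c n) • n

theorem refl_eq {n : E3} (hn : n ∈ H.N) (z : E3) : H.refl n z = z - (2 * H.ell n z) • n := by
  unfold refl reflA ell
  rw [Submodule.reflection_orthogonal_apply, Submodule.reflection_singleton_apply, H.unit n hn]
  simp only [RCLike.ofReal_real_eq_id, id]
  norm_num
  module

theorem refl_ell {n : E3} (hn : n ∈ H.N) (z : E3) : H.ell n (H.refl n z) = - H.ell n z := by
  have h := H.ell_sub n (H.refl n z) z
  rw [H.refl_eq hn] at h ⊢
  rw [show z - (2 * H.ell n z) • n - z = (-(2 * H.ell n z)) • n by module, inner_smul_right, real_inner_self_eq_norm_sq, H.unit n hn] at h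
  linarith

theorem refl_refl {n : E3} (hn : n ∈ H.N) (z : E3) : H.refl n (H.refl n z) = z := by
  rw [H.refl_eq hn (H.refl n z), H.refl_ell hn, H.refl_eq hn]
  module

theorem refl_dist {n : E3} (x y : E3) : ‖H.refl n x - H.refl n y‖ = ‖x - y‖ := by
  unfold refl
  rw [add_sub_add_right_eq_sub, ← map_sub, LinearIsometryEquiv.norm_map]

theorem refl_near {n : E3} (hn : n ∈ H.N) (x : E3) : ‖H.refl n x - x‖ = 2 * |H.ell n x| := by
  rw [H.refl_eq hn, show x - (2 * H.ell n x) • n - x = (-(2 * H.ell n x)) • n by module, norm_smul, H.unit n hn]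
  simp

end HRep
end

section
theorem emb_isom (A : E3 ≃ₗᵢ[ℝ] E3) (p : E3) : MeasurableEmbedding (fun z => A z + p) :=
  (A.toHomeomorph.trans (Homeomorph.addRight p)).measurableEmbedding

theorem lap_shift {f : E3 → ℝ} (hf : ContDiff ℝ 2 f) (x z : E3) : lap (fun z => f (z - x)) z = lap f (z - x) := by
  have := lap_isom hf (LinearIsometryEquiv.refl ℝ E3) (-x) z
  simpa [sub_eq_add_neg] using this

theorem rpow_dbl {a γ : ℝ} (ha : 0 ≤ a) (h0 : 0 ≤ γ) (h1 : γ < 1) : (2 * a) ^ (2 * γ) ≤ 4 * a ^ (2 * γ) := by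
  rw [Real.mul_rpow (by norm_num) ha]
  gcongr
  calc (2:ℝ) ^ (2 * γ) ≤ 2 ^ (2:ℝ) := Real.rpow_le_rpow_of_exponent_le (by norm_num) (by linarith)
    _ = 4 := by norm_num

namespace HRep
variable {D : Set E3} (H : HRep D)

theorem refl_int (n : E3) (q : E3 → ℝ) : ∫ z, q (H.refl n z) = ∫ z, q z :=
  (mp_isom (reflA n) _).integral_comp (emb_isom _ _) q

/-- the local identity -/
theorem chart_id (K : Ker) {w F : E3 → ℝ} (hwi : Integrable w)
    (hw0 : ∀ x, x ∉ D → w x = 0) (hF : Continuous F) {B : ℝ} (hFb : ∀ x, |F x| ≤ B) (hF0 : ∀ x, x ∉ D → F x = 0)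
    (hvw : ∀ φ : E3 → ℝ, ContDiff ℝ 2 φ → (∀ x ∈ frontier D, φ x = 0) →
        ∫ x in D, w x * lap φ x = -∫ x in D, F x * φ x)
    {d t : ℝ} (ht : 0 < t) (htd : t ≤ d) (x : E3) :
    ((∀ z ∈ frontier D, d ≤ ‖z - x‖) → ∫ z, w z * ((t⁻¹)^3 * K.ρ (t⁻¹ • (z - x)) + (d⁻¹)^3 * K.k (d⁻¹ • (z - x))) =
      ∫ z, F z * K.Φ d t (z - x)) ∧
    ∀ n ∈ H.N, (∀ z ∈ frontier D, H.refl n z = z ∨ (d ≤ ‖z - x‖ ∧ d ≤ ‖H.refl n z - x‖)) →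
      ∫ z, (w z - w (H.refl n z)) * ((t⁻¹)^3 * K.ρ (t⁻¹ • (z - x)) + (d⁻¹)^3 * K.k (d⁻¹ • (z - x))) =
      ∫ z, (F z - F (H.refl n z)) * K.Φ d t (z - x) := by
  have hvw' : ∀ φ : E3 → ℝ, ContDiff ℝ 2 φ → (∀ x ∈ frontier D, φ x = 0) → ∫ x, w x * -lap φ x = ∫ x, F x * φ x := by
    intro φ h1 h2
    have := hvw φ h1 h2
    rw [setIntegral_eq_integral_of_forall_compl_eq_zero (fun z hz => by rw [hw0 z hz]; ring),
      setIntegral_eq_integral_of_forall_compl_eq_zero (fun z hz => by rw [hF0 z hz]; ring)] at this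
    simp only [mul_neg, integral_neg]
    linarith
  have hd : 0 < d := ht.trans_le htd
  have hΦ := contDiff_infty.1 (K.hΦ d t ht htd) 2
  obtain ⟨g, hg⟩ : ∃ g : E3 → ℝ, g = fun z => (t⁻¹)^3 * K.ρ (t⁻¹ • z) + (d⁻¹)^3 * K.k (d⁻¹ • z) := ⟨_, rfl⟩
  have hgz : ∀ z, (t⁻¹)^3 * K.ρ (t⁻¹ • z) + (d⁻¹)^3 * K.k (d⁻¹ • z) = g z := fun z => by rw [hg]
  have hgl : ∀ z, -lap (K.Φ d t) z = g z := fun z => by rw [K.Φ_lap d t z ht htd, neg_neg, hgz]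
  have hgc : Continuous g := by
    have := cont_lap hΦ
    rw [← funext hgl]
    exact this.neg
  simp only [hgz]
  have hs : ContDiff ℝ 2 (fun z => K.Φ d t (z - x)) := hΦ.comp (contDiff_id.sub contDiff_const)
  refine ⟨fun h => ?_, fun n hn h => ?_⟩
  · rw [← hvw' _ hs fun z hz => K.Φ_supp d t _ ht htd (h z hz)]
    simp only [lap_shift hΦ, hgl]
  · have hs2 : ContDiff ℝ 2 (fun z => -1 * K.Φ d t (H.refl n z - x)) :=
      contDiff_const.mul (hs.comp ((reflA n).contDiff.add contDiff_const))
    have hlr : ∀ z, lap (fun z => K.Φ d t (H.refl n z - x)) z = lap (K.Φ d t) (H.refl n z - x) := by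
      intro z
      have := lap_isom hs (reflA n) ((2 * H.c n) • n) z
      rw [lap_shift hΦ] at this
      exact this
    have hs3 : ContDiff ℝ 2 (fun z => K.Φ d t (H.refl n z - x)) := hs.comp ((reflA n).contDiff.add contDiff_const)
    have := hvw' _ (hs.add hs2) fun z hz => by
      rcases h z hz with h1 | ⟨h1, h2⟩
      · rw [h1]; ring
      · rw [K.Φ_supp d t _ ht htd h1, K.Φ_supp d t _ ht htd h2]; ring
    have hl : ∀ z, -lap (fun z => K.Φ d t (z - x) + -1 * K.Φ d t (H.refl n z - x)) z = g (z - x) - g (H.refl n z - x) := by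
      intro z
      rw [lap_add hs.contDiffAt hs2.contDiffAt, lap_const_mul _ _ hs3, hlr, lap_shift hΦ, ← hgl, ← hgl]; ring
    simp only [hl] at this
    have hΦc := hΦ.continuous
    have hΦi : Integrable fun z => K.Φ d t (z - x) := by
      have h1 : HasCompactSupport (fun z => K.Φ d t (z - x)) := by
        refine HasCompactSupport.intro (isCompact_closedBall x d) fun z hz => ?_
        rw [mem_closedBall, dist_eq_norm, not_le] at hz
        exact K.Φ_supp d t _ ht htd hz.le
      exact Continuous.integrable_of_hasCompactSupport (by fun_prop) h1
    have hmp := mp_isom (reflA n) ((2 * H.c n) • n)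
    have hRc : Continuous (H.refl n) := (reflA n).continuous.add continuous_const
    have hgb : ∃ C, ∀ z, |g z| ≤ C := by
      have : HasCompactSupport g := by
        rw [← funext hgl]
        refine HasCompactSupport.intro (isCompact_closedBall 0 d) fun z hz => ?_
        have hz' : d < ‖z‖ := by simpa using hz
        have : K.Φ d t =ᶠ[𝓝 z] fun _ => 0 := by
          filter_upwards [(isOpen_lt continuous_const continuous_norm).mem_nhds hz'] with y hy
          exact K.Φ_supp d t y ht htd (le_of_lt hy)
        rw [lap_congr this]
        simp [lap]
      exact hgc.bounded_above_of_compact_support this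
    obtain ⟨Cg, hCg⟩ := hgb
    have hwR : Integrable fun z => w (H.refl n z) := (hmp.integrable_comp_emb (emb_isom _ _)).2 hwi
    have hwg : ∀ v : E3 → ℝ, Integrable v → ∀ q : E3 → E3, Continuous q → Integrable fun z => v z * g (q z) := fun v hv q hq =>
      hv.mul_bdd (hgc.comp hq).aestronglyMeasurable (Eventually.of_forall fun z => hCg _)
    have hFΦ : ∀ v : E3 → ℝ, Continuous v → (∀ z, |v z| ≤ B) → ∀ u : E3 → ℝ, Integrable u → Integrable fun z => v z * u z := fun v hv hb u hu =>
      hu.bdd_mul hv.aestronglyMeasurable (Eventually.of_forall fun z => hb _)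
    have hΦR : Integrable fun z => K.Φ d t (H.refl n z - x) := (hmp.integrable_comp_emb (emb_isom _ _)).2 hΦi
    have e1 : ∫ z, w z * (g (z - x) - g (H.refl n z - x)) = ∫ z, (w z - w (H.refl n z)) * g (z - x) := by
      have a1 := hwg w hwi (fun z => z - x) (by fun_prop)
      have a2 := hwg w hwi (fun z => H.refl n z - x) (by fun_prop)
      have a3 := hwg _ hwR (fun z => z - x) (by fun_prop)
      simp only [mul_sub, sub_mul]
      rw [integral_sub a1 a2, integral_sub a1 a3, ← H.refl_int n (fun z => w (H.refl n z) * g (z - x))]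
      simp only [H.refl_refl hn]
    have e2 : ∫ z, F z * (K.Φ d t (z - x) + -1 * K.Φ d t (H.refl n z - x)) = ∫ z, (F z - F (H.refl n z)) * K.Φ d t (z - x) := by
      have a1 := hFΦ F hF hFb _ hΦi
      have a2 := hFΦ F hF hFb _ hΦR
      have a3 := hFΦ _ (hF.comp hRc) (fun z => hFb _) _ hΦi
      simp only [Function.comp] at a3
      have : ∀ z, F z * (K.Φ d t (z - x) + -1 * K.Φ d t (H.refl n z - x)) = F z * K.Φ d t (z - x) - F z * K.Φ d t (H.refl n z - x) := fun z => by ring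
      simp only [this, sub_mul]
      rw [integral_sub a1 a2, integral_sub a1 a3, ← H.refl_int n (fun z => F (H.refl n z) * K.Φ d t (z - x))]
      simp only [H.refl_refl hn]
    rw [← e1, ← e2]
    exact this

theorem exists_L' : ∃ L : ℝ, 1 ≤ L ∧ ∀ z ∈ D, H.rho z ≤ L := by
  obtain ⟨L, h0, h1⟩ := H.exists_L
  refine ⟨max 1 L, le_max_left _ _, fun z hz => ?_⟩
  obtain ⟨p, hp⟩ := H.off
  obtain ⟨a1, a2, a3⟩ := Finset.mem_offDiag.1 hp
  refine (Finset.inf'_le _ hp).trans ((max_le (h1 z (subset_closure hz) _ a1) (h1 z (subset_closure hz) _ a2)).trans (le_max_right _ _))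

theorem chart (K : Ker) {γ : ℝ} (hγ0 : 1/2 < γ) (hγ1 : γ < 1) : ∃ C : ℝ, 0 < C ∧ ∀ (w F : E3 → ℝ) (A0 B : ℝ), 0 ≤ A0 → 0 ≤ B → Measurable w →
    (∀ x ∈ D, |w x| ≤ A0 * H.rho x ^ (2 * γ)) → (∀ x, x ∉ D → w x = 0) → ContDiff ℝ 2 F → (∀ x, x ∉ D → F x = 0) →
    (∀ x, |F x| ≤ B) → (∀ x, ‖fderiv ℝ F x‖ ≤ B) → (∀ x, ‖fderiv ℝ (fderiv ℝ F) x‖ ≤ B) →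
    (∀ φ : E3 → ℝ, ContDiff ℝ 2 φ → (∀ x ∈ frontier D, φ x = 0) → ∫ x in D, w x * lap φ x = -∫ x in D, F x * φ x) →
    ∀ x0 ∈ D, ∃ U : E3 → ℝ, ContDiff ℝ 2 U ∧ (∀ᵐ x, x ∈ ball x0 (H.rho x0 / 32) ∩ D → w x = U x) ∧
      (∀ x, ‖fderiv ℝ U x‖ ≤ C * (A0 + B) * H.rho x0 ^ (2 * γ - 1)) ∧
      ∀ x, ‖fderiv ℝ (fderiv ℝ U) x‖ ≤ C * (A0 + B) * H.rho x0 ^ (2 * γ - 2) := by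
  obtain ⟨Cl, hCl, hrep⟩ := local_rep K
  obtain ⟨L, hL1, hL⟩ := H.exists_L'
  refine ⟨Cl * (8192 + 2 * L^4), by positivity, ?_⟩
  intro w F A0 B hA0 hB hwm hwb hw0 hF hF0 hB0 hB1 hB2 hvw x0 hx0
  have hr := H.rho_pos hx0
  obtain ⟨r0, hr0⟩ : ∃ r, r = H.rho x0 := ⟨_, rfl⟩
  obtain ⟨d, hd⟩ : ∃ d, d = r0 / 32 := ⟨_, rfl⟩
  have hrL : r0 ≤ L := hr0 ▸ hL x0 hx0
  rw [← hr0] at hr ⊢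
  have hd0 : 0 < d := by rw [hd]; positivity
  have hwi : Integrable w := by
    obtain ⟨R, hR⟩ := H.bdd.subset_closedBall 0
    refine integrable_of_bdd_supp (B := A0 * L^(2*γ)) (R := R) hwm.aestronglyMeasurable (fun x => ?_) fun x hx => ?_
    · by_cases hx : x ∈ D
      · refine (hwb x hx).trans ?_
        have := (H.rho_pos hx).le
        have := hL x hx
        gcongr
      · rw [hw0 x hx, abs_zero]; positivity
    · refine hw0 x fun h => ?_
      have := hR h
      rw [mem_closedBall_zero_iff] at this
      linarith
  have hwA : ∀ z, ‖z - x0‖ ≤ r0 → |w z| ≤ 4 * A0 * r0 ^ (2 * γ) := by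
    intro z hz
    by_cases hx : z ∈ D
    · refine (hwb z hx).trans ?_
      have h1 := H.rho_lip z x0
      have h2 := rpow_dbl hr.le (by linarith : 0 ≤ γ) hγ1
      have h3 : H.rho z ^ (2*γ) ≤ (2 * r0) ^ (2 * γ) :=
        Real.rpow_le_rpow (H.rho_pos hx).le (by linarith) (by linarith)
      nlinarith
    · rw [hw0 z hx, abs_zero]; positivity
  -- conversion of the bounds
  have hconv : ∀ U : E3 → ℝ, ContDiff ℝ 2 U → (∀ᵐ x, x ∈ ball x0 d ∩ D → w x = U x) →
      (∀ x, ‖fderiv ℝ U x‖ ≤ Cl * (8 * A0 * r0 ^ (2 * γ) / d + 2 * B * d^2)) →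
      (∀ x, ‖fderiv ℝ (fderiv ℝ U) x‖ ≤ Cl * (8 * A0 * r0 ^ (2 * γ) / d^2 + 2 * B * d^2)) →
      ∃ U : E3 → ℝ, ContDiff ℝ 2 U ∧ (∀ᵐ x, x ∈ ball x0 (r0 / 32) ∩ D → w x = U x) ∧
      (∀ x, ‖fderiv ℝ U x‖ ≤ Cl * (8192 + 2 * L^4) * (A0 + B) * r0 ^ (2 * γ - 1)) ∧
      ∀ x, ‖fderiv ℝ (fderiv ℝ U) x‖ ≤ Cl * (8192 + 2 * L^4) * (A0 + B) * r0 ^ (2 * γ - 2) := by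
    intro U h1 h2 h3 h4
    have hp : ∀ e : ℝ, 0 ≤ e → e ≤ 4 → r0 ^ e ≤ L ^ 4 := by
      intro e h0 h4
      calc r0 ^ e ≤ L ^ e := Real.rpow_le_rpow hr.le hrL h0
        _ ≤ L ^ (4:ℝ) := Real.rpow_le_rpow_of_exponent_le hL1 h4
        _ = L ^ 4 := by norm_cast
    have k1 : d^2 ≤ L^4 * r0 ^ (2 * γ - 1) := by
      have : r0 ^ (2:ℕ) = r0 ^ (3 - 2 * γ) * r0 ^ (2 * γ - 1) := by
        rw [← Real.rpow_add hr, ← Real.rpow_natCast]; congr 1; push_cast; ring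
      have h5 := hp (3 - 2 * γ) (by linarith) (by linarith)
      have h6 : d^2 ≤ r0^2 := by rw [hd]; nlinarith
      rw [this] at h6
      exact h6.trans (by gcongr)
    have k2 : d^2 ≤ L^4 * r0 ^ (2 * γ - 2) := by
      have : r0 ^ (2:ℕ) = r0 ^ (4 - 2 * γ) * r0 ^ (2 * γ - 2) := by
        rw [← Real.rpow_add hr, ← Real.rpow_natCast]; congr 1; push_cast; ring
      have h5 := hp (4 - 2 * γ) (by linarith) (by linarith)
      have h6 : d^2 ≤ r0^2 := by rw [hd]; nlinarith
      rw [this] at h6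
      exact h6.trans (by gcongr)
    have k3 : r0 ^ (2 * γ) / d = 32 * r0 ^ (2 * γ - 1) := by
      rw [Real.rpow_sub hr, Real.rpow_one, hd]; field_simp
    have k4 : r0 ^ (2 * γ) / d^2 = 1024 * r0 ^ (2 * γ - 2) := by
      rw [Real.rpow_sub hr, Real.rpow_two, hd]; field_simp; norm_num
    have q1 : 0 < r0 ^ (2 * γ - 1) := by positivity
    have q2 : 0 < r0 ^ (2 * γ - 2) := by positivity
    have fin : ∀ X Y e : ℝ, 0 < e → Y ≤ L^4 * e → X ≤ 1024 * e → Cl * (8 * A0 * X + 2 * B * Y) ≤ Cl * (8192 + 2 * L^4) * (A0 + B) * e := by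
      intro X Y e he hY hX
      have t1 : 8 * A0 * X ≤ 8 * A0 * (1024 * e) := by gcongr
      have t2 : 2 * B * Y ≤ 2 * B * (L^4 * e) := by gcongr
      have t3 : 0 ≤ B * e := by positivity
      have t4 : 0 ≤ A0 * L^4 * e := by positivity
      calc Cl * (8 * A0 * X + 2 * B * Y) ≤ Cl * ((8192 + 2 * L^4) * (A0 + B) * e) := by gcongr; nlinarith
        _ = _ := by ring
    refine ⟨U, h1, hd ▸ h2, fun x => (h3 x).trans ?_, fun x => (h4 x).trans ?_⟩
    · rw [mul_div_assoc]
      exact fin _ _ _ q1 k1 (by rw [k3]; nlinarith)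
    · rw [mul_div_assoc]
      exact fin _ _ _ q2 k2 k4.le
  obtain ⟨n, hn, hne⟩ := Finset.exists_mem_eq_inf' H.Nne (fun n => H.ell n x0)
  change H.lam x0 = _ at hne
  have hnp : 0 < H.ell n x0 := H.mem_iff.1 hx0 n hn
  by_cases hcase : r0 / 8 ≤ H.lam x0
  · obtain ⟨U, a1, a2, a3, a4⟩ := hrep w F x0 d (8 * A0 * r0 ^ (2 * γ)) (2 * B) (ball x0 d) hd0 (by positivity) (by positivity) hwm
      hwi.locallyIntegrable hF (fun z hz => by
        rw [mem_ball, dist_eq_norm] at hz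
        refine (hwA z (by linarith)).trans ?_
        have : 0 ≤ A0 * r0 ^ (2 * γ) := by positivity
        linarith) (fun x => (hB0 x).trans (by linarith)) (fun x => (hB1 x).trans (by linarith)) (fun x => (hB2 x).trans (by linarith)) subset_rfl
      (fun x hx t ht htd => (H.chart_id K hwi hw0 hF.continuous hB0 hF0 hvw ht htd x).1 fun z hz => by
        by_contra hcon
        push Not at hcon
        rw [mem_ball, dist_eq_norm] at hx
        have h1 : z ∉ D := fun h => (H.isOpen.frontier_eq ▸ hz).2 h
        refine h1 (H.mem_iff_lam.2 ?_)
        have h2 := H.lam_lip x0 z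
        have h3 : ‖x0 - z‖ ≤ ‖z - x‖ + ‖x - x0‖ := by
          rw [norm_sub_rev]; exact norm_sub_le_norm_sub_add_norm_sub _ _ _
        linarith)
    exact hconv U a1 (by filter_upwards [a2] with x hx hx2 using hx hx2.1) a3 a4
  · push Not at hcase
    rw [hne] at hcase
    have hmp := mp_isom (reflA n) ((2 * H.c n) • n)
    have hwR : Integrable fun z => w (H.refl n z) := (hmp.integrable_comp_emb (emb_isom _ _)).2 hwi
    have hRc : ContDiff ℝ 2 (H.refl n) := (reflA n).contDiff.add contDiff_const
    have hib := fun x => isom_bounds F (reflA n) ((2 * H.c n) • n) x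
    have hFR : ContDiff ℝ 2 (fun z => F (H.refl n z)) := hF.comp hRc
    have hdF : fderiv ℝ (fun x => F x - F (H.refl n x)) = fun x => fderiv ℝ F x - fderiv ℝ (fun z => F (H.refl n z)) x := by
      ext1 x
      exact fderiv_fun_sub (hF.differentiable (by norm_num)).differentiableAt (hFR.differentiable (by norm_num)).differentiableAt
    have hRx0 : ∀ z, ‖H.refl n z - x0‖ ≤ ‖z - x0‖ + r0 / 4 := by
      intro z
      have h1 := H.refl_near hn x0
      rw [abs_of_pos hnp] at h1
      have h2 := norm_sub_le_norm_sub_add_norm_sub (H.refl n z) (H.refl n x0) x0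
      rw [H.refl_dist] at h2
      linarith
    obtain ⟨U, a1, a2, a3, a4⟩ := hrep (fun z => w z - w (H.refl n z)) (fun z => F z - F (H.refl n z)) x0 d (8 * A0 * r0 ^ (2 * γ)) (2 * B) (ball x0 d ∩ D)
      hd0 (by positivity) (by positivity) (hwm.sub (hwm.comp hRc.continuous.measurable))
      (hwi.sub hwR).locallyIntegrable (hF.sub hFR) (fun z hz => by
        rw [mem_ball, dist_eq_norm] at hz
        have h1 := hwA z (by linarith)
        have h2 := hwA (H.refl n z) (by linarith [hRx0 z])
        have h3 := abs_sub (w z) (w (H.refl n z))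
        linarith) (fun x => (abs_sub _ _).trans (by linarith [hB0 x, hB0 (H.refl n x)]))
      (fun x => by
        rw [hdF]
        refine (nsl (hB1 x) ((hib x).1.le.trans (hB1 _))).trans (by linarith))
      (fun x => by
        rw [hdF]
        have : fderiv ℝ (fun x => fderiv ℝ F x - fderiv ℝ (fun z => F (H.refl n z)) x) x = fderiv ℝ (fderiv ℝ F) x - fderiv ℝ (fderiv ℝ (fun z => F (H.refl n z))) x :=
          fderiv_fun_sub ((cdfd1 hF).differentiable (by norm_num)).differentiableAt ((cdfd1 hFR).differentiable (by norm_num)).differentiableAt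
        rw [this]
        refine (nsl (G := E3 →L[ℝ] E3 →L[ℝ] ℝ) (hB2 x) ((hib x).2.le.trans (hB2 _))).trans (by linarith)) inter_subset_left
      (fun x hx t ht htd => (H.chart_id K hwi hw0 hF.continuous hB0 hF0 hvw ht htd x).2 n hn fun z hz => by
        have hxb := hx.1
        rw [mem_ball, dist_eq_norm] at hxb
        have h1 : z ∉ D := fun h => (H.isOpen.frontier_eq ▸ hz).2 h
        rw [H.mem_iff] at h1
        push Not at h1
        obtain ⟨m, hm, hmz⟩ := h1
        by_cases hmn : m = n
        · left
          rw [hmn] at hmz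
          have h2 := H.ell_clos (frontier_subset_closure hz) hn
          have h3 : H.ell n z = 0 := le_antisymm hmz h2
          rw [H.refl_eq hn, h3]; simp
        · right
          have h4 : r0 ≤ max (H.ell n x0) (H.ell m x0) := hr0 ▸ Finset.inf'_le (fun p : E3 × E3 => max (H.ell p.1 x0) (H.ell p.2 x0)) (Finset.mem_offDiag.2 (show (n, m).1 ∈ H.N ∧ _ from ⟨hn, hm, fun h => hmn h.symm⟩))
          have h5 : r0 ≤ H.ell m x0 := (le_max_iff.1 h4).resolve_left (by linarith)
          have h6 := H.ell_lip hm x0 z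
          rw [norm_sub_rev] at h6
          have h7 := norm_sub_le_norm_sub_add_norm_sub z x x0
          have h8 := norm_sub_le_norm_sub_add_norm_sub (H.refl n z) x x0
          have h9 := hRx0 (H.refl n z)
          rw [H.refl_refl hn] at h9
          exact ⟨by linarith, by linarith⟩)
    refine hconv U a1 ?_ a3 a4
    filter_upwards [a2] with x hx hx2
    rw [← hx hx2, hw0 (H.refl n x), sub_zero]
    intro hD
    have h1 := H.mem_iff.1 hD n hn
    have h2 := H.mem_iff.1 hx2.2 n hn
    rw [H.refl_ell hn] at h1
    linarith

end HRep
end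

section
theorem grad_congr {f g : E3 → ℝ} {x : E3} (h : f =ᶠ[𝓝 x] g) : gradient f x = gradient g x := by
  unfold gradient; rw [h.fderiv_eq]

theorem grad_zero {f : E3 → ℝ} {x : E3} (h : f =ᶠ[𝓝 x] fun _ => 0) : gradient f x = 0 := by
  rw [grad_congr h]; simp [gradient]

theorem grad_le {f : E3 → ℝ} {k : ℝ≥0} (hf : LipschitzWith k f) (x : E3) : ‖gradient f x‖ ≤ k := by
  rw [norm_grad]; exact norm_fderiv_le_of_lipschitz ℝ hf

theorem grad_meas (f : E3 → ℝ) : Measurable (gradient f) :=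
  (InnerProductSpace.toDual ℝ E3).symm.continuous.measurable.comp (measurable_fderiv ℝ f)

theorem ip_le {f g : E3 → ℝ} {k l : ℝ≥0} (hf : LipschitzWith k f) (hg : LipschitzWith l g) (x : E3) :
    ‖⟪gradient f x, gradient g x⟫‖ ≤ k * l :=
  (norm_inner_le_norm _ _).trans (mul_le_mul (grad_le hf x) (grad_le hg x) (norm_nonneg _) k.2)

theorem off_cl {D : Set E3} {v : E3 → ℝ} (h0 : ∀ x, x ∉ D → v x = 0) {x : E3} (hx : x ∉ closure D) :
    v =ᶠ[𝓝 x] fun _ => 0 := by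
  filter_upwards [isClosed_closure.isOpen_compl.mem_nhds hx] with y hy using h0 y fun h => hy (subset_closure h)

theorem weak_of_strong {D : Set E3} (hDo : IsOpen D) (hDb : Bornology.IsBounded D) (hDc : Convex ℝ D)
    {W F v : E3 → ℝ} {l k : ℝ≥0} (hW : LipschitzWith l W) (hWD : ContDiffOn ℝ 2 W D) (hF : Continuous F)
    (hWF : ∀ x ∈ D, lap W x = -F x) (hv : LipschitzWith k v) (h0 : ∀ x, x ∉ D → v x = 0) :
    ∫ x, ⟪gradient v x, gradient W x⟫ = ∫ x, v x * F x := by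
  have hne : (Dᶜ).Nonempty := by
    by_contra h
    rw [not_nonempty_iff_eq_empty, compl_empty_iff] at h
    exact NormedSpace.unbounded_univ ℝ E3 (h ▸ hDb)
  set δ : ℕ → ℝ := fun n => 1 / ((n : ℝ) + 1)
  have hδ0 : ∀ n, 0 < δ n := fun n => by positivity
  have hδ : Tendsto δ atTop (𝓝 0) := tendsto_one_div_add_atTop_nhds_zero_nat
  set a : ℝ≥0 := 2 * (k + 1)
  set m : ℕ → E3 → ℝ := fun n x => max ((a : ℝ) * infDist x Dᶜ - δ n) 0
  set vn : ℕ → E3 → ℝ := fun n x => max (min (v x) (m n x)) (-m n x)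
  have hm : ∀ n, LipschitzWith a (m n) := fun n => by
    have h1 : LipschitzWith a fun x => (a : ℝ) * infDist x Dᶜ := by
      refine LipschitzWith.of_dist_le_mul fun x y => ?_
      have := (lipschitz_infDist_pt Dᶜ).dist_le_mul x y
      rw [Real.dist_eq] at this ⊢
      rw [← mul_sub, abs_mul, abs_of_nonneg (show (0:ℝ) ≤ a from a.2)]
      simp only [NNReal.coe_one, one_mul] at this
      exact mul_le_mul_of_nonneg_left this a.2
    have h2 : LipschitzWith a fun x => (a : ℝ) * infDist x Dᶜ - δ n := by
      simpa using h1.sub (LipschitzWith.const (δ n))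
    simpa [m] using h2.max_const 0
  have hka : k ≤ a := by
    have : (k : ℝ) ≤ a := by simp [a]; nlinarith [k.2]
    exact this
  have hvn : ∀ n, LipschitzWith a (vn n) := fun n => by
    have h1 := (hv.weaken hka).min (hm n)
    have h2 := h1.max (hm n).neg
    simpa using h2
  have hvd : ∀ x, |v x| ≤ k * infDist x Dᶜ := fun x => by
    have hk0 := k.2
    rcases eq_or_lt_of_le (show (0:ℝ) ≤ k from k.2) with hk | hk
    · obtain ⟨y, hy⟩ := hne
      have := hv.dist_le_mul x y
      rw [h0 y hy, ← hk, Real.dist_eq, sub_zero] at this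
      rw [← hk]; linarith
    · rw [← div_le_iff₀' hk]
      refine (le_infDist hne).2 fun y hy => ?_
      have := hv.dist_le_mul x y
      rw [h0 y hy, Real.dist_eq, sub_zero] at this
      rw [div_le_iff₀' hk]; exact this
  have hm0 : ∀ n x, 0 ≤ m n x := fun n x => le_max_right _ _
  have hvnv : ∀ n x, |vn n x| ≤ |v x| := fun n x => by
    have h1 := hm0 n x
    have h3 : -|v x| ≤ v x := neg_abs_le _
    have h4 := le_abs_self (v x)
    have h5 := abs_nonneg (v x)
    rw [abs_le]
    by_cases hvp : 0 ≤ v x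
    · constructor
      · exact le_max_of_le_left (le_min h3 (by linarith))
      · exact max_le ((min_le_left _ _).trans h4) (by linarith)
    · push Not at hvp
      rw [abs_of_neg hvp, neg_neg]
      constructor
      · exact le_max_of_le_left (le_min le_rfl (by linarith))
      · exact max_le ((min_le_left _ _).trans (by linarith)) (by linarith)
  have hvn0 : ∀ n x, x ∉ D → vn n x = 0 := fun n x hx => by
    have := hvnv n x
    rw [h0 x hx, abs_zero] at this
    exact abs_nonpos_iff.1 this
  have hsup : ∀ n, tsupport (vn n) ⊆ D := fun n => by
    have hcl : IsClosed {x | δ n ≤ (a : ℝ) * infDist x Dᶜ} :=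
      isClosed_le continuous_const (continuous_const.mul (continuous_infDist_pt _))
    refine (closure_minimal (fun x hx => ?_) hcl).trans fun x hx => ?_
    · by_contra h
      have h : (a : ℝ) * infDist x Dᶜ < δ n := not_le.1 h
      have : m n x = 0 := max_eq_right (by linarith)
      apply hx
      simp only [vn, this]
      rw [neg_zero]; exact max_eq_right (min_le_right _ _)
    · by_contra h
      have hx : δ n ≤ (a : ℝ) * infDist x Dᶜ := hx
      rw [infDist_zero_of_mem (show x ∈ Dᶜ from h), mul_zero] at hx
      exact absurd (hδ0 n) (not_lt.2 hx)
  have hcs : ∀ n, HasCompactSupport (vn n) := fun n =>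
    hDb.isCompact_closure.of_isClosed_subset (isClosed_tsupport _) ((hsup n).trans subset_closure)
  have hibp := fun n => ibp (hvn n) (hcs n) hDo (hsup n) hWD
  have hR : ∀ n, - ∫ x, vn n x * lap W x = ∫ x, vn n x * F x := fun n => by
    rw [← integral_neg]
    refine integral_congr_ae (Eventually.of_forall fun x => ?_)
    by_cases hx : x ∈ D
    · simp [hWF x hx]
    · simp [hvn0 n x hx]
  have hev : ∀ x ∈ D, ∀ᶠ n in atTop, vn n =ᶠ[𝓝 x] v := fun x hx => by
    have hd : 0 < infDist x Dᶜ := (hDo.isClosed_compl.notMem_iff_infDist_pos hne).1 (fun h => h hx)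
    have hd2 : 0 < (a - k : ℝ) * infDist x Dᶜ := mul_pos (by simp [a]; nlinarith [k.2]) hd
    filter_upwards [hδ.eventually (gt_mem_nhds hd2)] with n hn
    have hc : Continuous fun y => (a - k : ℝ) * infDist y Dᶜ := continuous_const.mul (continuous_infDist_pt _)
    filter_upwards [(isOpen_lt continuous_const hc).mem_nhds hn] with y hy
    have hy : δ n < (a - k : ℝ) * infDist y Dᶜ := hy
    have h1 := hvd y
    have h2 : |v y| ≤ m n y := le_max_of_le_left (by linarith)
    rw [abs_le] at h2
    simp only [vn]
    rw [min_eq_left h2.2, max_eq_left h2.1]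
  have hcl := hDb.isCompact_closure
  have hfin : IntegrableOn (fun _ : E3 => (a : ℝ) * l) (closure D) := by
    rw [integrableOn_const_iff]; right; exact hcl.measure_lt_top
  have L1 : Tendsto (fun n => ∫ x, ⟪gradient (vn n) x, gradient W x⟫) atTop (𝓝 (∫ x, ⟪gradient v x, gradient W x⟫)) := by
    refine tendsto_integral_of_dominated_convergence ((closure D).indicator fun _ => (a : ℝ) * l)
      (fun n => ((grad_meas _).inner (grad_meas _)).aestronglyMeasurable) (hfin.integrable_indicator isClosed_closure.measurableSet)
      (fun n => Eventually.of_forall fun x => ?_) ?_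
    · by_cases hx : x ∈ closure D
      · rw [indicator_of_mem hx]; exact ip_le (hvn n) hW x
      · rw [indicator_of_notMem hx, grad_zero (off_cl (hvn0 n) hx)]; simp
    · filter_upwards [ae_D hDc] with x hx
      rcases hx with hx | hx
      · refine tendsto_const_nhds.congr' ?_
        filter_upwards [hev x hx] with n hn
        rw [grad_congr hn]
      · refine tendsto_const_nhds.congr' (Eventually.of_forall fun n => ?_)
        simp only [grad_zero (off_cl (hvn0 n) hx), grad_zero (off_cl h0 hx)]
  have L2 : Tendsto (fun n => ∫ x, vn n x * F x) atTop (𝓝 (∫ x, v x * F x)) := by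
    have hvF : Integrable fun x => v x * F x := by
      have := (hv.continuous.mul hF).continuousOn.integrableOn_compact (μ := volume) hcl
      refine (integrableOn_iff_integrable_of_support_subset fun x hx => ?_).1 this
      by_contra h
      exact hx (by simp [h0 x fun h' => h (subset_closure h')])
    refine tendsto_integral_of_dominated_convergence (fun x => |v x * F x|)
      (fun n => ((hvn n).continuous.mul hF).aestronglyMeasurable) hvF.abs
      (fun n => Eventually.of_forall fun x => ?_) (Eventually.of_forall fun x => ?_)
    · rw [norm_mul, abs_mul]; exact mul_le_mul_of_nonneg_right (hvnv n x) (norm_nonneg _)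
    · by_cases hx : x ∈ D
      · refine tendsto_const_nhds.congr' ?_
        filter_upwards [hev x hx] with n hn
        rw [hn.eq_of_nhds]
      · refine tendsto_const_nhds.congr' (Eventually.of_forall fun n => ?_)
        simp only [h0 x hx, hvn0 n x hx]
  refine tendsto_nhds_unique L1 ?_
  simp only [hibp, hR]
  exact L2

namespace HRep
variable {D : Set E3} (H : HRep D)

/-- regularity of the Dirichlet problem on the polyhedron -/
theorem green_exists (K : Ker) : ∃ γ C : ℝ, 1/2 < γ ∧ γ < 1 ∧ 0 < C ∧ ∀ (F : E3 → ℝ) (B : ℝ), 0 ≤ B → ContDiff ℝ 2 F →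
    (∀ x, x ∉ D → F x = 0) → (∀ x, |F x| ≤ B) → (∀ x, ‖fderiv ℝ F x‖ ≤ B) → (∀ x, ‖fderiv ℝ (fderiv ℝ F) x‖ ≤ B) →
    ∃ W : E3 → ℝ, (∃ k, LipschitzWith k W) ∧ (∀ x, x ∉ D → W x = 0) ∧ ContDiffOn ℝ 2 W D ∧
    (∀ x ∈ D, |W x| ≤ C * B * H.rho x ^ (2 * γ) ∧ ‖fderiv ℝ W x‖ ≤ C * B * H.rho x ^ (2 * γ - 1) ∧
      ‖fderiv ℝ (fderiv ℝ W) x‖ ≤ C * B * H.rho x ^ (2 * γ - 2) ∧ lap W x = -F x) ∧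
    ∀ (v : E3 → ℝ) (k : ℝ≥0), LipschitzWith k v → (∀ x, x ∉ D → v x = 0) →
      ∫ x, ⟪gradient v x, gradient W x⟫ = ∫ x, v x * F x := by
  classical
  obtain ⟨γ, M, hγ0, hγ1, hM, hk⟩ := H.kato2
  obtain ⟨Cc, hCc, hch⟩ := H.chart K hγ0 hγ1
  obtain ⟨L, hL1, hL⟩ := H.exists_L'
  refine ⟨γ, Cc * (M + 1) + M, hγ0, hγ1, by positivity, ?_⟩
  intro F B hB hF hF0 hB0 hB1 hB2
  set β : E3 → ℝ := fun x => M * min (H.rho x ^ (2 * γ)) (H.lam x)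
  have cβ : Continuous β := continuous_const.mul ((H.crho.rpow_const fun x => Or.inr (by linarith)).min H.clam)
  have hβ0 : ∀ x ∈ D, 0 ≤ β x := fun x hx => mul_nonneg hM.le (le_min (Real.rpow_nonneg (H.rho_pos hx).le _) (H.lam_pos hx).le)
  obtain ⟨w, hwm, hwb, hw0, hvw⟩ := vw_exists H.isOpen H.bdd cβ hβ0 (fun φ hφ h0 => by
    have := hk φ hφ h0
    simp only [β, mul_assoc, integral_const_mul]; exact this) hF.continuous hB hB0
  have hβρ : ∀ x, β x ≤ M * H.rho x ^ (2 * γ) := fun x => mul_le_mul_of_nonneg_left (min_le_left _ _) hM.le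
  have hβl : ∀ x, β x ≤ M * H.lam x := fun x => mul_le_mul_of_nonneg_left (min_le_right _ _) hM.le
  have hc := hch w F (B * M) B (by positivity) hB hwm (fun x hx => (hwb x hx).trans (by
    rw [mul_assoc]; exact mul_le_mul_of_nonneg_left (hβρ x) hB)) hw0 hF hF0 hB0 hB1 hB2 hvw
  choose! U hU hUw hU1 hU2 using hc
  set W : E3 → ℝ := fun x => if x ∈ D then U x x else 0 with hWdef
  have hop : ∀ x, IsOpen (ball x (H.rho x / 32) ∩ D) := fun x => isOpen_ball.inter H.isOpen
  have hself : ∀ x ∈ D, x ∈ ball x (H.rho x / 32) ∩ D := fun x hx => ⟨mem_ball_self (by have := H.rho_pos hx; positivity), hx⟩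
  have hWU : ∀ x ∈ D, ∀ z ∈ ball x (H.rho x / 32) ∩ D, W z = U x z := fun x hx z hz => by
    have hzD := hz.2
    have hop2 := (hop x).inter (hop z)
    have : EqOn (U z) (U x) ((ball x (H.rho x / 32) ∩ D) ∩ (ball z (H.rho z / 32) ∩ D)) := by
      refine Measure.eqOn_open_of_ae_eq (μ := volume) ((ae_restrict_iff' hop2.measurableSet).2 ?_) hop2 (hU z hzD).continuous.continuousOn (hU x hx).continuous.continuousOn
      filter_upwards [hUw x hx, hUw z hzD] with y h1 h2 h3
      rw [← h1 h3.1, ← h2 h3.2]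
    simp only [hWdef, if_pos hzD]
    exact this ⟨hz, hself z hzD⟩
  have hWe : ∀ x ∈ D, W =ᶠ[𝓝 x] U x := fun x hx => by
    filter_upwards [(hop x).mem_nhds (hself x hx)] with z hz using hWU x hx z hz
  have hW0 : ∀ x, x ∉ D → W x = 0 := fun x hx => if_neg hx
  have hWb : ∀ x ∈ D, |W x| ≤ B * β x := fun x hx => by
    have : EqOn (fun z => max |U x z| (B * β z)) (fun z => B * β z) (ball x (H.rho x / 32) ∩ D) := by
      refine Measure.eqOn_open_of_ae_eq (μ := volume) ((ae_restrict_iff' (hop x).measurableSet).2 ?_) (hop x)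
        ((hU x hx).continuous.abs.max (continuous_const.mul cβ)).continuousOn (continuous_const.mul cβ).continuousOn
      filter_upwards [hUw x hx] with y h1 h3
      rw [← h1 h3]; exact max_eq_right (hwb y h3.2)
    rw [hWU x hx x (hself x hx)]
    exact max_eq_right_iff.1 (this (hself x hx))
  have hWw : ∀ᵐ x, x ∈ D → W x = w x := by
    rw [ae_iff]
    refine measure_null_of_locally_null _ fun x hx => ?_
    have hxD : x ∈ D := by simp only [mem_ofPred_eq, not_forall] at hx; exact hx.1
    refine ⟨{z | ¬ (z ∈ D → W z = w z)} ∩ (ball x (H.rho x / 32) ∩ D), inter_mem_nhdsWithin _ ((hop x).mem_nhds (hself x hxD)), ?_⟩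
    refine measure_mono_null ?_ (ae_iff.1 (hUw x hxD))
    rintro z ⟨hz1, hz2⟩ hz3
    exact hz1 fun _ => by rw [hz3 hz2]; exact hWU x hxD z hz2
  have hWc : ContDiffOn ℝ 2 W D := fun x hx => ((hU x hx).contDiffAt.congr_of_eventuallyEq (hWe x hx)).contDiffWithinAt
  have e1 : ∀ x ∈ D, fderiv ℝ W x = fderiv ℝ (U x) x := fun x hx => (hWe x hx).fderiv_eq
  have e2 : ∀ x ∈ D, fderiv ℝ (fderiv ℝ W) x = fderiv ℝ (fderiv ℝ (U x)) x := fun x hx => (hWe x hx).fderiv.fderiv_eq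
  have hcLap : ContinuousOn (lap W) D := fun x hx => by
    refine (ContinuousAt.congr (cont_lap (hU x hx)).continuousAt ?_).continuousWithinAt
    filter_upwards [(hWe x hx).eventuallyEq_nhds] with y hy using (lap_congr hy).symm
  have hLip : ∃ k, LipschitzWith k W := by
    obtain ⟨A, hA⟩ : ∃ A, A = Cc * (B * M + B) * L ^ (2 * γ - 1) := ⟨_, rfl⟩
    have hL0 : (0:ℝ) < L := by linarith
    have hA0 : 0 ≤ A := by rw [hA]; positivity
    have hbd : ∀ x ∈ D, ‖fderiv ℝ W x‖ ≤ A + B * M := fun x hx => by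
      rw [e1 x hx]
      have h0 : 0 ≤ B * M := by positivity
      have h1 : H.rho x ^ (2 * γ - 1) ≤ L ^ (2 * γ - 1) := Real.rpow_le_rpow (H.rho_pos hx).le (hL x hx) (by linarith)
      have := (hU1 x hx x).trans (mul_le_mul_of_nonneg_left h1 (by positivity))
      linarith
    have hin := H.convex.lipschitzOnWith_of_nnnorm_fderiv_le (f := W) (C := ⟨A + B * M, by positivity⟩)
      (fun x hx => (hWc.contDiffAt (H.isOpen.mem_nhds hx)).differentiableAt (by norm_num)) (fun x hx => hbd x hx)
    refine ⟨⟨A + B * M, by positivity⟩, ?_⟩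
    have hmix : ∀ x ∈ D, ∀ y, y ∉ D → |W x| ≤ (A + B * M) * dist x y := fun x hx y hy => by
      have h1 := hWb x hx
      have h2 := hβl x
      have h3 : H.lam y ≤ 0 := not_lt.1 fun h => hy (H.mem_iff_lam.2 h)
      have h4 := H.lam_lip x y
      rw [← dist_eq_norm] at h4
      have h5 : B * β x ≤ B * (M * dist x y) := by gcongr; exact h2.trans (mul_le_mul_of_nonneg_left (by linarith) hM.le)
      have h6 : 0 ≤ A * dist x y := by positivity
      linarith
    refine LipschitzWith.of_dist_le_mul fun x y => ?_
    change dist (W x) (W y) ≤ (A + B * M) * dist x y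
    by_cases hx : x ∈ D <;> by_cases hy : y ∈ D
    · exact hin.dist_le_mul x hx y hy
    · rw [hW0 y hy, Real.dist_eq, sub_zero]; exact hmix x hx y hy
    · rw [hW0 x hx, Real.dist_eq, zero_sub, abs_neg, dist_comm]; exact hmix y hy x hx
    · rw [hW0 x hx, hW0 y hy, dist_self]; positivity
  obtain ⟨k, hkW⟩ := hLip
  have hcs : HasCompactSupport W := HasCompactSupport.intro H.bdd.isCompact_closure fun x hx => hW0 x fun h => hx (subset_closure h)
  have hlap : ∀ x ∈ D, lap W x = -F x := by
    have hae : ∀ᵐ x, x ∈ D → lap W x + F x = 0 := by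
      refine H.isOpen.ae_eq_zero_of_integral_contDiff_smul_eq_zero
        ((hcLap.add hF.continuous.continuousOn).locallyIntegrableOn H.isOpen.measurableSet) fun g hg hgc hgD => ?_
      have hg2 : ContDiff ℝ 2 g := hg.of_le ENat.LEInfty.out
      obtain ⟨kg, hkg⟩ := hg2.lipschitzWith_of_hasCompactSupport hgc (by norm_num)
      have i1 := ibp hkg hgc H.isOpen hgD hWc
      have i2 := ibp hkW hcs isOpen_univ (subset_univ _) hg2.contDiffOn
      have hgz : ∀ x, x ∉ D → g x = 0 := fun x hx => image_eq_zero_of_notMem_tsupport fun h => hx (hgD h)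
      have i3 := hvw g hg2 fun x hx => hgz x fun h => (H.isOpen.frontier_eq ▸ hx).2 h
      have i4 : ∫ x in D, w x * lap g x = ∫ x, W x * lap g x := by
        rw [← setIntegral_eq_integral_of_forall_compl_eq_zero (s := D) (f := fun x => W x * lap g x) (fun x hx => by simp only [hW0 x hx, zero_mul])]
        refine setIntegral_congr_ae H.isOpen.measurableSet ?_
        filter_upwards [hWw] with x hx hxD
        rw [hx hxD]
      rw [i4, setIntegral_eq_integral_of_forall_compl_eq_zero (fun x hx => by simp only [hF0 x hx, zero_mul])] at i3
      have j1 : Integrable fun x => g x * lap W x := by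
        have := (hg2.continuous.continuousOn.mul (hcLap.mono hgD)).integrableOn_compact (μ := volume) hgc
        refine (integrableOn_iff_integrable_of_support_subset fun x hx => ?_).1 this
        by_contra h
        exact hx (by simp [image_eq_zero_of_notMem_tsupport h])
      have j2 : Integrable fun x => g x * F x := (hg2.continuous.mul hF.continuous).integrable_of_hasCompactSupport hgc.mul_right
      simp only [smul_eq_mul, mul_add]
      rw [integral_add j1 j2]
      simp only [mul_comm (F _)] at i3
      rw [i3] at i2
      have i5 : ∫ x, ⟪gradient W x, gradient g x⟫ = ∫ x, ⟪gradient g x, gradient W x⟫ := by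
        congr 1; ext1 x; exact real_inner_comm _ _
      rw [i5] at i2
      linarith
    have : EqOn (fun x => lap W x + F x) (fun _ => 0) D := by
      refine Measure.eqOn_open_of_ae_eq (μ := volume) ((ae_restrict_iff' H.isOpen.measurableSet).2 hae) H.isOpen
        (hcLap.add hF.continuous.continuousOn) continuousOn_const
    intro x hx
    have := this hx
    simp only at this
    linarith
  refine ⟨W, ⟨k, hkW⟩, hW0, hWc, fun x hx => ⟨?_, ?_, ?_, hlap x hx⟩, fun v kv hv hv0 =>
    weak_of_strong H.isOpen H.bdd H.convex hkW hWc hF.continuous hlap hv hv0⟩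
  · have p : 0 ≤ Cc * (M + 1) * B * H.rho x ^ (2 * γ) := by have := H.rho_pos hx; positivity
    have := (hWb x hx).trans (mul_le_mul_of_nonneg_left (hβρ x) hB)
    linarith
  · have p : 0 ≤ M * B * H.rho x ^ (2 * γ - 1) := by have := H.rho_pos hx; positivity
    have := hU1 x hx x
    rw [e1 x hx]; linarith
  · have p : 0 ≤ M * B * H.rho x ^ (2 * γ - 2) := by have := H.rho_pos hx; positivity
    have := hU2 x hx x
    rw [e2 x hx]; linarith
end HRep
end

theorem ext_finite (S : Finset E3) (Q : Set E3) (hQ : Q = {n | ∀ s ∈ S, -1 ≤ ⟪n, s⟫}) : (Q.extremePoints ℝ).Finite := by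
  classical
  have key : ∀ n ∈ Q, ∀ n' ∈ Q, (∀ s ∈ S, ⟪n, s⟫ = -1 → ⟪n', s⟫ = -1) → ∃ t : ℝ, 0 < t ∧ ∀ e : ℝ, |e| ≤ t → n + e • (n - n') ∈ Q := by
    intro n hn n' hn' hA
    rw [hQ] at hn hn'
    have : ∀ s ∈ S, ∀ᶠ t in 𝓝[>] (0:ℝ), ∀ e : ℝ, |e| ≤ t → -1 ≤ ⟪n + e • (n - n'), s⟫ := by
      intro s hs
      by_cases h : ⟪n, s⟫ = -1
      · refine Eventually.of_forall fun t e _ => ?_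
        rw [inner_add_left, inner_smul_left, inner_sub_left, h, hA s hs h]; simp
      · have h1 : -1 < ⟪n, s⟫ := lt_of_le_of_ne (hn s hs) (Ne.symm h)
        have h2 : Tendsto (fun t : ℝ => t * |⟪n - n', s⟫|) (𝓝[>] 0) (𝓝 (0 * |⟪n - n', s⟫|)) :=
          tendsto_nhdsWithin_of_tendsto_nhds ((continuous_id.mul continuous_const).tendsto 0)
        rw [zero_mul] at h2
        filter_upwards [h2.eventually (gt_mem_nhds (show (0:ℝ) < ⟪n, s⟫ + 1 by linarith))] with t ht e he
        rw [inner_add_left, inner_smul_left]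
        have h3 : |e * ⟪n - n', s⟫| ≤ t * |⟪n - n', s⟫| := by rw [abs_mul]; gcongr
        have h4 := neg_abs_le (e * ⟪n - n', s⟫)
        simp only [conj_trivial]
        linarith
    have := ((Filter.eventually_all_finset S).2 this).and self_mem_nhdsWithin
    obtain ⟨t, ht, ht0⟩ := this.exists
    exact ⟨t, ht0, fun e he => by rw [hQ]; exact fun s hs => ht s hs e he⟩
  refine Set.Finite.of_finite_image (f := fun n => S.filter fun s => ⟪n, s⟫ = -1) ((S.powerset.finite_toSet).subset (by rintro _ ⟨n, _, rfl⟩; exact Finset.mem_coe.2 (Finset.mem_powerset.2 (Finset.filter_subset _ _)))) ?_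
  intro n hn n' hn' h
  have hA : ∀ s ∈ S, ⟪n, s⟫ = -1 → ⟪n', s⟫ = -1 := fun s hs hns => by
    have : s ∈ S.filter fun s => ⟪n, s⟫ = -1 := Finset.mem_filter.2 ⟨hs, hns⟩
    rw [show (S.filter fun s => ⟪n, s⟫ = -1) = S.filter fun s => ⟪n', s⟫ = -1 from h] at this
    exact (Finset.mem_filter.1 this).2
  obtain ⟨t, ht, htQ⟩ := key n hn.1 n' hn'.1 hA
  have h1 := htQ t (abs_of_pos ht).le
  have h2 := htQ (-t) (by rw [abs_neg, abs_of_pos ht])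
  have h3 := hn.2 h1 h2 ⟨1/2, 1/2, by norm_num, by norm_num, by norm_num, by module⟩
  have h4 : t • (n - n') = 0 := by simpa using h3
  exact sub_eq_zero.1 ((smul_eq_zero.1 h4).resolve_left ht.ne')

theorem hrep_exists {D : Set E3} (hD : IsConvexPolyhedron D) (hne : D.Nonempty) : Nonempty (HRep D) := by
  classical
  obtain ⟨hDo, hDb, hDc, S, hS⟩ := hD
  obtain ⟨p, hp⟩ := hne
  set S' : Finset E3 := S.image fun s => s - p
  set Q : Set E3 := {n | ∀ s ∈ S', -1 ≤ ⟪n, s⟫} with hQ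
  have hQ2 : ∀ n, n ∈ Q ↔ ∀ s ∈ S, -1 ≤ ⟪n, s - p⟫ := fun n => by simp [hQ, S']
  have hQc : ∀ n ∈ Q, ∀ y ∈ convexHull ℝ (S : Set E3), -1 ≤ ⟪n, y - p⟫ := fun n hn => by
    have hcv : Convex ℝ {y : E3 | -1 ≤ ⟪n, y - p⟫} := by
      have : {y : E3 | -1 ≤ ⟪n, y - p⟫} = {y | -1 + ⟪n, p⟫ ≤ innerₗ E3 n y} := by
        ext y; simp only [mem_ofPred_eq, inner_sub_right, innerₗ_apply_apply]; constructor <;> intro h <;> linarith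
      rw [this]; exact convex_halfSpace_ge (innerₗ E3 n).isLinear _
    exact convexHull_min (fun s hs => (hQ2 n).1 hn s hs) hcv
  obtain ⟨ε, hε, hball⟩ := Metric.isOpen_iff.1 hDo p hp
  have hDS : D ⊆ convexHull ℝ (S : Set E3) := hS ▸ interior_subset
  have hSD : convexHull ℝ (S : Set E3) ⊆ closure D := by
    have hcv := convex_convexHull ℝ (S : Set E3)
    rw [hS, hcv.closure_interior_eq_closure_of_nonempty_interior ⟨p, hS ▸ hp⟩]
    exact subset_closure
  have hmove : ∀ n : E3, ∀ z ∈ D, ∃ t : ℝ, 0 < t ∧ z - t • n ∈ D := fun n z hz => by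
    have : Tendsto (fun t : ℝ => z - t • n) (𝓝[>] 0) (𝓝 (z - (0:ℝ) • n)) :=
      tendsto_nhdsWithin_of_tendsto_nhds ((continuous_const.sub (continuous_id.smul continuous_const)).tendsto 0)
    rw [zero_smul, sub_zero] at this
    obtain ⟨t, ht, ht0⟩ := ((this.eventually (hDo.mem_nhds hz)).and self_mem_nhdsWithin).exists
    exact ⟨t, ht0, ht⟩
  have hQb : Q ⊆ closedBall 0 (2 / ε) := fun n hn => by
    rw [mem_closedBall_zero_iff]
    by_cases h0 : n = 0
    · rw [h0, norm_zero]; positivity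
    have hn0 : 0 < ‖n‖ := norm_pos_iff.2 h0
    have := hQc n hn (p - (ε / 2 / ‖n‖) • n) (hDS (hball (by
      rw [mem_ball, dist_eq_norm, sub_sub_cancel_left, norm_neg, norm_smul, Real.norm_of_nonneg (by positivity), div_mul_cancel₀ _ hn0.ne']; linarith)))
    rw [sub_sub_cancel_left, inner_neg_right, inner_smul_right, real_inner_self_eq_norm_sq] at this
    rw [le_div_iff₀ hε]
    have h2 : ε / 2 / ‖n‖ * ‖n‖ ^ 2 = ε / 2 * ‖n‖ := by field_simp
    rw [h2] at this; linarith
  have hQcl : IsClosed Q := by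
    rw [hQ]; simp only [ofPred_forall]
    exact isClosed_iInter fun s => isClosed_iInter fun _ => isClosed_le continuous_const (by fun_prop)
  have hQcv : Convex ℝ Q := by
    rw [hQ]; simp only [ofPred_forall]
    refine convex_iInter fun s => convex_iInter fun _ => ?_
    have : {n : E3 | -1 ≤ ⟪n, s⟫} = {n | -1 ≤ innerₗ E3 s n} := by ext n; simp [real_inner_comm]
    rw [this]; exact convex_halfSpace_ge (innerₗ E3 s).isLinear _
  have hQk : IsCompact Q := (isCompact_closedBall _ _).of_isClosed_subset hQcl hQb
  have hfin := ext_finite S' Q hQ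
  have hKM := closure_convexHull_extremePoints hQk hQcv
  rw [(hfin.isClosed_convexHull ℝ).closure_eq] at hKM
  have hin : ∀ z ∈ D, ∀ n ∈ Q, -1 < ⟪n, z - p⟫ := fun z hz n hn => by
    obtain ⟨t, ht, htD⟩ := hmove n z hz
    have := hQc n hn _ (hDS htD)
    by_cases h0 : n = 0
    · rw [h0, inner_zero_left]; norm_num
    rw [sub_right_comm, inner_sub_right, inner_smul_right, real_inner_self_eq_norm_sq] at this
    have : 0 < t * ‖n‖ ^ 2 := mul_pos ht (pow_pos (norm_pos_iff.2 h0) 2)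
    linarith
  have hout : ∀ z, (∀ n ∈ Q.extremePoints ℝ, -1 < ⟪n, z - p⟫) → z ∈ D := fun z hz => by
    by_contra hzD
    obtain ⟨f, hf⟩ := geometric_hahn_banach_open_point hDc hDo hzD
    obtain ⟨m, rfl⟩ := (InnerProductSpace.toDual ℝ E3).surjective f
    simp only [InnerProductSpace.toDual_apply_apply] at hf
    have hd : 0 < ⟪m, z⟫ - ⟪m, p⟫ := by linarith [hf p hp]
    set n := (-(⟪m, z⟫ - ⟪m, p⟫)⁻¹) • m
    have hcl : ∀ y ∈ closure D, ⟪m, y⟫ ≤ ⟪m, z⟫ := fun y hy =>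
      closure_minimal (t := {y | ⟪m, y⟫ ≤ ⟪m, z⟫}) (fun y hy => (hf y hy).le) (isClosed_le (by fun_prop) continuous_const) hy
    have hnQ : n ∈ Q := (hQ2 n).2 fun s hs => by
      have := hcl s (hSD (subset_convexHull ℝ _ hs))
      rw [inner_smul_left, inner_sub_right]
      simp only [conj_trivial, neg_mul, neg_le_neg_iff]
      rw [inv_mul_le_one₀ hd]; linarith
    rw [← hKM] at hnQ
    have hsub : convexHull ℝ (Q.extremePoints ℝ) ⊆ {n | -1 < innerₗ E3 (z - p) n} :=
      convexHull_min (fun n hn => by rw [mem_ofPred_eq, innerₗ_apply_apply, real_inner_comm]; exact hz n hn) (convex_halfSpace_gt (innerₗ E3 _).isLinear _)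
    have := hsub hnQ
    simp only [mem_ofPred_eq, innerₗ_apply_apply] at this
    rw [real_inner_comm, inner_smul_left, inner_sub_right] at this
    simp only [conj_trivial, neg_mul, inv_mul_cancel₀ hd.ne'] at this
    exact lt_irrefl _ this
  set c : E3 → ℝ := fun m => sInf ((fun y => ⟪m, y⟫) '' D)
  have hbb : ∀ m : E3, BddBelow ((fun y => ⟪m, y⟫) '' D) := fun m => by
    obtain ⟨R, hR⟩ := hDb.exists_norm_le
    refine ⟨-(‖m‖ * R), ?_⟩
    rintro _ ⟨y, hy, rfl⟩
    have h1 := abs_le.1 (abs_real_inner_le_norm m y)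
    have h2 := mul_le_mul_of_nonneg_left (hR y hy) (norm_nonneg m)
    simp only; linarith
  set N : Finset E3 := (hfin.toFinset.filter fun n => n ≠ 0).image fun n => ‖n‖⁻¹ • n
  have hNu : ∀ m ∈ N, ‖m‖ = 1 := fun m hm => by
    obtain ⟨n, hn, rfl⟩ := Finset.mem_image.1 hm
    rw [norm_smul, norm_inv, norm_norm, inv_mul_cancel₀ (norm_ne_zero_iff.2 (Finset.mem_filter.1 hn).2)]
  have heq : D = {z | ∀ n ∈ N, c n < ⟪n, z⟫} := by
    ext z
    constructor
    · intro hz m hm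
      obtain ⟨t, ht, htD⟩ := hmove m z hz
      have := csInf_le (hbb m) ⟨_, htD, rfl⟩
      simp only [inner_sub_right, inner_smul_right, real_inner_self_eq_norm_sq, hNu m hm] at this
      simp only [c]; linarith
    · intro hz
      refine hout z fun n hn => ?_
      by_cases h0 : n = 0
      · rw [h0, inner_zero_left]; norm_num
      have hn0 : 0 < ‖n‖ := norm_pos_iff.2 h0
      have h1 := hz (‖n‖⁻¹ • n) (Finset.mem_image.2 ⟨n, Finset.mem_filter.2 ⟨hfin.mem_toFinset.2 hn, h0⟩, rfl⟩)
      have h2 : ‖n‖⁻¹ * (⟪n, p⟫ - 1) ≤ c (‖n‖⁻¹ • n) := by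
        refine le_csInf ⟨_, p, hp, rfl⟩ ?_
        rintro _ ⟨y, hy, rfl⟩
        have := hin y hy n hn.1
        rw [inner_sub_right] at this
        simp only [inner_smul_left, conj_trivial]
        gcongr; linarith
      have h3 := h2.trans_lt h1
      rw [inner_smul_left, conj_trivial, mul_lt_mul_iff_right₀ (inv_pos.2 hn0)] at h3
      rw [inner_sub_right]; linarith
  refine ⟨N, c, hNu, heq, hDb, ⟨p, hp⟩, ?_⟩
  by_contra hoff
  obtain ⟨e, he1, he⟩ : ∃ e : E3, ‖e‖ = 1 ∧ ∀ n ∈ N, n = e := by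
    rcases N.eq_empty_or_nonempty with h | ⟨e, he⟩
    · exact ⟨be 0, by simp, by simp [h]⟩
    · refine ⟨e, hNu e he, fun n hn => ?_⟩
      by_contra hne
      exact hoff ⟨(n, e), Finset.mem_offDiag.2 ⟨hn, he, hne⟩⟩
  obtain ⟨R, hR⟩ := hDb.exists_norm_le
  have hR0 : 0 ≤ R := (norm_nonneg p).trans (hR p hp)
  have hmem : p + (2 * R + 1) • e ∈ D := by
    rw [heq]
    intro n hn
    have hpn : c n < ⟪n, p⟫ := by
      have h := hp
      rw [heq] at h; exact h n hn
    rw [he n hn] at hpn ⊢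
    rw [inner_add_right, inner_smul_right, real_inner_self_eq_norm_sq, he1]
    linarith
  have h1 := hR _ hmem
  have h2 : ‖(2 * R + 1) • e‖ ≤ ‖p + (2 * R + 1) • e‖ + ‖p‖ := by
    have := norm_sub_le (p + (2 * R + 1) • e) p
    rwa [add_sub_cancel_left] at this
  rw [norm_smul, he1, Real.norm_of_nonneg (by linarith)] at h2
  have := hR p hp
  linarith

section
theorem pull_int {M : Matrix (Fin 3) (Fin 3) ℝ} (hM : M.det ≠ 0) {g : (Fin 3 → ℝ) → ℝ} (hg : Integrable g) :
    Integrable fun z : E3 => g (M.toLin' z.ofLp) := by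
  have h1 := Real.map_matrix_volume_pi_eq_smul_volume_pi hM
  have hm : Measurable (Matrix.toLin' M) := (LinearMap.continuous_of_finiteDimensional _).measurable
  have h2 : Integrable g (Measure.map (Matrix.toLin' M) volume) := by
    rw [h1]; exact hg.smul_measure ENNReal.ofReal_ne_top
  have h3 := (integrable_map_measure h2.1 hm.aemeasurable).1 h2
  have := PiLp.volume_preserving_ofLp (Fin 3)
  rw [← this.map_eq] at h3
  exact (integrable_map_measure h3.1 this.measurable.aemeasurable).1 h3

theorem pair_int {D : Set E3} (hDm : MeasurableSet D) (hDb : Bornology.IsBounded D) {n m : E3} (hn : ‖n‖ = 1) (hm : ‖m‖ = 1) (h1 : n ≠ m) (h2 : n ≠ -m)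
    {a b L s : ℝ} (hs : s < 1) (ha : ∀ z ∈ D, ⟪n, z⟫ + a ∈ Ioc 0 L) (hb : ∀ z ∈ D, ⟪m, z⟫ + b ∈ Ioc 0 L) :
    IntegrableOn (fun z => (⟪n, z⟫ + a) ^ (-s) * (⟪m, z⟫ + b) ^ (-s)) D := by
  set k : Fin 3 → ℝ := ![n 1 * m 2 - n 2 * m 1, n 2 * m 0 - n 0 * m 2, n 0 * m 1 - n 1 * m 0]
  set M : Matrix (Fin 3) (Fin 3) ℝ := !![n 0, n 1, n 2; m 0, m 1, m 2; k 0, k 1, k 2]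
  have en : ∀ x y : E3, ⟪x, y⟫ = x 0 * y 0 + x 1 * y 1 + x 2 * y 2 := fun x y => by
    rw [EuclideanSpace.inner_eq_star_dotProduct]; simp [dotProduct, Fin.sum_univ_three]; ring
  have hdet : M.det ≠ 0 := by
    have e1 : ⟪n, n⟫ = 1 := by rw [real_inner_self_eq_norm_sq, hn]; norm_num
    have e2 : ⟪m, m⟫ = 1 := by rw [real_inner_self_eq_norm_sq, hm]; norm_num
    have hd : M.det = ⟪n, n⟫ * ⟪m, m⟫ - ⟪n, m⟫ ^ 2 := by
      rw [en, en, en, Matrix.det_fin_three]; simp [M, k]; ring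
    rw [hd, e1, e2]
    intro h
    have h3 : (⟪n, m⟫ - 1) * (⟪n, m⟫ + 1) = 0 := by linarith
    rcases mul_eq_zero.1 h3 with h | h
    · exact h1 ((inner_eq_one_iff_of_norm_eq_one (𝕜 := ℝ) hn hm).1 (by linarith))
    · exact h2 ((inner_eq_neg_one_iff_of_norm_eq_one (𝕜 := ℝ) hn hm).1 (by linarith))
  set φ : ℝ → ℝ := (Ioc 0 L).indicator fun t => t ^ (-s)
  have hφ : Integrable φ := by
    refine IntegrableOn.integrable_indicator ?_ measurableSet_Ioc
    rcases le_or_gt 0 L with hL | hL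
    · exact (intervalIntegrable_iff_integrableOn_Ioc_of_le hL).1 (intervalIntegral.intervalIntegrable_rpow' (by linarith))
    · rw [Ioc_eq_empty (by linarith)]; exact integrableOn_empty
  set K : E3 := WithLp.toLp 2 k
  obtain ⟨R, hR⟩ := hDb.exists_norm_le
  have hKR : ∀ z ∈ D, ⟪K, z⟫ ∈ Icc (-(‖K‖ * R)) (‖K‖ * R) := fun z hz =>
    abs_le.1 ((abs_real_inner_le_norm _ _).trans (mul_le_mul_of_nonneg_left (hR z hz) (norm_nonneg _)))
  set ψ : ℝ → ℝ := (Icc (-(‖K‖ * R)) (‖K‖ * R)).indicator fun _ => 1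
  have hψ : Integrable ψ := IntegrableOn.integrable_indicator (by simp) measurableSet_Icc
  have hg := Integrable.fintype_prod (μ := fun _ : Fin 3 => (volume : Measure ℝ)) (f := ![fun t => φ (t + a), fun t => φ (t + b), ψ]) (fun i => by
    fin_cases i
    · exact hφ.comp_add_right a
    · exact hφ.comp_add_right b
    · exact hψ)
  have hI := pull_int hdet hg
  refine hI.integrableOn.congr_fun (s := D) (fun z hz => ?_) hDm
  have c0 : (Matrix.toLin' M) z.ofLp 0 = ⟪n, z⟫ := by
    rw [en]; simp [M, Matrix.toLin'_apply, Matrix.mulVec, dotProduct, Fin.sum_univ_three]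
  have c1 : (Matrix.toLin' M) z.ofLp 1 = ⟪m, z⟫ := by
    rw [en]; simp [M, Matrix.toLin'_apply, Matrix.mulVec, dotProduct, Fin.sum_univ_three]
  have c2 : (Matrix.toLin' M) z.ofLp 2 = ⟪K, z⟫ := by
    rw [en]; simp [M, K, Matrix.toLin'_apply, Matrix.mulVec, dotProduct, Fin.sum_univ_three]
  simp only [Fin.prod_univ_three, Matrix.cons_val_zero, Matrix.cons_val_one, Matrix.cons_val, c0, c1, c2]
  simp only [φ, ψ]
  rw [indicator_of_mem (ha z hz), indicator_of_mem (hb z hz), indicator_of_mem (hKR z hz), mul_one]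

namespace HRep
variable {D : Set E3} (H : HRep D)

theorem rho_int {q : ℝ} (hq0 : 0 ≤ q) (hq : q < 2) : IntegrableOn (fun z => H.rho z ^ (-q)) D := by
  classical
  obtain ⟨L, hL0, hL⟩ := H.exists_L
  have hDm := H.isOpen.measurableSet
  have hI : ∀ n ∈ H.N, ∀ z ∈ D, ⟪n, z⟫ + -H.c n ∈ Ioc 0 L := fun n hn z hz => ⟨H.mem_iff.1 hz n hn, hL z (subset_closure hz) n hn⟩
  have hfin : IntegrableOn (fun _ : E3 => (1:ℝ)) D := int_cont H.bdd continuous_const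
  have hpair : ∀ p ∈ H.N.offDiag, ∃ f : E3 → ℝ, IntegrableOn f D ∧ ∀ z ∈ D, max (H.ell p.1 z) (H.ell p.2 z) ^ (-q) ≤ f z := by
    intro p hp
    obtain ⟨h1, h2, h3⟩ := Finset.mem_offDiag.1 hp
    by_cases hneg : p.1 = -p.2
    · obtain ⟨z0, hz0⟩ := H.ne
      set w := (H.ell p.1 z0 + H.ell p.2 z0) / 2
      have hw : 0 < w := half_pos (add_pos (H.mem_iff.1 hz0 _ h1) (H.mem_iff.1 hz0 _ h2))
      refine ⟨fun _ => w ^ (-q) * 1, hfin.const_mul _, fun z hz => ?_⟩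
      rw [mul_one]
      refine Real.rpow_le_rpow_of_nonpos hw ?_ (by linarith)
      have : H.ell p.1 z + H.ell p.2 z = 2 * w := by
        simp only [w, ell, hneg, inner_neg_left]; ring
      have := le_max_left (H.ell p.1 z) (H.ell p.2 z)
      have := le_max_right (H.ell p.1 z) (H.ell p.2 z)
      linarith
    · refine ⟨_, pair_int hDm H.bdd (H.unit _ h1) (H.unit _ h2) h3 hneg (show q / 2 < 1 by linarith) (hI _ h1) (hI _ h2), fun z hz => ?_⟩
      have a1 := (hI _ h1 z hz).1
      have a2 := (hI _ h2 z hz).1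
      change max (⟪p.1, z⟫ + -H.c p.1) (⟪p.2, z⟫ + -H.c p.2) ^ (-q) ≤ _
      have am : 0 < max (⟪p.1, z⟫ + -H.c p.1) (⟪p.2, z⟫ + -H.c p.2) := lt_max_of_lt_left a1
      rw [show -q = -(q/2) + -(q/2) by ring, Real.rpow_add am]
      exact mul_le_mul (Real.rpow_le_rpow_of_nonpos a1 (le_max_left _ _) (by linarith)) (Real.rpow_le_rpow_of_nonpos a2 (le_max_right _ _) (by linarith)) (by positivity) (by positivity)
  choose! f hf hfb using hpair
  have hsum : IntegrableOn (fun z => ∑ p ∈ H.N.offDiag, f p z) D := integrable_finsetSum _ hf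
  refine Integrable.mono' hsum (H.crho.measurable.pow_const _).aestronglyMeasurable ?_
  refine (ae_restrict_iff' hDm).2 (Eventually.of_forall fun z hz => ?_)
  rw [Real.norm_of_nonneg (Real.rpow_nonneg (H.rho_pos hz).le _)]
  obtain ⟨p, hp, he⟩ := Finset.exists_mem_eq_inf' H.off (fun p => max (H.ell p.1 z) (H.ell p.2 z))
  change H.rho z = _ at he
  rw [he]
  refine (hfb p hp z hz).trans (Finset.single_le_sum (f := fun p => f p z) (fun p hp => ?_) hp)
  obtain ⟨h1, h2, h3⟩ := Finset.mem_offDiag.1 hp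
  exact (Real.rpow_nonneg (le_max_of_le_left (H.mem_iff.1 hz _ h1).le) _).trans (hfb p hp z hz)
end HRep
end

def evL : MvPolynomial (Fin 3) ℝ →ₗ[ℝ] (E3 → ℝ) where
  toFun P := fun x => MvPolynomial.eval (fun i => x i) P
  map_add' _ _ := by ext; simp
  map_smul' _ _ := by ext; simp [MvPolynomial.smul_eval]

def PP (r : ℕ) : Submodule ℝ (E3 → ℝ) := (MvPolynomial.restrictTotalDegree (Fin 3) ℝ r).map evL

instance (r : ℕ) : Module.Finite ℝ (PP r) := by unfold PP; infer_instance

theorem PP_iff {r : ℕ} {f : E3 → ℝ} : f ∈ PP r ↔ ∃ P : MvPolynomial (Fin 3) ℝ,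
    P.totalDegree ≤ r ∧ ∀ x : E3, f x = MvPolynomial.eval (fun i => x i) P := by
  simp only [PP, Submodule.mem_map, MvPolynomial.mem_restrictTotalDegree]
  exact ⟨fun ⟨P, h, e⟩ => ⟨P, h, fun x => by rw [← e]; rfl⟩, fun ⟨P, h, e⟩ => ⟨P, h, by ext x; rw [e]; rfl⟩⟩

theorem PP_mono {a b : ℕ} (h : a ≤ b) : PP a ≤ PP b := fun f hf => by
  obtain ⟨P, h1, h2⟩ := PP_iff.1 hf
  exact PP_iff.2 ⟨P, h1.trans h, h2⟩

theorem PP_const (r : ℕ) (a : ℝ) : (fun _ => a) ∈ PP r :=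
  PP_iff.2 ⟨MvPolynomial.C a, by simp, by simp⟩

theorem PP_mul {a b : ℕ} {f g : E3 → ℝ} (hf : f ∈ PP a) (hg : g ∈ PP b) :
    (fun x => f x * g x) ∈ PP (a + b) := by
  obtain ⟨P, h1, h2⟩ := PP_iff.1 hf
  obtain ⟨Q, h3, h4⟩ := PP_iff.1 hg
  exact PP_iff.2 ⟨P * Q, (MvPolynomial.totalDegree_mul _ _).trans (by lia), fun x => by simp [h2, h4]⟩

theorem PP_prod {ι : Type*} (s : Finset ι) (a : ι → ℕ) (f : ι → E3 → ℝ) (h : ∀ i ∈ s, f i ∈ PP (a i)) :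
    (fun x => ∏ i ∈ s, f i x) ∈ PP (∑ i ∈ s, a i) := by
  classical
  induction s using Finset.induction_on with
  | empty => simpa using PP_const 0 1
  | insert j s hj ih =>
    simp only [Finset.prod_insert hj, Finset.sum_insert hj]
    exact PP_mul (h j (by simp)) (ih fun i hi => h i (by simp [hi]))

theorem PP_sum {ι : Type*} (s : Finset ι) (r : ℕ) (f : ι → E3 → ℝ) (h : ∀ i ∈ s, f i ∈ PP r) :
    (fun x => ∑ i ∈ s, f i x) ∈ PP r := by
  have := Submodule.sum_mem (PP r) h
  convert this using 1; ext x; simp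

theorem PP_coord (i : Fin 3) : (fun x : E3 => x i) ∈ PP 1 :=
  PP_iff.2 ⟨MvPolynomial.X i, by simp, by simp⟩

theorem PP_lin (l : E3 →ₗ[ℝ] ℝ) : (fun x => l x) ∈ PP 1 := by
  have : (fun x => l x) = fun x : E3 => ∑ i, l (be i) * x i := by
    ext x
    conv_lhs => rw [← (EuclideanSpace.basisFun (Fin 3) ℝ).sum_repr x]
    simp [map_sum, be, mul_comm]
  rw [this]
  exact PP_sum _ _ _ fun i _ => (PP 1).smul_mem (l (be i)) (PP_coord i)

theorem PP_aff (l : E3 →ᵃ[ℝ] ℝ) : (fun x => l x) ∈ PP 1 := by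
  have : (fun x => l x) = (fun x => l.linear x) + fun _ => l 0 := by
    ext x; have := congrFun (AffineMap.decomp l) x; simpa using this
  rw [this]; exact (PP 1).add_mem (PP_lin _) (PP_const _ _)

theorem PP_comp {r : ℕ} {f : E3 → ℝ} (hf : f ∈ PP r) (x : E3) (h : ℝ) :
    (fun z => f (x + h • z)) ∈ PP r := by
  obtain ⟨P, h1, h2⟩ := PP_iff.1 hf
  have : (fun z => f (x + h • z)) = fun z : E3 => ∑ d ∈ P.support, P.coeff d * ∏ i : Fin 3, (x i + h * z i) ^ d i := by
    ext z; rw [h2, MvPolynomial.eval_eq']; simp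
  rw [this]
  refine PP_sum _ _ _ fun d hd => (PP r).smul_mem (P.coeff d) ?_
  have h3 := PP_prod Finset.univ d (fun i (z : E3) => (x i + h * z i) ^ d i) fun i _ => by
    have := PP_prod (Finset.range (d i)) (fun _ => 1) (fun _ (z : E3) => x i + h * z i) fun _ _ =>
      (PP 1).add_mem (PP_const 1 (x i)) ((PP 1).smul_mem h (PP_coord i))
    simpa using this
  refine PP_mono ?_ h3
  have := MvPolynomial.le_totalDegree hd
  rw [Finsupp.sum_fintype _ _ (by simp)] at this
  exact this.trans h1

theorem PP_an {r : ℕ} {f : E3 → ℝ} (hf : f ∈ PP r) : AnalyticOnNhd ℝ f univ := by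
  obtain ⟨P, h1, h2⟩ := PP_iff.1 hf
  have := AnalyticOnNhd.aeval_mvPolynomial (𝕜 := ℝ) (f := fun (x : E3) i => x i) (s := univ)
    (fun i => (EuclideanSpace.proj (𝕜 := ℝ) i : E3 →L[ℝ] ℝ).analyticOnNhd univ) P
  have e : f = fun x : E3 => MvPolynomial.aeval (fun i => x i) P := by
    ext x; rw [h2]; simp [MvPolynomial.aeval_eq_eval]
  rw [e]; exact this

theorem PP_smooth {r : ℕ} {f : E3 → ℝ} (hf : f ∈ PP r) {n : WithTop ℕ∞} : ContDiff ℝ n f :=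
  contDiffOn_univ.1 (PP_an hf).contDiffOn_of_completeSpace

theorem PP_zero {r : ℕ} {f : E3 → ℝ} (hf : f ∈ PP r) {x : E3} {s : ℝ} (hs : 0 < s)
    (h : ∀ y ∈ closedBall x s, f y = 0) : f = 0 := by
  have := (PP_an hf).eqOn_zero_of_preconnected_of_eventuallyEq_zero isPreconnected_univ (mem_univ x)
    (by filter_upwards [closedBall_mem_nhds x hs] with y hy using h y hy)
  ext y; exact this (mem_univ y)

theorem PP_fd {r : ℕ} {f : E3 → ℝ} (hf : f ∈ PP r) (v : E3) : (fun z => fderiv ℝ f z v) ∈ PP r := by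
  have hcl : IsClosed (PP r : Set (E3 → ℝ)) := (PP r).closed_of_finiteDimensional
  have ht : Tendsto (fun (t : ℝ) (z : E3) => t⁻¹ * (f (z + t • v) - f z)) (𝓝[≠] 0) (𝓝 fun z => fderiv ℝ f z v) := by
    rw [tendsto_pi_nhds]; intro z
    have := ((PP_smooth hf (n := 1)).differentiable one_ne_zero z).hasFDerivAt.hasLineDerivAt v
    simpa using this.tendsto_slope_zero
  refine hcl.mem_of_tendsto ht (Eventually.of_forall fun t => ?_)
  have h1 := PP_comp hf (t • v) 1
  have := (PP r).smul_mem t⁻¹ ((PP r).sub_mem h1 hf)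
  have e : (fun z : E3 => t⁻¹ * (f (z + t • v) - f z)) = t⁻¹ • ((fun z => f (t • v + (1 : ℝ) • z)) - f) := by
    ext z; simp [add_comm]
  show _ ∈ PP r
  rw [e]; exact this

def evC (r : ℕ) (s : ℝ) : PP r →ₗ[ℝ] C(closedBall (0 : E3) s, ℝ) where
  toFun p := ⟨fun z => p.1 z, (PP_smooth p.2 (n := 0)).continuous.comp continuous_subtype_val⟩
  map_add' _ _ := by ext; simp
  map_smul' _ _ := by ext; simp

def dP (r : ℕ) (v : E3) : PP r →ₗ[ℝ] PP r where
  toFun p := ⟨fun z => fderiv ℝ p.1 z v, PP_fd p.2 v⟩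
  map_add' p q := by
    ext z
    have h := fderiv_add ((PP_smooth p.2 (n := 1)).differentiable one_ne_zero z)
      ((PP_smooth q.2 (n := 1)).differentiable one_ne_zero z)
    show fderiv ℝ (p.1 + q.1) z v = _
    rw [h]; rfl
  map_smul' a p := by
    ext z
    have h := fderiv_const_smul ((PP_smooth p.2 (n := 1)).differentiable one_ne_zero z) a
    show fderiv ℝ (a • p.1) z v = _
    rw [h]; rfl

theorem fin_bd {F G : Type*} [NormedAddCommGroup F] [NormedSpace ℝ F] [FiniteDimensional ℝ F] [NormedAddCommGroup G]
    [NormedSpace ℝ G] (φ : F →ₗ[ℝ] G) : ∃ C, 0 < C ∧ ∀ x, ‖φ x‖ ≤ C * ‖x‖ :=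
  ⟨‖LinearMap.toContinuousLinearMap φ‖ + 1, by positivity, fun x =>
    ((LinearMap.toContinuousLinearMap φ).le_opNorm x).trans (by gcongr; linarith)⟩

theorem evC_bd (r : ℕ) {s t : ℝ} (hs : 0 < s) (A : PP r →ₗ[ℝ] PP r) :
    ∃ C, 0 < C ∧ ∀ p : PP r, ‖evC r t (A p)‖ ≤ C * ‖evC r s p‖ := by
  have hi : Function.Injective (evC r s) := by
    rw [injective_iff_map_eq_zero]
    intro p hp
    ext1
    refine PP_zero p.2 (x := 0) hs fun y hy => ?_
    exact congrArg (fun g => g ⟨y, hy⟩) hp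
  let e := LinearEquiv.ofInjective (evC r s) hi
  obtain ⟨C, hC, H⟩ := fin_bd (F := ↥(LinearMap.range (evC r s))) (G := C(closedBall (0 : E3) t, ℝ)) ((evC r t).comp (A.comp e.symm.toLinearMap))
  refine ⟨C, hC, fun p => ?_⟩
  have := H (e p)
  simp only [LinearMap.comp_apply, LinearEquiv.coe_coe, LinearEquiv.symm_apply_apply] at this
  exact this

theorem evC_ap {r : ℕ} {s : ℝ} (p : PP r) {z : E3} (hz : z ∈ closedBall 0 s) : |p.1 z| ≤ ‖evC r s p‖ :=
  (evC r s p).norm_coe_le_norm ⟨z, hz⟩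

theorem fd_le {f : E3 → ℝ} {z : E3} {A : ℝ} (h : ∀ i, |fderiv ℝ f z (be i)| ≤ A) : ‖fderiv ℝ f z‖ ≤ 2 * A := by
  have hA : 0 ≤ A := (abs_nonneg _).trans (h 0)
  rw [← norm_grad]
  refine abs_le_of_sq_le_sq' ?_ (by positivity) |>.2
  rw [← real_inner_self_eq_norm_sq, inner_grad]
  have : ∀ i, fderiv ℝ f z (be i) * fderiv ℝ f z (be i) ≤ A ^ 2 := fun i => by
    rw [← abs_mul_abs_self, ← sq]; exact pow_le_pow_left₀ (abs_nonneg _) (h i) 2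
  simp only [Fin.sum_univ_three]
  nlinarith [this 0, this 1, this 2]

theorem peak0 (r : ℕ) {c : ℝ} (hc : 0 < c) : ∃ C, 0 < C ∧ ∀ p ∈ PP r, ∃ x' ∈ closedBall (0 : E3) (c / 2),
    ∀ z ∈ closedBall (0 : E3) 1, |p z| ≤ C * |p x'| ∧ ‖fderiv ℝ p z‖ ≤ C * |p x'| ∧ |lap p z| ≤ C * |p x'| := by
  obtain ⟨C0, h0, H0⟩ := evC_bd r (t := 1) (half_pos hc) LinearMap.id
  choose C1 h1 H1 using fun i : Fin 3 => evC_bd r (t := 1) (half_pos hc) (dP r (be i))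
  choose C2 h2 H2 using fun i : Fin 3 => evC_bd r (t := 1) (half_pos hc) ((dP r (be i)).comp (dP r (be i)))
  have hs1 : ∀ i, C1 i ≤ ∑ j, C1 j := fun i => Finset.single_le_sum (fun j _ => (h1 j).le) (Finset.mem_univ i)
  have p1 : 0 ≤ ∑ j, C1 j := Finset.sum_nonneg fun j _ => (h1 j).le
  have p2 : 0 ≤ ∑ j, C2 j := Finset.sum_nonneg fun j _ => (h2 j).le
  refine ⟨C0 + 2 * ∑ i, C1 i + ∑ i, C2 i, by positivity, fun p hp => ?_⟩
  obtain ⟨x', hx', hm⟩ := (isCompact_closedBall (0 : E3) (c / 2)).exists_isMaxOn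
    ⟨0, by simpa using (half_pos hc).le⟩ (f := fun z => |p z|) (PP_smooth hp (n := 0)).continuous.abs.continuousOn
  refine ⟨x', hx', fun z hz => ?_⟩
  have hM : ‖evC r (c / 2) ⟨p, hp⟩‖ ≤ |p x'| :=
    (ContinuousMap.norm_le _ (abs_nonneg _)).2 fun y => hm y.2
  have n0 := abs_nonneg (p x')
  have a0 := (evC_ap ⟨p, hp⟩ hz).trans (H0 ⟨p, hp⟩)
  have a1 := fun i => (evC_ap (dP r (be i) ⟨p, hp⟩) hz).trans (H1 i ⟨p, hp⟩)
  have a2 := fun i => (evC_ap (((dP r (be i)).comp (dP r (be i))) ⟨p, hp⟩) hz).trans (H2 i ⟨p, hp⟩)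
  have b0 := a0.trans (mul_le_mul_of_nonneg_left hM h0.le)
  have b1 := fun i => (a1 i).trans (mul_le_mul_of_nonneg_left hM (h1 i).le)
  have b2 := fun i => (a2 i).trans (mul_le_mul_of_nonneg_left hM (h2 i).le)
  refine ⟨b0.trans (by gcongr; linarith), ?_, ?_⟩
  · refine (fd_le (A := (∑ i, C1 i) * |p x'|) fun i => (b1 i).trans (by gcongr; exact hs1 i)).trans ?_
    nlinarith [mul_nonneg h0.le n0, mul_nonneg p2 n0]
  · refine (Finset.abs_sum_le_sum_abs _ _).trans ((Finset.sum_le_sum fun i _ => b2 i).trans ?_)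
    rw [← Finset.sum_mul]
    gcongr; linarith

theorem peak (r : ℕ) {c : ℝ} (hc : 0 < c) (hc1 : c ≤ 1) {δ : ℝ} (hδ : 0 < δ) : ∃ ε C, 0 < ε ∧ ε ≤ c / 2 ∧ 0 < C ∧
    ∀ h, 0 < h → ∀ (x : E3), ∀ p ∈ PP r, ∃ x' ∈ closedBall x (c * h / 2),
    (∀ z ∈ closedBall x h, |p z| ≤ C * |p x'| ∧ ‖fderiv ℝ p z‖ ≤ C * h⁻¹ * |p x'| ∧ |lap p z| ≤ C * (h⁻¹) ^ 2 * |p x'|) ∧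
    ∀ z ∈ closedBall x' (ε * h), |p z - p x'| ≤ δ * |p x'| := by
  obtain ⟨C, hC, H⟩ := peak0 r hc
  refine ⟨min (c / 2) (δ / C), C, by positivity, min_le_left _ _, hC, fun h hh x p hp => ?_⟩
  obtain ⟨w, hw, hb⟩ := H _ (PP_comp hp x h)
  have cv : ∀ z : E3, x + h • (h⁻¹ • (z - x)) = z := fun z => by rw [smul_inv_smul₀ hh.ne']; abel
  have mb : ∀ z ∈ closedBall x h, h⁻¹ • (z - x) ∈ closedBall (0 : E3) 1 := fun z hz => by
    rw [mem_closedBall_iff_norm] at *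
    rw [sub_zero, norm_smul, norm_inv, Real.norm_of_nonneg hh.le, inv_mul_le_iff₀ hh]; linarith
  have fd : ∀ z : E3, fderiv ℝ p z = h⁻¹ • fderiv ℝ (fun z => p (x + h • z)) (h⁻¹ • (z - x)) := fun z => by
    have h1 : HasFDerivAt (fun z : E3 => x + h • z) (h • ContinuousLinearMap.id ℝ E3) (h⁻¹ • (z - x)) :=
      ((hasFDerivAt_id _).const_smul h).const_add x
    have h2 := ((PP_smooth hp (n := 1)).differentiable one_ne_zero (x + h • (h⁻¹ • (z - x)))).hasFDerivAt
    have h3 := (HasFDerivAt.comp (h⁻¹ • (z - x)) (g := p) (f := fun z : E3 => x + h • z) h2 h1).fderiv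
    rw [cv] at h3
    change fderiv ℝ (fun z => p (x + h • z)) _ = _ at h3
    rw [h3]; ext v; simp [hh.ne']
  have gb : ∀ z ∈ closedBall x h, ‖fderiv ℝ p z‖ ≤ C * h⁻¹ * |p (x + h • w)| := fun z hz => by
    rw [fd, norm_smul, norm_inv, Real.norm_of_nonneg hh.le]
    have := (hb _ (mb z hz)).2.1
    calc _ ≤ h⁻¹ * (C * |p (x + h • w)|) := by gcongr
      _ = _ := by ring
  have hwn : ‖h • w‖ ≤ c * h / 2 := by
    rw [norm_smul, Real.norm_of_nonneg hh.le]
    have : ‖w‖ ≤ c / 2 := by simpa using hw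
    nlinarith
  refine ⟨x + h • w, by simpa [mem_closedBall_iff_norm] using hwn, fun z hz => ⟨?_, gb z hz, ?_⟩, fun z hz => ?_⟩
  · have := (hb _ (mb z hz)).1
    rwa [cv] at this
  · have := (hb _ (mb z hz)).2.2
    have e := lap_comp_affine h (-(h⁻¹ • x)) (h⁻¹ • (z - x)) (PP_smooth hp (n := 2))
    have e1 : ∀ y : E3, h • (y - -(h⁻¹ • x)) = x + h • y := fun y => by
      rw [sub_neg_eq_add, smul_add, smul_inv_smul₀ hh.ne', add_comm]
    simp only [e1] at e
    rw [e, cv, abs_mul, abs_of_nonneg (by positivity)] at this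
    rw [show C * h⁻¹ ^ 2 * |p (x + h • w)| = h⁻¹ ^ 2 * (C * |p (x + h • w)|) by ring]
    rw [inv_pow, le_inv_mul_iff₀ (by positivity)]; exact this
  · have hm : min (c / 2) (δ / C) * h ≤ c / 2 * h := by gcongr; exact min_le_left _ _
    have hx'x : x + h • w ∈ closedBall x h := by
      rw [mem_closedBall_iff_norm, add_sub_cancel_left]; nlinarith
    rw [mem_closedBall_iff_norm] at hz
    have hzx : z ∈ closedBall x h := by
      rw [mem_closedBall_iff_norm]
      calc ‖z - x‖ = ‖(z - (x + h • w)) + h • w‖ := by congr 1; abel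
        _ ≤ _ := norm_add_le _ _
        _ ≤ h := by nlinarith
    have := (convex_closedBall x h).norm_image_sub_le_of_norm_fderiv_le (𝕜 := ℝ)
      (fun y _ => (PP_smooth hp (n := 1)).differentiable one_ne_zero y) gb hx'x hzx
    rw [Real.norm_eq_abs] at this
    refine this.trans ?_
    calc _ ≤ C * h⁻¹ * |p (x + h • w)| * (δ / C * h) := by
          gcongr; exact hz.trans (by gcongr; exact min_le_right _ _)
      _ = _ := by field_simp

section
def Lg (r a : ℕ) (t : ℝ) : ℝ := ∏ j ∈ Finset.range a, (r * t - j) / ((a : ℝ) - j)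

theorem Lg_zero {r a : ℕ} (ha : a ≠ 0) : Lg r a 0 = 0 :=
  Finset.prod_eq_zero (Finset.mem_range.2 (Nat.pos_of_ne_zero ha)) (by simp)

theorem Lg_lt {r a b : ℕ} (hr : r ≠ 0) (h : b < a) : Lg r a (b / r) = 0 :=
  Finset.prod_eq_zero (Finset.mem_range.2 h) (by rw [mul_div_cancel₀ _ (by exact_mod_cast hr)]; simp)

theorem Lg_self {r a : ℕ} (hr : r ≠ 0) : Lg r a (a / r) = 1 :=
  Finset.prod_eq_one fun j hj => by
    have hj : (j : ℝ) < a := by exact_mod_cast Finset.mem_range.1 hj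
    rw [mul_div_cancel₀ _ (by exact_mod_cast hr), div_self (by linarith)]

theorem Lg_bd {r a : ℕ} (h : a ≤ r) {t : ℝ} (h0 : 0 ≤ t) (h1 : t ≤ 1) : |Lg r a t| ≤ (r : ℝ) ^ a := by
  rw [Lg, Finset.abs_prod]
  refine (Finset.prod_le_prod (fun _ _ => abs_nonneg _) (g := fun _ => (r : ℝ)) fun j hj => ?_).trans (by simp)
  have hj := Finset.mem_range.1 hj
  have h2 : (j : ℝ) + 1 ≤ a := by exact_mod_cast hj
  have h3 : (a : ℝ) ≤ r := by exact_mod_cast h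
  have h4 : (0 : ℝ) ≤ j := by positivity
  rw [abs_div, abs_of_pos (a := (a : ℝ) - j) (by linarith), div_le_iff₀ (by linarith), abs_le]
  constructor <;> nlinarith

def nd (r : ℕ) (S : Finset E3) (α : E3 → ℕ) : E3 := ∑ p ∈ S, ((α p : ℝ) / r) • p

def JJ (r : ℕ) (S : Finset E3) (w : E3 → ℝ) (f : E3 → ℝ) : ℝ :=
  ∑ α ∈ S.piAntidiag r, f (nd r S α) * ∏ p ∈ S, Lg r (α p) (w p)

theorem JJ_sub {r : ℕ} {S V : Finset E3} (hS : S ⊆ V) {w : E3 → ℝ} (hw : ∀ p ∈ V, p ∉ S → w p = 0)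
    (f : E3 → ℝ) : JJ r V w f = JJ r S w f := by
  have hz : ∀ α ∈ S.piAntidiag r, ∀ p ∈ V, p ∉ S → α p = 0 := fun α hα p _ hpS => by
    by_contra h; exact hpS ((Finset.mem_piAntidiag.1 hα).2 p h)
  have h1 : JJ r S w f = ∑ α ∈ S.piAntidiag r, f (nd r V α) * ∏ p ∈ V, Lg r (α p) (w p) := by
    refine Finset.sum_congr rfl fun α hα => ?_
    congr 1
    · rw [nd, nd, Finset.sum_subset hS fun p hp hpS => by simp [hz α hα p hp hpS]]
    · exact Finset.prod_subset hS fun p hp hpS => by simp [hz α hα p hp hpS, Lg]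
  rw [h1]; symm
  refine Finset.sum_subset (fun α hα => ?_) fun α hα hn => ?_
  · rw [Finset.mem_piAntidiag] at *
    refine ⟨?_, fun p hp => hS (hα.2 p hp)⟩
    rw [← hα.1]; symm
    exact Finset.sum_subset hS fun p hp hpS => hz α (Finset.mem_piAntidiag.2 hα) p hp hpS
  · obtain ⟨h3, h4⟩ := Finset.mem_piAntidiag.1 hα
    have : ∃ p, α p ≠ 0 ∧ p ∉ S := by
      by_contra! hc
      refine hn (Finset.mem_piAntidiag.2 ⟨?_, hc⟩)
      rw [← h3]
      exact Finset.sum_subset hS fun p hp hpS => by by_contra h; exact hpS (hc p h)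
    obtain ⟨p, hp, hpS⟩ := this
    rw [Finset.prod_eq_zero (h4 p hp) (by rw [hw p (h4 p hp) hpS, Lg_zero hp]), mul_zero]

theorem JJ_congr {r : ℕ} {S : Finset E3} {w w' f g : E3 → ℝ} (hw : ∀ p ∈ S, w p = w' p)
    (hf : ∀ α ∈ S.piAntidiag r, f (nd r S α) = g (nd r S α)) : JJ r S w f = JJ r S w' g :=
  Finset.sum_congr rfl fun α hα => by
    rw [hf α hα]; congr 1; exact Finset.prod_congr rfl fun p hp => by rw [hw p hp]

theorem aff_sum (l : E3 →ᵃ[ℝ] ℝ) {S : Finset E3} {w : E3 → ℝ} (hw : ∑ p ∈ S, w p = 1) :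
    l (∑ p ∈ S, w p • p) = ∑ p ∈ S, w p * l p := by
  have e : ∀ x, l x = l.linear x + l 0 := fun x => by
    have := congrFun (AffineMap.decomp l) x; simpa using this
  have : ∑ p ∈ S, w p * l p = ∑ p ∈ S, (w p * l.linear p + w p * l 0) :=
    Finset.sum_congr rfl fun p _ => by rw [e p, mul_add]
  rw [e, this, Finset.sum_add_distrib, ← Finset.sum_mul, hw, one_mul]
  simp only [map_sum, map_smul, smul_eq_mul]

def vs (v : Fin 4 → E3) : Finset E3 := Finset.univ.image v

theorem tet_eq (v : Fin 4 → E3) : tet v = convexHull ℝ (vs v : Set E3) := by simp [tet, vs]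

def bas {v : Fin 4 → E3} (hv : AffineIndependent ℝ v) : AffineBasis (Fin 4) ℝ E3 :=
  ⟨v, hv, by rw [hv.affineSpan_eq_top_iff_card_eq_finrank_add_one]; simp⟩

def lamv {v : Fin 4 → E3} (hv : AffineIndependent ℝ v) (p : E3) : E3 →ᵃ[ℝ] ℝ :=
  ∑ i, if v i = p then (bas hv).coord i else 0

section
variable {v : Fin 4 → E3} (hv : AffineIndependent ℝ v)

theorem lamv_v (i : Fin 4) : lamv hv (v i) = (bas hv).coord i := by
  rw [lamv, Finset.sum_eq_single i (fun j _ hj => if_neg fun h => hj (hv.injective h)) (by simp), if_pos rfl]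

theorem sum_vs (hv : AffineIndependent ℝ v) {M : Type*} [AddCommMonoid M] (f : E3 → M) : ∑ p ∈ vs v, f p = ∑ i, f (v i) :=
  Finset.sum_image fun _ _ _ _ h => hv.injective h

theorem lamv_sum (x : E3) : ∑ p ∈ vs v, lamv hv p x = 1 := by
  rw [sum_vs hv]; simp only [lamv_v]; exact (bas hv).sum_coord_apply_eq_one x

theorem lamv_pt (x : E3) : ∑ p ∈ vs v, lamv hv p x • p = x := by
  rw [sum_vs hv]; simp only [lamv_v]; exact (bas hv).linear_combination_coord_eq_self x

theorem lamv_ap {p q : E3} (hp : p ∈ vs v) (hq : q ∈ vs v) : lamv hv p q = if q = p then 1 else 0 := by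
  obtain ⟨i, -, rfl⟩ := Finset.mem_image.1 hp
  obtain ⟨j, -, rfl⟩ := Finset.mem_image.1 hq
  rw [lamv_v]
  have : v j = (bas hv) j := rfl
  rw [this, AffineBasis.coord_apply, ← this]
  simp [hv.injective.eq_iff, eq_comm]

theorem lamv_comb {S : Finset E3} (hS : S ⊆ vs v) {w : E3 → ℝ} (hw : ∑ p ∈ S, w p = 1) {p : E3} (hp : p ∈ vs v) :
    lamv hv p (∑ q ∈ S, w q • q) = if p ∈ S then w p else 0 := by
  rw [aff_sum _ hw, Finset.sum_congr rfl fun q hq => by rw [lamv_ap hv hp (hS hq)]]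
  simp

theorem mem_tet {x : E3} : x ∈ tet v ↔ ∀ p ∈ vs v, 0 ≤ lamv hv p x := by
  rw [tet_eq, Finset.mem_convexHull']
  constructor
  · rintro ⟨w, h0, h1, rfl⟩ p hp
    rw [lamv_comb hv subset_rfl h1 hp, if_pos hp]; exact h0 p hp
  · exact fun h => ⟨fun p => lamv hv p x, h, lamv_sum hv x, lamv_pt hv x⟩

theorem lamv_le {x : E3} (hx : x ∈ tet v) {p : E3} (hp : p ∈ vs v) : lamv hv p x ≤ 1 := by
  rw [← lamv_sum hv x]
  exact Finset.single_le_sum (f := fun p => lamv hv p x) (fun q hq => (mem_tet hv).1 hx q hq) hp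

theorem nd_w {r : ℕ} (hr : r ≠ 0) {S : Finset E3} {α : E3 → ℕ} (hα : α ∈ S.piAntidiag r) :
    ∑ p ∈ S, ((α p : ℝ) / r) = 1 := by
  have := (Finset.mem_piAntidiag.1 hα).1
  rw [← Finset.sum_div, ← Nat.cast_sum]
  show ((S.sum α : ℕ) : ℝ) / r = 1
  rw [this, div_self (by exact_mod_cast hr)]

theorem nd_mem {r : ℕ} (hr : r ≠ 0) {S : Finset E3} {α : E3 → ℕ} (hα : α ∈ S.piAntidiag r) :
    nd r S α ∈ convexHull ℝ (S : Set E3) :=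
  Finset.mem_convexHull'.2 ⟨_, fun _ _ => by positivity, nd_w hr hα, rfl⟩

theorem card_vs (r : ℕ) : ((vs v).piAntidiag r).card ≤ (r + 1) ^ 4 := by
  have : (Fintype.piFinset fun _ : Fin 4 => Finset.range (r + 1)).card = (r + 1) ^ 4 := by simp
  rw [← this]
  refine Finset.card_le_card_of_injOn (fun α i => α (v i)) (fun α hα => ?_) fun α hα β hβ h => ?_
  · obtain ⟨h1, h2⟩ := Finset.mem_piAntidiag.1 hα
    simp only [Fintype.coe_piFinset, Finset.coe_range, Set.mem_pi, mem_Iio, mem_univ, forall_const]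
    intro i
    have := Finset.single_le_sum (f := α) (fun _ _ => Nat.zero_le _) (show v i ∈ vs v by simp [vs])
    lia
  · obtain ⟨-, h2⟩ := Finset.mem_piAntidiag.1 hα
    obtain ⟨-, h3⟩ := Finset.mem_piAntidiag.1 hβ
    ext p
    by_cases hp : p ∈ vs v
    · obtain ⟨i, -, rfl⟩ := Finset.mem_image.1 hp
      exact congrFun h i
    · have a := not_imp_comm.1 (h2 p) hp
      have b := not_imp_comm.1 (h3 p) hp
      rw [a, b]

def IT (r : ℕ) (f : E3 → ℝ) (x : E3) : ℝ := JJ r (vs v) (fun p => lamv hv p x) f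

theorem IT_PP (r : ℕ) (f : E3 → ℝ) : IT hv r f ∈ PP r := by
  refine PP_sum _ _ _ fun α hα => (PP r).smul_mem (f _) ?_
  have := PP_prod (vs v) α (fun p x => Lg r (α p) (lamv hv p x)) fun p _ => by
    have := PP_prod (Finset.range (α p)) (fun _ => 1) (fun (j : ℕ) x => (r * lamv hv p x - j) / ((α p : ℝ) - j)) fun j _ => by
      have := (PP 1).sub_mem ((PP 1).smul_mem ((r : ℝ) / ((α p : ℝ) - j)) (PP_aff (lamv hv p))) (PP_const 1 (j / ((α p : ℝ) - j)))
      convert this using 1; ext x; simp; ring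
    simp only [Finset.sum_const, Finset.card_range, smul_eq_mul, mul_one] at this; exact this
  rwa [show ∑ p ∈ vs v, α p = r from (Finset.mem_piAntidiag.1 hα).1] at this

theorem IT_bd {r : ℕ} (hr : r ≠ 0) {f : E3 → ℝ} {A : ℝ} (hf : ∀ x ∈ tet v, |f x| ≤ A) {x : E3} (hx : x ∈ tet v) :
    |IT hv r f x| ≤ ((r + 1) ^ 4 * r ^ r : ℝ) * A := by
  have hA : 0 ≤ A := (abs_nonneg _).trans (hf x hx)
  refine (Finset.abs_sum_le_sum_abs _ _).trans ((Finset.sum_le_card_nsmul _ _ (A * r ^ r) fun α hα => ?_).trans ?_)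
  · have hs := (Finset.mem_piAntidiag.1 hα).1
    rw [abs_mul, Finset.abs_prod]
    refine mul_le_mul (hf _ (by rw [tet_eq]; exact nd_mem hr hα)) ?_ (Finset.prod_nonneg fun _ _ => abs_nonneg _) hA
    refine (Finset.prod_le_prod (fun _ _ => abs_nonneg _) fun p hp =>
      Lg_bd ?_ ((mem_tet hv).1 hx p hp) (lamv_le hv hx hp)).trans ?_
    · rw [← hs]; exact Finset.single_le_sum (f := α) (fun _ _ => Nat.zero_le _) hp
    · rw [Finset.prod_pow_eq_pow_sum, hs]
  · rw [nsmul_eq_mul]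
    have : (((vs v).piAntidiag r).card : ℝ) ≤ (r + 1) ^ 4 := by exact_mod_cast card_vs r
    calc _ ≤ (r + 1 : ℝ) ^ 4 * (A * r ^ r) := by gcongr
      _ = _ := by ring

theorem IT_nd {r : ℕ} (hr : r ≠ 0) (f : E3 → ℝ) {β : E3 → ℕ} (hβ : β ∈ (vs v).piAntidiag r) :
    IT hv r f (nd r (vs v) β) = f (nd r (vs v) β) := by
  have hl : ∀ p ∈ vs v, lamv hv p (nd r (vs v) β) = (β p : ℝ) / r := fun p hp => by
    rw [nd, lamv_comb hv subset_rfl (nd_w hr hβ) hp, if_pos hp]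
  rw [IT, JJ_congr hl fun _ _ => rfl, JJ, Finset.sum_eq_single β]
  · rw [Finset.prod_eq_one fun p _ => Lg_self hr, mul_one]
  · intro α hα hne
    have : ∃ p ∈ vs v, β p < α p := by
      by_contra! hc
      refine hne (funext fun p => ?_)
      obtain ⟨h1, h2⟩ := Finset.mem_piAntidiag.1 hα
      obtain ⟨h3, h4⟩ := Finset.mem_piAntidiag.1 hβ
      by_cases hp : p ∈ vs v
      · exact (Finset.sum_eq_sum_iff_of_le hc).1 (h1.trans h3.symm) p hp
      · rw [not_imp_comm.1 (h2 p) hp, not_imp_comm.1 (h4 p) hp]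
    obtain ⟨p, hp, hlt⟩ := this
    rw [Finset.prod_eq_zero hp (Lg_lt hr hlt), mul_zero]
  · exact fun h => absurd hβ h

theorem PP_rank (hv : AffineIndependent ℝ v) (r : ℕ) : Module.finrank ℝ (PP r) ≤ ((vs v).piAntidiag r).card := by
  have h1 : Module.finrank ℝ (PP r) ≤ Module.finrank ℝ (MvPolynomial.restrictTotalDegree (Fin 3) ℝ r) :=
    Submodule.finrank_map_le _ _
  refine h1.trans ?_
  rw [MvPolynomial.restrictTotalDegree, Module.finrank_eq_nat_card_basis (MvPolynomial.basisRestrictSupport ℝ _)]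
  let F : (Fin 3 →₀ ℕ) → E3 → ℕ := fun m p => ∑ i, if v i = p then (Fin.cons (r - ∑ j, m j) m : Fin 4 → ℕ) i else 0
  have hF : ∀ m i, F m (v i) = (Fin.cons (r - ∑ j, m j) m : Fin 4 → ℕ) i := fun m i => by
    show ∑ j, _ = _
    rw [Finset.sum_eq_single i (fun j _ hj => if_neg fun h => hj (hv.injective h)) (by simp), if_pos rfl]
  have hm : ∀ m : {n : Fin 3 →₀ ℕ | (n.sum fun _ e => e) ≤ r}, F m ∈ (vs v).piAntidiag r := fun m => by
    have h := m.2
    rw [mem_ofPred_eq, Finsupp.sum_fintype _ _ (by simp)] at h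
    refine Finset.mem_piAntidiag.2 ⟨?_, fun p hp => ?_⟩
    · show ∑ p ∈ vs v, F m p = r
      rw [sum_vs hv]; rw [Fin.sum_univ_succ]; simp only [hF, Fin.cons_zero, Fin.cons_succ]; exact Nat.sub_add_cancel h
    · obtain ⟨i, -, hi⟩ := Finset.exists_ne_zero_of_sum_ne_zero hp
      have : v i = p := by by_contra h; simp [h] at hi
      simp [vs, ← this]
  have := Nat.card_le_card_of_injective (fun m : {n : Fin 3 →₀ ℕ | (n.sum fun _ e => e) ≤ r} =>
    (⟨F m, hm m⟩ : (vs v).piAntidiag r)) fun m m' h => by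
      have h := congrArg Subtype.val h
      ext i
      have := congrFun h (v i.succ)
      simpa only [hF, Fin.cons_succ] using this
  rwa [Nat.card_eq_fintype_card (α := (vs v).piAntidiag r), Fintype.card_coe] at this

theorem IT_PPeq {r : ℕ} (hr : r ≠ 0) {p : E3 → ℝ} (hp : p ∈ PP r) : IT hv r p = p := by
  let Φ : PP r →ₗ[ℝ] ((vs v).piAntidiag r → ℝ) :=
    { toFun := fun q α => q.1 (nd r (vs v) α.1), map_add' := fun _ _ => rfl, map_smul' := fun _ _ => rfl }
  have hs : Function.Surjective Φ := fun g => by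
    have hj : Function.Injective fun α : (vs v).piAntidiag r => nd r (vs v) α.1 := fun α β h => by
      refine Subtype.ext (funext fun p => ?_)
      by_cases hp : p ∈ vs v
      · have := congrArg (lamv hv p) h
        simp only [nd] at this
        rw [lamv_comb hv subset_rfl (nd_w hr α.2) hp, lamv_comb hv subset_rfl (nd_w hr β.2) hp, if_pos hp, if_pos hp,
          div_left_inj' (by exact_mod_cast hr)] at this
        exact_mod_cast this
      · rw [not_imp_comm.1 ((Finset.mem_piAntidiag.1 α.2).2 p) hp, not_imp_comm.1 ((Finset.mem_piAntidiag.1 β.2).2 p) hp]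
    refine ⟨⟨IT hv r (Function.extend (fun α : (vs v).piAntidiag r => nd r (vs v) α.1) g 0), IT_PP hv r _⟩, funext fun α => ?_⟩
    exact (IT_nd hv hr _ α.2).trans (hj.extend_apply g 0 α)
  have hd : Module.finrank ℝ (PP r) = Module.finrank ℝ ((vs v).piAntidiag r → ℝ) := by
    refine le_antisymm ?_ (LinearMap.finrank_le_finrank_of_surjective hs)
    rw [Module.finrank_fintype_fun_eq_card, Fintype.card_coe]; exact PP_rank hv r
  have hi := (LinearMap.injective_iff_surjective_of_finrank_eq_finrank hd).2 hs
  have : (⟨IT hv r p, IT_PP hv r p⟩ : PP r) = ⟨p, hp⟩ := hi (funext fun α => IT_nd hv hr p α.2)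
  exact congrArg Subtype.val this

end
end

structure FE (D : Set E3) (c h : ℝ) (r : ℕ) where
  ι : Type
  fi : Fintype ι
  τ : ι → Set E3
  o : ι → E3
  ball : ∀ v, closedBall (o v) (c * h) ⊆ τ v
  sub : ∀ v, τ v ⊆ closedBall (o v) h
  cvx : ∀ v, Convex ℝ (τ v)
  cl : ∀ v, IsClosed (τ v)
  cover : ⋃ v, τ v = closure D
  disj : ∀ v w, v ≠ w → interior (τ v) ∩ interior (τ w) = ∅
  Vh : Submodule ℝ (E3 → ℝ)
  fin : Module.Finite ℝ Vh
  lip : ∀ χ ∈ Vh, ∃ k, LipschitzWith k χ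
  zero : ∀ χ ∈ Vh, ∀ x, x ∉ D → χ x = 0
  poly : ∀ χ ∈ Vh, ∀ v, ∃ p ∈ PP r, ∀ x ∈ τ v, χ x = p x
  I : (E3 → ℝ) → E3 → ℝ
  IV : ι → (E3 → ℝ) → E3 → ℝ
  IP : ∀ v f, IV v f ∈ PP r
  Ieq : ∀ v f x, x ∈ τ v → I f x = IV v f x
  Imem : ∀ f, (∀ x, x ∉ D → f x = 0) → I f ∈ Vh
  Isub : ∀ v f g, IV v (fun x => f x - g x) = fun x => IV v f x - IV v g x
  Irep : ∀ v, ∀ p ∈ PP r, IV v p = p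
  Icongr : ∀ v f g, (∀ x ∈ τ v, f x = g x) → IV v f = IV v g
  Ibd : ∀ v f A, (∀ x ∈ τ v, |f x| ≤ A) → ∀ x ∈ τ v, |IV v f x| ≤ ((r + 1) ^ 4 * r ^ r : ℝ) * A

theorem pw_lip {ι : Type*} [Finite ι] {D : Set E3} (hD : Convex ℝ D) (hb : Bornology.IsBounded D) {τ : ι → Set E3}
    (hc : ∀ v, IsClosed (τ v)) (hU : ⋃ v, τ v = closure D) {χ : E3 → ℝ} (hχ : ContinuousOn χ (closure D))
    {p : ι → E3 → ℝ} (hp : ∀ v, ContDiff ℝ 1 (p v)) (he : ∀ v, ∀ x ∈ τ v, χ x = p v x) :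
    ∃ k, LipschitzOnWith k χ (closure D) := by
  have := Fintype.ofFinite ι
  have hK := hb.isCompact_closure
  have hL : ∀ v, ∃ k, LipschitzOnWith k (p v) (closure D) := fun v => by
    obtain ⟨B, hB⟩ := hK.exists_bound_of_continuousOn ((hp v).continuous_fderiv one_ne_zero).continuousOn
    refine ⟨B.toNNReal, hD.closure.lipschitzOnWith_of_nnnorm_fderiv_le
      (fun x _ => (hp v).differentiable one_ne_zero x) fun x hx => ?_⟩
    rw [← NNReal.coe_le_coe, coe_nnnorm]; exact (hB x hx).trans (Real.le_coe_toNNReal B)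
  choose k hk using hL
  refine ⟨∑ v, k v, LipschitzOnWith.of_dist_le_mul fun x hx y hy => ?_⟩
  set M : ℝ := ((∑ v, k v : ℝ≥0) : ℝ)
  have hM : ∀ v, (k v : ℝ) ≤ M := fun v => NNReal.coe_le_coe.2 (Finset.single_le_sum (fun _ _ => zero_le) (Finset.mem_univ v))
  let γ : ℝ → E3 := AffineMap.lineMap y x
  have hγc : Continuous γ := AffineMap.lineMap_continuous
  have hγ : ∀ t ∈ Icc (0 : ℝ) 1, γ t ∈ closure D := fun t ht => hD.closure.lineMap_mem hy hx ht
  have hγd : ∀ s t, dist (γ s) (γ t) = |s - t| * dist x y := fun s t => by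
    simp only [γ, dist_lineMap_lineMap, Real.dist_eq, dist_comm y x]
  let S : Set ℝ := {t | |χ (γ t) - χ y| ≤ M * (t * dist x y)}
  have hcl : IsClosed (S ∩ Icc 0 1) := by
    rw [inter_comm]
    exact isClosed_Icc.isClosed_le (f := fun t => |χ (γ t) - χ y|)
      (((hχ.comp hγc.continuousOn hγ).sub continuousOn_const).abs) (by fun_prop)
  have h1 : (1 : ℝ) ∈ S := by
    refine hcl.mem_of_ge_of_forall_exists_gt (by simp [S, γ]) zero_le_one fun t ht => ?_
    have hev : ∃ v, ∃ᶠ s in 𝓝[>] t, γ s ∈ τ v := by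
      by_contra hcon
      simp only [not_exists, not_frequently] at hcon
      have h2 : ∀ᶠ s in 𝓝[>] t, s ∈ Ioc t 1 := Ioc_mem_nhdsGT ht.2.2
      obtain ⟨s, hs, hs2⟩ := ((eventually_all.2 hcon).and h2).exists
      have := hγ s ⟨ht.2.1.trans hs2.1.le, hs2.2⟩
      rw [← hU, mem_iUnion] at this
      exact this.elim hs
    obtain ⟨v, hv⟩ := hev
    have htv : γ t ∈ τ v := (hc v).mem_of_frequently_of_tendsto hv (hγc.tendsto t |>.mono_left nhdsWithin_le_nhds)
    obtain ⟨s, hs, hs2⟩ := (hv.and_eventually (Ioc_mem_nhdsGT ht.2.2)).exists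
    refine ⟨s, ?_, hs2⟩
    have h3 := (hk v).dist_le_mul _ (hγ s ⟨ht.2.1.trans hs2.1.le, hs2.2⟩) _ (hγ t ⟨ht.2.1, ht.2.2.le⟩)
    rw [← he v _ hs, ← he v _ htv, hγd, Real.dist_eq, abs_of_pos (sub_pos.2 hs2.1)] at h3
    have h4 : |χ (γ t) - χ y| ≤ M * (t * dist x y) := ht.1
    have h5 : |χ (γ s) - χ y| ≤ |χ (γ s) - χ (γ t)| + |χ (γ t) - χ y| := abs_sub_le _ _ _
    have h6 := mul_le_mul_of_nonneg_right (hM v) (mul_nonneg (sub_pos.2 hs2.1).le (dist_nonneg (x := x) (y := y)))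
    show |χ (γ s) - χ y| ≤ M * (s * dist x y)
    nlinarith
  simpa [S, γ, Real.dist_eq] using h1

theorem IT_cons {v w : Fin 4 → E3} (hv : AffineIndependent ℝ v) (hw : AffineIndependent ℝ w) {r : ℕ} {x : E3}
    (hx : x ∈ convexHull ℝ (range v ∩ range w)) (f : E3 → ℝ) : IT hv r f x = IT hw r f x := by
  classical
  have e : (range v ∩ range w) = ((vs v ∩ vs w : Finset E3) : Set E3) := by simp [vs]
  rw [e, Finset.mem_convexHull'] at hx
  obtain ⟨a, h0, h1, rfl⟩ := hx
  have key : ∀ {u : Fin 4 → E3} (hu : AffineIndependent ℝ u) (hS : vs v ∩ vs w ⊆ vs u),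
      IT hu r f (∑ q ∈ vs v ∩ vs w, a q • q) = JJ r (vs v ∩ vs w) a f := fun hu hS => by
    rw [IT, JJ_sub hS fun p hp hpS => by rw [lamv_comb hu hS h1 hp, if_neg hpS]]
    exact JJ_congr (fun p hp => by rw [lamv_comb hu hS h1 (hS hp), if_pos hp]) fun _ _ => rfl
  rw [key hv Finset.inter_subset_left, key hw Finset.inter_subset_right]

theorem IT_bdry {D : Set E3} (H : HRep D) {v : Fin 4 → E3} (hv : AffineIndependent ℝ v) (hvD : tet v ⊆ closure D)
    {r : ℕ} (hr : r ≠ 0) {f : E3 → ℝ} (hf : ∀ x, x ∉ D → f x = 0) {x : E3} (hx : x ∈ tet v) (hxD : x ∉ D) :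
    IT hv r f x = 0 := by
  classical
  rw [H.mem_iff] at hxD
  push Not at hxD
  obtain ⟨n, hn, hnx⟩ := hxD
  have hp0 : ∀ p ∈ vs v, 0 ≤ H.ell n p := fun p hp =>
    H.ell_clos (hvD (by rw [tet_eq]; exact subset_convexHull _ _ hp)) hn
  have hell : ∀ {S : Finset E3} {w : E3 → ℝ}, ∑ p ∈ S, w p = 1 → H.ell n (∑ p ∈ S, w p • p) = ∑ p ∈ S, w p * H.ell n p := by
    intro S w hw
    simp only [HRep.ell, inner_sum, inner_smul_right, mul_add, Finset.sum_add_distrib]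
    rw [← Finset.sum_mul, hw, one_mul]
  have h2 : ∑ p ∈ vs v, lamv hv p x * H.ell n p ≤ 0 := by
    rw [← hell (lamv_sum hv x), lamv_pt]; exact hnx
  have h3 : ∀ p ∈ vs v, lamv hv p x * H.ell n p = 0 :=
    (Finset.sum_eq_zero_iff_of_nonneg fun p hp => mul_nonneg ((mem_tet hv).1 hx p hp) (hp0 p hp)).1
      (le_antisymm h2 (Finset.sum_nonneg fun p hp => mul_nonneg ((mem_tet hv).1 hx p hp) (hp0 p hp)))
  let S := (vs v).filter fun p => lamv hv p x ≠ 0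
  rw [IT, JJ_sub (S := S) (Finset.filter_subset _ _) fun p hp hpS => by
    by_contra hc; exact hpS (Finset.mem_filter.2 ⟨hp, hc⟩)]
  refine Finset.sum_eq_zero fun α hα => ?_
  rw [hf, zero_mul]
  rw [H.mem_iff]; push Not
  refine ⟨n, hn, ?_⟩
  rw [nd, hell (nd_w hr hα)]
  refine (Finset.sum_eq_zero fun p hp => ?_).le
  obtain ⟨hp1, hp2⟩ := Finset.mem_filter.1 hp
  rw [(mul_eq_zero.1 (h3 p hp1)).resolve_left hp2, mul_zero]

theorem fe_exists {D : Set E3} (H : HRep D) {T : Finset (Fin 4 → E3)} {c h : ℝ} (hT : IsTetPartition D T h c)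
    (hch : 0 ≤ c * h) {r : ℕ} (hr : r ≠ 0) : ∃ F : FE D c h r, ∀ χ, χ ∈ F.Vh ↔ (∀ x, x ∉ D → χ x = 0) ∧ MemSh0 D T r χ := by
  classical
  obtain ⟨hA, hU, hd, hi, hdi, hb⟩ := hT
  obtain ⟨T', hT', hbij⟩ := exists_subset_bijOn (T : Set (Fin 4 → E3)) tet
  have hA' : ∀ v : T', AffineIndependent ℝ v.1 := fun v => hA _ (hT' v.2)
  have hfin : Finite T' := (T.finite_toSet.subset hT').to_subtype
  have hne : ∀ v w : T', v ≠ w → tet v.1 ≠ tet w.1 := fun v w hvw h => hvw (Subtype.ext (hbij.injOn v.2 w.2 h))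
  have hcl : ∀ v : T', IsClosed (tet v.1) := fun v => (finite_range v.1).isClosed_convexHull ℝ
  have hrep : ∀ w ∈ T, ∃ v : T', tet v.1 = tet w := fun w hw => by
    obtain ⟨v, h1, h2⟩ := hbij.surjOn ⟨w, hw, rfl⟩
    exact ⟨⟨v, h1⟩, h2⟩
  have hcov : ⋃ v : T', tet v.1 = closure D := by
    rw [← hU]; ext x; simp only [mem_iUnion]
    constructor
    · exact fun ⟨v, hv⟩ => ⟨v.1, hT' v.2, hv⟩
    · rintro ⟨w, hw, hx⟩
      obtain ⟨v, hv⟩ := hrep w hw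
      exact ⟨v, hv ▸ hx⟩
  choose o ho using fun v : T' => hb v.1 (hT' v.2)
  have hsubD : ∀ v : T', tet v.1 ⊆ closure D := fun v => hcov ▸ subset_iUnion (fun v : T' => tet v.1) v
  let I : (E3 → ℝ) → E3 → ℝ := fun f x => if hx : ∃ v : T', x ∈ tet v.1 then IT (hA' hx.choose) r f x else 0
  have hIeq : ∀ (v : T') f x, x ∈ tet v.1 → I f x = IT (hA' v) r f x := fun v f x hx => by
    have hex : ∃ v : T', x ∈ tet v.1 := ⟨v, hx⟩
    simp only [I, dif_pos hex]
    by_cases hvw : hex.choose = v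
    · rw [hvw]
    · rcases hi _ (hT' hex.choose.2) _ (hT' v.2) (hne _ _ hvw) with h | h
      · exact absurd (show x ∈ (∅ : Set E3) from h ▸ ⟨hex.choose_spec, hx⟩) (by simp)
      · exact IT_cons _ _ (h ▸ ⟨hex.choose_spec, hx⟩) f
  have hm0 : ∀ χ : E3 → ℝ, MemSh D T r χ ↔ ContinuousOn χ (closure D) ∧ ∀ v : T', ∃ p ∈ PP r, ∀ x ∈ tet v.1, χ x = p x := by
    intro χ
    refine and_congr_right fun _ => ⟨fun h v => ?_, fun h w hw => ?_⟩
    · obtain ⟨P, h1, h2⟩ := h _ (hT' v.2)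
      exact ⟨_, PP_iff.2 ⟨P, h1, fun _ => rfl⟩, h2⟩
    · obtain ⟨v, hv⟩ := hrep w hw
      obtain ⟨p, hp, h2⟩ := h v
      obtain ⟨P, h1, h3⟩ := PP_iff.1 hp
      exact ⟨P, h1, fun x hx => by rw [h2 x (hv ▸ hx), h3]⟩
  have hfr : ∀ {χ : E3 → ℝ}, (∀ x, x ∉ D → χ x = 0) → ∀ x ∈ frontier D, χ x = 0 := fun h x hx =>
    h x (H.isOpen.frontier_eq ▸ hx).2
  let Vh : Submodule ℝ (E3 → ℝ) :=
    { carrier := {χ | (∀ x, x ∉ D → χ x = 0) ∧ ContinuousOn χ (closure D) ∧ ∀ v : T', ∃ p ∈ PP r, ∀ x ∈ tet v.1, χ x = p x}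
      add_mem' := by
        rintro a b ⟨h1, h2, h3⟩ ⟨h4, h5, h6⟩
        refine ⟨fun x hx => by simp [h1 x hx, h4 x hx], h2.add h5, fun v => ?_⟩
        obtain ⟨p, hp, hp2⟩ := h3 v
        obtain ⟨q, hq, hq2⟩ := h6 v
        exact ⟨p + q, (PP r).add_mem hp hq, fun x hx => by simp [hp2 x hx, hq2 x hx]⟩
      zero_mem' := ⟨fun _ _ => rfl, continuousOn_const, fun v => ⟨0, (PP r).zero_mem, fun _ _ => rfl⟩⟩
      smul_mem' := by
        rintro a b ⟨h1, h2, h3⟩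
        refine ⟨fun x hx => by simp [h1 x hx], h2.const_smul a, fun v => ?_⟩
        obtain ⟨p, hp, hp2⟩ := h3 v
        exact ⟨a • p, (PP r).smul_mem a hp, fun x hx => by simp [hp2 x hx]⟩ }
  have hrp : ∀ χ ∈ Vh, ∀ (v : T') x, x ∈ tet v.1 → χ x = IT (hA' v) r χ x := fun χ hχ v x hx => by
    obtain ⟨p, hp, hp2⟩ := hχ.2.2 v
    have : IT (hA' v) r χ x = IT (hA' v) r p x := JJ_congr (fun _ _ => rfl) fun α hα =>
      hp2 _ (by rw [tet_eq]; exact nd_mem hr hα)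
    rw [this, IT_PPeq _ hr hp, hp2 x hx]
  have hVfin : Module.Finite ℝ Vh := by
    let Φ : Vh →ₗ[ℝ] ((v : T') → (vs v.1).piAntidiag r → ℝ) :=
      { toFun := fun χ v α => χ.1 (nd r (vs v.1) α.1), map_add' := fun _ _ => rfl, map_smul' := fun _ _ => rfl }
    refine Module.Finite.of_injective Φ fun χ χ' hh => Subtype.ext (funext fun x => ?_)
    by_cases hx : x ∈ D
    · have := subset_closure hx
      rw [← hcov, mem_iUnion] at this
      obtain ⟨v, hv⟩ := this
      rw [hrp χ χ.2 v x hv, hrp χ' χ'.2 v x hv]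
      exact JJ_congr (fun _ _ => rfl) fun α hα => congrFun (congrFun hh v) ⟨α, hα⟩
    · rw [χ.2.1 x hx, χ'.2.1 x hx]
  refine ⟨{ ι := T', fi := Fintype.ofFinite T', τ := fun v => tet v.1, o := o, ball := ho, sub := fun v x hx => ?_,
            cvx := fun v => convex_convexHull ℝ _, cl := hcl, cover := hcov,
            disj := fun v w hvw => hd _ (hT' v.2) _ (hT' w.2) (hne v w hvw), Vh := Vh, fin := hVfin,
            lip := fun χ hχ => ?_, zero := fun χ hχ => hχ.1, poly := fun χ hχ => hχ.2.2, I := I,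
            IV := fun v => IT (hA' v) r, IP := fun v f => IT_PP _ r f, Ieq := hIeq, Imem := fun f hf => ?_,
            Isub := fun v f g => ?_, Irep := fun v p hp => IT_PPeq _ hr hp, Icongr := fun v f g hfg => ?_,
            Ibd := fun v f A hf x hx => IT_bd _ hr hf hx }, fun χ => ?_⟩
  · exact (dist_le_diam_of_mem (H.bdd.closure.subset (hsubD v)) hx (ho v (mem_closedBall_self hch))).trans (hdi _ (hT' v.2))
  · choose p hp he using hχ.2.2
    obtain ⟨k, hk⟩ := pw_lip H.convex H.bdd hcl hcov hχ.2.1 (fun v => PP_smooth (hp v)) he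
    refine ⟨k, ?_⟩
    have := lip_ext hk (hfr hχ.1)
    rwa [show D.indicator χ = χ from indicator_eq_self.2 fun x hx => by by_contra h; exact hx (hχ.1 x h)] at this
  · have hz : ∀ x, x ∉ D → I f x = 0 := fun x hx => by
      by_cases hex : ∃ v : T', x ∈ tet v.1
      · obtain ⟨v, hv⟩ := hex
        rw [hIeq v f x hv]; exact IT_bdry H _ (hsubD v) hr hf hv hx
      · simp only [I, dif_neg hex]
    refine ⟨hz, ?_, fun v => ⟨_, IT_PP (hA' v) r f, fun x hx => hIeq v f x hx⟩⟩
    rw [← hcov]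
    exact (locallyFinite_of_finite _).continuousOn_iUnion hcl fun v =>
      (PP_smooth (IT_PP (hA' v) r f) (n := 0)).continuous.continuousOn.congr fun x hx => hIeq v f x hx
  · ext x; simp only [IT, JJ, sub_mul, Finset.sum_sub_distrib]
  · ext x; exact JJ_congr (fun _ _ => rfl) fun α hα => hfg _ (by rw [tet_eq]; exact nd_mem hr hα)
  · show χ ∈ Vh ↔ _
    rw [MemSh0, hm0]
    exact ⟨fun hx => ⟨hx.1, hx.2, hfr hx.1⟩, fun hx => ⟨hx.1, hx.2.1⟩⟩

theorem lip_mul {f g : E3 → ℝ} {a b A B : ℝ≥0} (hf : LipschitzWith a f) (hg : LipschitzWith b g)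
    (hA : ∀ x, |f x| ≤ A) (hB : ∀ x, |g x| ≤ B) : LipschitzWith (A * b + B * a) fun x => f x * g x := by
  refine LipschitzWith.of_dist_le_mul fun x y => ?_
  have h1 := hf.dist_le_mul x y
  have h2 := hg.dist_le_mul x y
  rw [Real.dist_eq] at *
  have : f x * g x - f y * g y = f x * (g x - g y) + g y * (f x - f y) := by ring
  rw [this]
  refine (abs_add_le _ _).trans ?_
  rw [abs_mul, abs_mul]; push_cast
  nlinarith [mul_le_mul (hA x) h2 (abs_nonneg _) A.2, mul_le_mul (hB y) h1 (abs_nonneg _) B.2]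

theorem grad_mul {f g : E3 → ℝ} {x : E3} (hf : DifferentiableAt ℝ f x) (hg : DifferentiableAt ℝ g x) :
    gradient (fun y => f y * g y) x = f x • gradient g x + g x • gradient f x := by
  unfold gradient; rw [fderiv_fun_mul hf hg]; simp

theorem grad_sub {f g : E3 → ℝ} {x : E3} (hf : DifferentiableAt ℝ f x) (hg : DifferentiableAt ℝ g x) :
    gradient (fun y => f y - g y) x = gradient f x - gradient g x := by
  unfold gradient; rw [fderiv_fun_sub hf hg]; simp

theorem lemQ {V : Set E3} {o : E3} {c h : ℝ} (hc : 0 < c) (hh : 0 < h) (hV : IsOpen V) (hVc : Convex ℝ V)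
    (hb : ball o (c * h) ⊆ V) (hs : V ⊆ closedBall o h) {u φ : E3 → ℝ} {k : ℝ≥0} (hu : LipschitzWith k u) {U A B : ℝ}
    (hU : ∀ x, |u x| ≤ U) (hφ : ContDiffOn ℝ 2 φ V) (hA : ∀ x ∈ V, ‖gradient φ x‖ ≤ A) (hB : ∀ x ∈ V, |lap φ x| ≤ B) :
    |∫ x in V, ⟪gradient u x, gradient φ x⟫| ≤ volume.real V * (B + 6 * (c * h)⁻¹ * A) * U := by
  set S : Set E3 := (fun x => o + x) ⁻¹' V
  have hch : 0 < c * h := by positivity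
  have hSc : Convex ℝ S := hVc.translate_preimage_right o
  have hSo : IsOpen S := hV.preimage (by fun_prop)
  have h0 : (0 : E3) ∈ S := by simpa [S] using hb (mem_ball_self hch)
  have hoV : o ∈ V := hb (mem_ball_self hch)
  obtain ⟨R, hR⟩ : ∃ R : ℝ≥0, (R : ℝ) = c * h := ⟨⟨c * h, hch.le⟩, rfl⟩
  have hR0 : 0 < R := by rw [← NNReal.coe_pos, hR]; exact hch
  have hgl : LipschitzWith R⁻¹ (gauge S) := hSc.lipschitzWith_gauge hR0 (by
    intro x hx; apply hb; simpa [hR] using hx)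
  set g : E3 → ℝ := fun x => gauge S (x - o)
  have hg : LipschitzWith R⁻¹ g := by
    refine LipschitzWith.of_dist_le_mul fun x y => ?_
    simpa using hgl.dist_le_mul (x - o) (y - o)
  have hgV : ∀ x, g x < 1 ↔ x ∈ V := fun x => by
    have := setOfPred_gauge_lt_one_eq_self_of_isOpen hSc h0 hSo
    have h2 : x - o ∈ {x | gauge S x < 1} ↔ x - o ∈ S := by rw [this]
    simpa [S] using h2
  have hU0 : 0 ≤ U := (abs_nonneg _).trans (hU o)
  have hA0 : 0 ≤ A := (norm_nonneg _).trans (hA o hoV)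
  have hB0 : 0 ≤ B := (abs_nonneg _).trans (hB o hoV)
  have hVb := isBounded_closedBall.subset hs
  have hVf : volume V < ⊤ := hVb.measure_lt_top
  set ν := volume.real V
  have hν : 0 ≤ ν := measureReal_nonneg
  have key : ∀ δ : ℝ, 0 < δ → δ < 1 / 2 →
      |∫ x in V, ⟪gradient u x, gradient φ x⟫| ≤ ν * (B + 6 * (c * h)⁻¹ * A) * U + δ * (6 * ν * k * A) := fun δ hδ hδ2 => by
    obtain ⟨d, hd⟩ : ∃ d : ℝ≥0, (d : ℝ) = δ := ⟨⟨δ, hδ.le⟩, rfl⟩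
    set η : E3 → ℝ := fun x => min (max (δ⁻¹ * (1 - g x) - 1) 0) 1
    have hη : LipschitzWith (d⁻¹ * R⁻¹) η := by
      have h1 : LipschitzWith (d⁻¹ * R⁻¹) fun x => δ⁻¹ * (1 - g x) - 1 := by
        refine LipschitzWith.of_dist_le_mul fun x y => ?_
        have := hg.dist_le_mul x y
        rw [Real.dist_eq] at *
        rw [show δ⁻¹ * (1 - g x) - 1 - (δ⁻¹ * (1 - g y) - 1) = -(δ⁻¹ * (g x - g y)) by ring, abs_neg, abs_mul,
          abs_of_pos (inv_pos.2 hδ)]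
        push_cast; rw [hd, mul_assoc]; exact mul_le_mul_of_nonneg_left (by simpa using this) (inv_pos.2 hδ).le
      exact (h1.max_const 0).min_const 1
    have hη0 : ∀ x, 0 ≤ η x := fun x => le_min (le_max_right _ _) zero_le_one
    have hη1 : ∀ x, η x ≤ 1 := fun x => min_le_right _ _
    have hηz : ∀ x, 1 - δ ≤ g x → η x = 0 := fun x hx => by
      have : δ⁻¹ * (1 - g x) ≤ 1 := by rw [inv_mul_le_iff₀ hδ]; linarith
      simp only [η]; rw [max_eq_right (by linarith)]; simp
    have hηo : ∀ x, g x < 1 - 2 * δ → η x = 1 := fun x hx => by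
      have : 2 ≤ δ⁻¹ * (1 - g x) := by rw [le_inv_mul_iff₀ hδ]; linarith
      simp only [η]; rw [max_eq_left (by linarith)]; exact min_eq_right (by linarith)
    set v : E3 → ℝ := fun x => η x * u x
    have hv : LipschitzWith _ v := lip_mul hη hu (A := 1) (B := U.toNNReal)
      (fun x => by rw [abs_of_nonneg (hη0 x)]; simpa using hη1 x) fun x => (hU x).trans (Real.le_coe_toNNReal U)
    have hcl : IsClosed {x | g x ≤ 1 - δ} := isClosed_le hg.continuous continuous_const
    have hts : tsupport v ⊆ {x | g x ≤ 1 - δ} := closure_minimal (fun x hx => by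
      by_contra h
      exact hx (by simp only [v]; rw [hηz x (not_le.1 h).le, zero_mul])) hcl
    have htsV : tsupport v ⊆ V := fun x hx => (hgV x).1 (lt_of_le_of_lt (hts hx) (by linarith))
    have hcs : HasCompactSupport v :=
      hVb.isCompact_closure.of_isClosed_subset (isClosed_tsupport _) (htsV.trans subset_closure)
    have hibp := ibp hv hcs hV htsV hφ
    have hvV : ∀ x, x ∉ V → v =ᶠ[𝓝 x] fun _ => 0 := fun x hx =>
      notMem_tsupport_iff_eventuallyEq.1 fun h => hx (htsV h)
    have e1 : ∫ x, ⟪gradient v x, gradient φ x⟫ = ∫ x in V, ⟪gradient v x, gradient φ x⟫ :=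
      (setIntegral_eq_integral_of_forall_compl_eq_zero fun x hx => by rw [grad_zero (hvV x hx), inner_zero_left]).symm
    have e2 : ∫ x, v x * lap φ x = ∫ x in V, v x * lap φ x :=
      (setIntegral_eq_integral_of_forall_compl_eq_zero fun x hx => by rw [(hvV x hx).eq_of_nhds, zero_mul]).symm
    have b2 : |∫ x in V, v x * lap φ x| ≤ U * B * ν := by
      have := norm_setIntegral_le_of_norm_le_const (f := fun x => v x * lap φ x) (C := U * B) hVf fun x hx => by
        rw [norm_mul, Real.norm_eq_abs, Real.norm_eq_abs]
        refine mul_le_mul ?_ (hB x hx) (abs_nonneg _) hU0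
        simp only [v]; rw [abs_mul, abs_of_nonneg (hη0 x)]
        nlinarith [hU x, hη1 x, abs_nonneg (u x), hη0 x]
      exact this
    set St : Set E3 := V ∩ {x | 1 - 2 * δ ≤ g x}
    have hStm : MeasurableSet St := hV.measurableSet.inter (isClosed_le continuous_const hg.continuous).measurableSet
    have hStv : volume.real St ≤ 6 * δ * ν := by
      set a := 1 - 2 * δ
      have ha : 0 < a := by simp only [a]; linarith
      set V' := AffineMap.homothety o a '' V
      have hV'g : ∀ x ∈ V', g x < a ∧ x ∈ V := by
        rintro _ ⟨x, hx, rfl⟩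
        have h1 : g (AffineMap.homothety o a x) = a * g x := by
          simp only [g, AffineMap.homothety_apply, vsub_eq_sub, vadd_eq_add, add_sub_cancel_right]
          rw [gauge_smul_of_nonneg ha.le]; rfl
        have h2 := (hgV x).2 hx
        have h3 : g (AffineMap.homothety o a x) < a := by rw [h1]; nlinarith
        exact ⟨h3, (hgV _).1 (h3.trans (by simp only [a]; linarith))⟩
      have hvol : volume.real V' = a ^ 3 * ν := by
        rw [measureReal_def, Measure.addHaar_image_homothety, ENNReal.toReal_mul]
        simp [ν, measureReal_def, abs_of_pos ha, ha.le]
      have hsub : St ⊆ V \ V' := fun x hx => ⟨hx.1, fun h => absurd (hV'g x h).1 (not_lt.2 hx.2)⟩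
      have hm : MeasurableSet V' := by
        have : IsOpen V' := AffineMap.homothety_isOpenMap o a ha.ne' V hV
        exact this.measurableSet
      have := measureReal_mono hsub (ne_top_of_le_ne_top hVf.ne (measure_mono sdiff_subset))
      rw [measureReal_sdiff (fun x hx => (hV'g x hx).2) hm hVf.ne, hvol] at this
      have h6 : 1 - a ^ 3 ≤ 6 * δ := by simp only [a]; nlinarith [pow_pos hδ 3, mul_pos hδ hδ]
      nlinarith
    set w : E3 → ℝ := fun x => ⟪gradient u x, gradient φ x⟫ - ⟪gradient v x, gradient φ x⟫
    have hi : ∀ {f : E3 → ℝ} {l : ℝ≥0}, LipschitzWith l f → IntegrableOn (fun x => ⟪gradient f x, gradient φ x⟫) V :=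
      fun {f l} hf => Measure.integrableOn_of_bounded (M := l * A) hVf.ne
        ((grad_meas f).inner (grad_meas φ)).aestronglyMeasurable
        (by filter_upwards [ae_restrict_mem hV.measurableSet] with x hx using
          (norm_inner_le_norm _ _).trans (mul_le_mul (grad_le hf x) (hA x hx) (norm_nonneg _) l.2))
    have hwS : ∀ x ∈ V \ St, w x = 0 := fun x hx => by
      have h1 : g x < 1 - 2 * δ := by
        by_contra h; exact hx.2 ⟨hx.1, not_lt.1 h⟩
      have : v =ᶠ[𝓝 x] u := by
        filter_upwards [(isOpen_lt hg.continuous continuous_const).mem_nhds h1] with y hy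
        simp only [v]; rw [hηo y hy, one_mul]
      simp only [w]; rw [grad_congr this, sub_self]
    have hw : ∫ x in V, w x = ∫ x in St, w x :=
      (setIntegral_eq_of_subset_of_forall_sdiff_eq_zero hV.measurableSet inter_subset_left hwS)
    have hwb : |∫ x in St, w x| ≤ (k * A + U * (δ⁻¹ * (c * h)⁻¹) * A) * (6 * δ * ν) := by
      have := norm_setIntegral_le_of_norm_le_const_ae' (f := w) (C := k * A + U * (δ⁻¹ * (c * h)⁻¹) * A)
        (s := St) (lt_of_le_of_lt (measure_mono inter_subset_left) hVf) (by
        filter_upwards [hu.ae_differentiableAt, hη.ae_differentiableAt] with x h1 h2 hx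
        simp only [w, v]
        rw [grad_mul h2 h1, inner_add_left, inner_smul_left, inner_smul_left]
        simp only [conj_trivial]
        rw [show ∀ p q : ℝ, p - (η x * p + u x * q) = (1 - η x) * p - u x * q by intros; ring]
        refine (norm_sub_le _ _).trans ?_
        rw [norm_mul, norm_mul]
        have n1 : ‖⟪gradient u x, gradient φ x⟫‖ ≤ k * A := (norm_inner_le_norm _ _).trans
          (mul_le_mul (grad_le hu x) (hA x hx.1) (norm_nonneg _) k.2)
        have n2 : ‖⟪gradient η x, gradient φ x⟫‖ ≤ δ⁻¹ * (c * h)⁻¹ * A := (norm_inner_le_norm _ _).trans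
          (mul_le_mul (by have := grad_le hη x; push_cast at this; rwa [hd, hR] at this) (hA x hx.1) (norm_nonneg _) (by positivity))
        have n3 : ‖1 - η x‖ ≤ 1 := by rw [Real.norm_eq_abs, abs_le]; constructor <;> linarith [hη0 x, hη1 x]
        have n4 := mul_le_mul n3 n1 (norm_nonneg _) zero_le_one
        have n5 := mul_le_mul (hU x) n2 (norm_nonneg _) hU0
        rw [Real.norm_eq_abs (u x)]
        linarith)
      exact this.trans (mul_le_mul_of_nonneg_left hStv (by positivity))
    have hsum : ∫ x in V, ⟪gradient u x, gradient φ x⟫ = (∫ x in V, w x) - ∫ x in V, v x * lap φ x := by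
      simp only [w]; rw [integral_sub (hi hu) (hi hv), ← e1, hibp, e2]; ring
    rw [hsum, hw]
    refine (abs_sub _ _).trans ((add_le_add hwb b2).trans (le_of_eq ?_))
    field_simp; ring
  refine le_of_forall_pos_le_add fun ε hε => ?_
  set Z := 6 * ν * k * A
  have hZ : 0 ≤ Z := by positivity
  set δ := min (1 / 4) (ε / (Z + 1))
  have hδ0 : 0 < δ := lt_min (by norm_num) (by positivity)
  refine (key δ hδ0 ((min_le_left _ _).trans_lt (by norm_num))).trans ?_
  have : δ * (Z + 1) ≤ ε := by rw [← le_div_iff₀ (by positivity)]; exact min_le_right _ _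
  nlinarith

section
attribute [instance] FE.fi FE.fin

def om : ℝ := volume.real (closedBall (0 : E3) 1)

theorem om_pos : 0 < om := ENNReal.toReal_pos (measure_closedBall_pos _ _ one_pos).ne' measure_closedBall_lt_top.ne

theorem vol_ball (x : E3) {t : ℝ} (ht : 0 ≤ t) : volume.real (closedBall x t) = t ^ 3 * om := by
  rw [Measure.addHaar_real_closedBall' volume x ht]; simp [om]

namespace FE
variable {D : Set E3} {c h : ℝ} {r : ℕ} (F : FE D c h r)

def V (v : F.ι) : Set E3 := interior (F.τ v)

theorem Vo (v : F.ι) : IsOpen (F.V v) := isOpen_interior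
theorem Vc (v : F.ι) : Convex ℝ (F.V v) := (F.cvx v).interior
theorem Vτ (v : F.ι) : F.V v ⊆ F.τ v := interior_subset
theorem Vs (v : F.ι) : F.V v ⊆ closedBall (F.o v) h := interior_subset.trans (F.sub v)
theorem Vb (v : F.ι) : Metric.ball (F.o v) (c * h) ⊆ F.V v :=
  ball_subset_interior_closedBall.trans (interior_mono (F.ball v))
theorem τcl (v : F.ι) : F.τ v ⊆ closure D := F.cover ▸ subset_iUnion F.τ v
theorem Vfin (v : F.ι) : volume (F.V v) < ⊤ := (isBounded_closedBall.subset (F.Vs v)).measure_lt_top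

theorem VD (hD : IsOpen D) (hDc : Convex ℝ D) (v : F.ι) : F.V v ⊆ D := by
  rcases D.eq_empty_or_nonempty with h0 | h0
  · have := (F.Vτ v).trans (F.τcl v); simpa [h0] using this
  · have := interior_mono (F.τcl v)
    rwa [hDc.interior_closure_eq_interior_of_nonempty_interior (by rwa [hD.interior_eq]), hD.interior_eq] at this

theorem vol_le (hh : 0 < h) (v : F.ι) : volume.real (F.V v) ≤ om * h ^ 3 := by
  have := measureReal_mono (F.Vs v) (measure_closedBall_lt_top (μ := volume)).ne
  rw [vol_ball _ hh.le] at this; linarith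

theorem vol_ge (hc : 0 < c) (hh : 0 < h) (v : F.ι) : c ^ 3 * om * h ^ 3 ≤ volume.real (F.V v) := by
  have := measureReal_mono (F.Vb v) (F.Vfin v).ne
  rw [measureReal_def, ← Measure.addHaar_closedBall_eq_addHaar_ball, ← measureReal_def, vol_ball _ (by positivity)] at this
  linarith

theorem ae_cover : ∀ᵐ x, x ∈ closure D → ∃ v, x ∈ F.V v := by
  have h : ∀ v, ∀ᵐ x, x ∉ frontier (F.τ v) := fun v => by
    have := (F.cvx v).addHaar_frontier (μ := volume)
    exact measure_eq_zero_iff_ae_notMem.1 this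
  filter_upwards [eventually_all.2 h] with x hx hD
  obtain ⟨v, hv⟩ := mem_iUnion.1 (F.cover ▸ hD)
  exact ⟨v, by by_contra h; exact hx v ⟨subset_closure hv, h⟩⟩

theorem dj : Pairwise (Function.onFun Disjoint F.V) := fun v w hvw => disjoint_iff_inter_eq_empty.2 (F.disj v w hvw)

theorem sum_eq {f : E3 → ℝ} (hf : Integrable f) : ∑ v, ∫ x in F.V v, f x = ∫ x in ⋃ v, F.V v, f x :=
  (integral_iUnion_fintype (fun v => (F.Vo v).measurableSet) F.dj fun _ => hf.integrableOn).symm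

theorem sum_le {f : E3 → ℝ} (hf : Integrable f) (h0 : ∀ x, 0 ≤ f x) : ∑ v, ∫ x in F.V v, f x ≤ ∫ x, f x := by
  rw [F.sum_eq hf]; exact setIntegral_le_integral hf (Eventually.of_forall h0)

theorem pw {f : E3 → ℝ} (hf : Integrable f) (h0 : ∀ x, x ∉ closure D → f x = 0) : ∫ x, f x = ∑ v, ∫ x in F.V v, f x := by
  rw [F.sum_eq hf]
  refine (setIntegral_eq_integral_of_ae_compl_eq_zero ?_).symm
  filter_upwards [F.ae_cover] with x hx hn
  by_contra hne
  have : x ∈ closure D := by by_contra h'; exact hne (h0 x h')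
  exact hn (mem_iUnion.2 (hx this))

theorem pw_le (hh : 0 < h) {T Y : E3 → ℝ} (hT : Integrable T) (hY : Integrable Y) (hT0 : ∀ x, x ∉ closure D → T x = 0)
    (hY0 : ∀ x, 0 ≤ Y x) {X : F.ι → ℝ} (hX : ∀ v, 0 ≤ X v) (hle : ∀ᵐ x, ∀ v, x ∈ F.V v → T x ≤ Y x + X v) :
    ∫ x, T x ≤ (∫ x, Y x) + om * h ^ 3 * ∑ v, X v := by
  rw [F.pw hT hT0]
  refine le_trans ?_ (add_le_add_left (F.sum_le hY hY0) _)
  rw [Finset.mul_sum, ← Finset.sum_add_distrib]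
  refine Finset.sum_le_sum fun v _ => ?_
  have hc : IntegrableOn (fun _ : E3 => X v) (F.V v) := integrableOn_const (F.Vfin v).ne
  have h1 := setIntegral_mono_on_ae (g := fun x => Y x + X v) hT.integrableOn (hY.integrableOn.add hc) (F.Vo v).measurableSet
    (by filter_upwards [hle] with x hx hxv using hx v hxv)
  refine h1.trans ?_
  rw [integral_add hY.integrableOn hc, setIntegral_const, smul_eq_mul]
  have := mul_le_mul_of_nonneg_right (F.vol_le hh v) (hX v)
  linarith

theorem sum_a (hc : 0 < c) (hh : 0 < h) {f : E3 → ℝ} (hf : Integrable f) (h0 : ∀ x, 0 ≤ f x) {a : F.ι → ℝ}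
    (ha : ∀ v, ∀ x ∈ F.V v, a v ≤ f x) : ∑ v, (c ^ 3 * om * h ^ 3 * a v) ≤ ∫ x, f x := by
  refine le_trans (Finset.sum_le_sum fun v _ => ?_) (F.sum_le hf h0)
  rcases le_total (a v) 0 with hav | hav
  · have : 0 ≤ ∫ x in F.V v, f x := integral_nonneg h0
    have h2 := om_pos
    exact le_trans (mul_nonpos_of_nonneg_of_nonpos (by positivity) hav) this
  · have hi : IntegrableOn (fun _ : E3 => a v) (F.V v) := integrableOn_const (F.Vfin v).ne
    have h1 := setIntegral_mono_on hi hf.integrableOn (F.Vo v).measurableSet (ha v)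
    rw [setIntegral_const, smul_eq_mul] at h1
    exact (mul_le_mul_of_nonneg_right (F.vol_ge hc hh v) hav).trans h1
end FE

def kI (p : ℕ) : ℝ := ∫ x : E3, ((‖x‖ + 1)⁻¹) ^ p

theorem kI_int {p : ℕ} (hp : 4 ≤ p) {h : ℝ} (hh : 0 < h) (z : E3) : Integrable (fun x : E3 => ((‖x - z‖ + h)⁻¹) ^ p) ∧
    ∫ x : E3, ((‖x - z‖ + h)⁻¹) ^ p = h ^ 3 * (h⁻¹) ^ p * kI p := by
  have h1 : Integrable fun x : E3 => ((‖x‖ + 1)⁻¹) ^ p := by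
    have := integrable_one_add_norm (E := E3) (μ := volume) (r := p) (by
      simp only [finrank_euclideanSpace, Fintype.card_fin]; exact_mod_cast (by omega : 3 < p))
    refine this.congr (Eventually.of_forall fun x => ?_)
    simp only
    rw [Real.rpow_neg (by positivity), Real.rpow_natCast, inv_pow, add_comm]
  have e : (fun x : E3 => ((‖x - z‖ + h)⁻¹) ^ p) = fun x => (h⁻¹) ^ p * (fun y : E3 => ((‖h⁻¹ • y‖ + 1)⁻¹) ^ p) (x - z) := by
    funext x; simp only; rw [← mul_pow, ← mul_inv, norm_smul, Real.norm_of_nonneg (inv_pos.2 hh).le]; congr 2; field_simp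
  have h2 : Integrable (fun y : E3 => ((‖h⁻¹ • y‖ + 1)⁻¹) ^ p) := h1.comp_smul (inv_pos.2 hh).ne'
  rw [e]
  refine ⟨(h2.comp_sub_right z).const_mul _, ?_⟩
  rw [integral_const_mul, integral_sub_right_eq_self (fun y : E3 => ((‖h⁻¹ • y‖ + 1)⁻¹) ^ p) z,
    Measure.integral_comp_smul volume (fun y : E3 => ((‖y‖ + 1)⁻¹) ^ p)]
  simp [kI, abs_of_pos hh]; ring

theorem kI_nn (p : ℕ) : 0 ≤ kI p := integral_nonneg fun x => by positivity

theorem cs {F P Q : E3 → ℝ} (hF : ∀ x, 0 ≤ F x) (hP : Integrable P) (hQ : Integrable Q) (hP0 : ∀ x, 0 ≤ P x) (hQ0 : ∀ x, 0 ≤ Q x)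
    (h : ∀ᵐ x, F x ^ 2 ≤ P x * Q x) : (∫ x, F x) ^ 2 ≤ (∫ x, P x) * ∫ x, Q x := by
  have h0 : 0 ≤ ∫ x, F x := integral_nonneg hF
  have key : ∀ t : ℝ, 0 < t → 2 * t * ∫ x, F x ≤ t ^ 2 * (∫ x, P x) + ∫ x, Q x := fun t ht => by
    rw [← integral_const_mul, ← integral_const_mul, ← integral_add (hP.const_mul _) hQ]
    refine integral_mono_of_nonneg (Eventually.of_forall fun x => by have := hF x; positivity) ((hP.const_mul _).add hQ) ?_
    filter_upwards [h] with x hx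
    have := hP0 x; have := hQ0 x
    refine abs_le_of_sq_le_sq' ?_ (by positivity) |>.2
    nlinarith [sq_nonneg (t ^ 2 * P x - Q x), mul_le_mul_of_nonneg_left hx (sq_nonneg t)]
  set a := ∫ x, F x
  set b := ∫ x, P x
  set d := ∫ x, Q x
  have hb : 0 ≤ b := integral_nonneg hP0
  have hd : 0 ≤ d := integral_nonneg hQ0
  rcases eq_or_lt_of_le h0 with ha | ha
  · rw [← ha]; nlinarith
  rcases eq_or_lt_of_le hb with hb' | hb'
  · have := key ((d + 1) / a) (by positivity)
    rw [← hb', mul_div_assoc', div_mul_cancel₀ _ ha.ne'] at this; linarith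
  · have := key (a / b) (by positivity)
    field_simp at this; nlinarith

namespace FE
variable {D : Set E3} {c h : ℝ} {r : ℕ} (F : FE D c h r)
theorem sumP (hc : 0 < c) (hh : 0 < h) {p : ℕ} (hp : 4 ≤ p) (z : E3) :
    ∑ v, ((‖F.o v - z‖ + h)⁻¹) ^ p ≤ 2 ^ p * kI p / (c ^ 3 * om) * (h⁻¹) ^ p := by
  obtain ⟨h1, h2⟩ := kI_int hp hh z
  have := F.sum_a hc hh (h1.const_mul (2 ^ p)) (fun x => by positivity) (a := fun v => ((‖F.o v - z‖ + h)⁻¹) ^ p) fun v x hx => by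
    rw [← mul_pow]
    refine pow_le_pow_left₀ (by positivity) ?_ p
    rw [← div_eq_mul_inv, inv_le_comm₀ (by positivity) (by positivity), inv_div, div_le_iff₀ two_pos]
    have h3 := F.Vs v hx
    rw [mem_closedBall, dist_eq_norm] at h3
    have := norm_add_le (x - F.o v) (F.o v - z)
    rw [sub_add_sub_cancel] at this
    linarith [norm_nonneg (F.o v - z)]
  rw [← Finset.mul_sum, integral_const_mul, h2] at this
  have h4 := om_pos
  rw [div_mul_eq_mul_div, le_div_iff₀ (by positivity)]
  have h5 : 0 < h ^ 3 := by positivity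
  nlinarith

theorem card_le (hc : 0 < c) (hh : 0 < h) {M : ℝ} (hM : D ⊆ closedBall 0 M) (hM0 : 0 < M) :
    h ^ 3 * Fintype.card F.ι ≤ M ^ 3 / c ^ 3 := by
  have hi : Integrable ((closedBall (0:E3) M).indicator fun _ => (1:ℝ)) :=
    (integrable_indicator_iff measurableSet_closedBall).2 (integrableOn_const measure_closedBall_lt_top.ne)
  have := F.sum_a hc hh hi (fun x => indicator_nonneg (fun _ _ => zero_le_one) x) (a := fun _ => 1) fun v x hx => by
    rw [indicator_of_mem (closure_minimal hM isClosed_closedBall (F.τcl v (F.Vτ v hx)))]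
  rw [integral_indicator_const _ measurableSet_closedBall, vol_ball _ hM0.le] at this
  simp only [mul_one, Finset.sum_const, Finset.card_univ, nsmul_eq_mul, smul_eq_mul] at this
  have h4 := om_pos
  rw [le_div_iff₀ (by positivity)]
  nlinarith
end FE
end

section
structure VV (D : Set E3) (v : E3 → ℝ) : Prop where
  lip : ∃ k, LipschitzWith k v
  zero : ∀ x, x ∉ D → v x = 0

def aa (v w : E3 → ℝ) : ℝ := ∫ x, ⟪gradient v x, gradient w x⟫

theorem aa_comm (v w : E3 → ℝ) : aa v w = aa w v := by
  unfold aa; congr 1; funext x; exact real_inner_comm _ _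

theorem int_bd {D : Set E3} (hDb : Bornology.IsBounded D) {f : E3 → ℝ} (hm : Measurable f) {B : ℝ} (hB : ∀ x, |f x| ≤ B)
    (h0 : ∀ x, x ∉ closure D → f x = 0) : Integrable f := by
  obtain ⟨R, hR⟩ := hDb.closure.subset_closedBall 0
  exact integrable_of_bdd_supp hm.aestronglyMeasurable hB (R := R) fun x hx => h0 x fun h => by
    have := hR h; rw [mem_closedBall, dist_zero_right] at this; linarith

theorem grad_smul (a : ℝ) (f : E3 → ℝ) (x : E3) : gradient (a • f) x = a • gradient f x := by
  unfold gradient; rw [fderiv_const_smul_field]; simp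

namespace VV
variable {D : Set E3} {v w z : E3 → ℝ}

theorem off (hv : VV D v) {x : E3} (hx : x ∉ closure D) : gradient v x = 0 := grad_zero (off_cl hv.zero hx)

theorem diff (hv : VV D v) : ∀ᵐ x, DifferentiableAt ℝ v x := by
  obtain ⟨k, hk⟩ := hv.lip; exact hk.ae_differentiableAt

theorem sub (hv : VV D v) (hw : VV D w) : VV D fun x => v x - w x := by
  obtain ⟨k, hk⟩ := hv.lip
  obtain ⟨l, hl⟩ := hw.lip
  exact ⟨⟨_, hk.sub hl⟩, fun x hx => by rw [hv.zero x hx, hw.zero x hx, sub_zero]⟩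

theorem cs (hDb : Bornology.IsBounded D) (hv : VV D v) : HasCompactSupport v :=
  hDb.isCompact_closure.of_isClosed_subset (isClosed_tsupport _) (closure_mono fun x hx => by
    by_contra h; exact hx (hv.zero x h))

theorem bd (hDb : Bornology.IsBounded D) (hv : VV D v) : ∃ B : ℝ≥0, ∀ x, |v x| ≤ B := by
  obtain ⟨k, hk⟩ := hv.lip
  obtain ⟨B, hB⟩ := (hv.cs hDb).exists_bound_of_continuous hk.continuous
  exact ⟨B.toNNReal, fun x => (hB x).trans (Real.le_coe_toNNReal B)⟩

theorem mul (hDb : Bornology.IsBounded D) (hv : VV D v) {m : E3 → ℝ} {k B : ℝ≥0} (hm : LipschitzWith k m)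
    (hB : ∀ x, |m x| ≤ B) : VV D fun x => m x * v x := by
  obtain ⟨l, hl⟩ := hv.lip
  obtain ⟨A, hA⟩ := hv.bd hDb
  exact ⟨⟨_, lip_mul hm hl hB hA⟩, fun x hx => by rw [hv.zero x hx, mul_zero]⟩

theorem int (hDb : Bornology.IsBounded D) (hv : VV D v) (hw : VV D w) {m : E3 → ℝ} (hm : Continuous m) {B : ℝ}
    (hB : ∀ x, |m x| ≤ B) : Integrable fun x => m x * ⟪gradient v x, gradient w x⟫ := by
  obtain ⟨k, hk⟩ := hv.lip
  obtain ⟨l, hl⟩ := hw.lip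
  refine int_bd hDb (hm.measurable.mul ((grad_meas v).inner (grad_meas w))) (B := B * (k * l)) (fun x => ?_)
    fun x hx => by rw [hv.off hx, inner_zero_left, mul_zero]
  rw [abs_mul]
  exact mul_le_mul (hB x) (ip_le hk hl x) (abs_nonneg _) ((abs_nonneg _).trans (hB x))

theorem int1 (hDb : Bornology.IsBounded D) (hv : VV D v) (hw : VV D w) :
    Integrable fun x => ⟪gradient v x, gradient w x⟫ := by
  simpa using hv.int hDb hw (m := fun _ => 1) continuous_const (B := 1) (by simp)

theorem aa_sub (hDb : Bornology.IsBounded D) (hv : VV D v) (hw : VV D w) (hz : VV D z) :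
    aa v (fun x => w x - z x) = aa v w - aa v z := by
  unfold aa
  rw [← integral_sub (hv.int1 hDb hw) (hv.int1 hDb hz)]
  refine integral_congr_ae ?_
  filter_upwards [hw.diff, hz.diff] with x h1 h2
  rw [grad_sub h1 h2, inner_sub_right]
end VV

namespace FE
variable {D : Set E3} {c h : ℝ} {r : ℕ} (F : FE D c h r)
theorem vv {χ : E3 → ℝ} (hχ : χ ∈ F.Vh) : VV D χ := ⟨F.lip χ hχ, F.zero χ hχ⟩

theorem ritz (hDb : Bornology.IsBounded D) {g : E3 → ℝ} (hg : VV D g) : ∃ R ∈ F.Vh, ∀ χ ∈ F.Vh, aa χ R = aa χ g := by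
  have hadd : ∀ {v w z : E3 → ℝ}, VV D v → VV D w → VV D z → aa v (w + z) = aa v w + aa v z := fun {v w z} hv hw hz => by
    have h1 : VV D (w + z) := by
      obtain ⟨k, hk⟩ := hw.lip
      obtain ⟨l, hl⟩ := hz.lip
      exact ⟨⟨_, hk.add hl⟩, fun x hx => by rw [Pi.add_apply, hw.zero x hx, hz.zero x hx, add_zero]⟩
    have := hv.aa_sub hDb h1 hz
    simp only [Pi.add_apply, add_sub_cancel_right] at this
    linarith
  have hsm : ∀ (a : ℝ) (v w : E3 → ℝ), aa v (a • w) = a * aa v w := fun a v w => by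
    unfold aa; rw [← integral_const_mul]; congr 1; funext x; rw [grad_smul, inner_smul_right]
  let L : ∀ g : E3 → ℝ, VV D g → Module.Dual ℝ F.Vh := fun g hg =>
    { toFun := fun χ => aa g χ.1
      map_add' := fun a b => hadd hg (F.vv a.2) (F.vv b.2)
      map_smul' := fun a b => hsm a g b.1 }
  let B : F.Vh →ₗ[ℝ] Module.Dual ℝ F.Vh :=
    { toFun := fun χ => L χ.1 (F.vv χ.2)
      map_add' := fun a b => by
        ext χ
        have := hadd (F.vv χ.2) (F.vv a.2) (F.vv b.2)
        simpa [L, aa_comm _ χ.1] using this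
      map_smul' := fun a b => by
        ext χ
        have := hsm a χ.1 b.1
        simpa [L, aa_comm _ χ.1] using this }
  have hinj : Function.Injective B := by
    rw [injective_iff_map_eq_zero]
    intro χ hχ
    have h0 : aa χ.1 χ.1 = 0 := by
      have := congrArg (fun l => l χ) hχ
      simpa [B, L] using this
    have hv := F.vv χ.2
    obtain ⟨k, hk⟩ := hv.lip
    have h1 := (integral_eq_zero_iff_of_nonneg (fun x => real_inner_self_nonneg) (hv.int1 hDb hv)).1 h0
    have h2 := eq_zero_of_grad hk (hv.cs hDb) (by filter_upwards [h1] with x hx using inner_self_eq_zero.1 hx)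
    exact Subtype.ext h2
  have hsur := (LinearMap.injective_iff_surjective_of_finrank_eq_finrank (Subspace.dual_finrank_eq).symm).1 hinj
  obtain ⟨R, hR⟩ := hsur (L g hg)
  refine ⟨R.1, R.2, fun χ hχ => ?_⟩
  have := congrArg (fun l => l ⟨χ, hχ⟩) hR
  rw [aa_comm, aa_comm χ]; exact this
end FE
end

def rs (K : Ker) (s : ℝ) (x z : E3) : ℝ := (s⁻¹) ^ 3 * K.ρ (s⁻¹ • (z - x))

theorem rs_supp (K : Ker) {s : ℝ} (hs : 0 < s) (x z : E3) (h : z ∉ ball x s) : rs K s x z = 0 := by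
  unfold rs
  rw [K.ρ_supp, mul_zero]
  rw [norm_smul, Real.norm_of_nonneg (inv_pos.2 hs).le, ← div_eq_inv_mul, le_div_iff₀ hs, one_mul, ← dist_eq_norm]
  exact not_lt.1 h

theorem rs_cont (K : Ker) (s : ℝ) (x : E3) : Continuous (rs K s x) := by
  have := K.hρ.continuous; unfold rs; fun_prop

theorem rs_abs (K : Ker) : ∃ B : ℝ, 0 < B ∧ ∀ s, 0 < s → ∀ x (f : E3 → ℝ) (a : ℝ), (∀ z ∈ ball x s, |f z| ≤ a) →
    |∫ z, f z * rs K s x z| ≤ B * a := by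
  obtain ⟨B, hB, h⟩ := K.ρ_bd
  refine ⟨B * om, mul_pos hB om_pos, fun s hs x f a hf => ?_⟩
  rw [← setIntegral_eq_integral_of_forall_compl_eq_zero (s := ball x s) fun z hz => by rw [rs_supp K hs x z hz, mul_zero]]
  have := norm_setIntegral_le_of_norm_le_const (f := fun z => f z * rs K s x z) (C := a * ((s⁻¹) ^ 3 * B)) (measure_ball_lt_top (x := x) (r := s) (μ := volume))
    fun z hz => by
      rw [norm_mul]
      refine mul_le_mul (hf z hz) ?_ (norm_nonneg _) ((abs_nonneg _).trans (hf z hz))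
      unfold rs
      rw [norm_mul, Real.norm_of_nonneg (by positivity)]
      exact mul_le_mul_of_nonneg_left (h _) (by positivity)
  rw [measureReal_def, ← Measure.addHaar_closedBall_eq_addHaar_ball, ← measureReal_def, vol_ball _ hs.le] at this
  refine this.trans (le_of_eq ?_)
  field_simp

theorem lap_sum {f : E3 → ℝ} {x : E3} (h : DifferentiableAt ℝ (fderiv ℝ f) x) :
    lap f x = ∑ i, fderiv ℝ (fderiv ℝ f) x (be i) (be i) := by
  unfold lap
  refine Finset.sum_congr rfl fun i _ => ?_
  rw [fderiv_clm_apply h (by fun_prop)]; simp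

theorem lap_le {f : E3 → ℝ} {x : E3} (h : DifferentiableAt ℝ (fderiv ℝ f) x) {M : ℝ} (hM : ‖fderiv ℝ (fderiv ℝ f) x‖ ≤ M) :
    |lap f x| ≤ 3 * M := by
  rw [lap_sum h]
  refine (Finset.abs_sum_le_sum_abs _ _).trans ((Finset.sum_le_sum fun i _ => (?_ : _ ≤ M)).trans (by simp))
  have h1 := ((fderiv ℝ (fderiv ℝ f) x) (be i)).le_opNorm (be i)
  have h2 := (fderiv ℝ (fderiv ℝ f) x).le_opNorm (be i)
  have h3 : ‖be i‖ = 1 := by simp [be]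
  rw [h3, mul_one] at h1 h2
  rw [← Real.norm_eq_abs]; linarith

structure LC (K : Ker) (c : ℝ) (r : ℕ) (A ε : ℝ) : Prop where
  A1 : 1 ≤ A
  e0 : 0 < ε
  e1 : ε ≤ c / 2
  L1 : ∀ {D : Set E3} {h : ℝ} (F : FE D c h r), 0 < h → ∀ v f a, (∀ x ∈ F.τ v, |f x| ≤ a) → ∀ x ∈ F.τ v,
    |F.IV v f x| ≤ A * a ∧ ‖fderiv ℝ (F.IV v f) x‖ ≤ A * h⁻¹ * a ∧ |lap (F.IV v f) x| ≤ A * (h⁻¹) ^ 2 * a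
  L2 : ∀ h, 0 < h → ∀ o, ∀ p ∈ PP r, ∃ x' ∈ closedBall o (c * h / 2), ∀ z ∈ closedBall o h,
    |p z| ≤ A * |∫ z, p z * rs K (ε * h) x' z| ∧ ‖fderiv ℝ p z‖ ≤ A * h⁻¹ * |∫ z, p z * rs K (ε * h) x' z|
  L3 : ∀ {D : Set E3} {h : ℝ} (F : FE D c h r), 0 < h → ∀ v, ∀ p ∈ PP r, ∃ n, 0 ≤ n ∧
    (∀ z ∈ F.τ v, ‖fderiv ℝ p z‖ ≤ n ∧ |lap p z| ≤ A * h⁻¹ * n) ∧ h ^ 3 * n ^ 2 ≤ A * ∫ x in F.V v, ‖gradient p x‖ ^ 2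
  R : ∀ s, 0 < s → ∀ x (f : E3 → ℝ) (a : ℝ), (∀ z ∈ Metric.ball x s, |f z| ≤ a) → |∫ z, f z * rs K s x z| ≤ A * a

theorem lc_exists (K : Ker) {c : ℝ} (hc : 0 < c) (hc1 : c ≤ 1) (r : ℕ) : ∃ A ε, LC K c r A ε := by
  obtain ⟨B, hB, hR⟩ := rs_abs K
  set δ := min (1 / 2) (1 / (2 * B))
  have hδ : 0 < δ := lt_min (by norm_num) (by positivity)
  have hδB : B * δ ≤ 1 / 2 := by
    have : δ ≤ 1 / (2 * B) := min_le_right _ _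
    rw [le_div_iff₀ (by positivity)] at this; linarith
  obtain ⟨ε, C, hε, hε2, hC, H⟩ := peak r hc hc1 hδ
  have hom := om_pos
  set N : ℝ := (r + 1) ^ 4 * r ^ r
  have hN : 0 ≤ N := by positivity
  set A3 := (36 / (ε ^ 3 * om)) * (2 * C) ^ 2
  have hA3 : 0 ≤ A3 := by positivity
  refine ⟨1 + N + C * N + 2 * C + A3 + B, ε, ⟨?_, hε, hε2, ?_, ?_, ?_, ?_⟩⟩
  · nlinarith [mul_nonneg hC.le hN]
  · intro D h F hh v f a ha x hx
    have hb := F.Ibd v f a ha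
    obtain ⟨x', hx', h1, -⟩ := H h hh (F.o v) _ (F.IP v f)
    have hxτ : x' ∈ F.τ v := F.ball v (closedBall_subset_closedBall (by nlinarith) hx')
    have h2 := hb x' hxτ
    obtain ⟨-, h4, h5⟩ := h1 x (F.sub v hx)
    have ha0 : 0 ≤ a := (abs_nonneg _).trans (ha x hx)
    have hCN := mul_nonneg hC.le hN
    refine ⟨(hb x hx).trans (mul_le_mul_of_nonneg_right (by nlinarith) ha0), h4.trans ?_, h5.trans ?_⟩
    · calc C * h⁻¹ * |F.IV v f x'| ≤ C * h⁻¹ * (N * a) := by gcongr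
        _ = C * N * h⁻¹ * a := by ring
        _ ≤ _ := by gcongr; nlinarith
    · calc C * h⁻¹ ^ 2 * |F.IV v f x'| ≤ C * h⁻¹ ^ 2 * (N * a) := by gcongr
        _ = C * N * h⁻¹ ^ 2 * a := by ring
        _ ≤ _ := by gcongr; nlinarith
  · intro h hh o p hp
    obtain ⟨x', hx', h1, h2⟩ := H h hh o p hp
    have hs : 0 < ε * h := by positivity
    have key : |p x'| ≤ 2 * |∫ z, p z * rs K (ε * h) x' z| := by
      have h3 := hR (ε * h) hs x' (fun z => p z - p x') _ fun z hz => h2 z (ball_subset_closedBall hz)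
      have hi : Integrable (rs K (ε * h) x') := integrable_of_integral_eq_one (moll_int K hs x')
      have hpc := (PP_smooth hp (n := 0)).continuous
      have hi2 : Integrable fun z => p z * rs K (ε * h) x' z :=
        (hpc.mul (rs_cont K _ _)).integrable_of_hasCompactSupport (HasCompactSupport.intro (isCompact_closedBall x' (ε * h)) fun z hz => by
          simp only [Pi.mul_apply]; rw [rs_supp K hs x' z fun h => hz (ball_subset_closedBall h), mul_zero])
      have e : ∫ z, (p z - p x') * rs K (ε * h) x' z = (∫ z, p z * rs K (ε * h) x' z) - p x' := by
        simp_rw [sub_mul]; rw [integral_sub hi2 (hi.const_mul _), integral_const_mul]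
        have : ∫ z, rs K (ε * h) x' z = 1 := moll_int K hs x'
        rw [this, mul_one]
      rw [e] at h3
      have h4 := abs_sub_abs_le_abs_sub (p x') (∫ z, p z * rs K (ε * h) x' z)
      rw [abs_sub_comm] at h4
      nlinarith [abs_nonneg (p x')]
    refine ⟨x', hx', fun z hz => ?_⟩
    obtain ⟨h3, h4, -⟩ := h1 z hz
    set J := |∫ z, p z * rs K (ε * h) x' z|
    have hJ : 0 ≤ J := abs_nonneg _
    have hCN := mul_nonneg hC.le hN
    constructor
    · calc _ ≤ C * (2 * J) := h3.trans (by gcongr)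
        _ = 2 * C * J := by ring
        _ ≤ _ := by gcongr; linarith
    · calc _ ≤ C * h⁻¹ * (2 * J) := h4.trans (by gcongr)
        _ = 2 * C * h⁻¹ * J := by ring
        _ ≤ _ := by gcongr; linarith
  · intro D h F hh v p hp
    choose y hy h1 h2 using fun i => H h hh (F.o v) _ (PP_fd hp (be i))
    set S := ∑ i, |fderiv ℝ p (y i) (be i)|
    have hS : ∀ i, |fderiv ℝ p (y i) (be i)| ≤ S := fun i => Finset.single_le_sum (f := fun i => |fderiv ℝ p (y i) (be i)|) (fun _ _ => abs_nonneg _) (Finset.mem_univ i)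
    have hS0 : 0 ≤ S := (abs_nonneg _).trans (hS 0)
    have hCN := mul_nonneg hC.le hN
    refine ⟨2 * (C * S), by positivity, fun z hz => ⟨fd_le fun i => ?_, ?_⟩, ?_⟩
    · exact (h1 i z (F.sub v hz)).1.trans (by gcongr; exact hS i)
    · have : |lap p z| ≤ C * h⁻¹ * S := by
        unfold lap
        refine (Finset.abs_sum_le_sum_abs _ _).trans ?_
        rw [Finset.mul_sum]
        refine Finset.sum_le_sum fun i _ => ?_
        have := (h1 i z (F.sub v hz)).2.1
        refine le_trans ?_ this
        have h3 := (fderiv ℝ (fun y => fderiv ℝ p y (be i)) z).le_opNorm (be i)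
        have h4 : ‖be i‖ = 1 := by simp [be]
        rwa [h4, mul_one] at h3
      refine this.trans ?_
      calc C * h⁻¹ * S = 1 * h⁻¹ * (1 * (C * S)) := by ring
        _ ≤ _ := by gcongr <;> linarith
    · have hq : ∀ i, (ε * h) ^ 3 * om * (1 / 4 * (fderiv ℝ p (y i) (be i)) ^ 2) ≤ ∫ x in F.V v, ‖gradient p x‖ ^ 2 := fun i => by
        have hsub : ball (y i) (ε * h) ⊆ F.V v := fun z hz => F.Vb v (by
          rw [mem_ball] at *; have := hy i; rw [mem_closedBall] at this
          have := dist_triangle z (y i) (F.o v); nlinarith)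
        have hci : IntegrableOn (fun x => ‖gradient p x‖ ^ 2) (F.V v) := by
          have : Continuous fun x => ‖gradient p x‖ ^ 2 := by
            simp_rw [norm_grad]; exact (((PP_smooth hp (n := 1)).continuous_fderiv one_ne_zero).norm).pow 2
          exact (this.continuousOn.integrableOn_compact (isCompact_closedBall (F.o v) h)).mono_set (F.Vs v)
        refine le_trans ?_ (setIntegral_mono_set hci (Eventually.of_forall fun x => by positivity) hsub.eventuallyLE)
        have h3 := setIntegral_mono_on (f := fun _ => 1 / 4 * (fderiv ℝ p (y i) (be i)) ^ 2) (integrableOn_const measure_ball_lt_top.ne) (hci.mono_set hsub) measurableSet_ball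
          fun z hz => by
            have h4 := h2 i z (ball_subset_closedBall hz)
            have h5 : δ ≤ 1 / 2 := min_le_left _ _
            have h6 : |fderiv ℝ p z (be i)| ≤ ‖gradient p z‖ := by
              rw [norm_grad]; have h3 := (fderiv ℝ p z).le_opNorm (be i)
              have h4 : ‖be i‖ = 1 := by simp [be]
              rwa [h4, mul_one] at h3
            have h7 := abs_sub_abs_le_abs_sub (fderiv ℝ p (y i) (be i)) (fderiv ℝ p z (be i))
            rw [abs_sub_comm] at h7
            have h8 := abs_nonneg (fderiv ℝ p (y i) (be i))
            have h9 := mul_le_mul_of_nonneg_right h5 h8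
            have h10 : 1 / 2 * |fderiv ℝ p (y i) (be i)| ≤ ‖gradient p z‖ := by linarith
            have h11 := pow_le_pow_left₀ (by positivity) h10 2
            rw [mul_pow, sq_abs] at h11
            linarith
        rw [setIntegral_const, measureReal_def, ← Measure.addHaar_closedBall_eq_addHaar_ball, ← measureReal_def, vol_ball _ (by positivity), smul_eq_mul] at h3
        exact h3
      set Z := ∫ x in F.V v, ‖gradient p x‖ ^ 2
      have hZ : 0 ≤ Z := integral_nonneg fun x => by positivity
      have hS2 : S ^ 2 ≤ 3 * ∑ i, (fderiv ℝ p (y i) (be i)) ^ 2 := by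
        have := sq_sum_le_card_mul_sum_sq (s := Finset.univ) (f := fun i => |fderiv ℝ p (y i) (be i)|)
        simpa using this
      have hsum : ε ^ 3 * om * h ^ 3 * S ^ 2 ≤ 36 * Z := by
        have h3 := Finset.sum_le_sum fun i (_ : i ∈ Finset.univ) => hq i
        rw [← Finset.mul_sum, ← Finset.mul_sum] at h3
        simp only [Finset.sum_const, Finset.card_univ, Fintype.card_fin, nsmul_eq_mul] at h3
        have h4 := mul_le_mul_of_nonneg_left hS2 (by positivity : 0 ≤ ε ^ 3 * om * h ^ 3)
        push_cast at h3
        nlinarith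
      calc h ^ 3 * (2 * (C * S)) ^ 2 = (2 * C) ^ 2 / (ε ^ 3 * om) * (ε ^ 3 * om * h ^ 3 * S ^ 2) := by field_simp
        _ ≤ (2 * C) ^ 2 / (ε ^ 3 * om) * (36 * Z) := by gcongr
        _ = A3 * Z := by simp only [A3]; ring
        _ ≤ _ := by gcongr; linarith
  · intro s hs x f a ha
    have ha0 : 0 ≤ a := (abs_nonneg _).trans (ha x (mem_ball_self hs))
    refine (hR s hs x f a ha).trans (mul_le_mul_of_nonneg_right ?_ ha0)
    have hCN := mul_nonneg hC.le hN
    linarith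

section
theorem PP_quad (B : E3 →L[ℝ] E3 →L[ℝ] ℝ) (o : E3) : (∀ l : E3 →L[ℝ] ℝ, (fun z => l (z - o)) ∈ PP 1) ∧
    (fun z => B (z - o) (z - o)) ∈ PP 2 := by
  have haf : ∀ l : E3 →L[ℝ] ℝ, (fun z => l (z - o)) ∈ PP 1 := fun l => by
    have : (fun z => l (z - o)) = (fun z => (l : E3 →ₗ[ℝ] ℝ) z) - fun _ => l o := by funext z; simp
    rw [this]; exact (PP 1).sub_mem (PP_lin _) (PP_const _ _)
  refine ⟨haf, ?_⟩
  have hw : ∀ w : E3, B w w = ∑ i, (EuclideanSpace.proj i : E3 →L[ℝ] ℝ) w * B (be i) w := fun w => by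
    calc B w w = B (∑ i, w i • be i) w := by rw [sum_be]
      _ = _ := by rw [map_sum]; simp [sum_apply]
  have : (fun z => B (z - o) (z - o)) = fun z => ∑ i, (EuclideanSpace.proj i : E3 →L[ℝ] ℝ) (z - o) * B (be i) (z - o) :=
    funext fun z => hw _
  rw [this]
  exact PP_sum _ _ _ fun i _ => PP_mul (a := 1) (b := 1) (haf _) (haf _)

theorem taylor {V : Set E3} {o : E3} {h : ℝ} (hVo : IsOpen V) (hVc : Convex ℝ V) (hoV : o ∈ V) (hs : V ⊆ closedBall o h)
    {f : E3 → ℝ} (hf : ContDiffOn ℝ 2 f V) {B : E3 →L[ℝ] E3 →L[ℝ] ℝ} (hB : ∀ x y, B x y = B y x) {M : ℝ}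
    (hM : ∀ z ∈ V, ‖fderiv ℝ (fderiv ℝ f) z - B‖ ≤ M) : ∃ q ∈ PP 2, ∀ z ∈ V, |f z - q z| ≤ M * h ^ 2 ∧
      ‖fderiv ℝ (fun y => f y - q y) z‖ ≤ M * h ∧ |lap (fun y => f y - q y) z| ≤ 3 * M := by
  set l := fderiv ℝ f o
  set q : E3 → ℝ := fun z => (f o + l (z - o)) + (2:ℝ)⁻¹ * B (z - o) (z - o)
  have hq : q ∈ PP 2 := by
    obtain ⟨haf, hb⟩ := PP_quad B o
    have e : q = ((fun _ => f o) + fun z => l (z - o)) + (2:ℝ)⁻¹ • fun z => B (z - o) (z - o) := rfl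
    rw [e]
    exact (PP 2).add_mem ((PP 2).add_mem (PP_const _ _) (PP_mono one_le_two (haf l))) ((PP 2).smul_mem _ hb)
  have hqd : ∀ z, HasFDerivAt q (l + B (z - o)) z := fun z => by
    have h0 : HasFDerivAt (fun z : E3 => z - o) (ContinuousLinearMap.id ℝ E3) z := (hasFDerivAt_id z).sub_const o
    have h1 := B.hasFDerivAt_of_bilinear h0 h0
    have h2 := ((l.hasFDerivAt.comp z h0).const_add (f o)).add (h1.const_mul (2:ℝ)⁻¹)
    refine h2.congr_fderiv ?_
    ext w
    simp [hB w]
    ring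
  have hat : ∀ z ∈ V, ContDiffAt ℝ 2 f z := fun z hz => hf.contDiffAt (hVo.mem_nhds hz)
  have hgd : ∀ z ∈ V, HasFDerivAt (fun y => f y - q y) (fderiv ℝ f z - (l + B (z - o))) z := fun z hz =>
    ((hat z hz).differentiableAt two_ne_zero).hasFDerivAt.sub (hqd z)
  have hfd : ∀ z ∈ V, fderiv ℝ (fun y => f y - q y) z = fderiv ℝ f z - (l + B (z - o)) := fun z hz => (hgd z hz).fderiv
  have h2d : ∀ z ∈ V, HasFDerivAt (fun z => fderiv ℝ f z - (l + B (z - o))) (fderiv ℝ (fderiv ℝ f) z - B) z := fun z hz => by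
    have h0 : HasFDerivAt (fun z : E3 => z - o) (ContinuousLinearMap.id ℝ E3) z := (hasFDerivAt_id z).sub_const o
    have h1 := (((hat z hz).fderiv_right (m := 1) (by norm_num)).differentiableAt one_ne_zero).hasFDerivAt.sub
      ((B.hasFDerivAt.comp z h0).const_add l)
    exact h1.congr_fderiv (by ext; simp)
  have hM0 : 0 ≤ M := le_trans (norm_nonneg (fderiv ℝ (fderiv ℝ f) o - B)) (hM o hoV)
  have hn : ∀ z ∈ V, ‖z - o‖ ≤ h := fun z hz => by have := hs hz; rwa [mem_closedBall, dist_eq_norm] at this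
  have hh : 0 ≤ h := (norm_nonneg _).trans (hn o hoV)
  have hD : ∀ z ∈ V, ‖fderiv ℝ f z - (l + B (z - o))‖ ≤ M * h := fun z hz => by
    have := hVc.norm_image_sub_le_of_norm_hasFDerivWithin_le (fun z hz => (h2d z hz).hasFDerivWithinAt) hM hoV hz
    simp only [sub_self, map_zero, add_zero, l] at this
    rw [sub_zero] at this
    exact this.trans (mul_le_mul_of_nonneg_left (hn z hz) hM0)
  refine ⟨q, hq, fun z hz => ⟨?_, by rw [hfd z hz]; exact hD z hz, ?_⟩⟩
  · have := hVc.norm_image_sub_le_of_norm_hasFDerivWithin_le (fun z hz => (hgd z hz).hasFDerivWithinAt) hD hoV hz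
    have hqo : f o - q o = 0 := by simp [q]
    rw [hqo, sub_zero] at this
    refine this.trans ?_
    rw [pow_two, ← mul_assoc]
    exact mul_le_mul_of_nonneg_left (hn z hz) (by positivity)
  · have hev : fderiv ℝ (fun y => f y - q y) =ᶠ[𝓝 z] fun z => fderiv ℝ f z - (l + B (z - o)) := by
      filter_upwards [hVo.mem_nhds hz] with y hy using hfd y hy
    have h3 := (h2d z hz).congr_of_eventuallyEq hev
    refine lap_le h3.differentiableAt ?_
    rw [h3.fderiv]; exact hM z hz

namespace FE
variable {D : Set E3} {c h : ℝ} {r : ℕ} (F : FE D c h r)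

theorem τV (hc : 0 < c) (hh : 0 < h) (v : F.ι) : F.τ v ⊆ closure (F.V v) := by
  have := (F.cvx v).closure_interior_eq_closure_of_nonempty_interior ⟨F.o v, F.Vb v (mem_ball_self (by positivity))⟩
  rw [V, this]; exact subset_closure

theorem clos_le (hc : 0 < c) (hh : 0 < h) (v : F.ι) {f : E3 → ℝ} (hf : Continuous f) {a : ℝ} (ha : ∀ x ∈ F.V v, f x ≤ a) :
    ∀ x ∈ F.τ v, f x ≤ a := fun _ hx =>
  closure_minimal (t := {x | f x ≤ a}) ha (isClosed_le hf continuous_const) (F.τV hc hh v hx)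

theorem interp {K : Ker} {A ε : ℝ} (L : LC K c r A ε) (hc : 0 < c) (hh : 0 < h) (v : F.ι) {f q : E3 → ℝ} (hf : Continuous f) (hq : q ∈ PP r)
    (hfd : ContDiffOn ℝ 2 f (F.V v)) {a b d : ℝ} (h0 : ∀ x ∈ F.V v, |f x - q x| ≤ a ∧ ‖fderiv ℝ (fun y => f y - q y) x‖ ≤ b ∧
      |lap (fun y => f y - q y) x| ≤ d) : ∀ x ∈ F.V v, |f x - F.I f x| ≤ a + A * a ∧
      ‖gradient (fun y => f y - F.I f y) x‖ ≤ b + A * h⁻¹ * a ∧ |lap (fun y => f y - F.I f y) x| ≤ d + A * (h⁻¹) ^ 2 * a := by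
  intro x hx
  have hqc := (PP_smooth hq (n := 0)).continuous
  have h1 := F.clos_le hc hh v (f := fun x => |f x - q x|) (hf.sub hqc).abs fun x hx => (h0 x hx).1
  set p := F.IV v fun y => f y - q y
  have hp : p ∈ PP r := F.IP v _
  have hev : (fun y => f y - F.I f y) =ᶠ[𝓝 x] fun y => (f y - q y) + (-1 : ℝ) * p y := by
    filter_upwards [(F.Vo v).mem_nhds hx] with y hy
    have e : p = fun y => F.IV v f y - q y := by
      simp only [p]; rw [F.Isub]; rw [F.Irep v q hq]
    rw [F.Ieq v f y (F.Vτ v hy), e]; ring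
  obtain ⟨b1, b2, b3⟩ := L.L1 F hh v _ a h1 x (F.Vτ v hx)
  obtain ⟨g1, g2, g3⟩ := h0 x hx
  have hfx := hfd.contDiffAt ((F.Vo v).mem_nhds hx)
  have c1 : ContDiffAt ℝ 2 (fun y => f y - q y) x := hfx.sub (PP_smooth hq).contDiffAt
  have c2 : ContDiff ℝ 2 p := PP_smooth hp
  refine ⟨?_, ?_, ?_⟩
  · rw [show f x - F.I f x = _ from hev.eq_of_nhds]
    refine (abs_add_le _ _).trans ?_
    rw [neg_one_mul, abs_neg]; linarith
  · rw [grad_congr hev, norm_grad, fderiv_fun_add (c1.differentiableAt two_ne_zero) ((c2.differentiable two_ne_zero x).const_mul _), fderiv_const_mul (c2.differentiable two_ne_zero x)]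
    refine (norm_add_le _ _).trans ?_
    rw [neg_one_smul, norm_neg]; linarith
  · rw [lap_congr hev, lap_add c1 (contDiff_const.mul c2).contDiffAt, lap_const_mul _ _ c2]
    refine (abs_add_le _ _).trans ?_
    rw [neg_one_mul, abs_neg]; linarith
end FE
end

section
theorem mv1 {G : Type*} [NormedAddCommGroup G] [NormedSpace ℝ G] {g : E3 → G} (hg : ContDiff ℝ 1 g) {V : Set E3} (hV : Convex ℝ V) {M : ℝ}
    (h : ∀ w ∈ V, ‖iteratedFDeriv ℝ 1 g w‖ ≤ M) {o z : E3} (ho : o ∈ V) (hz : z ∈ V) : ‖g z - g o‖ ≤ M * ‖z - o‖ :=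
  hV.norm_image_sub_le_of_norm_fderiv_le (fun w _ => hg.differentiable one_ne_zero w) (fun w hw => by
    rw [← norm_iteratedFDeriv_one]; exact h w hw) ho hz

namespace FE
variable {D : Set E3} {c h : ℝ} {r : ℕ} (F : FE D c h r)

theorem interp2 {K : Ker} {A ε : ℝ} (L : LC K c r A ε) (hc : 0 < c) (hh : 0 < h) (hr : 2 ≤ r) (v : F.ι) {f : E3 → ℝ} (hf : Continuous f)
    (hfd : ContDiffOn ℝ 2 f (F.V v)) {B : E3 →L[ℝ] E3 →L[ℝ] ℝ} (hB : ∀ x y, B x y = B y x) {M : ℝ}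
    (hM : ∀ z ∈ F.V v, ‖fderiv ℝ (fderiv ℝ f) z - B‖ ≤ M) : ∀ x ∈ F.V v, |f x - F.I f x| ≤ (3 + A) * M * h ^ 2 ∧
      ‖gradient (fun y => f y - F.I f y) x‖ ≤ (3 + A) * M * h ∧ |lap (fun y => f y - F.I f y) x| ≤ (3 + A) * M := by
  have hoV := F.Vb v (mem_ball_self (by positivity))
  have hM0 : 0 ≤ M := le_trans (norm_nonneg (fderiv ℝ (fderiv ℝ f) (F.o v) - B)) (hM _ hoV)
  obtain ⟨q, hq, hq'⟩ := taylor (F.Vo v) (F.Vc v) hoV (F.Vs v) hfd hB hM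
  intro x hx
  obtain ⟨h1, h2, h3⟩ := F.interp L hc hh v hf (PP_mono hr hq) hfd hq' x hx
  have e : A * (h⁻¹) ^ 2 * (M * h ^ 2) = A * M := by field_simp
  have e2 : A * h⁻¹ * (M * h ^ 2) = A * M * h := by field_simp
  rw [e] at h3; rw [e2] at h2
  have h4 : 0 ≤ M * h ^ 2 := by positivity
  have h5 : 0 ≤ M * h := by positivity
  exact ⟨by linarith, by linarith, by linarith⟩

theorem cd_sub (v : F.ι) {f : E3 → ℝ} (hf : ContDiffOn ℝ 2 f (F.V v)) : ContDiffOn ℝ 2 (fun y => f y - F.I f y) (F.V v) :=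
  (hf.sub (PP_smooth (F.IP v f)).contDiffOn).congr fun y hy => by rw [F.Ieq v f y (F.Vτ v hy)]

theorem interpK {K : Ker} {A ε : ℝ} (L : LC K c r A ε) (hc : 0 < c) (hc1 : c ≤ 1) (hh : 0 < h) (hr : 2 ≤ r) {d : ℝ} (hd : ε * h ≤ d)
    (x : E3) (v : F.ι) : ∀ z ∈ F.V v, |K.Φ d (ε * h) (z - x) - F.I (fun z => K.Φ d (ε * h) (z - x)) z| ≤
        (3 + A) * (K.C * (2 / ε) ^ 4) * h ^ 3 * ((‖F.o v - x‖ + h)⁻¹) ^ 4 ∧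
      ‖gradient (fun z => K.Φ d (ε * h) (z - x) - F.I (fun z => K.Φ d (ε * h) (z - x)) z) z‖ ≤
        (3 + A) * (K.C * (2 / ε) ^ 4) * h ^ 2 * ((‖F.o v - x‖ + h)⁻¹) ^ 4 ∧
      |lap (fun z => K.Φ d (ε * h) (z - x) - F.I (fun z => K.Φ d (ε * h) (z - x)) z) z| ≤
        (3 + A) * (K.C * (2 / ε) ^ 4) * h * ((‖F.o v - x‖ + h)⁻¹) ^ 4 := by
  have he := L.e0
  have hs : 0 < ε * h := by positivity
  have hg := K.hΦ d _ hs hd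
  set f : E3 → ℝ := fun z => K.Φ d (ε * h) (z - x)
  have hf : ContDiff ℝ ∞ f := hg.comp (contDiff_id.sub contDiff_const)
  have hoV := F.Vb v (mem_ball_self (by positivity))
  have hf1 : ContDiff ℝ ∞ (fderiv ℝ f) := hf.fderiv_right (by simp)
  have hf2 : ContDiff ℝ ∞ (fderiv ℝ (fderiv ℝ f)) := hf1.fderiv_right (by simp)
  set T := ((‖F.o v - x‖ + h)⁻¹) ^ 4
  have h3 : ∀ w ∈ F.V v, ‖iteratedFDeriv ℝ 1 (fderiv ℝ (fderiv ℝ f)) w‖ ≤ K.C * (2 / ε) ^ 4 * T := fun w hw => by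
    rw [norm_iteratedFDeriv_fderiv, norm_iteratedFDeriv_fderiv]
    have e : iteratedFDeriv ℝ (1 + 1 + 1) f w = iteratedFDeriv ℝ 3 (K.Φ d (ε * h)) (w - x) := iteratedFDeriv_comp_sub 3 x w
    rw [e]
    refine (K.Φ_D3 d _ (w - x) hs hd).trans ?_
    rw [mul_assoc, ← mul_pow]
    refine mul_le_mul_of_nonneg_left (pow_le_pow_left₀ (by positivity) ?_ 4) K.Cpos.le
    rw [← div_eq_mul_inv, div_div, inv_le_comm₀ (by positivity) (by positivity), inv_div, div_le_iff₀ two_pos]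
    have h1 := F.Vs v hw
    rw [mem_closedBall, dist_eq_norm, norm_sub_rev] at h1
    have h2 := norm_add_le (F.o v - w) (w - x)
    rw [sub_add_sub_cancel] at h2
    have := L.e1
    nlinarith [norm_nonneg (w - x)]
  have hM : ∀ z ∈ F.V v, ‖fderiv ℝ (fderiv ℝ f) z - fderiv ℝ (fderiv ℝ f) (F.o v)‖ ≤ K.C * (2 / ε) ^ 4 * T * h := fun z hz => by
    have := mv1 (hf2.of_le ENat.LEInfty.out) (F.Vc v) h3 hoV hz
    refine this.trans (mul_le_mul_of_nonneg_left ?_ (by have := K.Cpos; positivity))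
    have h1 := F.Vs v hz
    rwa [mem_closedBall, dist_eq_norm] at h1
  have hsy : ∀ a b, fderiv ℝ (fderiv ℝ f) (F.o v) a b = fderiv ℝ (fderiv ℝ f) (F.o v) b a := fun a b =>
    (hf.contDiffAt.isSymmSndFDerivAt (by simp [ENat.LEInfty.out])) a b
  intro z hz
  obtain ⟨a1, a2, a3⟩ := F.interp2 L hc hh hr v hf.continuous (hf.of_le ENat.LEInfty.out).contDiffOn hsy hM z hz
  exact ⟨a1.trans_eq (by ring), a2.trans_eq (by ring), a3.trans_eq (by ring)⟩

theorem interpW (H : HRep D) {K : Ker} {A ε : ℝ} (L : LC K c r A ε) (hc : 0 < c) (hh : 0 < h) (hh1 : h ≤ 1) (hr : 2 ≤ r) {γ C : ℝ}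
    (hγ0 : 1 / 2 < γ) (hγ1 : γ < 1) (hC : 0 ≤ C) {W : E3 → ℝ} (hW : Continuous W) (hWD : ContDiffOn ℝ 2 W D)
    (hb : ∀ x ∈ D, |W x| ≤ C * H.rho x ^ (2 * γ) ∧ ‖fderiv ℝ W x‖ ≤ C * H.rho x ^ (2 * γ - 1) ∧
      ‖fderiv ℝ (fderiv ℝ W) x‖ ≤ C * H.rho x ^ (2 * γ - 2) ∧ |lap W x| ≤ C) (v : F.ι) :
    ∃ P, 0 ≤ P ∧ ∀ z ∈ F.V v, ‖gradient (fun y => W y - F.I W y) z‖ ≤ h * P ∧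
      |lap (fun y => W y - F.I W y) z| ≤ P ∧ P ≤ (64 * (3 + A) * C) * H.rho z ^ (2 * γ - 2) := by
  have hA := L.A1
  have hVD := F.VD H.isOpen H.convex v
  have hn : ∀ z ∈ F.V v, ∀ w ∈ F.V v, ‖z - w‖ ≤ 2 * h := fun z hz w hw => by
    have h1 := F.Vs v hz
    have h2 := F.Vs v hw
    rw [mem_closedBall] at h1 h2
    rw [← dist_eq_norm]; linarith [dist_triangle_right z w (F.o v)]
  have hmon : ∀ a b : ℝ, 0 < b → b ≤ 4 * a → a ^ (2 * γ - 2) ≤ 4 * b ^ (2 * γ - 2) := fun a b hb hab => by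
    have h1 : (4:ℝ) ^ (2 * γ - 2) * a ^ (2 * γ - 2) ≤ b ^ (2 * γ - 2) := by
      rw [← Real.mul_rpow (by norm_num) (by linarith)]
      exact Real.rpow_le_rpow_of_nonpos hb hab (by linarith)
    have h2 : (4:ℝ)⁻¹ ≤ (4:ℝ) ^ (2 * γ - 2) := by
      rw [← Real.rpow_neg_one]; exact Real.rpow_le_rpow_of_exponent_le (by norm_num) (by linarith)
    have h3 : 0 ≤ a ^ (2 * γ - 2) := Real.rpow_nonneg (by linarith) _
    nlinarith
  by_cases hg : ∃ z0 ∈ F.V v, 4 * h < H.rho z0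
  · obtain ⟨z0, hz0, h4⟩ := hg
    have hcmp : ∀ z ∈ F.V v, H.rho z0 / 2 ≤ H.rho z ∧ H.rho z ≤ 4 * (H.rho z0 / 2) := fun z hz => by
      have h1 := H.rho_lip z z0
      have h2 := H.rho_lip z0 z
      have h3 := hn z hz z0 hz0
      rw [norm_sub_rev] at h2
      exact ⟨by linarith, by linarith⟩
    set a := H.rho z0 / 2
    have ha : 0 < a := by simp only [a]; linarith
    have := F.interp2 L hc hh hr v hW (hWD.mono hVD) (B := 0) (fun _ _ => rfl) (M := C * a ^ (2 * γ - 2)) fun z hz => by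
      have h1 := (hb z (hVD hz)).2.2.1
      rw [sub_zero]
      exact h1.trans (mul_le_mul_of_nonneg_left (Real.rpow_le_rpow_of_nonpos ha (hcmp z hz).1 (by linarith)) hC)
    have ha' : 0 ≤ a ^ (2 * γ - 2) := Real.rpow_nonneg ha.le _
    refine ⟨(3 + A) * (C * a ^ (2 * γ - 2)), by positivity, fun z hz => ⟨(this z hz).2.1.trans_eq (mul_comm _ _), (this z hz).2.2, ?_⟩⟩
    have h5 := hmon a (H.rho z) (H.rho_pos (hVD hz)) (hcmp z hz).2
    have h6 : 0 ≤ (3 + A) * C := by positivity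
    have h7 : 0 ≤ H.rho z ^ (2 * γ - 2) := Real.rpow_nonneg (H.rho_pos (hVD hz)).le _
    nlinarith [mul_nonneg h6 h7]
  · push Not at hg
    have hp : ∀ a : ℝ, 0 ≤ a → a ≤ 2 → (4 * h) ^ a ≤ 16 * h ^ a := fun a h0 h2 => by
      rw [Real.mul_rpow (by norm_num) hh.le]
      refine mul_le_mul_of_nonneg_right ?_ (Real.rpow_nonneg hh.le _)
      calc (4:ℝ) ^ a ≤ 4 ^ (2:ℝ) := Real.rpow_le_rpow_of_exponent_le (by norm_num) h2
        _ = 16 := by norm_num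
    have := F.interp L hc hh v hW (q := fun _ => 0) (PP_const _ _) (hWD.mono hVD) (a := C * (16 * h ^ (2 * γ))) (b := C * (16 * h ^ (2 * γ - 1))) (d := C)
      fun z hz => by
        obtain ⟨b1, b2, -, b4⟩ := hb z (hVD hz)
        have h0 := (H.rho_pos (hVD hz)).le
        simp only [sub_zero]
        exact ⟨b1.trans (mul_le_mul_of_nonneg_left ((Real.rpow_le_rpow h0 (hg z hz) (by linarith)).trans (hp _ (by linarith) (by linarith))) hC),
          b2.trans (mul_le_mul_of_nonneg_left ((Real.rpow_le_rpow h0 (hg z hz) (by linarith)).trans (hp _ (by linarith) (by linarith))) hC), b4⟩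
    set Q := h ^ (2 * γ - 2)
    have e1 : h ^ (2 * γ - 1) = Q * h := by
      rw [show 2 * γ - 1 = 2 * γ - 2 + 1 by ring, Real.rpow_add_one hh.ne']
    have e2 : h ^ (2 * γ) = Q * h ^ 2 := by
      rw [show 2 * γ = 2 * γ - 2 + (2:ℕ) by push_cast; ring, Real.rpow_add_natCast hh.ne']
    have hQ : 1 ≤ Q := Real.one_le_rpow_of_pos_of_le_one_of_nonpos hh hh1 (by linarith)
    have hCQ : C ≤ C * Q := le_mul_of_one_le_right hC hQ
    have hCQ0 : 0 ≤ C * Q := by positivity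
    refine ⟨16 * (3 + A) * C * Q, by positivity, fun z hz => ?_⟩
    obtain ⟨-, t2, t3⟩ := this z hz
    rw [e1, e2] at t2
    rw [e2] at t3
    have e3 : A * h⁻¹ * (C * (16 * (Q * h ^ 2))) = 16 * A * C * Q * h := by field_simp
    have e4 : A * (h⁻¹) ^ 2 * (C * (16 * (Q * h ^ 2))) = 16 * A * C * Q := by field_simp
    rw [e3] at t2; rw [e4] at t3
    refine ⟨t2.trans ?_, t3.trans ?_, ?_⟩
    · nlinarith [mul_nonneg hCQ0 hh.le]
    · nlinarith
    · have h5 := hmon h (H.rho z) (H.rho_pos (hVD hz)) (hg z hz)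
      have h6 : 0 ≤ 16 * (3 + A) * C := by positivity
      calc 16 * (3 + A) * C * Q ≤ 16 * (3 + A) * C * (4 * H.rho z ^ (2 * γ - 2)) := mul_le_mul_of_nonneg_left h5 h6
        _ = _ := by ring
end FE

structure KP {D : Set E3} (H : HRep D) (K : Ker) {c h : ℝ} {r : ℕ} (F : FE D c h r) (ε γ C : ℝ) (x : E3) (k w : E3 → ℝ) (P : F.ι → ℝ) : Prop where
  vk : VV D k
  vw : VV D w
  id : ∀ v, VV D v → ∫ z, v z * rs K (ε * h) x z = aa v k - aa v w
  ck : ∀ v, ContDiffOn ℝ 2 (fun y => k y - F.I k y) (F.V v)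
  cw : ∀ v, ContDiffOn ℝ 2 (fun y => w y - F.I w y) (F.V v)
  bk : ∀ v, ∀ z ∈ F.V v, |k z - F.I k z| ≤ C * h ^ 3 * ((‖F.o v - x‖ + h)⁻¹) ^ 4 ∧
    ‖gradient (fun y => k y - F.I k y) z‖ ≤ C * h ^ 2 * ((‖F.o v - x‖ + h)⁻¹) ^ 4 ∧
    |lap (fun y => k y - F.I k y) z| ≤ C * h * ((‖F.o v - x‖ + h)⁻¹) ^ 4
  P0 : ∀ v, 0 ≤ P v
  bw : ∀ v, ∀ z ∈ F.V v, ‖gradient (fun y => w y - F.I w y) z‖ ≤ h * P v ∧ |lap (fun y => w y - F.I w y) z| ≤ P v ∧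
    P v ≤ C * H.rho z ^ (2 * γ - 2)

theorem kp_exists {D : Set E3} (H : HRep D) (K : Ker) {c A ε d : ℝ} {r : ℕ} (L : LC K c r A ε) (hc : 0 < c) (hc1 : c ≤ 1) (hr : 2 ≤ r) (hd : 0 < d) :
    ∃ γ C, 1 / 2 < γ ∧ γ < 1 ∧ 0 < C ∧ ∀ h, 0 < h → h ≤ 1 → ε * h ≤ d → ∀ (F : FE D c h r) x, closedBall x d ⊆ D →
      ∃ k w P, KP H K F ε γ C x k w P := by
  obtain ⟨γ, C0, hγ0, hγ1, hC0, hG⟩ := H.green_exists K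
  have he := L.e0
  have hA := L.A1
  have hKC := K.Cpos
  have hk2 : ContDiff ℝ 2 K.k := K.hk.of_le ENat.LEInfty.out
  obtain ⟨B0, hB0, b1, b2, b3⟩ := cs_bounds hk2 (HasCompactSupport.of_support_subset_isCompact (isCompact_closedBall (0:E3) 1) fun z hz => by
    by_contra h; rw [mem_closedBall, dist_zero_right, not_le] at h; exact hz (K.k_supp z h))
  set B := (d⁻¹) ^ 3 * B0 + (d⁻¹) ^ 3 * d⁻¹ * B0 + (d⁻¹) ^ 3 * d⁻¹ ^ 2 * B0
  have hB : 0 < B := by positivity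
  obtain ⟨s1, s2⟩ := scale_bounds hk2 ((d⁻¹) ^ 3) d⁻¹ b2 b3
  rw [abs_of_pos (by positivity), abs_of_pos (by positivity : 0 < d⁻¹)] at s1 s2
  set g : E3 → ℝ := fun y => (d⁻¹) ^ 3 * K.k (d⁻¹ • y)
  have hg : ContDiff ℝ 2 g := contDiff_const.mul (hk2.comp (contDiff_const_smul _))
  refine ⟨γ, (3 + A) * (K.C * (2 / ε) ^ 4) + 64 * (3 + A) * (C0 * B + B), hγ0, hγ1, by positivity, ?_⟩
  intro h hh hh1 hd' F x hx
  have hs : 0 < ε * h := by positivity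
  set k : E3 → ℝ := fun z => K.Φ d (ε * h) (z - x)
  have hkc : ContDiff ℝ ∞ k := (K.hΦ d _ hs hd').comp (contDiff_id.sub contDiff_const)
  have hkc2 : ContDiff ℝ 2 k := hkc.of_le ENat.LEInfty.out
  have hnx : ∀ z, z ∉ D → d < ‖z - x‖ := fun z hz => by
    by_contra hn; exact hz (hx (by rw [mem_closedBall, dist_eq_norm]; linarith))
  have hk0 : ∀ z, z ∉ D → k z = 0 := fun z hz => K.Φ_supp d _ _ hs hd' (hnx z hz).le
  have hkl : ∃ l, LipschitzWith l k := by
    refine ContDiff.lipschitzWith_of_hasCompactSupport (HasCompactSupport.of_support_subset_isCompact H.bdd.isCompact_closure fun z hz => ?_) (hkc2.of_le one_le_two) one_ne_zero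
    by_contra h; exact hz (hk0 z fun h' => h (subset_closure h'))
  have hvk : VV D k := ⟨hkl, hk0⟩
  set f : E3 → ℝ := fun z => g (z - x)
  have hf : ContDiff ℝ 2 f := hg.comp (contDiff_id.sub contDiff_const)
  have p1 : 0 ≤ (d⁻¹) ^ 3 * B0 := by positivity
  have p2 : 0 ≤ (d⁻¹) ^ 3 * d⁻¹ * B0 := by positivity
  have p3 : 0 ≤ (d⁻¹) ^ 3 * d⁻¹ ^ 2 * B0 := by positivity
  have hfB : ∀ z, |f z| ≤ B := fun z => by
    have : |f z| ≤ (d⁻¹) ^ 3 * B0 := by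
      simp only [f, g]; rw [abs_mul, abs_of_pos (by positivity)]; exact mul_le_mul_of_nonneg_left (b1 _) (by positivity)
    simp only [B]; linarith
  have hfd : fderiv ℝ f = fun z => fderiv ℝ g (z - x) := funext fun z => fderiv_comp_sub x
  obtain ⟨w, wl, w0, wD, wb, wI⟩ := hG f B hB.le hf (fun z hz => by
      simp only [f, g]; rw [K.k_supp, mul_zero]
      rw [norm_smul, Real.norm_of_nonneg (by positivity), ← div_eq_inv_mul, lt_div_iff₀ hd, one_mul]; exact hnx z hz) hfB
    (fun z => by rw [hfd]; refine (s1 _).trans ?_; simp only [B]; linarith)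
    (fun z => by
      have : fderiv ℝ (fun z => fderiv ℝ g (z - x)) z = fderiv ℝ (fderiv ℝ g) (z - x) := fderiv_comp_sub x
      rw [hfd, this]; refine (s2 _).trans ?_; simp only [B]; linarith)
  have hwc : Continuous w := by obtain ⟨l, hl⟩ := wl; exact hl.continuous
  have := fun v => F.interpW H L hc hh hh1 hr hγ0 hγ1 (C := C0 * B + B) (by positivity) hwc wD (fun z hz => by
    obtain ⟨t1, t2, t3, t4⟩ := wb z hz
    have hm : ∀ a : ℝ, C0 * B * H.rho z ^ a ≤ (C0 * B + B) * H.rho z ^ a := fun a =>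
      mul_le_mul_of_nonneg_right (by linarith) (Real.rpow_nonneg (H.rho_pos hz).le _)
    refine ⟨t1.trans (hm _), t2.trans (hm _), t3.trans (hm _), ?_⟩
    rw [t4, abs_neg]; linarith [hfB z, mul_pos hC0 hB]) v
  choose P hP0 hP using this
  refine ⟨k, w, P, ⟨hvk, ⟨wl, w0⟩, fun v hv => ?_, fun v => F.cd_sub v hkc2.contDiffOn,
    fun v => F.cd_sub v (wD.mono (F.VD H.isOpen H.convex v)), fun v z hz => ?_, hP0, fun v z hz => ?_⟩⟩
  · obtain ⟨l, hl⟩ := hv.lip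
    obtain ⟨m, hm⟩ := hkl
    have e1 : aa v k = ∫ z, v z * (rs K (ε * h) x z + f z) :=
      weak_of_strong H.isOpen H.bdd H.convex hm hkc2.contDiffOn ((rs_cont K _ x).add hf.continuous) (fun z _ => by
        have e0 := lap_shift ((K.hΦ d _ hs hd').of_le ENat.LEInfty.out) x z
        have e2 := K.Φ_lap d _ (z - x) hs hd'
        rw [e2] at e0; exact e0) hl hv.zero
    have e2 : aa v w = ∫ z, v z * f z := wI v l hl hv.zero
    rw [e1, e2, ← integral_sub]
    · congr 1; funext z; ring
    · exact (hl.continuous.mul ((rs_cont K _ x).add hf.continuous)).integrable_of_hasCompactSupport ((hv.cs H.bdd).mul_right)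
    · exact (hl.continuous.mul hf.continuous).integrable_of_hasCompactSupport ((hv.cs H.bdd).mul_right)
  · obtain ⟨t1, t2, t3⟩ := F.interpK L hc hc1 hh hr hd' x v z hz
    have : (3 + A) * (K.C * (2 / ε) ^ 4) ≤ (3 + A) * (K.C * (2 / ε) ^ 4) + 64 * (3 + A) * (C0 * B + B) := by
      have : 0 ≤ 64 * (3 + A) * (C0 * B + B) := by positivity
      linarith
    exact ⟨t1.trans (by gcongr), t2.trans (by gcongr), t3.trans (by gcongr)⟩
  · obtain ⟨t1, t2, t3⟩ := hP v z hz
    refine ⟨t1, t2, t3.trans (mul_le_mul_of_nonneg_right ?_ (Real.rpow_nonneg (H.rho_pos (F.VD H.isOpen H.convex v hz)).le _))⟩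
    have : 0 ≤ (3 + A) * (K.C * (2 / ε) ^ 4) := by positivity
    linarith
end

section
def sg (y : E3) (a t : ℝ) (z : E3) : ℝ := min (‖z - y‖ + a) t

theorem sg_lip (y : E3) (a t : ℝ) : LipschitzWith 1 (sg y a t) := by
  have h1 : LipschitzWith 1 fun z : E3 => ‖z - y‖ + a := LipschitzWith.of_dist_le_mul fun z w => by
    rw [Real.dist_eq, dist_eq_norm, NNReal.coe_one, one_mul, add_sub_add_right_eq_sub]
    simpa using abs_norm_sub_norm_le (z - y) (w - y)
  have := h1.min (LipschitzWith.const t)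
  rw [max_eq_left zero_le_one] at this; exact this

theorem sg_le (y : E3) (a t : ℝ) (z : E3) : sg y a t z ≤ t := min_le_right _ _
theorem sg_ge (y : E3) {a t : ℝ} (h : a ≤ t) (z : E3) : a ≤ sg y a t z := le_min (by linarith [norm_nonneg (z - y)]) h
theorem sg_sub (y : E3) (a t : ℝ) (z w : E3) : sg y a t z ≤ sg y a t w + ‖z - w‖ := by
  have := (sg_lip y a t).dist_le_mul z w
  rw [Real.dist_eq, NNReal.coe_one, one_mul, dist_eq_norm] at this
  linarith [le_abs_self (sg y a t z - sg y a t w)]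

theorem sg4 (y : E3) {a t : ℝ} (ha : 0 ≤ a) (hat : a ≤ t) : (∃ k : ℝ≥0, LipschitzWith k fun z => sg y a t z ^ 4) ∧ ∀ z, |sg y a t z ^ 4| ≤ t ^ 4 := by
  have ht : 0 ≤ t := ha.trans hat
  have h0 : ∀ z, 0 ≤ sg y a t z := fun z => ha.trans (sg_ge y hat z)
  refine ⟨⟨(4 * t ^ 3).toNNReal, LipschitzWith.of_dist_le_mul fun z w => ?_⟩, fun z => ?_⟩
  · have h1 := (sg_lip y a t).dist_le_mul z w
    rw [NNReal.coe_one, one_mul, Real.dist_eq] at h1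
    rw [Real.dist_eq, Real.coe_toNNReal _ (by positivity), show sg y a t z ^ 4 - sg y a t w ^ 4 = ((sg y a t z + sg y a t w) * (sg y a t z ^ 2 + sg y a t w ^ 2)) * (sg y a t z - sg y a t w) by ring, abs_mul]
    have := h0 z; have := h0 w; have := sg_le y a t z; have := sg_le y a t w
    refine mul_le_mul ?_ h1 (abs_nonneg _) (by positivity)
    rw [abs_of_nonneg (by positivity)]
    calc _ ≤ (t + t) * (t ^ 2 + t ^ 2) := by gcongr
      _ = _ := by ring
  · rw [abs_of_nonneg (by have := h0 z; positivity)]; exact pow_le_pow_left₀ (h0 z) (sg_le _ _ _ _) 4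

theorem sg_grad (y : E3) {a t : ℝ} (ha : 0 ≤ a) (hat : a ≤ t) : ∀ᵐ z, DifferentiableAt ℝ (fun z => sg y a t z ^ 4) z ∧
    ‖gradient (fun z => sg y a t z ^ 4) z‖ ≤ 4 * sg y a t z ^ 3 := by
  filter_upwards [(sg_lip y a t).ae_differentiableAt] with z hz
  have h0 : 0 ≤ sg y a t z := ha.trans (sg_ge y hat z)
  refine ⟨hz.pow 4, ?_⟩
  have h1 := grad_le (sg_lip y a t) z
  rw [norm_grad] at h1 ⊢
  have := hz.hasFDerivAt.pow 4
  rw [this.fderiv, norm_smul]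
  simp only [NNReal.coe_one] at h1
  rw [Real.norm_of_nonneg (by positivity)]
  norm_num
  nlinarith [pow_nonneg h0 3]

theorem wt_alg {M s B N E P Q x : ℝ} (m1 : s ^ 4 ≤ 16 * M) (m2 : M ≤ 6 * s ^ 4) (m3 : 0 < M) (hN : 0 ≤ N) (hB : 0 ≤ B) (hs : 0 < s)
    (hE : 0 ≤ E) (hP : 0 ≤ P) (hQ : 0 ≤ Q) (hq : Q ≤ E) (hx0 : 0 ≤ x) (hx : x ≤ B * s ^ 3 * N) :
    M * (Q * P) + x * (Q + P) ≤ 1 / 2 * (M * P ^ 2) + (7 * s ^ 4 * E ^ 2 + 17 * B ^ 2 * s ^ 2 * N ^ 2) := by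
  have h7 : x * (Q + P) ≤ B * s ^ 3 * N * (E + P) := by gcongr
  have h8 : M * (Q * P) ≤ M * (E * P) := by gcongr
  have a1 := mul_nonneg m3.le (sq_nonneg (P / 2 - E))
  have a2 := mul_le_mul_of_nonneg_right m2 (sq_nonneg E)
  have a3 := sq_nonneg (s ^ 2 * P / 8 - 4 * B * s * N)
  have a4 := mul_le_mul_of_nonneg_right m1 (sq_nonneg P)
  have a5 := sq_nonneg (s ^ 2 * E - B * s * N)
  have a6 := sq_nonneg (s ^ 2 * E)
  have a7 := sq_nonneg (B * s * N)
  ring_nf at *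
  linarith

namespace FE
variable {D : Set E3} {c h : ℝ} {r : ℕ} (F : FE D c h r)

theorem sg_cmp {y : E3} {a t : ℝ} (hh : 0 < h) (ha : 2 * h ≤ a) (hat : a ≤ t) (v : F.ι) {z : E3} (hz : z ∈ closedBall (F.o v) h) :
    sg y a t (F.o v) ≤ 2 * sg y a t z ∧ sg y a t z ≤ 3 / 2 * sg y a t (F.o v) ∧
    |sg y a t z ^ 4 - sg y a t (F.o v) ^ 4| ≤ 10 * sg y a t (F.o v) ^ 3 * h := by
  rw [mem_closedBall, dist_eq_norm] at hz
  have h1 := sg_sub y a t z (F.o v)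
  have h2 := sg_sub y a t (F.o v) z
  rw [norm_sub_rev] at h2
  have h3 := sg_ge y hat (F.o v)
  set s := sg y a t (F.o v)
  set u := sg y a t z
  have hu : u ≤ 3 / 2 * s := by linarith
  have hu2 : s ≤ 2 * u := by linarith
  have hs : 0 < s := by linarith
  have hu0 : 0 < u := by linarith
  refine ⟨hu2, hu, ?_⟩
  rw [show u ^ 4 - s ^ 4 = ((u + s) * (u ^ 2 + s ^ 2)) * (u - s) by ring, abs_mul, abs_of_pos (by positivity)]
  have h4 : |u - s| ≤ h := abs_le.2 ⟨by linarith, by linarith⟩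
  have h5 : (u + s) * (u ^ 2 + s ^ 2) ≤ (3 / 2 * s + s) * ((3 / 2 * s) ^ 2 + s ^ 2) := by gcongr
  refine (mul_le_mul h5 h4 (abs_nonneg _) (by positivity)).trans ?_
  have := mul_pos (pow_pos hs 3) hh
  nlinarith

theorem wt {K : Ker} {A ε : ℝ} (L : LC K c r A ε) (hDb : Bornology.IsBounded D) (hh : 0 < h) {y : E3} {a t : ℝ}
    (ha : 2 * h ≤ a) (hat : a ≤ t) {k R J : E3 → ℝ} (hk : VV D k) (hR : R ∈ F.Vh) (hJ : J ∈ F.Vh)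
    (hG : ∀ χ ∈ F.Vh, aa χ R = aa χ k) {E m : F.ι → ℝ} (hE : ∀ v, ∀ z ∈ F.V v, ‖gradient (fun y => k y - J y) z‖ ≤ E v)
    (hm0 : ∀ v, 0 ≤ m v) (hm : ∀ v, ∀ z ∈ F.τ v, |R z - J z| ≤ m v) (hm' : ∀ v, ∀ z ∈ F.V v, ‖gradient (fun y => R y - J y) z‖ ≤ h⁻¹ * m v) :
    ∫ x, sg y a t x ^ 4 * ‖gradient (fun y => R y - J y) x‖ ^ 2 ≤ 2 * om * h ^ 3 * ∑ v, (7 * sg y a t (F.o v) ^ 4 * E v ^ 2 +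
      17 * (60 * A) ^ 2 * sg y a t (F.o v) ^ 2 * (if ‖F.o v - y‖ < t + h then m v else 0) ^ 2) := by
  have hA := L.A1
  have ha0 : 0 ≤ a := by linarith
  obtain ⟨⟨kμ, hμl⟩, hμb⟩ := sg4 y ha0 hat
  have ht : 0 ≤ t := by linarith
  obtain ⟨n, hn⟩ : ∃ n : F.ι → ℝ, n = fun v => if ‖F.o v - y‖ < t + h then m v else 0 := ⟨_, rfl⟩
  have hn0 : ∀ v, 0 ≤ n v := fun v => by rw [hn]; dsimp only; split_ifs; exacts [hm0 v, le_rfl]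
  set μ : E3 → ℝ := fun z => sg y a t z ^ 4
  set ψ : E3 → ℝ := fun y => R y - J y
  have hψ : ψ ∈ F.Vh := F.Vh.sub_mem hR hJ
  have vψ := F.vv hψ
  have ve := hk.sub (F.vv hR)
  have vη := hk.sub (F.vv hJ)
  have vμ : VV D fun x => μ x * ψ x := vψ.mul hDb (B := ⟨t ^ 4, by positivity⟩) hμl hμb
  have hIm : F.I (fun x => μ x * ψ x) ∈ F.Vh := F.Imem _ vμ.zero
  set Q := F.I fun x => μ x * ψ x
  set e : E3 → ℝ := fun x => k x - R x
  have hs : ∀ v, 0 < sg y a t (F.o v) := fun v => by linarith [sg_ge y hat (F.o v)]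
  have hfar : ∀ v, ¬ ‖F.o v - y‖ < t + h → ∀ z ∈ closedBall (F.o v) h, μ z = t ^ 4 := fun v hv z hz => by
    rw [mem_closedBall, dist_eq_norm, norm_sub_rev] at hz
    have := norm_add_le (F.o v - z) (z - y)
    rw [sub_add_sub_cancel] at this
    simp only [μ, sg]; rw [min_eq_right (by linarith)]
  have hμm : ∀ v, ∀ z ∈ closedBall (F.o v) h, |μ z - μ (F.o v)| * m v ≤ 10 * sg y a t (F.o v) ^ 3 * h * n v := fun v z hz => by
    by_cases hv : ‖F.o v - y‖ < t + h
    · rw [hn]; dsimp only; rw [if_pos hv]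
      exact mul_le_mul_of_nonneg_right (F.sg_cmp hh ha hat v hz).2.2 (hm0 v)
    · rw [hfar v hv z hz, hfar v hv _ (mem_closedBall_self hh.le)]
      have := hn0 v; have := hs v; simp; positivity
  have hμg : ∀ᵐ z, ∀ v, z ∈ F.V v → ‖gradient μ z‖ * m v ≤ 14 * sg y a t (F.o v) ^ 3 * n v := by
    filter_upwards [sg_grad y ha0 hat] with z hz v hzv
    by_cases hv : ‖F.o v - y‖ < t + h
    · rw [hn]; dsimp only; rw [if_pos hv]
      refine mul_le_mul_of_nonneg_right (hz.2.trans ?_) (hm0 v)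
      have h1 := (F.sg_cmp (y := y) hh ha hat v (F.Vs v hzv)).2.1
      have h0 := sg_ge y hat z
      calc 4 * sg y a t z ^ 3 ≤ 4 * (3 / 2 * sg y a t (F.o v)) ^ 3 := by gcongr; linarith
        _ = 27 / 2 * sg y a t (F.o v) ^ 3 := by ring
        _ ≤ _ := by have := pow_pos (hs v) 3; linarith
    · have : gradient μ z = 0 := by
        have : μ =ᶠ[𝓝 z] fun _ => t ^ 4 := by
          filter_upwards [(F.Vo v).mem_nhds hzv] with w hw using hfar v hv w (F.Vs v hw)
        rw [grad_congr this]; simp [gradient]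
      rw [this]; have := hn0 v; have := hs v; simp; positivity
  have hsup : ∀ᵐ z, ∀ v, z ∈ F.V v → ‖gradient (fun x => μ x * ψ x) z - gradient Q z‖ + ‖ψ z • gradient μ z‖ ≤ 60 * A * sg y a t (F.o v) ^ 3 * n v := by
    filter_upwards [hμg, sg_grad y ha0 hat, vψ.diff] with z h1 h2 h3 v hzv
    obtain ⟨p, hp, hpe⟩ := F.poly ψ hψ v
    set μ0 := μ (F.o v)
    set f : E3 → ℝ := fun x => μ x * ψ x - (μ0 • p) x
    have hp' : μ0 • p ∈ PP r := (PP r).smul_mem _ hp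
    set S := sg y a t (F.o v) ^ 3 * n v
    have hfb : ∀ x ∈ F.τ v, |f x| ≤ 10 * S * h := fun x hx => by
      have := hμm v x (F.sub v hx)
      simp only [f, Pi.smul_apply, smul_eq_mul, ← hpe x hx]
      rw [← sub_mul, abs_mul]
      refine (mul_le_mul_of_nonneg_left (hm v x hx) (abs_nonneg _)).trans (this.trans_eq (by simp only [S]; ring))
    have hI : F.IV v (fun x => μ x * ψ x) = fun x => F.IV v f x + μ0 * p x := by
      have := F.Isub v (fun x => μ x * ψ x) (μ0 • p)
      rw [F.Irep v _ hp'] at this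
      funext x; have := congrFun this x; simp only [Pi.smul_apply, smul_eq_mul] at this
      simp only [f, Pi.smul_apply, smul_eq_mul]; linarith
    have b2 := (L.L1 F hh v f _ hfb z (F.Vτ v hzv)).2.1
    have e2 : A * h⁻¹ * (10 * S * h) = 10 * A * S := by field_simp
    rw [e2, ← norm_grad] at b2
    have hpz : gradient p z = gradient ψ z := grad_congr (by
      filter_upwards [(F.Vo v).mem_nhds hzv] with w hw using (hpe w (F.Vτ v hw)).symm)
    have hpd : DifferentiableAt ℝ p z := (PP_smooth hp (n := 1)).differentiable one_ne_zero z
    have hfd : DifferentiableAt ℝ (F.IV v f) z := (PP_smooth (F.IP v f) (n := 1)).differentiable one_ne_zero z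
    have hQ : gradient Q z = gradient (F.IV v f) z + μ0 • gradient ψ z := by
      have : Q =ᶠ[𝓝 z] fun x => F.IV v f x - ((-μ0) • p) x := by
        filter_upwards [(F.Vo v).mem_nhds hzv] with w hw
        have := F.Ieq v (fun x => μ x * ψ x) w (F.Vτ v hw)
        rw [hI] at this; simp only [Q]; rw [this]; simp
      rw [grad_congr this, grad_sub hfd (hpd.const_smul _), grad_smul, hpz, neg_smul, sub_neg_eq_add]
    have hg : gradient (fun x => μ x * ψ x) z = μ z • gradient ψ z + ψ z • gradient μ z := grad_mul h2.1 h3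
    have b1 := h1 v hzv
    have b3 : ‖ψ z • gradient μ z‖ ≤ 14 * S := by
      rw [norm_smul]
      refine (mul_le_mul_of_nonneg_right (hm v z (F.Vτ v hzv)) (norm_nonneg _)).trans ?_
      simp only [S]; linarith
    have b4 : ‖(μ z - μ0) • gradient ψ z‖ ≤ 10 * S := by
      rw [norm_smul]
      refine (mul_le_mul_of_nonneg_left (hm' v z hzv) (norm_nonneg _)).trans ?_
      have := hμm v z (F.Vs v hzv)
      calc ‖μ z - μ0‖ * (h⁻¹ * m v) = h⁻¹ * (|μ z - μ0| * m v) := by rw [Real.norm_eq_abs]; ring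
        _ ≤ h⁻¹ * (10 * sg y a t (F.o v) ^ 3 * h * n v) := by gcongr
        _ = _ := by simp only [S]; field_simp
    have b5 : ‖gradient (fun x => μ x * ψ x) z - gradient Q z‖ ≤ 10 * S + 14 * S + 10 * A * S := by
      rw [hg, hQ, show μ z • gradient ψ z + ψ z • gradient μ z - (gradient (F.IV v f) z + μ0 • gradient ψ z) =
        (μ z - μ0) • gradient ψ z + ψ z • gradient μ z - gradient (F.IV v f) z by module]
      exact (norm_sub_le _ _).trans (add_le_add ((norm_add_le _ _).trans (add_le_add b4 b3)) b2)
    have hS : 0 ≤ S := mul_nonneg (pow_nonneg (hs v).le 3) (hn0 v)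
    nlinarith
  have hQ0 : aa Q e = 0 := by rw [(F.vv hIm).aa_sub hDb hk (F.vv hR), hG _ hIm, sub_self]
  set J0 : E3 → ℝ := fun x => μ x * ⟪gradient ψ x, gradient ψ x⟫
  have iJ : Integrable J0 := vψ.int hDb vψ hμl.continuous hμb
  have iQ := (F.vv hIm).int1 hDb ve
  have hJ0 : ∀ x, 0 ≤ J0 x := fun x => mul_nonneg (by simp only [μ]; positivity) real_inner_self_nonneg
  have key := F.pw_le hh (T := fun x => J0 x + ⟪gradient Q x, gradient e x⟫) (Y := fun x => 1 / 2 * J0 x) (iJ.add iQ) (iJ.const_mul _)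
    (fun x hx => by simp only [J0]; rw [vψ.off hx, ve.off hx]; simp) (fun x => by have := hJ0 x; positivity)
    (X := fun v => 7 * sg y a t (F.o v) ^ 4 * E v ^ 2 + 17 * (60 * A) ^ 2 * sg y a t (F.o v) ^ 2 * n v ^ 2)
    (fun v => by have := hs v; have := hn0 v; positivity) (by
      filter_upwards [hsup, sg_grad y ha0 hat, vψ.diff, vη.diff] with z h1 h2 h3 h4 v hzv
      have b1 := h1 v hzv
      have hg : gradient (fun x => μ x * ψ x) z = μ z • gradient ψ z + ψ z • gradient μ z := grad_mul h2.1 h3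
      have he : gradient e z = gradient (fun y => k y - J y) z - gradient ψ z := by
        rw [← grad_sub h4 h3]; congr 1; funext x; simp only [e, ψ]; ring
      have hq := hE v z hzv
      set q := gradient (fun y => k y - J y) z
      set p := gradient ψ z
      set X := gradient (fun x => μ x * ψ x) z - gradient Q z
      set Z := ψ z • gradient μ z
      have e1 : J0 z + ⟪gradient Q z, gradient e z⟫ = μ z * ⟪q, p⟫ - ⟪X - Z, q - p⟫ := by
        have e2 : gradient Q z = μ z • p + Z - X := by simp only [X]; rw [hg]; abel
        rw [e2, he]; simp only [J0, inner_sub_left, inner_add_left, inner_sub_right, inner_smul_left]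
        simp [real_inner_comm q p]; ring
      rw [e1]
      have h5 : μ z * ⟪q, p⟫ ≤ μ z * (‖q‖ * ‖p‖) := mul_le_mul_of_nonneg_left (real_inner_le_norm _ _) (by simp only [μ]; positivity)
      have h6 : -⟪X - Z, q - p⟫ ≤ (‖X‖ + ‖Z‖) * (‖q‖ + ‖p‖) := by
        have := (abs_real_inner_le_norm (X - Z) (q - p)).trans (mul_le_mul (norm_sub_le X Z) (norm_sub_le q p) (norm_nonneg _) (by positivity))
        linarith [neg_abs_le ⟪X - Z, q - p⟫]
      have hJz : J0 z = μ z * ‖p‖ ^ 2 := by simp only [J0]; rw [real_inner_self_eq_norm_sq]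
      rw [hJz]
      obtain ⟨c1, c2, -⟩ := F.sg_cmp (y := y) hh ha hat v (F.Vs v hzv)
      have hsv := hs v
      have hnv := hn0 v
      obtain ⟨s, hs'⟩ : ∃ s, s = sg y a t (F.o v) := ⟨_, rfl⟩
      rw [← hs'] at b1 c1 c2 hsv ⊢
      have m1 : s ^ 4 ≤ 16 * μ z := by
        have := pow_le_pow_left₀ hsv.le c1 4
        rw [mul_pow] at this; simp only [μ]; linarith
      have m2 : μ z ≤ 6 * s ^ 4 := by
        have := pow_le_pow_left₀ (by linarith : 0 ≤ sg y a t z) c2 4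
        rw [mul_pow] at this; simp only [μ]; linarith [pow_pos hsv 4]
      have m3 : 0 < μ z := by linarith [pow_pos hsv 4]
      obtain ⟨M, hM⟩ : ∃ M, M = μ z := ⟨_, rfl⟩
      rw [← hM] at m1 m2 m3 h5 ⊢
      obtain ⟨P, hP⟩ : ∃ P, P = ‖p‖ := ⟨_, rfl⟩
      have hP0 : 0 ≤ P := hP ▸ norm_nonneg _
      obtain ⟨Q', hQ'⟩ : ∃ Q, Q = ‖q‖ := ⟨_, rfl⟩
      have hQ0' : 0 ≤ Q' := hQ' ▸ norm_nonneg _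
      rw [← hP, ← hQ'] at h5 h6
      rw [← hP]; rw [← hQ'] at hq
      obtain ⟨B, hB⟩ : ∃ B, B = 60 * A := ⟨_, rfl⟩
      have hB0 : 0 ≤ B := by linarith
      rw [← hB] at b1 ⊢
      have := wt_alg m1 m2 m3 hnv hB0 hsv (hQ0'.trans hq) hP0 hQ0' hq (by positivity) b1
      linarith)
  rw [integral_add iJ iQ, show ∫ x, ⟪gradient Q x, gradient e x⟫ = 0 from hQ0, integral_const_mul] at key
  have e3 : ∫ x, sg y a t x ^ 4 * ‖gradient ψ x‖ ^ 2 = ∫ x, J0 x := by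
    congr 1; funext x; simp only [J0, μ]; rw [real_inner_self_eq_norm_sq]
  rw [e3]
  rw [hn] at key; linarith
end FE
end

section
theorem VV.aa_cs {D : Set E3} (hDo : IsOpen D) (hDc : Convex ℝ D) (hDb : Bornology.IsBounded D) {e η W Q : E3 → ℝ} {B : ℝ} (he : VV D e)
    (hW : Continuous W) (hB : ∀ x, |W x| ≤ B) (hW0 : ∀ x, 0 ≤ W x) (hQ : IntegrableOn Q D) (hQ0 : ∀ x ∈ D, 0 ≤ Q x)
    (hle : ∀ᵐ x, x ∈ D → ‖gradient η x‖ ^ 2 ≤ W x * Q x) :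
    aa e η ^ 2 ≤ (∫ x, W x * ‖gradient e x‖ ^ 2) * ∫ x in D, Q x := by
  rw [← integral_indicator hDo.measurableSet]
  have h1 : |aa e η| ≤ ∫ x, |⟪gradient e x, gradient η x⟫| := by
    unfold aa; exact norm_integral_le_integral_norm (fun x => ⟪gradient e x, gradient η x⟫)
  refine (sq_le_sq' (by linarith [neg_abs_le (aa e η)]) ((le_abs_self _).trans h1)).trans ?_
  have hi := he.int hDb he hW hB
  simp only [real_inner_self_eq_norm_sq] at hi
  refine _root_.cs (fun _ => abs_nonneg _) hi ((integrable_indicator_iff hDo.measurableSet).2 hQ) (fun x => mul_nonneg (hW0 x) (sq_nonneg _))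
    (fun x => indicator_nonneg hQ0 x) ?_
  filter_upwards [ae_D hDc, hle] with x hx h2
  rcases hx with hx | hx
  · rw [indicator_of_mem hx]
    have := pow_le_pow_left₀ (abs_nonneg _) (abs_real_inner_le_norm (gradient e x) (gradient η x)) 2
    rw [mul_pow] at this
    nlinarith [mul_le_mul_of_nonneg_left (h2 hx) (sq_nonneg ‖gradient e x‖)]
  · rw [he.off hx]; simp [show x ∉ D from fun h => hx (subset_closure h)]

theorem iadd {D : Set E3} {f g : E3 → ℝ} (hf : IntegrableOn f D) (hg : IntegrableOn g D) : IntegrableOn (fun x => f x + g x) D := hf.add hg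

theorem sgX (y : E3) {a t : ℝ} (ha : 0 < a) (hat : a ≤ t) (z : E3) :
    1 = sg y a t z ^ 4 * ((‖z - y‖ + a)⁻¹) ^ 4 ∧ ‖z - y‖ ≤ t ∨ 1 = sg y a t z ^ 4 * (t⁻¹) ^ 4 := by
  have := norm_nonneg (z - y)
  unfold sg
  rcases le_total (‖z - y‖ + a) t with h | h
  · rw [min_eq_left h, ← mul_pow, mul_inv_cancel₀ (by positivity)]; left; exact ⟨by norm_num, by linarith⟩
  · right; rw [min_eq_right h, ← mul_pow, mul_inv_cancel₀ (by linarith)]; norm_num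

theorem T1_alg {s S g i q X T : ℝ} (hg : 0 < g) (hs : 0 < s) (hS : 0 < S) (h1 : S ≤ s + g⁻¹) (hi : g ≤ i) (hq : 1 ≤ s * q)
    (h : 1 ≤ s ^ 4 * (X + T)) : g ^ 4 ≤ s ^ 4 * ((S⁻¹) ^ 2 * (2 * q ^ 2 * g ^ 4 + 2 * i ^ 2 * X + 2 * i ^ 2 * T)) := by
  have e : s ^ 4 * ((S⁻¹) ^ 2 * (2 * q ^ 2 * g ^ 4 + 2 * i ^ 2 * X + 2 * i ^ 2 * T)) = (s ^ 4 * (2 * q ^ 2 * g ^ 4 + 2 * i ^ 2 * X + 2 * i ^ 2 * T)) / S ^ 2 := by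
    rw [inv_pow]; field_simp
  rw [e, le_div_iff₀ (by positivity)]
  have h2 : S * g ≤ s * g + 1 := by
    have := mul_le_mul_of_nonneg_right h1 hg.le
    rwa [add_mul, inv_mul_cancel₀ hg.ne'] at this
  have h3 : (S * g) ^ 2 ≤ 2 * (s * g) ^ 2 + 2 := (pow_le_pow_left₀ (by positivity) h2 2).trans (by nlinarith [sq_nonneg (s * g - 1)])
  have h4 : (1:ℝ) ≤ (s * q) ^ 2 := one_le_pow₀ hq
  have h5 : g ^ 2 ≤ i ^ 2 := pow_le_pow_left₀ hg.le hi 2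
  have h6 : i ^ 2 * 1 ≤ i ^ 2 * (s ^ 4 * (X + T)) := by gcongr
  have h7 : s ^ 2 * g ^ 4 * 1 ≤ s ^ 2 * g ^ 4 * (s * q) ^ 2 := by gcongr
  have h8 := mul_le_mul_of_nonneg_right h3 (sq_nonneg g)
  nlinarith

namespace FE
variable {D : Set E3} {H : HRep D} {K : Ker} {c h ε γ C a t : ℝ} {r : ℕ} {F : FE D c h r} {x' y : E3} {k' w' e : E3 → ℝ} {P' : F.ι → ℝ}

theorem g_cont (hh : 0 < h) (o : E3) : Continuous fun z : E3 => ((‖z - o‖ + h)⁻¹) ^ 4 :=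
  (Continuous.inv₀ (by fun_prop) fun z => by positivity).pow 4

theorem g_int (hh : 0 < h) (o : E3) : ∫ z in D, ((‖z - o‖ + h)⁻¹) ^ 4 ≤ h⁻¹ * kI 4 := by
  obtain ⟨h1, h2⟩ := kI_int (le_refl 4) hh o
  have := setIntegral_le_integral (s := D) h1 (Eventually.of_forall fun x => by positivity)
  rw [h2] at this
  rw [show h ^ 3 * (h⁻¹) ^ 4 = h⁻¹ by field_simp] at this; exact this

theorem T1 (hh : 0 < h) (ha : h ≤ a) (hat : a ≤ t) (he : VV D e) (hC : 0 ≤ C) (hK : KP H K F ε γ C x' k' w' P') (v : F.ι)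
    (hx : x' ∈ closedBall (F.o v) h) : sg y a t (F.o v) ^ 2 * aa e (fun y => k' y - F.I k' y) ^ 2 ≤
      (∫ x, (sg y a t x ^ 4 * ((‖x - F.o v‖ + h)⁻¹) ^ 4) * ‖gradient e x‖ ^ 2) *
        (81 ^ 2 * C ^ 2 * 2 * (2 * kI 4 + (t⁻¹) ^ 4 * volume.real D) * (h ^ 2 * a⁻¹ + h ^ 2)) := by
  have ha0 : 0 < a := by linarith
  have ht0 : 0 < t := by linarith
  set S := sg y a t (F.o v)
  have hS : 0 < S := by linarith [sg_ge y hat (F.o v)]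
  obtain ⟨⟨kμ, hμl⟩, hμb⟩ := sg4 y ha0.le hat
  have i1 := int_cont H.bdd (g_cont hh (F.o v))
  have i2 := int_cont H.bdd (g_cont ha0 y)
  have i3 : IntegrableOn (fun _ : E3 => 2 * (h⁻¹) ^ 2 * (t⁻¹) ^ 4) D := int_cont H.bdd continuous_const
  have hkI := kI_nn 4
  set q := 81 ^ 2 * C ^ 2 * h ^ 4
  have key := VV.aa_cs H.isOpen H.convex H.bdd (B := t ^ 4 * (h⁻¹) ^ 4) (η := fun y => k' y - F.I k' y)
    (W := fun x => sg y a t x ^ 4 * ((‖x - F.o v‖ + h)⁻¹) ^ 4) (Q := fun z => q * ((S⁻¹) ^ 2 * (2 * (a⁻¹) ^ 2 * ((‖z - F.o v‖ + h)⁻¹) ^ 4 +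
      2 * (h⁻¹) ^ 2 * ((‖z - y‖ + a)⁻¹) ^ 4 + 2 * (h⁻¹) ^ 2 * (t⁻¹) ^ 4))) he
    (hμl.continuous.mul (g_cont hh _)) (fun x => by
      rw [abs_mul, abs_of_nonneg (by positivity : (0:ℝ) ≤ ((‖x - F.o v‖ + h)⁻¹) ^ 4)]
      refine mul_le_mul (hμb x) ?_ (by positivity) (by positivity)
      gcongr; linarith [norm_nonneg (x - F.o v)]) (fun x => by positivity)
    (((iadd (iadd (i1.const_mul _) (i2.const_mul _)) i3).const_mul _).const_mul _) (fun x _ => by positivity) (by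
      filter_upwards [F.ae_cover] with z hz hzD
      obtain ⟨u, hu⟩ := hz (subset_closure hzD)
      have b := (hK.bk u z hu).2.1
      have hz1 := F.Vs u hu
      rw [mem_closedBall, dist_eq_norm] at hz1 hx
      have n1 : ‖z - F.o v‖ ≤ ‖z - F.o u‖ + ‖F.o u - x'‖ + ‖x' - F.o v‖ := by
        refine le_trans (le_of_eq ?_) (norm_add₃_le (a := z - F.o u) (b := F.o u - x') (c := x' - F.o v)); congr 1; abel
      have n0 := norm_nonneg (F.o u - x')
      have g1 : (‖F.o u - x'‖ + h)⁻¹ ≤ 3 * (‖z - F.o v‖ + h)⁻¹ := by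
        rw [← div_eq_mul_inv, inv_eq_one_div, div_le_div_iff₀ (by positivity) (by positivity)]; linarith
      obtain ⟨g, hg⟩ : ∃ g, g = (‖z - F.o v‖ + h)⁻¹ := ⟨_, rfl⟩
      have hg0 : 0 < g := by rw [hg]; positivity
      have b2 : ‖gradient (fun y => k' y - F.I k' y) z‖ ≤ 81 * C * h ^ 2 * g ^ 4 := b.trans (by
        rw [← hg] at g1
        calc _ ≤ C * h ^ 2 * (3 * g) ^ 4 := by gcongr
          _ = _ := by ring)
      have s1 := sg_sub y a t (F.o v) z
      rw [norm_sub_rev] at s1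
      have s2 := sg_ge y hat z
      have := T1_alg (s := sg y a t z) (S := S) (i := h⁻¹) (q := a⁻¹) (X := ((‖z - y‖ + a)⁻¹) ^ 4) (T := (t⁻¹) ^ 4) hg0 (by linarith) hS (by rw [hg, inv_inv]; linarith)
        (by rw [hg]; gcongr; linarith [norm_nonneg (z - F.o v)]) (by rw [← div_eq_mul_inv, le_div_iff₀ ha0]; linarith) (by
          have p1 : 0 ≤ sg y a t z ^ 4 * ((‖z - y‖ + a)⁻¹) ^ 4 := by positivity
          have p2 : 0 ≤ sg y a t z ^ 4 * (t⁻¹) ^ 4 := by positivity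
          rcases sgX y ha0 hat z with h | h <;> linarith)
      rw [← hg]
      calc _ ≤ (81 * C * h ^ 2 * g ^ 4) ^ 2 := by gcongr
        _ = q * g ^ 4 * g ^ 4 := by ring
        _ ≤ _ := (mul_le_mul_of_nonneg_left this (by positivity)).trans_eq (by ring))
  rw [integral_const_mul, integral_const_mul, integral_add (iadd (i1.const_mul _) (i2.const_mul _)) i3, integral_add (i1.const_mul _) (i2.const_mul _),
    integral_const_mul, integral_const_mul, setIntegral_const, smul_eq_mul] at key
  have j1 := g_int (D := D) hh (F.o v)
  have j2 := g_int (D := D) ha0 y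
  have hJ : 0 ≤ ∫ x, (sg y a t x ^ 4 * ((‖x - F.o v‖ + h)⁻¹) ^ 4) * ‖gradient e x‖ ^ 2 := integral_nonneg fun x => by positivity
  refine (mul_le_mul_of_nonneg_left key (sq_nonneg S)).trans ?_
  rw [mul_left_comm]
  refine mul_le_mul_of_nonneg_left ?_ hJ
  have hv : 0 ≤ volume.real D := measureReal_nonneg
  calc _ ≤ S ^ 2 * (q * ((S⁻¹) ^ 2 * (2 * (a⁻¹) ^ 2 * (h⁻¹ * kI 4) + 2 * (h⁻¹) ^ 2 * (a⁻¹ * kI 4) + volume.real D * (2 * (h⁻¹) ^ 2 * (t⁻¹) ^ 4)))) := by gcongr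
    _ = 81 ^ 2 * C ^ 2 * 2 * (kI 4 * (h ^ 2 * a⁻¹ * (h * a⁻¹)) + kI 4 * (h ^ 2 * a⁻¹) + (t⁻¹) ^ 4 * volume.real D * h ^ 2) := by
      simp only [q]; field_simp
    _ ≤ 81 ^ 2 * C ^ 2 * 2 * (kI 4 * (h ^ 2 * a⁻¹ * 1) + kI 4 * (h ^ 2 * a⁻¹) + (t⁻¹) ^ 4 * volume.real D * h ^ 2) := by
      gcongr; rw [← div_eq_mul_inv, div_le_one ha0]; exact ha
    _ ≤ _ := by
      rw [mul_assoc _ (_ + _) (_ + _)]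
      refine mul_le_mul_of_nonneg_left ?_ (by positivity)
      have : 0 ≤ (t⁻¹) ^ 4 * volume.real D * (h ^ 2 * a⁻¹) := by positivity
      have : 0 ≤ kI 4 * h ^ 2 := by positivity
      linarith

theorem T2 (hh : 0 < h) (ha : h ≤ a) (hat : a ≤ t) (he : VV D e) (hγ : 1 / 2 < γ) (hγ1 : γ < 1) (hK : KP H K F ε γ C x' k' w' P')
    (hy : 2 * t ≤ H.lam y) : aa e (fun y => w' y - F.I w' y) ^ 2 ≤ (∫ x, sg y a t x ^ 4 * ‖gradient e x‖ ^ 2) *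
        (C ^ 2 * (t ^ (4 * γ - 4) * kI 4 + (t⁻¹) ^ 4 * ∫ z in D, H.rho z ^ (4 * γ - 4)) * (h ^ 2 * a⁻¹ + h ^ 2)) := by
  have ha0 : 0 < a := by linarith
  have ht0 : 0 < t := by linarith
  obtain ⟨⟨kμ, hμl⟩, hμb⟩ := sg4 y ha0.le hat
  have i2 := int_cont H.bdd (g_cont ha0 y)
  have i3 : IntegrableOn (fun z => H.rho z ^ (4 * γ - 4)) D := by
    have := H.rho_int (q := 4 - 4 * γ) (by linarith) (by linarith)
    rwa [show -(4 - 4 * γ) = 4 * γ - 4 by ring] at this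
  have hkI := kI_nn 4
  have hr0 : ∀ z ∈ D, 0 ≤ H.rho z ^ (4 * γ - 4) := fun z hz => Real.rpow_nonneg (H.rho_pos hz).le _
  have hI : 0 ≤ ∫ z in D, H.rho z ^ (4 * γ - 4) := setIntegral_nonneg H.isOpen.measurableSet hr0
  have key := VV.aa_cs H.isOpen H.convex H.bdd (B := t ^ 4) (η := fun y => w' y - F.I w' y) (W := fun x => sg y a t x ^ 4)
    (Q := fun z => C ^ 2 * h ^ 2 * (t ^ (4 * γ - 4) * ((‖z - y‖ + a)⁻¹) ^ 4 + (t⁻¹) ^ 4 * H.rho z ^ (4 * γ - 4))) he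
    hμl.continuous hμb (fun x => by positivity) ((iadd (i2.const_mul _) (i3.const_mul _)).const_mul _)
    (fun x hx => by have := hr0 x hx; positivity) (by
      filter_upwards [F.ae_cover] with z hz hzD
      obtain ⟨u, hu⟩ := hz (subset_closure hzD)
      obtain ⟨b1, -, b2⟩ := hK.bw u z hu
      have hρ := H.rho_pos hzD
      have hq := hr0 z hzD
      have hle : H.rho z ^ (4 * γ - 4) ≤ sg y a t z ^ 4 * (t ^ (4 * γ - 4) * ((‖z - y‖ + a)⁻¹) ^ 4 + (t⁻¹) ^ 4 * H.rho z ^ (4 * γ - 4)) := by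
        rcases sgX y ha0 hat z with ⟨h1, h2⟩ | h1
        · have l1 := H.lam_lip y z
          rw [norm_sub_rev] at l1
          have := Real.rpow_le_rpow_of_nonpos ht0 (show t ≤ H.rho z by linarith [H.lam_le_rho z]) (show 4 * γ - 4 ≤ 0 by linarith)
          rw [mul_add, mul_left_comm, ← h1]
          have : 0 ≤ sg y a t z ^ 4 * ((t⁻¹) ^ 4 * H.rho z ^ (4 * γ - 4)) := by positivity
          linarith
        · rw [mul_add, ← mul_assoc _ ((t⁻¹) ^ 4), ← h1]
          have : 0 ≤ sg y a t z ^ 4 * (t ^ (4 * γ - 4) * ((‖z - y‖ + a)⁻¹) ^ 4) := by positivity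
          linarith
      calc _ ≤ (h * (C * H.rho z ^ (2 * γ - 2))) ^ 2 := by gcongr; exact b1.trans (by gcongr)
        _ = C ^ 2 * h ^ 2 * H.rho z ^ (4 * γ - 4) := by
          rw [show 4 * γ - 4 = (2 * γ - 2) + (2 * γ - 2) by ring, Real.rpow_add hρ]; ring
        _ ≤ _ := (mul_le_mul_of_nonneg_left hle (by positivity)).trans_eq (by ring))
  rw [integral_const_mul, integral_add (i2.const_mul _) (i3.const_mul _), integral_const_mul, integral_const_mul] at key
  have hJ : 0 ≤ ∫ x, sg y a t x ^ 4 * ‖gradient e x‖ ^ 2 := integral_nonneg fun x => by positivity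
  refine key.trans (mul_le_mul_of_nonneg_left ?_ hJ)
  have j2 := g_int (D := D) ha0 y
  have ht4 : 0 ≤ t ^ (4 * γ - 4) := by positivity
  calc _ ≤ C ^ 2 * h ^ 2 * (t ^ (4 * γ - 4) * (a⁻¹ * kI 4) + (t⁻¹) ^ 4 * ∫ z in D, H.rho z ^ (4 * γ - 4)) := by gcongr
    _ ≤ _ := by
      rw [mul_assoc, mul_assoc]
      refine mul_le_mul_of_nonneg_left ?_ (by positivity)
      have : 0 ≤ t ^ (4 * γ - 4) * kI 4 * h ^ 2 := by positivity
      have : 0 ≤ ((t⁻¹) ^ 4 * ∫ z in D, H.rho z ^ (4 * γ - 4)) * (h ^ 2 * a⁻¹) := by positivity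
      linarith
end FE
end

section
namespace FE
variable {D : Set E3} {H : HRep D} {K : Ker} {c h ε γ C a t A : ℝ} {r : ℕ} {F : FE D c h r} {x' y : E3} {k w k' w' R p : E3 → ℝ} {P P' : F.ι → ℝ}

theorem rsV (L : LC K c r A ε) (hc : 0 < c) (hh : 0 < h) {v : F.ι} (hx : x' ∈ closedBall (F.o v) (c * h / 2)) :
    0 < ε * h ∧ Metric.ball x' (ε * h) ⊆ F.V v := by
  have := mul_pos hc hh
  refine ⟨mul_pos L.e0 hh, (ball_subset_ball' ?_).trans (F.Vb v)⟩
  have := mul_le_mul_of_nonneg_right L.e1 hh.le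
  rw [mem_closedBall] at hx; linarith

theorem rs_congr (L : LC K c r A ε) (hc : 0 < c) (hh : 0 < h) {v : F.ι} (hx : x' ∈ closedBall (F.o v) (c * h / 2)) {f g : E3 → ℝ}
    (hfg : ∀ z ∈ F.τ v, f z = g z) : ∫ z, f z * rs K (ε * h) x' z = ∫ z, g z * rs K (ε * h) x' z := by
  obtain ⟨h1, h2⟩ := rsV L hc hh hx
  congr 1; funext z
  by_cases hz : z ∈ Metric.ball x' (ε * h)
  · rw [hfg z (F.Vτ v (h2 hz))]
  · rw [rs_supp K h1 x' z hz, mul_zero, mul_zero]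

theorem gal (hDb : Bornology.IsBounded D) (hk : VV D k) (hR : R ∈ F.Vh) (hG : ∀ χ ∈ F.Vh, aa χ R = aa χ k) (hk' : VV D k') :
    aa (fun x => k x - R x) (fun x => k' x - F.I k' x) = aa (fun x => k x - R x) k' := by
  have hI := F.Imem k' hk'.zero
  rw [(hk.sub (F.vv hR)).aa_sub hDb hk' (F.vv hI), aa_comm _ (F.I k'), (F.vv hI).aa_sub hDb hk (F.vv hR), hG _ hI, sub_self, sub_zero]

theorem near (L : LC K c r A ε) (hc : 0 < c) (hc1 : c ≤ 1) (hh : 0 < h) (ha : h ≤ a) (hat : a ≤ t) (hC : 0 ≤ C) (hγ : 1 / 2 < γ) (hγ1 : γ < 1)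
    (hY : KP H K F ε γ C y k w P) (hK : KP H K F ε γ C x' k' w' P') (hR : R ∈ F.Vh) (hG : ∀ χ ∈ F.Vh, aa χ R = aa χ k) (v : F.ι)
    (hx : x' ∈ closedBall (F.o v) (c * h / 2)) (hy : 2 * t ≤ H.lam y) :
    sg y a t (F.o v) ^ 2 * (∫ z, (R z - F.I k z) * rs K (ε * h) x' z) ^ 2 ≤ 3 * (sg y a t (F.o v) ^ 2 * (A * (C * h ^ 3 * ((‖F.o v - y‖ + h)⁻¹) ^ 4)) ^ 2 +
      (∫ x, (sg y a t x ^ 4 * ((‖x - F.o v‖ + h)⁻¹) ^ 4) * ‖gradient (fun x => k x - R x) x‖ ^ 2) *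
        (81 ^ 2 * C ^ 2 * 2 * (2 * kI 4 + (t⁻¹) ^ 4 * volume.real D) * (h ^ 2 * a⁻¹ + h ^ 2)) +
      t ^ 2 * ((∫ x, sg y a t x ^ 4 * ‖gradient (fun x => k x - R x) x‖ ^ 2) *
        (C ^ 2 * (t ^ (4 * γ - 4) * kI 4 + (t⁻¹) ^ 4 * ∫ z in D, H.rho z ^ (4 * γ - 4)) * (h ^ 2 * a⁻¹ + h ^ 2)))) := by
  have ve := hY.vk.sub (F.vv hR)
  have vη := hY.vk.sub (F.vv (F.Imem k hY.vk.zero))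
  have hx1 : x' ∈ closedBall (F.o v) h := closedBall_subset_closedBall (by linarith [mul_le_of_le_one_left hh.le hc1]) hx
  have t1 := T1 (y := y) hh ha hat ve hC hK v hx1
  have t2 := T2 hh ha hat ve hγ hγ1 hK hy
  obtain ⟨h1, h2⟩ := rsV L hc hh hx
  have hint : ∀ f, VV D f → Integrable fun z => f z * rs K (ε * h) x' z := fun f hf => by
    obtain ⟨l, hl⟩ := hf.lip
    exact (hl.continuous.mul (rs_cont K _ _)).integrable_of_hasCompactSupport (hf.cs H.bdd).mul_right
  have e1 : ∫ z, (R z - F.I k z) * rs K (ε * h) x' z = (∫ z, (k z - F.I k z) * rs K (ε * h) x' z) - ∫ z, (k z - R z) * rs K (ε * h) x' z := by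
    rw [← integral_sub (hint _ vη) (hint _ ve)]; congr 1; funext z; ring
  have e2 := hK.id _ ve
  rw [← gal H.bdd hY.vk hR hG hK.vk, ← gal H.bdd hY.vk hR hG hK.vw] at e2
  have b0 := L.R _ h1 x' (fun z => k z - F.I k z) _ fun z hz => (hY.bk v z (h2 hz)).1
  rw [e1, e2]
  set S := sg y a t (F.o v)
  have hS0 : 0 ≤ S := by linarith [sg_ge y hat (F.o v)]
  have hS : S ^ 2 ≤ t ^ 2 := pow_le_pow_left₀ hS0 (sg_le y a t _) 2
  set α := ∫ z, (k z - F.I k z) * rs K (ε * h) x' z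
  set β1 := aa (fun x => k x - R x) (fun x => k' x - F.I k' x)
  set β2 := aa (fun x => k x - R x) (fun x => w' x - F.I w' x)
  have b1 : α ^ 2 ≤ (A * (C * h ^ 3 * ((‖F.o v - y‖ + h)⁻¹) ^ 4)) ^ 2 := sq_le_sq' (by linarith [neg_abs_le α]) ((le_abs_self α).trans b0)
  have b3 : (α - (β1 - β2)) ^ 2 ≤ 3 * (α ^ 2 + β1 ^ 2 + β2 ^ 2) := by linarith [sq_nonneg (α + β1), sq_nonneg (α - β2), sq_nonneg (β1 + β2)]
  have c1 := mul_le_mul_of_nonneg_left b3 (sq_nonneg S)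
  have c2 := mul_le_mul_of_nonneg_left b1 (sq_nonneg S)
  have c3 := mul_le_mul hS t2 (sq_nonneg _) (sq_nonneg _)
  linarith

set_option maxHeartbeats 1600000 in
/-- weighted energy of the discrete error -/
theorem close1 (H : HRep D) (L : LC K c r A ε) (hc : 0 < c) (hc1 : c ≤ 1) (ht : 0 < t) (hC : 0 < C) (hγ : 1 / 2 < γ) (hγ1 : γ < 1) :
    ∃ B : ℝ, 0 < B ∧ ∀ κ h : ℝ, 2 ≤ κ → 0 < h → h ≤ 1 → 2 * h < t → κ * h ≤ t → ∀ (F : FE D c h r),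
      (∀ x, closedBall x t ⊆ D → ∃ k w P, KP H K F ε γ C x k w P) → ∀ y k w P, 4 * t ≤ H.lam y → KP H K F ε γ C y k w P →
      ∀ R ∈ F.Vh, (∀ χ ∈ F.Vh, aa χ R = aa χ k) →
      ∫ x, sg y (κ * h) t x ^ 4 * ‖gradient (fun x => R x - F.I k x) x‖ ^ 2 ≤
        B * κ ^ 4 * h ^ 3 + B * (κ⁻¹ + h) * ∫ x, sg y (κ * h) t x ^ 4 * ‖gradient (fun x => R x - F.I k x) x‖ ^ 2 := by
  have hA := L.A1
  have hom := om_pos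
  obtain ⟨M, hM0, hM⟩ : ∃ M : ℝ, 0 < M ∧ D ⊆ closedBall 0 M := by
    obtain ⟨M, hM⟩ := H.bdd.subset_closedBall 0
    exact ⟨max M 1, by positivity, hM.trans (closedBall_subset_closedBall (le_max_left _ _))⟩
  obtain ⟨S4, hS4⟩ : ∃ s, s = 2 ^ 4 * kI 4 / (c ^ 3 * om) := ⟨_, rfl⟩
  obtain ⟨S6, hS6⟩ : ∃ s, s = 2 ^ 6 * kI 6 / (c ^ 3 * om) := ⟨_, rfl⟩
  have h4 : 0 ≤ S4 := by have := kI_nn 4; rw [hS4]; positivity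
  have h6 : 0 ≤ S6 := by have := kI_nn 6; rw [hS6]; positivity
  obtain ⟨C1, hC1⟩ : ∃ s, s = 81 ^ 2 * C ^ 2 * 2 * (2 * kI 4 + (t⁻¹) ^ 4 * volume.real D) := ⟨_, rfl⟩
  obtain ⟨C2, hC2⟩ : ∃ s, s = C ^ 2 * (t ^ (4 * γ - 4) * kI 4 + (t⁻¹) ^ 4 * ∫ z in D, H.rho z ^ (4 * γ - 4)) := ⟨_, rfl⟩
  have h1 : 0 ≤ C1 := by have := kI_nn 4; rw [hC1]; have : 0 ≤ volume.real D := measureReal_nonneg; positivity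
  have h2 : 0 ≤ C2 := by
    have := kI_nn 4
    have : 0 ≤ ∫ z in D, H.rho z ^ (4 * γ - 4) := setIntegral_nonneg H.isOpen.measurableSet fun z hz => Real.rpow_nonneg (H.rho_pos hz).le _
    rw [hC2]; positivity
  obtain ⟨q, hq⟩ : ∃ q, q = 34 * om * (60 * A) ^ 2 * (3 * A ^ 2) := ⟨_, rfl⟩
  have hq0 : 0 ≤ q := by rw [hq]; positivity
  obtain ⟨N, hN⟩ : ∃ N, N = S4 * C1 + M ^ 3 / c ^ 3 * t ^ 2 * C2 := ⟨_, rfl⟩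
  have hN0 : 0 ≤ N := by rw [hN]; positivity
  refine ⟨14 * om * C ^ 2 * S4 + q * (A ^ 2 * C ^ 2 * S6) + 2 * q * N + 24 * q * N * om * C ^ 2 * S4 + 1, by positivity, ?_⟩
  intro κ h hκ hh hh1 h2t hκt F hkp y k w P hy hY R hR hG
  set a := κ * h
  have ha : 2 * h ≤ a := by simp only [a]; gcongr
  have hah : h ≤ a := by linarith
  have hJ := F.Imem k hY.vk.zero
  have hψ : (fun x => R x - F.I k x) ∈ F.Vh := F.Vh.sub_mem hR hJ
  choose p hp hpe using F.poly _ hψ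
  choose x' hx' hL2 using fun v => L.L2 h hh (F.o v) (p v) (hp v)
  obtain ⟨G, hGd⟩ : ∃ G : F.ι → ℝ, G = fun v => (‖F.o v - y‖ + h)⁻¹ := ⟨_, rfl⟩
  have hG0 : ∀ v, 0 < G v := fun v => by rw [hGd]; positivity
  have hs0 : ∀ v, 0 < sg y a t (F.o v) := fun v => by linarith [sg_ge y hκt (F.o v)]
  have hsG : ∀ v, sg y a t (F.o v) * G v ≤ κ := fun v => by
    rw [hGd]; dsimp only; rw [← div_eq_mul_inv, div_le_iff₀ (by positivity)]
    refine (min_le_left _ _).trans ?_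
    have := le_mul_of_one_le_left (norm_nonneg (F.o v - y)) (by linarith : 1 ≤ κ)
    simp only [a]; linarith
  set m : F.ι → ℝ := fun v => A * |∫ z, p v z * rs K (ε * h) (x' v) z|
  have W := F.wt (y := y) L H.bdd hh ha hκt hY.vk hR hJ hG (E := fun v => C * h ^ 2 * G v ^ 4) (m := m)
    (fun v z hz => by rw [hGd]; exact (hY.bk v z hz).2.1) (fun v => by positivity)
    (fun v z hz => by rw [hpe v z hz]; exact (hL2 v z (F.sub v hz)).1) (fun v z hz => by
      have : (fun x => R x - F.I k x) =ᶠ[𝓝 z] p v := by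
        filter_upwards [(F.Vo v).mem_nhds hz] with x hx using hpe v x (F.Vτ v hx)
      rw [grad_congr this, norm_grad]
      exact (hL2 v z (F.Vs v hz)).2.trans_eq (by simp only [m]; ring))
  obtain ⟨Jp, hJp⟩ : ∃ J, J = ∫ x, sg y a t x ^ 4 * ‖gradient (fun x => R x - F.I k x) x‖ ^ 2 := ⟨_, rfl⟩
  obtain ⟨Je, hJe⟩ : ∃ J, J = ∫ x, sg y a t x ^ 4 * ‖gradient (fun x => k x - R x) x‖ ^ 2 := ⟨_, rfl⟩
  have hJe0 : 0 ≤ Je := by rw [hJe]; exact integral_nonneg fun x => by positivity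
  have hJp0 : 0 ≤ Jp := by rw [hJp]; exact integral_nonneg fun x => by positivity
  obtain ⟨W', hW'⟩ : ∃ W' : F.ι → ℝ, W' = fun v => ∫ x, (sg y a t x ^ 4 * ((‖x - F.o v‖ + h)⁻¹) ^ 4) * ‖gradient (fun x => k x - R x) x‖ ^ 2 := ⟨_, rfl⟩
  have hE : ∀ v, sg y a t (F.o v) ^ 4 * (C * h ^ 2 * G v ^ 4) ^ 2 ≤ κ ^ 4 * C ^ 2 * h ^ 4 * G v ^ 4 := fun v => by
    have := hG0 v; have := hs0 v
    calc _ = (sg y a t (F.o v) * G v) ^ 4 * (C ^ 2 * h ^ 4 * G v ^ 4) := by ring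
      _ ≤ κ ^ 4 * (C ^ 2 * h ^ 4 * G v ^ 4) := by gcongr; exact hsG v
      _ = _ := by ring
  set δ := h ^ 2 * a⁻¹ + h ^ 2
  have hδ : δ = h * (κ⁻¹ + h) := by simp only [δ, a]; field_simp
  have hδ0 : 0 ≤ δ := by rw [hδ]; positivity
  have hn : ∀ v, sg y a t (F.o v) ^ 2 * (if ‖F.o v - y‖ < t + h then m v else 0) ^ 2 ≤
      3 * A ^ 2 * (A ^ 2 * C ^ 2 * κ ^ 2 * h ^ 6 * G v ^ 6 + W' v * (C1 * δ) + t ^ 2 * (Je * (C2 * δ))) := fun v => by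
    have := hG0 v; have := hs0 v
    have hW0 : 0 ≤ W' v := by rw [hW']; exact integral_nonneg fun x => by positivity
    split_ifs with hv
    · have hxv := hx' v
      have hxv' : ‖x' v - F.o v‖ ≤ h := by
        rw [mem_closedBall, dist_eq_norm] at hxv; linarith [mul_le_of_le_one_left hh.le hc1]
      obtain ⟨k', w', P', hK⟩ := hkp (x' v) fun z hz => by
        rw [mem_closedBall, dist_eq_norm] at hz
        have l1 := H.lam_lip y z
        have : ‖y - z‖ ≤ ‖y - F.o v‖ + ‖F.o v - x' v‖ + ‖x' v - z‖ := by
          refine le_trans (le_of_eq ?_) (norm_add₃_le (a := y - F.o v) (b := F.o v - x' v) (c := x' v - z)); congr 1; abel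
        rw [norm_sub_rev y (F.o v), norm_sub_rev (F.o v) (x' v), norm_sub_rev (x' v) z] at this
        exact H.mem_iff_lam.2 (by linarith)
      have nb := near L hc hc1 hh hah hκt hC.le hγ hγ1 hY hK hR hG v hxv (by linarith)
      rw [← hC1, ← hC2, rs_congr L hc hh hxv (hpe v), ← hJe, show ∫ x, (sg y a t x ^ 4 * ((‖x - F.o v‖ + h)⁻¹) ^ 4) * ‖gradient (fun x => k x - R x) x‖ ^ 2 = W' v by rw [hW'],
        show (‖F.o v - y‖ + h)⁻¹ = G v by rw [hGd]] at nb
      have e6 : sg y a t (F.o v) ^ 2 * (A * (C * h ^ 3 * G v ^ 4)) ^ 2 ≤ A ^ 2 * C ^ 2 * κ ^ 2 * h ^ 6 * G v ^ 6 := by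
        calc _ = (sg y a t (F.o v) * G v) ^ 2 * (A ^ 2 * C ^ 2 * h ^ 6 * G v ^ 6) := by ring
          _ ≤ κ ^ 2 * (A ^ 2 * C ^ 2 * h ^ 6 * G v ^ 6) := by gcongr; exact hsG v
          _ = _ := by ring
      have em : m v ^ 2 = A ^ 2 * (∫ z, p v z * rs K (ε * h) (x' v) z) ^ 2 := by simp only [m]; rw [mul_pow, sq_abs]
      rw [em]
      have := mul_le_mul_of_nonneg_left nb (sq_nonneg A)
      have := mul_le_mul_of_nonneg_left e6 (sq_nonneg A)
      linarith
    · rw [zero_pow two_ne_zero, mul_zero]; positivity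
  have s4 := F.sumP hc hh (le_refl 4) y
  have s6 := F.sumP hc hh (show 4 ≤ 6 by norm_num) y
  rw [← hS4] at s4; rw [← hS6] at s6
  have sW : ∑ v, W' v ≤ S4 * (h⁻¹) ^ 4 * Je := by
    obtain ⟨⟨kμ, hμl⟩, hμb⟩ := sg4 y (by linarith : 0 ≤ a) hκt
    have ve := hY.vk.sub (F.vv hR)
    have i0 := ve.int H.bdd ve hμl.continuous hμb
    simp only [real_inner_self_eq_norm_sq] at i0
    rw [hW', ← integral_finsetSum _ fun v _ => ?_]
    · rw [hJe, ← integral_const_mul]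
      refine integral_mono_of_nonneg (Eventually.of_forall fun x => by positivity) (i0.const_mul _) (Eventually.of_forall fun x => ?_)
      have := F.sumP hc hh (le_refl 4) x
      rw [← hS4] at this
      simp only [norm_sub_rev x]
      calc _ = (∑ v, ((‖F.o v - x‖ + h)⁻¹) ^ 4) * (sg y a t x ^ 4 * ‖gradient (fun x => k x - R x) x‖ ^ 2) := by
            rw [Finset.sum_mul]; exact Finset.sum_congr rfl fun v _ => by ring
        _ ≤ _ := by gcongr
    · have := ve.int H.bdd ve (m := fun x => sg y a t x ^ 4 * ((‖x - F.o v‖ + h)⁻¹) ^ 4) (hμl.continuous.mul (g_cont hh (F.o v))) (B := t ^ 4 * (h⁻¹) ^ 4) fun x => by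
        rw [abs_mul, abs_of_nonneg (by positivity : (0:ℝ) ≤ ((‖x - F.o v‖ + h)⁻¹) ^ 4)]
        refine mul_le_mul (hμb x) ?_ (by positivity) (by positivity)
        gcongr; linarith [norm_nonneg (x - F.o v)]
      simp only [real_inner_self_eq_norm_sq] at this; exact this
  have sc := F.card_le hc hh hM hM0
  have sE : h ^ 3 * ∑ v, sg y a t (F.o v) ^ 4 * (C * h ^ 2 * G v ^ 4) ^ 2 ≤ C ^ 2 * S4 * (κ ^ 4 * h ^ 3) := by
    calc _ ≤ h ^ 3 * ∑ v, κ ^ 4 * C ^ 2 * h ^ 4 * G v ^ 4 := mul_le_mul_of_nonneg_left (Finset.sum_le_sum fun v _ => hE v) (by positivity)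
      _ = h ^ 3 * (κ ^ 4 * C ^ 2 * h ^ 4 * ∑ v, G v ^ 4) := by rw [← Finset.mul_sum]
      _ ≤ h ^ 3 * (κ ^ 4 * C ^ 2 * h ^ 4 * (S4 * (h⁻¹) ^ 4)) := by rw [hGd]; gcongr
      _ = _ := by field_simp
  have sn : h ^ 3 * ∑ v, sg y a t (F.o v) ^ 2 * (if ‖F.o v - y‖ < t + h then m v else 0) ^ 2 ≤
      3 * A ^ 2 * (A ^ 2 * C ^ 2 * S6 * (κ ^ 4 * h ^ 3) + N * ((κ⁻¹ + h) * Je)) := by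
    calc _ ≤ h ^ 3 * ∑ v, 3 * A ^ 2 * (A ^ 2 * C ^ 2 * κ ^ 2 * h ^ 6 * G v ^ 6 + W' v * (C1 * δ) + t ^ 2 * (Je * (C2 * δ))) := mul_le_mul_of_nonneg_left (Finset.sum_le_sum fun v _ => hn v) (by positivity)
      _ = 3 * A ^ 2 * (A ^ 2 * C ^ 2 * κ ^ 2 * h ^ 9 * (∑ v, G v ^ 6) + h ^ 3 * (C1 * δ) * (∑ v, W' v) + h ^ 3 * Fintype.card F.ι * (t ^ 2 * (Je * (C2 * δ)))) := by
        rw [← Finset.mul_sum, Finset.sum_add_distrib, Finset.sum_add_distrib, ← Finset.mul_sum, ← Finset.sum_mul, Finset.sum_const, Finset.card_univ, nsmul_eq_mul]; ring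
      _ ≤ 3 * A ^ 2 * (A ^ 2 * C ^ 2 * κ ^ 2 * h ^ 9 * (S6 * (h⁻¹) ^ 6) + h ^ 3 * (C1 * δ) * (S4 * (h⁻¹) ^ 4 * Je) + M ^ 3 / c ^ 3 * (t ^ 2 * (Je * (C2 * δ)))) := by
        rw [hGd]; gcongr
      _ = 3 * A ^ 2 * (A ^ 2 * C ^ 2 * S6 * (κ ^ 2 * h ^ 3) + (S4 * C1 + M ^ 3 / c ^ 3 * t ^ 2 * C2 * h) * ((κ⁻¹ + h) * Je)) := by
        rw [hδ]; field_simp; ring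
      _ ≤ _ := by
        have z1 : κ ^ 2 ≤ κ ^ 4 := pow_le_pow_right₀ (by linarith) (by norm_num)
        have z2 : M ^ 3 / c ^ 3 * t ^ 2 * C2 * h ≤ M ^ 3 / c ^ 3 * t ^ 2 * C2 := mul_le_of_le_one_right (by positivity) hh1
        rw [hN]; gcongr
  have je : Je ≤ 2 * Jp + 12 * (om * (C ^ 2 * S4 * (κ ^ 4 * h ^ 3))) := by
    obtain ⟨⟨kμ, hμl⟩, hμb⟩ := sg4 y (by linarith : 0 ≤ a) hκt
    have ve := hY.vk.sub (F.vv hR)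
    have vη := hY.vk.sub (F.vv hJ)
    have vψ := F.vv hψ
    have i0 := ve.int H.bdd ve hμl.continuous hμb
    have i1 := vψ.int H.bdd vψ hμl.continuous hμb
    simp only [real_inner_self_eq_norm_sq] at i0 i1
    have := F.pw_le hh i0 (i1.const_mul 2) (fun x hx => by rw [ve.off hx]; simp) (fun x => by positivity)
      (X := fun v => 12 * (sg y a t (F.o v) ^ 4 * (C * h ^ 2 * G v ^ 4) ^ 2)) (fun v => by have := hG0 v; have := hs0 v; positivity) (by
      filter_upwards [vη.diff, vψ.diff] with z z1 z2 v hz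
      have e1 : gradient (fun x => k x - R x) z = gradient (fun x => k x - F.I k x) z - gradient (fun x => R x - F.I k x) z := by
        rw [← grad_sub z1 z2]; congr 1; funext x; ring
      have b := (hY.bk v z hz).2.1
      rw [show (‖F.o v - y‖ + h)⁻¹ = G v by rw [hGd]] at b
      have s1 := (F.sg_cmp (y := y) hh ha hκt v (F.Vs v hz)).2.1
      have s0 := sg_ge y hκt z
      have s2 := pow_le_pow_left₀ (by linarith) s1 4
      rw [mul_pow] at s2
      have n1 := norm_sub_le (gradient (fun x => k x - F.I k x) z) (gradient (fun x => R x - F.I k x) z)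
      rw [e1]
      have n2 := pow_le_pow_left₀ (norm_nonneg _) n1 2
      have n3 := pow_le_pow_left₀ (norm_nonneg _) b 2
      have n4 := add_sq_le (a := ‖gradient (fun x => k x - F.I k x) z‖) (b := ‖gradient (fun x => R x - F.I k x) z‖)
      have sp : 0 < sg y a t (F.o v) ^ 4 := pow_pos (hs0 v) 4
      have n5 := mul_le_mul (show sg y a t z ^ 4 ≤ 6 * sg y a t (F.o v) ^ 4 by linarith) n3 (by positivity) (by positivity)
      have n6 := mul_le_mul_of_nonneg_left (n2.trans n4) (show 0 ≤ sg y a t z ^ 4 by positivity)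
      linarith)
    rw [integral_const_mul, ← hJe, ← hJp, ← Finset.mul_sum] at this
    have := mul_le_mul_of_nonneg_left sE hom.le
    linarith
  rw [← hJp] at W ⊢
  have W2 : Jp ≤ 14 * om * (C ^ 2 * S4 * (κ ^ 4 * h ^ 3)) + q * (A ^ 2 * C ^ 2 * S6 * (κ ^ 4 * h ^ 3) + N * ((κ⁻¹ + h) * Je)) := by
    refine W.trans ?_
    calc _ = 14 * om * (h ^ 3 * ∑ v, sg y a t (F.o v) ^ 4 * (C * h ^ 2 * G v ^ 4) ^ 2) +
        34 * om * (60 * A) ^ 2 * (h ^ 3 * ∑ v, sg y a t (F.o v) ^ 2 * (if ‖F.o v - y‖ < t + h then m v else 0) ^ 2) := by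
          simp only [Finset.mul_sum]; rw [← Finset.sum_add_distrib]; exact Finset.sum_congr rfl fun v _ => by ring
      _ ≤ _ := by
        have := mul_le_mul_of_nonneg_left sE (show 0 ≤ 14 * om by positivity)
        have := mul_le_mul_of_nonneg_left sn (show 0 ≤ 34 * om * (60 * A) ^ 2 by positivity)
        rw [hq]; linarith
  have hk2 : κ⁻¹ + h ≤ 2 := by have := inv_le_one_of_one_le₀ (by linarith : 1 ≤ κ); linarith
  have hk0 : 0 ≤ κ⁻¹ + h := by positivity
  obtain ⟨Z, hZ⟩ : ∃ Z, Z = κ ^ 4 * h ^ 3 := ⟨_, rfl⟩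
  have hZ0 : 0 ≤ Z := by rw [hZ]; positivity
  rw [← hZ] at W2 je
  rw [mul_assoc _ (κ ^ 4), ← hZ]
  have f1 : q * (N * ((κ⁻¹ + h) * Je)) ≤ q * (N * ((κ⁻¹ + h) * (2 * Jp + 12 * (om * (C ^ 2 * S4 * Z))))) := by gcongr
  have f2 : q * (N * ((κ⁻¹ + h) * (12 * (om * (C ^ 2 * S4 * Z))))) ≤ q * (N * (2 * (12 * (om * (C ^ 2 * S4 * Z))))) := by gcongr
  have f3 : 0 ≤ 2 * q * N * Z := by positivity
  have f4 : 0 ≤ (14 * om * C ^ 2 * S4 + q * (A ^ 2 * C ^ 2 * S6) + 24 * q * N * om * C ^ 2 * S4 + 1) * (κ⁻¹ + h) * Jp := by positivity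
  linarith

theorem close (H : HRep D) (L : LC K c r A ε) (hc : 0 < c) (hc1 : c ≤ 1) (ht : 0 < t) (hC : 0 < C) (hγ : 1 / 2 < γ) (hγ1 : γ < 1) :
    ∃ κ h0 B : ℝ, 2 ≤ κ ∧ 0 < h0 ∧ 0 < B ∧ h0 ≤ 1 ∧ 2 * h0 < t ∧ κ * h0 ≤ t ∧ ∀ h : ℝ, 0 < h → h ≤ h0 → ∀ (F : FE D c h r),
      (∀ x, closedBall x t ⊆ D → ∃ k w P, KP H K F ε γ C x k w P) → ∀ y k w P, 4 * t ≤ H.lam y → KP H K F ε γ C y k w P →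
      ∀ R ∈ F.Vh, (∀ χ ∈ F.Vh, aa χ R = aa χ k) →
      ∫ x, sg y (κ * h) t x ^ 4 * ‖gradient (fun x => R x - F.I k x) x‖ ^ 2 ≤ B * h ^ 3 := by
  obtain ⟨B, hB, hb⟩ := close1 (t := t) (K := K) H L hc hc1 ht hC hγ hγ1
  obtain ⟨κ, hκ⟩ : ∃ κ, κ = 4 * B + 2 := ⟨_, rfl⟩
  have hκ2 : 2 ≤ κ := by linarith
  have hκ0 : 0 < κ := by linarith
  refine ⟨κ, min (min 1 (1 / (4 * B))) (min (t / 3) (t / κ)), 2 * B * κ ^ 4, hκ2, by positivity, by positivity, (min_le_left _ _).trans (min_le_left _ _), ?_, ?_, ?_⟩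
  · have : min (min 1 (1 / (4 * B))) (min (t / 3) (t / κ)) ≤ t / 3 := (min_le_right _ _).trans (min_le_left _ _)
    linarith
  · have : min (min 1 (1 / (4 * B))) (min (t / 3) (t / κ)) ≤ t / κ := (min_le_right _ _).trans (min_le_right _ _)
    rwa [le_div_iff₀ hκ0, mul_comm] at this
  · intro h hh hle F hkp y k w P hy hY R hR hG
    simp only [le_min_iff] at hle
    obtain ⟨⟨l1, l2⟩, l3, l4⟩ := hle
    have := hb κ h hκ2 hh l1 (by linarith) (by rwa [le_div_iff₀ hκ0, mul_comm] at l4) F hkp y k w P hy hY R hR hG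
    obtain ⟨J, hJ⟩ : ∃ J, J = ∫ x, sg y (κ * h) t x ^ 4 * ‖gradient (fun x => R x - F.I k x) x‖ ^ 2 := ⟨_, rfl⟩
    have hJ0 : 0 ≤ J := by rw [hJ]; exact integral_nonneg fun x => by positivity
    rw [← hJ] at this ⊢
    have b1 : B * κ⁻¹ ≤ 1 / 4 := by rw [← div_eq_mul_inv, div_le_iff₀ hκ0]; linarith
    have b2 : B * h ≤ 1 / 4 := by rw [le_div_iff₀ (by positivity)] at l2; linarith
    have := mul_le_mul_of_nonneg_right (add_le_add b1 b2) hJ0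
    linarith
end FE
end

section
namespace FE
variable {D : Set E3} {K : Ker} {c h ε t A : ℝ} {r : ℕ} (F : FE D c h r) {u : E3 → ℝ} {U : ℝ}

theorem aaQ (hDb : Bornology.IsBounded D) (hc : 0 < c) (hh : 0 < h) (hu : VV D u) (hU : ∀ x, |u x| ≤ U) {φ : E3 → ℝ} (hφ : VV D φ)
    (h2 : ∀ v, ContDiffOn ℝ 2 φ (F.V v)) {a b : F.ι → ℝ} (ha : ∀ v, ∀ x ∈ F.V v, ‖gradient φ x‖ ≤ a v)
    (hb : ∀ v, ∀ x ∈ F.V v, |lap φ x| ≤ b v) (ha0 : ∀ v, 0 ≤ a v) (hb0 : ∀ v, 0 ≤ b v) :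
    |aa u φ| ≤ om * h ^ 3 * U * ∑ v, (b v + 6 * (c * h)⁻¹ * a v) := by
  have hU0 : 0 ≤ U := (abs_nonneg _).trans (hU 0)
  obtain ⟨k, hk⟩ := hu.lip
  unfold aa
  rw [F.pw (hu.int1 hDb hφ) fun x hx => by rw [hu.off hx, inner_zero_left], Finset.mul_sum]
  refine (Finset.abs_sum_le_sum_abs _ _).trans (Finset.sum_le_sum fun v _ => ?_)
  refine (lemQ hc hh (F.Vo v) (F.Vc v) (F.Vb v) (F.Vs v) hk hU (h2 v) (ha v) (hb v)).trans ?_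
  have := ha0 v; have := hb0 v
  calc _ ≤ om * h ^ 3 * (b v + 6 * (c * h)⁻¹ * a v) * U := by gcongr; exact F.vol_le hh v
    _ = _ := by ring

theorem psiQ (hDb : Bornology.IsBounded D) (L : LC K c r A ε) (hc : 0 < c) (hh : 0 < h) (hu : VV D u) (hU : ∀ x, |u x| ≤ U) {ψ : E3 → ℝ} (hψ : ψ ∈ F.Vh)
    {W : E3 → ℝ} {B : ℝ} (hW : Continuous W) (hWB : ∀ x, |W x| ≤ B) (hW0 : ∀ x, 0 ≤ W x) {s : F.ι → ℝ} (hs0 : ∀ v, 0 < s v)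
    (hs : ∀ v, ∀ z ∈ F.V v, s v ≤ W z) :
    aa u ψ ^ 2 ≤ (om * (A + 6 / c) * U) ^ 2 * (A * (∫ x, W x * ‖gradient ψ x‖ ^ 2) * (h * ∑ v, (s v)⁻¹)) := by
  have hA := L.A1
  have hom := om_pos
  have vψ := F.vv hψ
  have hU0 : 0 ≤ U := (abs_nonneg _).trans (hU 0)
  choose p hp hpe using F.poly _ hψ
  choose n hn0 hn hn2 using fun v => L.L3 F hh v (p v) (hp v)
  have hev : ∀ v, ∀ z ∈ F.V v, ψ =ᶠ[𝓝 z] p v := fun v z hz => by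
    filter_upwards [(F.Vo v).mem_nhds hz] with x hx using hpe v x (F.Vτ v hx)
  have q := F.aaQ hDb hc hh hu hU vψ (a := n) (b := fun v => A * h⁻¹ * n v)
    (fun v => (PP_smooth (hp v)).contDiffOn.congr fun z hz => hpe v z (F.Vτ v hz))
    (fun v z hz => by rw [grad_congr (hev v z hz), norm_grad]; exact (hn v z (F.Vτ v hz)).1)
    (fun v z hz => by rw [lap_congr (hev v z hz)]; exact (hn v z (F.Vτ v hz)).2) hn0 fun v => by have := hn0 v; positivity
  rw [show om * h ^ 3 * U * ∑ v, (A * h⁻¹ * n v + 6 * (c * h)⁻¹ * n v) = om * (A + 6 / c) * U * ∑ v, h ^ 2 * n v by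
    rw [Finset.mul_sum, Finset.mul_sum]; exact Finset.sum_congr rfl fun v _ => by field_simp] at q
  have i0 := vψ.int hDb vψ hW hWB
  simp only [real_inner_self_eq_norm_sq] at i0
  have e1 : ∑ v, h ^ 3 * n v ^ 2 * s v ≤ A * ∫ x, W x * ‖gradient ψ x‖ ^ 2 := by
    refine le_trans (Finset.sum_le_sum fun v _ => ?_) ((Finset.mul_sum ..).symm.le.trans (mul_le_mul_of_nonneg_left (F.sum_le i0 fun x => by have := hW0 x; positivity) (by linarith)))
    have := hs0 v
    calc _ ≤ (A * ∫ x in F.V v, ‖gradient (p v) x‖ ^ 2) * s v := mul_le_mul_of_nonneg_right (hn2 v) this.le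
      _ = A * ∫ x in F.V v, s v * ‖gradient (p v) x‖ ^ 2 := by rw [integral_const_mul]; ring
      _ ≤ _ := by
        refine mul_le_mul_of_nonneg_left ?_ (by linarith)
        refine integral_mono_of_nonneg (Eventually.of_forall fun x => by positivity) i0.integrableOn ?_
        filter_upwards [ae_restrict_mem (F.Vo v).measurableSet] with x hx
        rw [grad_congr (hev v x hx)]
        exact mul_le_mul_of_nonneg_right (hs v x hx) (by positivity)
  have e2 : (∑ v, h ^ 2 * n v) ^ 2 ≤ (∑ v, h ^ 3 * n v ^ 2 * s v) * ∑ v, h * (s v)⁻¹ :=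
    Finset.sum_sq_le_sum_mul_sum_of_sq_le_mul _ (fun v _ => by have := hs0 v; positivity) (fun v _ => by have := hs0 v; positivity)
      fun v _ => by have := hs0 v; refine le_of_eq ?_; field_simp
  have e3 : 0 ≤ ∑ v, h * (s v)⁻¹ := Finset.sum_nonneg fun v _ => by have := hs0 v; positivity
  rw [← sq_abs]
  refine (pow_le_pow_left₀ (abs_nonneg _) q 2).trans ?_
  rw [mul_pow, Finset.mul_sum]
  exact mul_le_mul_of_nonneg_left (e2.trans (mul_le_mul_of_nonneg_right e1 e3)) (by positivity)

theorem sq_fin {x X U : ℝ} (hX : 0 ≤ X) (hU : 0 ≤ U) (h : x ^ 2 ≤ X * U ^ 2) : |x| ≤ (X + 1) * U := by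
  refine abs_le_of_sq_le_sq (h.trans ?_) (by positivity)
  rw [mul_pow]; gcongr; nlinarith

set_option maxHeartbeats 1600000 in
/-- interior stability on one element -/
theorem fin1 (H : HRep D) (hr : 2 ≤ r) (hc : 0 < c) (hc1 : c ≤ 1) (ht : 0 < t) :
    ∃ C h0 : ℝ, 0 < C ∧ 0 < h0 ∧ h0 ≤ t ∧ ∀ h : ℝ, 0 < h → h ≤ h0 → ∀ (F : FE D c h r) (u uh : E3 → ℝ) (U : ℝ), VV D u → (∀ x, |u x| ≤ U) →
      uh ∈ F.Vh → (∀ χ ∈ F.Vh, aa χ uh = aa χ u) → ∀ v, 5 * t ≤ H.lam (F.o v) → ∀ x ∈ F.τ v, |uh x| ≤ C * U := by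
  obtain ⟨K⟩ := ker_exists
  obtain ⟨A, ε, L⟩ := lc_exists K hc hc1 r
  obtain ⟨γ, C, hγ, hγ1, hC, hKP⟩ := kp_exists H K L hc hc1 hr ht
  obtain ⟨κ, h0, B, hκ, hh0, hB, h01, h0t, hκt, hcl⟩ := close (t := t) H L hc hc1 ht hC hγ hγ1
  have hA := L.A1
  have hom := om_pos
  obtain ⟨M, hM0, hM⟩ : ∃ M : ℝ, 0 < M ∧ D ⊆ closedBall 0 M := by
    obtain ⟨M, hM⟩ := H.bdd.subset_closedBall 0
    exact ⟨max M 1, by positivity, hM.trans (closedBall_subset_closedBall (le_max_left _ _))⟩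
  obtain ⟨S4, hS4⟩ : ∃ s, s = 2 ^ 4 * kI 4 / (c ^ 3 * om) := ⟨_, rfl⟩
  have h4 : 0 ≤ S4 := by have := kI_nn 4; rw [hS4]; positivity
  have hI : ∀ q : ℝ, 0 ≤ ∫ z in D, H.rho z ^ q := fun q =>
    setIntegral_nonneg H.isOpen.measurableSet fun z hz => Real.rpow_nonneg (H.rho_pos hz).le _
  obtain ⟨I2, hI2⟩ : ∃ s, s = ∫ z in D, H.rho z ^ (2 * γ - 2) := ⟨_, rfl⟩
  obtain ⟨I4, hI4⟩ : ∃ s, s = ∫ z in D, H.rho z ^ (4 * γ - 4) := ⟨_, rfl⟩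
  have i2 : 0 ≤ I2 := hI2 ▸ hI _
  have i4 : 0 ≤ I4 := hI4 ▸ hI _
  have r2 := H.rho_int (q := 2 - 2 * γ) (by linarith) (by linarith)
  have r4 := H.rho_int (q := 4 - 4 * γ) (by linarith) (by linarith)
  rw [neg_sub] at r2 r4
  obtain ⟨X1, hX1⟩ : ∃ s, s = (om * (A + 6 / c)) ^ 2 * (A * B * (16 * (S4 + M ^ 3 / c ^ 3 * (t⁻¹) ^ 4))) := ⟨_, rfl⟩
  obtain ⟨X2, hX2⟩ : ∃ s, s = (om * (A + 6 / c)) ^ 2 * (A * (C ^ 2 * I4) * (M ^ 3 / c ^ 3)) := ⟨_, rfl⟩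
  have hX10 : 0 ≤ X1 := by rw [hX1]; positivity
  have hX20 : 0 ≤ X2 := by rw [hX2]; positivity
  refine ⟨A * (A + om * C * (1 + 6 / c) * S4 + (X1 + 1) + (1 + 6 / c) / c ^ 3 * (C * I2) + (X2 + 1)), h0, by positivity, hh0, by linarith, ?_⟩
  intro h hh hhle F u uh U hu hU huh hG v hv x hx
  have hU0 : 0 ≤ U := (abs_nonneg _).trans (hU 0)
  have hh1 : h ≤ 1 := by linarith
  have hkt : κ * h ≤ t := le_trans (by gcongr) hκt
  have he : ε * h ≤ t := (mul_le_of_le_one_left hh.le (by linarith [L.e1])).trans (by linarith)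
  obtain ⟨p, hp, hpe⟩ := F.poly _ huh v
  obtain ⟨y, hy, hL2⟩ := L.L2 h hh (F.o v) p hp
  have hy4 : 4 * t ≤ H.lam y := by
    have := H.lam_lip (F.o v) y
    have := mul_le_of_le_one_left hh.le hc1
    rw [mem_closedBall, dist_comm, dist_eq_norm] at hy; linarith
  have hkp := fun x hx => hKP h hh hh1 he F x hx
  obtain ⟨k, w, P, hY⟩ := hkp y fun z hz => by
    have := H.lam_lip y z
    rw [mem_closedBall, dist_comm, dist_eq_norm] at hz
    exact H.mem_iff_lam.2 (by linarith)
  obtain ⟨Rk, hRk, gk⟩ := F.ritz H.bdd hY.vk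
  obtain ⟨Rw, hRw, gw⟩ := F.ritz H.bdd hY.vw
  have cl := hcl h hh hhle F hkp y k w P hy4 hY Rk hRk gk
  have vu := F.vv huh
  have hJk := F.Imem k hY.vk.zero
  have hJw := F.Imem w hY.vw.zero
  have hψk : (fun x => Rk x - F.I k x) ∈ F.Vh := F.Vh.sub_mem hRk hJk
  have hψw : (fun x => Rw x - F.I w x) ∈ F.Vh := F.Vh.sub_mem hRw hJw
  have sc := F.card_le hc hh hM hM0
  have s4 := F.sumP hc hh (le_refl 4) y
  rw [← hS4] at s4
  have id1 := hY.id _ vu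
  have id2 := hY.id _ hu
  have tr : ∀ k R : E3 → ℝ, VV D k → R ∈ F.Vh → (∀ χ ∈ F.Vh, aa χ R = aa χ k) →
      aa uh k = aa u k - aa u (fun x => k x - F.I k x) + aa u (fun x => R x - F.I k x) := fun k R vk hR g => by
    have hJ := F.vv (F.Imem k vk.zero)
    rw [hu.aa_sub H.bdd vk hJ, hu.aa_sub H.bdd (F.vv hR) hJ, ← g _ huh, aa_comm uh, hG _ hR, aa_comm R]; ring
  rw [tr k Rk hY.vk hRk gk, tr w Rw hY.vw hRw gw] at id1
  have b0 := L.R (ε * h) (mul_pos L.e0 hh) y u U fun z _ => hU z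
  have b1 : |aa u (fun x => k x - F.I k x)| ≤ om * C * (1 + 6 / c) * S4 * U := by
    refine (F.aaQ H.bdd hc hh hu hU (hY.vk.sub (F.vv hJk)) hY.ck (fun v z hz => (hY.bk v z hz).2.1) (fun v z hz => (hY.bk v z hz).2.2)
      (fun v => by positivity) fun v => by positivity).trans ?_
    calc _ = om * C * (1 + 6 / c) * U * h ^ 4 * ∑ v, ((‖F.o v - y‖ + h)⁻¹) ^ 4 := by
          rw [Finset.mul_sum, Finset.mul_sum]; exact Finset.sum_congr rfl fun v _ => by field_simp
      _ ≤ om * C * (1 + 6 / c) * U * h ^ 4 * (S4 * (h⁻¹) ^ 4) := by gcongr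
      _ = _ := by field_simp
  have ha : 2 * h ≤ κ * h := by gcongr
  have hs0 : ∀ v, 0 < sg y (κ * h) t (F.o v) := fun v => by linarith [sg_ge y hkt (F.o v)]
  have b2 : |aa u (fun x => Rk x - F.I k x)| ≤ (X1 + 1) * U := by
    obtain ⟨⟨kμ, hμl⟩, hμb⟩ := sg4 y (by positivity : 0 ≤ κ * h) hkt
    refine sq_fin hX10 hU0 ((F.psiQ H.bdd L hc hh hu hU hψk hμl.continuous hμb (fun x => by positivity)
      (s := fun v => sg y (κ * h) t (F.o v) ^ 4 / 16) (fun v => by have := hs0 v; positivity) fun v z hz => ?_).trans ?_)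
    · have := pow_le_pow_left₀ (hs0 v).le (F.sg_cmp (y := y) hh ha hkt v (F.Vs v hz)).1 4
      rw [mul_pow] at this; linarith
    have e1 : h * ∑ v, (sg y (κ * h) t (F.o v) ^ 4 / 16)⁻¹ ≤ 16 * (S4 + M ^ 3 / c ^ 3 * (t⁻¹) ^ 4) * (h⁻¹) ^ 3 := by
      calc _ ≤ h * ∑ v, 16 * (((‖F.o v - y‖ + h)⁻¹) ^ 4 + (t⁻¹) ^ 4) := by
            refine mul_le_mul_of_nonneg_left (Finset.sum_le_sum fun v _ => ?_) hh.le
            rw [inv_div, div_eq_mul_inv, ← inv_pow]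
            refine mul_le_mul_of_nonneg_left ?_ (by norm_num)
            rcases min_choice (‖F.o v - y‖ + κ * h) t with e | e
            · rw [sg, e]
              refine le_add_of_le_of_nonneg ?_ (by positivity)
              gcongr; linarith
            · rw [sg, e]; exact le_add_of_nonneg_left (by positivity)
        _ = 16 * (h * ∑ v, ((‖F.o v - y‖ + h)⁻¹) ^ 4) + 16 * ((h ^ 3 * Fintype.card F.ι) * (h⁻¹) ^ 2 * (t⁻¹) ^ 4) := by
            rw [← Finset.mul_sum, Finset.sum_add_distrib, Finset.sum_const, Finset.card_univ, nsmul_eq_mul]; field_simp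
        _ ≤ 16 * (h * (S4 * (h⁻¹) ^ 4)) + 16 * (M ^ 3 / c ^ 3 * (h⁻¹) ^ 3 * (t⁻¹) ^ 4) := by
            have z : (h⁻¹) ^ 2 ≤ (h⁻¹) ^ 3 := pow_le_pow_right₀ ((one_le_inv₀ hh).2 hh1) (by norm_num)
            gcongr
        _ = _ := by field_simp
    calc _ ≤ (om * (A + 6 / c) * U) ^ 2 * (A * (B * h ^ 3) * (16 * (S4 + M ^ 3 / c ^ 3 * (t⁻¹) ^ 4) * (h⁻¹) ^ 3)) := by
          have := Finset.sum_nonneg (s := Finset.univ) fun v _ => (show 0 ≤ (sg y (κ * h) t (F.o v) ^ 4 / 16)⁻¹ by positivity)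
          gcongr
      _ = _ := by rw [hX1]; field_simp
  have b3 : |aa u (fun x => w x - F.I w x)| ≤ (1 + 6 / c) / c ^ 3 * (C * I2) * U := by
    refine (F.aaQ H.bdd hc hh hu hU (hY.vw.sub (F.vv hJw)) hY.cw (fun v z hz => (hY.bw v z hz).1) (fun v z hz => (hY.bw v z hz).2.1)
      (fun v => mul_nonneg hh.le (hY.P0 v)) hY.P0).trans ?_
    have := F.sum_a hc hh ((integrable_indicator_iff H.isOpen.measurableSet).2 (r2.const_mul C))
      (fun x => indicator_nonneg (fun x hx => mul_nonneg hC.le (Real.rpow_nonneg (H.rho_pos hx).le _)) x) (a := P) fun v x hx => by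
        rw [indicator_of_mem (F.VD H.isOpen H.convex v hx)]; exact (hY.bw v x hx).2.2
    rw [integral_indicator H.isOpen.measurableSet, integral_const_mul, ← hI2] at this
    calc _ = (1 + 6 / c) / c ^ 3 * U * ∑ v, c ^ 3 * om * h ^ 3 * P v := by
          rw [Finset.mul_sum, Finset.mul_sum]; exact Finset.sum_congr rfl fun v _ => by field_simp
      _ ≤ (1 + 6 / c) / c ^ 3 * U * (C * I2) := by gcongr
      _ = _ := by ring
  have b4 : |aa u (fun x => Rw x - F.I w x)| ≤ (X2 + 1) * U := by
    refine sq_fin hX20 hU0 ((F.psiQ H.bdd L hc hh hu hU hψw (W := fun _ => 1) (B := 1) continuous_const (by simp) (by simp)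
      (s := fun v => 1) (fun v => by simp) fun v z hz => le_rfl).trans ?_)
    have vψ := F.vv hψw
    have e1 : aa (fun x => Rw x - F.I w x) (fun x => Rw x - F.I w x) = aa (fun x => Rw x - F.I w x) (fun x => w x - F.I w x) := by
      rw [vψ.aa_sub H.bdd (F.vv hRw) (F.vv hJw), vψ.aa_sub H.bdd hY.vw (F.vv hJw), gw _ hψw]
    have e2 := VV.aa_cs H.isOpen H.convex H.bdd vψ (η := fun x => w x - F.I w x) (W := fun _ => 1) (B := 1) continuous_const (by simp) (by simp)
      (r4.const_mul ((h * C) ^ 2)) (fun x hx => mul_nonneg (sq_nonneg _) (Real.rpow_nonneg (H.rho_pos hx).le _)) (by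
        filter_upwards [F.ae_cover] with x hx hxD
        obtain ⟨v, hv⟩ := hx (subset_closure hxD)
        obtain ⟨q1, -, q2⟩ := hY.bw v x hv
        rw [one_mul, show 4 * γ - 4 = (2 * γ - 2) * (2 : ℕ) by push_cast; ring, Real.rpow_mul (H.rho_pos hxD).le, Real.rpow_natCast, ← mul_pow, mul_assoc]
        exact pow_le_pow_left₀ (norm_nonneg _) (q1.trans (mul_le_mul_of_nonneg_left q2 hh.le)) 2)
    rw [← e1, integral_const_mul ((h * C) ^ 2), ← hI4] at e2
    obtain ⟨J, hJ⟩ : ∃ J, J = ∫ x, 1 * ‖gradient (fun x => Rw x - F.I w x) x‖ ^ 2 := ⟨_, rfl⟩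
    have e3 : aa (fun x => Rw x - F.I w x) (fun x => Rw x - F.I w x) = J := by
      rw [hJ]; unfold aa; congr 1; funext x; rw [real_inner_self_eq_norm_sq, one_mul]
    rw [e3, ← hJ] at e2
    rw [← hJ]
    have hJ0 : 0 ≤ J := by rw [hJ]; exact integral_nonneg fun x => by positivity
    have e4 : J ≤ (h * C) ^ 2 * I4 := by
      rcases hJ0.eq_or_lt with h' | h'
      · rw [← h']; positivity
      · exact le_of_mul_le_mul_left (by rw [← sq]; exact e2) h'
    rw [inv_one, Finset.sum_const, Finset.card_univ, nsmul_eq_mul, mul_one]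
    calc _ ≤ (om * (A + 6 / c) * U) ^ 2 * (A * ((h * C) ^ 2 * I4) * (h * Fintype.card F.ι)) := by gcongr
      _ = (om * (A + 6 / c) * U) ^ 2 * (A * (C ^ 2 * I4) * (h ^ 3 * Fintype.card F.ι)) := by ring
      _ ≤ (om * (A + 6 / c) * U) ^ 2 * (A * (C ^ 2 * I4) * (M ^ 3 / c ^ 3)) := by gcongr
      _ = _ := by rw [hX2]; ring
  rw [hpe x hx]
  refine (hL2 x (F.sub v hx)).1.trans ?_
  rw [mul_assoc]
  refine mul_le_mul_of_nonneg_left ?_ (by linarith)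
  rw [← rs_congr L hc hh hy hpe, id1]
  rw [id2] at b0
  rw [abs_le] at b0 b1 b2 b3 b4 ⊢
  constructor <;> linarith [b0.1, b0.2, b1.1, b1.2, b2.1, b2.2, b3.1, b3.2, b4.1, b4.2]

end FE
end

theorem main_aux
    (Ω Ωt : Set E3) (hΩt : IsConvexPolyhedron Ωt)
    (hsub : closure Ω ⊆ Ωt) (c : ℝ) (hc : 0 < c) (r : ℕ) (hr : 2 ≤ r) :
    ∃ C h₀ : ℝ, 0 < C ∧ 0 < h₀ ∧
      ∀ h : ℝ, 0 < h → h ≤ h₀ →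
      ∀ Tt : Finset (Fin 4 → E3), IsTetPartition Ωt Tt h c →
      ∀ ut : E3 → ℝ, (∃ K : ℝ≥0, LipschitzOnWith K ut (closure Ωt)) →
        (∀ x ∈ frontier Ωt, ut x = 0) →
      ∀ ut_h : E3 → ℝ, MemSh0 Ωt Tt r ut_h →
        (∀ χ : E3 → ℝ, MemSh0 Ωt Tt r χ →
          ∫ x in Ωt, ⟪gradient (fun y => ut y - ut_h y) x, gradient χ x⟫ = 0) →
        (⨆ x ∈ Ω, |ut x - ut_h x|) ≤ C * ⨆ x ∈ Ωt, |ut x| := by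
  have hn : ∀ f : E3 → ℝ, 0 ≤ ⨆ x ∈ Ωt, |f x| := fun f => Real.iSup_nonneg fun x => Real.iSup_nonneg fun _ => abs_nonneg _
  rcases Ω.eq_empty_or_nonempty with rfl | hne
  · refine ⟨1, 1, one_pos, one_pos, fun h _ _ Tt _ ut _ _ uh _ _ => ?_⟩
    have := hn ut
    simpa using this
  have hc' : 0 < min c 1 := lt_min hc one_pos
  obtain ⟨H⟩ := hrep_exists hΩt (hne.mono (subset_closure.trans hsub))
  obtain ⟨x0, hx0, hmin⟩ := (H.bdd.subset hsub |>.isCompact_closure.of_isClosed_subset isClosed_closure (closure_mono subset_closure)).exists_isMinOn hne.closure H.clam.continuousOn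
  have h00 : 0 < H.lam x0 := H.mem_iff_lam.1 (hsub hx0)
  obtain ⟨C, h0, hC, hh0, h0t, key⟩ := FE.fin1 H hr hc' (min_le_right c 1) (t := H.lam x0 / 6) (by positivity)
  refine ⟨1 + C, h0, by positivity, hh0, ?_⟩
  intro h hh hhle T hT u ⟨Ku, hKu⟩ hu0 uh huh hor
  have hT' : IsTetPartition Ωt T h (min c 1) := by
    obtain ⟨a1, a2, a3, a4, a5, a6⟩ := hT
    refine ⟨a1, a2, a3, a4, a5, fun v hv => ?_⟩
    obtain ⟨x, hx⟩ := a6 v hv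
    exact ⟨x, (closedBall_subset_closedBall (by gcongr; exact min_le_left _ _)).trans hx⟩
  obtain ⟨F, hF⟩ := fe_exists H hT' (by positivity) (r := r) (by omega)
  have vu : VV Ωt (Ωt.indicator u) := ⟨⟨_, lip_ext hKu hu0⟩, fun x hx => indicator_of_notMem hx _⟩
  have hcl : ∀ x ∈ closure Ωt, Ωt.indicator uh x = uh x := fun x hx => by
    by_cases h' : x ∈ Ωt
    · rw [indicator_of_mem h']
    · rw [indicator_of_notMem h', huh.2 x ⟨hx, by rwa [H.isOpen.interior_eq]⟩]
  have huV : Ωt.indicator uh ∈ F.Vh := (hF _).2 ⟨fun x hx => indicator_of_notMem hx _, ⟨huh.1.1.congr hcl, fun v hv => by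
    obtain ⟨p, hp, hpe⟩ := huh.1.2 v hv
    exact ⟨p, hp, fun x hx => by rw [← hpe x hx, hcl x (hT.2.1 ▸ mem_iUnion₂_of_mem hv hx)]⟩⟩, fun x hx => by
      rw [hcl x (frontier_subset_closure hx), huh.2 x hx]⟩
  obtain ⟨B, hB⟩ := vu.bd H.bdd
  obtain ⟨U, hU⟩ : ∃ U, U = ⨆ x ∈ Ωt, |u x| := ⟨_, rfl⟩
  have hU0 : 0 ≤ U := hU ▸ hn u
  have hub : ∀ x ∈ Ωt, |u x| ≤ U := fun x hx => by
    rw [hU]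
    refine le_ciSup_of_le ⟨B, ?_⟩ x (le_of_eq (by rw [ciSup_pos hx]))
    rintro _ ⟨z, rfl⟩
    refine Real.iSup_le (fun hz => ?_) B.2
    have := hB z
    rwa [indicator_of_mem hz] at this
  have hub' : ∀ x, |Ωt.indicator u x| ≤ U := fun x => by
    by_cases hx : x ∈ Ωt
    · rw [indicator_of_mem hx]; exact hub x hx
    · rw [indicator_of_notMem hx, abs_zero]; exact hU0
  have hG : ∀ χ ∈ F.Vh, aa χ (Ωt.indicator uh) = aa χ (Ωt.indicator u) := fun χ hχ => by
    have vχ := F.vv hχ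
    have e1 := vχ.aa_sub H.bdd vu (F.vv huV)
    have e2 := hor χ ((hF χ).1 hχ).2
    suffices aa χ (fun x => Ωt.indicator u x - Ωt.indicator uh x) = 0 by linarith
    rw [← e2]; unfold aa
    rw [← setIntegral_eq_integral_of_ae_compl_eq_zero (s := Ωt)]
    · refine setIntegral_congr_fun H.isOpen.measurableSet fun x hx => ?_
      have := grad_congr ((indicator_eqOn_nhds H.isOpen u hx).sub (indicator_eqOn_nhds H.isOpen uh hx))
      rw [real_inner_comm]; exact congrArg (inner ℝ · _) this
    · filter_upwards [ae_D H.convex] with x hx hxn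
      rw [vχ.off (hx.resolve_left hxn), inner_zero_left]
  rw [← hU]
  refine Real.iSup_le (fun x => Real.iSup_le (fun hx => ?_) (by positivity)) (by positivity)
  have hxD := hsub (subset_closure hx)
  have hxc : x ∈ ⋃ v, F.τ v := by rw [F.cover]; exact subset_closure hxD
  obtain ⟨v, hv⟩ := mem_iUnion.1 hxc
  have l1 := H.lam_lip x (F.o v)
  have l2 : H.lam x0 ≤ H.lam x := hmin (subset_closure hx)
  have l3 := F.sub v hv
  rw [mem_closedBall, dist_eq_norm] at l3
  have := key h hh hhle F _ _ U vu hub' huV hG v (by linarith) x hv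
  rw [indicator_of_mem hxD] at this
  have := abs_sub (u x) (uh x)
  linarith [hub x hxD]

end

/-- **Interior maximum-norm stability of the Ritz projection on an extended convex
polyhedron for elements of degree at least 2 (the estimate `E₁ ≤ C‖u‖_{L^∞}`).** -/
theorem interior_max_norm_stability
    (Ω Ωt : Set E3) (hΩ : IsConvexPolyhedron Ω) (hΩt : IsConvexPolyhedron Ωt)
    (hsub : closure Ω ⊆ Ωt) (c : ℝ) (hc : 0 < c) (r : ℕ) (hr : 2 ≤ r) :
    ∃ C h₀ : ℝ, 0 < C ∧ 0 < h₀ ∧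
      ∀ h : ℝ, 0 < h → h ≤ h₀ →
      ∀ Tt : Finset (Fin 4 → E3), IsTetPartition Ωt Tt h c →
      ∀ ut : E3 → ℝ, (∃ K : ℝ≥0, LipschitzOnWith K ut (closure Ωt)) →
        (∀ x ∈ frontier Ωt, ut x = 0) →
      ∀ ut_h : E3 → ℝ, MemSh0 Ωt Tt r ut_h →
        (∀ χ : E3 → ℝ, MemSh0 Ωt Tt r χ →
          ∫ x in Ωt, ⟪gradient (fun y => ut y - ut_h y) x, gradient χ x⟫ = 0) →
        (⨆ x ∈ Ω, |ut x - ut_h x|) ≤ C * ⨆ x ∈ Ωt, |ut x| := by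
  exact main_aux Ω Ωt hΩt hsub c hc r hr
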